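/- Assume the standing assumptions: Γ is a non-elementary hyperbolic group, d, d* ∈ D_Γ are strongly hyperbolic metrics that are not roughly similar, either Γ is not virtually free or Γ is virtually free and d has non-arithmetic length spectrum, and d, d* are scaled so that v_d = 1 and τ(d*/d) = 1. Define π_p(T) = Σ_{g : d(o,g) < T} (d*(o,g) − d(o,g))^p. Then there are constants C, σ² > 0 such that π₀(T) ~ C e^T and, for every even integer p ≥ 2, π_p(T) ~ C σ^p (p−1)!! e^T T^{p/2} as T → ∞. Consequently, for every even p ≥ 2, lim_{T→∞} (#{g : d(o,g) < T})^{−1} Σ_{d(o,g)<T} ((d*(o,g) − d(o,g))/√T)^p = σ^p (p−1)!!. -/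

import Mathlib

open Filter Set

namespace PaperCLT

variable {Γ : Type*} [Group Γ]

/-- Word length with respect to a generating set `S` (letters from `S ∪ S⁻¹`). -/
noncomputable def wordLength (S : Set Γ) (g : Γ) : ℕ :=
  sInf {n : ℕ | ∃ l : List Γ, l.length = n ∧ (∀ x ∈ l, x ∈ S ∪ S⁻¹) ∧ l.prod = g}

/-- The word metric associated to a generating set `S`. -/
noncomputable def wordDist (S : Set Γ) (x y : Γ) : ℝ := (wordLength S (x⁻¹ * y) : ℝ)

/-- `S` is a finite generating set of `Γ`. -/
def GeneratingSet (S : Set Γ) : Prop := S.Finite ∧ Subgroup.closure S = ⊤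

/-- `d` is a metric on `Γ`, viewed as a two-variable function. -/
structure IsMetric (d : Γ → Γ → ℝ) : Prop where
  refl : ∀ x, d x x = 0
  pos : ∀ x y, x ≠ y → 0 < d x y
  symm : ∀ x y, d x y = d y x
  triangle : ∀ x y z, d x z ≤ d x y + d y z

/-- The Gromov product `(x,y)_w`. -/
noncomputable def gromov (d : Γ → Γ → ℝ) (w x y : Γ) : ℝ := (d w x + d w y - d x y) / 2

/-- Gromov hyperbolicity of a (pseudo)metric. -/
def IsGromovHyperbolic (d : Γ → Γ → ℝ) : Prop :=
  ∃ δ : ℝ, 0 ≤ δ ∧ ∀ x y z w : Γ, min (gromov d w x z) (gromov d w y z) - δ ≤ gromov d w x y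

/-- `d'` is quasi-isometric to `d`. -/
def QuasiIsometric (d d' : Γ → Γ → ℝ) : Prop :=
  ∃ L > (0:ℝ), ∃ C ≥ (0:ℝ), ∀ x y : Γ,
    L⁻¹ * d x y - C ≤ d' x y ∧ d' x y ≤ L * d x y + C

/-- `d ∈ 𝒟_Γ`: left-invariant, Gromov hyperbolic, quasi-isometric to a word metric. -/
structure MemD (d : Γ → Γ → ℝ) : Prop where
  isMetric : IsMetric d
  leftInvariant : ∀ g x y : Γ, d (g * x) (g * y) = d x y
  hyperbolic : IsGromovHyperbolic d
  quasiIsom : ∃ S : Set Γ, GeneratingSet S ∧ QuasiIsometric (wordDist S) d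

/-- `Γ` is a hyperbolic group. -/
def IsHyperbolicGroup (Γ : Type*) [Group Γ] : Prop :=
  ∃ S : Set Γ, GeneratingSet S ∧ IsGromovHyperbolic (wordDist S)

/-- `Γ` is non-elementary: no cyclic subgroup of finite index. -/
def NonElementary (Γ : Type*) [Group Γ] : Prop :=
  ¬ ∃ H : Subgroup Γ, H.FiniteIndex ∧ IsCyclic H

/-- `Γ` is virtually free: it has a free subgroup of finite index. -/
def VirtuallyFree (Γ : Type*) [Group Γ] : Prop :=
  ∃ H : Subgroup Γ, H.FiniteIndex ∧ Nonempty (IsFreeGroup H)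

/-- Strong hyperbolicity of a metric. -/
def StronglyHyperbolic (d : Γ → Γ → ℝ) : Prop :=
  ∃ c > (0:ℝ), ∃ R₀ > (0:ℝ), ∀ R ≥ R₀, ∀ x x' y y' : Γ,
    R ≤ d x y - d x x' + d x' y' - d y y' →
    |d x y - d x' y - d x y' + d x' y'| ≤ Real.exp (-c * R)

/-- Rough similarity of two metrics. -/
def RoughlySimilar (d d' : Γ → Γ → ℝ) : Prop :=
  ∃ Λ > (0:ℝ), ∃ C > (0:ℝ), ∀ g h : Γ, |d g h - Λ * d' g h| ≤ C

/-- The (stable) translation length `ℓ_d[g] = lim_n d(o,gⁿ)/n`. -/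
noncomputable def translationLength (d : Γ → Γ → ℝ) (g : Γ) : ℝ :=
  limUnder atTop fun n : ℕ => d 1 (g ^ n) / n

/-- `d` has non-arithmetic length spectrum. -/
def NonArithmetic (d : Γ → Γ → ℝ) : Prop :=
  ¬ ∃ a : ℝ, ∀ g : Γ, ∃ k : ℤ, translationLength d g = a * k

/-- The ball `{g : d(o,g) < T}`. -/
def ball (d : Γ → Γ → ℝ) (T : ℝ) : Set Γ := {g : Γ | d 1 g < T}

/-- The exponential growth rate `v_d`. -/
noncomputable def growthRate (d : Γ → Γ → ℝ) : ℝ :=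
  limsup (fun T : ℝ => Real.log ((ball d T).ncard) / T) atTop

/-- `τ` is the mean distortion `τ(d⁎/d)`. -/
def IsMeanDistortion (d dst : Γ → Γ → ℝ) (τ : ℝ) : Prop :=
  Tendsto (fun T : ℝ => (((ball d T).ncard : ℝ))⁻¹ * ∑ᶠ g ∈ ball d T, dst 1 g / T)
    atTop (nhds τ)

/-- `σ2` is the variance `σ²(d⁎/d)` (relative to the normalisation `τ`). -/
def IsVariance (d dst : Γ → Γ → ℝ) (τ σ2 : ℝ) : Prop :=
  Tendsto (fun T : ℝ => (((ball d T).ncard : ℝ))⁻¹ *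
      ∑ᶠ g ∈ ball d T, (dst 1 g - τ * T) ^ 2 / T)
    atTop (nhds σ2)

/-- The distribution function `N_σ`: a centred Gaussian of standard deviation `σ > 0`,
and the point mass at `0` when `σ = 0`. -/
noncomputable def gaussCDF (σ t : ℝ) : ℝ :=
  if σ = 0 then (if t < 0 then 0 else 1)
  else (Real.sqrt (2 * Real.pi) * σ)⁻¹ * ∫ u in Set.Iic t, Real.exp (-u ^ 2 / (2 * σ ^ 2))

end PaperCLT

namespace PaperCLT

variable {Γ : Type*} [Group Γ]

/-- `π_p(T) = Σ_{d(o,g)<T} (d⁎(o,g) − d(o,g))^p`. -/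
noncomputable def piMoment (d dst : Γ → Γ → ℝ) (p : ℕ) (T : ℝ) : ℝ :=
  ∑ᶠ g ∈ ball d T, (dst 1 g - d 1 g) ^ p

end PaperCLT

section
open Filter Set
namespace PaperCLT

section Morse
variable {X : Type*} [Group X] {D : X → X → ℝ}

lemma morse_chain {δ : ℝ} (hyp : ∀ x y z w : X, min (gromov D w x z) (gromov D w y z) - δ ≤ gromov D w x y)
    (hm : IsMetric D) (w : X) (p : ℕ → X) (c : ℝ) (j : ℕ) : ∀ N : ℕ,
    (∀ l, j ≤ l → l < j + N → c ≤ gromov D w (p l) (p (l+1))) → c ≤ D w (p j) →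
    c - δ * N ≤ gromov D w (p j) (p (j+N)) := by
  intro N
  induction N with
  | zero =>
    intro _ h
    simp [gromov, hm.refl]; linarith
  | succ N ih =>
    intro h h0
    have h1 := ih (fun l hl hl' => h l hl (by omega)) h0
    have h2 := h (j+N) (by omega) (by omega)
    have h3 := hyp (p j) (p (j+(N+1))) (p (j+N)) w
    have h4 : gromov D w (p (j+(N+1))) (p (j+N)) = gromov D w (p (j+N)) (p (j+N+1)) := by
      unfold gromov; rw [hm.symm (p (j+N)), ← add_assoc]; ring
    rw [h4] at h3
    push_cast
    have hδ : 0 ≤ δ := by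
      have := hyp w w w w
      simp [gromov, hm.refl] at this; exact this
    rcases min_choice (gromov D w (p j) (p (j+N))) (gromov D w (p (j+N)) (p (j+N+1))) with e | e
    · rw [e] at h3; nlinarith
    · rw [e] at h3; nlinarith [mul_nonneg hδ (Nat.cast_nonneg N : (0:ℝ) ≤ N)]

lemma gromov_comm (hm : IsMetric D) (w x y : X) : gromov D w x y = gromov D w y x := by
  unfold gromov; rw [hm.symm x y]; ring

lemma hyp_nonneg {δ : ℝ} (hyp : ∀ x y z w : X, min (gromov D w x z) (gromov D w y z) - δ ≤ gromov D w x y)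
    (hm : IsMetric D) : 0 ≤ δ := by
  have := hyp 1 1 1 1
  simp [gromov, hm.refl] at this; exact this

lemma four_point {δ : ℝ} (hyp : ∀ x y z w : X, min (gromov D w x z) (gromov D w y z) - δ ≤ gromov D w x y)
    (hm : IsMetric D) (x y z w : X) : D x y + D z w ≤ max (D x z + D y w) (D x w + D y z) + 2 * δ := by
  have h := hyp x y z w
  unfold gromov at h
  have e1 := hm.symm w x
  have e2 := hm.symm w y
  have e3 := hm.symm w z
  rcases le_total (D x z + D y w) (D x w + D y z) with g | g
  · rw [max_eq_right g]
    rw [min_eq_right (by linarith)] at h; linarith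
  · rw [max_eq_left g]
    rw [min_eq_left (by linarith)] at h; linarith

lemma morse_drift {δ : ℝ} (hyp : ∀ x y z w : X, min (gromov D w x z) (gromov D w y z) - δ ≤ gromov D w x y)
    (hm : IsMetric D) (K H : ℝ) (hK0 : 0 ≤ K) (N : ℕ) (hN : 0 < N) (hH : K + δ * (N + 1) < H) (n : ℕ) (p : ℕ → X)
    (hK : ∀ i < n, D (p i) (p (i+1)) ≤ K) : ∀ k a : ℕ, a + k ≤ n →
    (∀ l, a ≤ l → l ≤ a + k → H < gromov D (p l) (p 0) (p n)) →
    |gromov D (p 0) (p n) (p a) - gromov D (p 0) (p n) (p (a+k))| ≤ δ * (k / N + 1) := by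
  have hδ := hyp_nonneg hyp hm
  have key : ∀ l, D (p 0) (p l) = gromov D (p 0) (p n) (p l) + gromov D (p l) (p 0) (p n) := by
    intro l; unfold gromov; rw [hm.symm (p n) (p l), hm.symm (p l) (p 0)]; ring
  -- comparison lemma
  have comp : ∀ a b l, a ≤ b → b ≤ n → (a = l ∨ b = l) → b - a ≤ N →
      (∀ i, a ≤ i → i ≤ b → H < gromov D (p i) (p 0) (p n) ∧
        gromov D (p 0) (p n) (p l) ≤ gromov D (p 0) (p n) (p i)) →
      (∀ i, (i = a ∨ i = b) → gromov D (p 0) (p n) (p i) - δ ≤ gromov D (p 0) (p n) (p l)) := by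
    intro a b l hab hbn hl hba h
    set t := gromov D (p 0) (p n) (p l) with ht
    have h1 := morse_chain hyp hm (p 0) p (t + H - K) a (b - a) (by
      intro i hi hi'
      have hk := key i
      have hh := h i hi (by omega)
      have := hK i (by omega)
      have t1 := hm.triangle (p 0) (p (i+1)) (p i)
      rw [hm.symm (p (i+1))] at t1
      unfold gromov at *; linarith) (by
      have hk := key a
      have hh := h a le_rfl hab
      linarith)
    rw [Nat.add_sub_cancel' hab] at h1
    have h2 : δ * ((b - a : ℕ):ℝ) ≤ δ * N := by
      apply mul_le_mul_of_nonneg_left _ hδ; exact_mod_cast hba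
    intro i hi
    by_cases hil : i = l
    · rw [hil]; linarith
    have h3 : t < gromov D (p 0) (p l) (p i) - δ := by
      have : gromov D (p 0) (p l) (p i) = gromov D (p 0) (p a) (p b) := by
        rcases hi with rfl | rfl <;> rcases hl with rfl | rfl
        · exact absurd rfl hil
        · exact gromov_comm hm _ _ _
        · rfl
        · exact absurd rfl hil
      rw [this]; linarith
    have h4 := hyp (p n) (p l) (p i) (p 0)
    rcases min_choice (gromov D (p 0) (p n) (p i)) (gromov D (p 0) (p l) (p i)) with e | e
    · rw [e] at h4; exact h4
    · rw [e] at h4; linarith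
  have chunk : ∀ a k, k ≤ N → a + k ≤ n → (∀ l, a ≤ l → l ≤ a + k → H < gromov D (p l) (p 0) (p n)) →
      |gromov D (p 0) (p n) (p a) - gromov D (p 0) (p n) (p (a+k))| ≤ δ := by
    intro a k hk hkn h
    obtain ⟨l, hl, hmin⟩ := (Finset.Icc a (a+k)).exists_min_image
      (fun l => gromov D (p 0) (p n) (p l)) ⟨a, by simp⟩
    simp only [Finset.mem_Icc] at hl hmin
    have h1 := comp a l l hl.1 (by omega) (Or.inr rfl) (by omega)
      (fun i hi hi' => ⟨h i hi (by omega), hmin i ⟨hi, by omega⟩⟩) a (Or.inl rfl)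
    have h2 := comp l (a+k) l hl.2 (by omega) (Or.inl rfl) (by omega)
      (fun i hi hi' => ⟨h i (by omega) hi', hmin i ⟨by omega, hi'⟩⟩) (a+k) (Or.inr rfl)
    have h3 := hmin a ⟨le_rfl, by omega⟩
    have h4 := hmin (a+k) ⟨by omega, le_rfl⟩
    rw [abs_le]; constructor <;> linarith
  intro k
  induction k using Nat.strong_induction_on with
  | _ k ih =>
    intro a hak h
    by_cases hkN : k ≤ N
    · refine (chunk a k hkN hak h).trans ?_
      have : (0:ℝ) ≤ k / N := by positivity
      nlinarith
    · push Not at hkN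
      have h1 := chunk a N le_rfl (by omega) (fun l hl hl' => h l hl (by omega))
      have h2 := ih (k - N) (by omega) (a + N) (by omega) (fun l hl hl' => h l (by omega) (by omega))
      rw [show a + N + (k - N) = a + k by omega] at h2
      have h3 : ((k - N : ℕ) : ℝ) / N = k / N - 1 := by
        rw [Nat.cast_sub hkN.le]; field_simp
      rw [h3] at h2
      calc _ ≤ _ := abs_sub_le _ (gromov D (p 0) (p n) (p (a+N))) _
        _ ≤ δ + δ * (k / N - 1 + 1) := add_le_add h1 h2
        _ = _ := by ring

lemma morse (hm : IsMetric D) (hh : IsGromovHyperbolic D) (K L C : ℝ) (hK0 : 0 ≤ K) (hL : 0 < L) :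
    ∃ M : ℝ, ∀ (n : ℕ) (p : ℕ → X), (∀ i < n, D (p i) (p (i+1)) ≤ K) →
      (∀ i j, i ≤ j → j ≤ n → L * ((j:ℝ) - i) - C ≤ D (p i) (p j)) →
      ∀ i ≤ n, gromov D (p i) (p 0) (p n) ≤ M := by
  obtain ⟨δ, hδ, hyp⟩ := hh
  obtain ⟨N, hN⟩ := exists_nat_gt (2 * δ / L)
  have hNpos : 0 < N := by
    rcases Nat.eq_zero_or_pos N with h | h
    · subst h
      have : 0 ≤ 2 * δ / L := by positivity
      simp at hN; linarith
    · exact h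
  have hNR : (0:ℝ) < N := by exact_mod_cast hNpos
  set H := K + δ * (N + 1) + 1 with hH
  have hHnn : 0 ≤ H := by positivity
  set B := (2 * H + 2 * K + 3 * δ + |C|) * 2 / L with hB
  have hBnn : 0 ≤ B := by positivity
  refine ⟨H + K * B, ?_⟩
  intro n p hp hq i hi
  by_cases hiH : gromov D (p i) (p 0) (p n) ≤ H
  · nlinarith [mul_nonneg hK0 hBnn]
  push Not at hiH
  have D0 : gromov D (p 0) (p 0) (p n) ≤ H := by
    simp [gromov, hm.refl]; exact hHnn
  have Dn : gromov D (p n) (p 0) (p n) ≤ H := by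
    simp [gromov, hm.refl, hm.symm (p n) (p 0)]; exact hHnn
  -- last index before i
  obtain ⟨j, hji, hjH, hj⟩ : ∃ j < i, gromov D (p j) (p 0) (p n) ≤ H ∧
      ∀ l, j < l → l ≤ i → H < gromov D (p l) (p 0) (p n) := by
    classical
    set j := Nat.findGreatest (fun j => gromov D (p j) (p 0) (p n) ≤ H) i with hj
    have h1 : gromov D (p j) (p 0) (p n) ≤ H :=
      Nat.findGreatest_spec (P := fun j => gromov D (p j) (p 0) (p n) ≤ H) (Nat.zero_le i) D0
    have h2 : j ≤ i := Nat.findGreatest_le _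
    refine ⟨j, lt_of_le_of_ne h2 (fun e => ?_), h1, fun l hl hl' => ?_⟩
    · rw [e] at h1; linarith
    · exact not_le.1 (Nat.findGreatest_is_greatest hl hl')
  obtain ⟨k, hik, hkn, hkH, hk⟩ : ∃ k, i < k ∧ k ≤ n ∧ gromov D (p k) (p 0) (p n) ≤ H ∧
      ∀ l, i ≤ l → l < k → H < gromov D (p l) (p 0) (p n) := by
    classical
    have hex : ∃ k, i ≤ k ∧ gromov D (p k) (p 0) (p n) ≤ H := ⟨n, hi, Dn⟩
    have h1 := Nat.find_spec hex
    refine ⟨Nat.find hex, lt_of_le_of_ne h1.1 (fun e => ?_), Nat.find_min' hex ⟨hi, Dn⟩, h1.2, ?_⟩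
    · have := h1.2; rw [← e] at this; linarith
    · intro l hl hl'
      have := Nat.find_min hex hl'
      push Not at this; exact this hl
  have hdrift := morse_drift hyp hm K H hK0 N hNpos (by linarith) n p hp (k - 1 - (j+1)) (j+1) (by omega)
    (fun l hl hl' => by
      rcases le_total l i with h | h
      · exact hj l (by omega) h
      · exact hk l h (by omega))
  rw [show j + 1 + (k - 1 - (j+1)) = k - 1 by omega] at hdrift
  have hkj : ((k - 1 - (j+1) : ℕ) : ℝ) ≤ (k:ℝ) - j := by
    rw [Nat.cast_sub (by omega), Nat.cast_sub (by omega)]; push_cast; linarith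
  have hdrift2 : |gromov D (p 0) (p n) (p (j+1)) - gromov D (p 0) (p n) (p (k-1))| ≤ L / 2 * ((k:ℝ) - j) + δ := by
    refine hdrift.trans ?_
    have h1 : δ * (((k - 1 - (j+1) : ℕ) : ℝ) / N) ≤ L / 2 * ((k:ℝ) - j) := by
      rw [← mul_div_assoc, div_le_iff₀ hNR]
      have : 2 * δ < N * L := by rwa [div_lt_iff₀ hL] at hN
      have hkj0 : (0:ℝ) ≤ (k:ℝ) - j := by
        have : (j:ℝ) ≤ k := by exact_mod_cast (by omega : j ≤ k)
        linarith
      calc _ ≤ δ * ((k:ℝ) - j) := mul_le_mul_of_nonneg_left hkj hδ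
        _ ≤ (N * L / 2) * ((k:ℝ) - j) := mul_le_mul_of_nonneg_right (by linarith) hkj0
        _ = _ := by ring
    linarith
  have s1 := hp j (by omega)
  have s2 := hp (k-1) (by omega)
  rw [show k - 1 + 1 = k by omega] at s2
  have fp := four_point hyp hm (p j) (p k) (p 0) (p n)
  have lower := hq j k (by omega) hkn
  have tri1 := hm.triangle (p 0) (p (j+1)) (p j)
  have tri2 := hm.triangle (p 0) (p j) (p (j+1))
  have tri3 := hm.triangle (p n) (p (j+1)) (p j)
  have tri4 := hm.triangle (p n) (p j) (p (j+1))
  have tri5 := hm.triangle (p 0) (p (k-1)) (p k)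
  have tri6 := hm.triangle (p 0) (p k) (p (k-1))
  have tri7 := hm.triangle (p n) (p (k-1)) (p k)
  have tri8 := hm.triangle (p n) (p k) (p (k-1))
  rw [hm.symm (p (j+1)) (p j)] at tri1 tri3
  rw [hm.symm (p k) (p (k-1))] at tri6 tri8
  have e1 := hm.symm (p j) (p 0)
  have e2 := hm.symm (p j) (p n)
  have e3 := hm.symm (p k) (p 0)
  have e4 := hm.symm (p k) (p n)
  have hkjB : (k:ℝ) - j ≤ B := by
    rw [hB, le_div_iff₀ hL]
    have hC := le_abs_self C
    rw [abs_le] at hdrift2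
    unfold gromov at hdrift2 hjH hkH
    rcases max_choice (D (p j) (p 0) + D (p k) (p n)) (D (p j) (p n) + D (p k) (p 0)) with e | e <;>
      rw [e] at fp <;> linarith
  have hsteps : ∀ m, j + m ≤ n → D (p (j+m)) (p j) ≤ K * m := by
    intro m
    induction m with
    | zero => intro _; simp [hm.refl]
    | succ m ih =>
      intro h
      have h1 := ih (by omega)
      have h2 := hp (j+m) (by omega)
      have h3 := hm.triangle (p (j+m+1)) (p (j+m)) (p j)
      rw [hm.symm (p (j+m+1)) (p (j+m))] at h3
      push_cast; rw [← add_assoc]; linarith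
  have hij := hsteps (i - j) (by omega)
  rw [Nat.add_sub_cancel' hji.le, Nat.cast_sub hji.le] at hij
  have hij2 : D (p i) (p j) ≤ K * B := by
    refine hij.trans (mul_le_mul_of_nonneg_left ?_ hK0)
    have : (i:ℝ) ≤ k := by exact_mod_cast hik.le
    linarith
  have u1 := hm.triangle (p i) (p j) (p 0)
  have u2 := hm.triangle (p i) (p j) (p n)
  unfold gromov at hjH ⊢
  linarith

end Morse
end PaperCLT
end

section
open Filter Set
namespace PaperCLT

section Words
variable {Γ : Type*} [Group Γ]

lemma wl_exists {S : Set Γ} (hS : Subgroup.closure S = ⊤) (g : Γ) :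
    ∃ l : List Γ, l.length = wordLength S g ∧ (∀ x ∈ l, x ∈ S ∪ S⁻¹) ∧ l.prod = g := by
  have hne : {n : ℕ | ∃ l : List Γ, l.length = n ∧ (∀ x ∈ l, x ∈ S ∪ S⁻¹) ∧ l.prod = g}.Nonempty := by
    obtain ⟨l, hl, hp⟩ := Submonoid.exists_list_of_mem_closure (s := S ∪ S⁻¹) (x := g) (by
      rw [← Subgroup.closure_toSubmonoid, hS]; trivial)
    exact ⟨l.length, l, rfl, hl, hp⟩
  exact Nat.sInf_mem hne

lemma wl_le {S : Set Γ} (l : List Γ) (hl : ∀ x ∈ l, x ∈ S ∪ S⁻¹) : wordLength S l.prod ≤ l.length :=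
  Nat.sInf_le ⟨l, rfl, hl, rfl⟩

lemma wl_mul {S : Set Γ} (hS : Subgroup.closure S = ⊤) (g h : Γ) :
    wordLength S (g * h) ≤ wordLength S g + wordLength S h := by
  obtain ⟨l, hl, hl', rfl⟩ := wl_exists hS g
  obtain ⟨m, hm, hm', rfl⟩ := wl_exists hS h
  rw [← hl, ← hm, ← List.prod_append, ← List.length_append]
  apply wl_le
  intro x hx
  rcases List.mem_append.1 hx with h | h
  · exact hl' x h
  · exact hm' x h

lemma fin_letters {S : Set Γ} (hS : S.Finite) : (S ∪ S⁻¹).Finite := hS.union hS.inv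

lemma wl_compare {S S' : Set Γ} (hS : GeneratingSet S) (hS' : GeneratingSet S') :
    ∃ A : ℕ, ∀ g, wordLength S g ≤ A * wordLength S' g := by
  obtain ⟨A, hA⟩ := ((fin_letters hS'.1).image (wordLength S)).bddAbove
  refine ⟨A, fun g => ?_⟩
  obtain ⟨l, hl, hl', rfl⟩ := wl_exists hS'.2 g
  rw [← hl]; clear hl
  induction l with
  | nil => simpa using wl_le (S := S) [] (by simp)
  | cons a l ih =>
    have h1 := ih (fun x hx => hl' x (by simp [hx]))
    have h2 := hA ⟨a, hl' a (by simp), rfl⟩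
    have h3 := wl_mul hS.2 a l.prod
    simp only [List.prod_cons, List.length_cons]; nlinarith

lemma word_path {S : Set Γ} (hS : Subgroup.closure S = ⊤) (x y : Γ) : ∃ (n : ℕ) (p : ℕ → Γ), p 0 = x ∧ p n = y ∧
    (∀ i < n, (p i)⁻¹ * p (i+1) ∈ S ∪ S⁻¹) ∧
    ∀ i j, i ≤ j → j ≤ n → j - i ≤ wordLength S ((p i)⁻¹ * p j) := by
  obtain ⟨l, hl, hl', hp⟩ := wl_exists hS (x⁻¹ * y)
  refine ⟨l.length, fun i => x * (l.take i).prod, by simp, by simp [hp], ?_, ?_⟩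
  · intro i hi
    simp only [mul_inv_rev]
    rw [List.take_add_one, List.prod_append, List.getElem?_eq_getElem hi]
    have := hl' l[i] (List.getElem_mem hi)
    simpa [mul_assoc] using this
  · intro i j hij hj
    by_contra hlt
    push Not at hlt
    obtain ⟨m, hm, hm', hmp⟩ := wl_exists hS ((x * (l.take i).prod)⁻¹ * (x * (l.take j).prod))
    have h1 : (l.take i ++ m ++ l.drop j).prod = x⁻¹ * y := by
      rw [List.prod_append, List.prod_append, hmp, ← hp]
      conv_rhs => rw [← List.take_append_drop j l, List.prod_append]
      group
    have h2 := wl_le (S := S) (l.take i ++ m ++ l.drop j) (by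
      intro a ha
      rcases List.mem_append.1 ha with h | h
      · rcases List.mem_append.1 h with h | h
        · exact hl' a (List.mem_of_mem_take h)
        · exact hm' a h
      · exact hl' a (List.mem_of_mem_drop h))
    rw [h1, ← hl] at h2
    simp only [List.length_append, List.length_take, List.length_drop, hm] at h2
    rw [← hm] at h2 hlt
    omega

lemma memD_lower {d : Γ → Γ → ℝ} (hd : MemD d) {S : Set Γ} (hS : GeneratingSet S) :
    ∃ L > (0:ℝ), ∃ C, ∀ x y, L * wordLength S (x⁻¹ * y) - C ≤ d x y := by
  obtain ⟨S', hS', L, hL, C, hC, h⟩ := hd.quasiIsom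
  obtain ⟨A, hA⟩ := wl_compare hS hS'
  refine ⟨L⁻¹ / (A+1), by positivity, C, fun x y => ?_⟩
  refine le_trans ?_ (h x y).1
  have h1 : (wordLength S (x⁻¹ * y) : ℝ) ≤ (A+1) * wordLength S' (x⁻¹ * y) := by
    have : (wordLength S (x⁻¹ * y) : ℝ) ≤ A * wordLength S' (x⁻¹ * y) := by exact_mod_cast hA _
    have h0 : (0:ℝ) ≤ wordLength S' (x⁻¹ * y) := Nat.cast_nonneg _
    linarith
  unfold wordDist
  have : L⁻¹ / (A+1) * wordLength S (x⁻¹ * y) ≤ L⁻¹ * wordLength S' (x⁻¹ * y) := by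
    rw [div_mul_eq_mul_div, div_le_iff₀ (by positivity), mul_assoc]
    apply mul_le_mul_of_nonneg_left _ (by positivity); linarith
  linarith

lemma memD_upper {d : Γ → Γ → ℝ} (hd : MemD d) {S : Set Γ} (hS : GeneratingSet S) :
    ∃ K ≥ (0:ℝ), (∀ x y, d x y ≤ K * wordLength S (x⁻¹ * y)) ∧ ∀ x y, x⁻¹ * y ∈ S ∪ S⁻¹ → d x y ≤ K := by
  obtain ⟨K, hK⟩ := ((fin_letters hS.1).image (d 1)).bddAbove
  have hloc : ∀ x y, x⁻¹ * y ∈ S ∪ S⁻¹ → d x y ≤ max K 0 := by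
    intro x y h
    have := hK ⟨_, h, rfl⟩
    rw [← hd.leftInvariant x⁻¹ x y, inv_mul_cancel]; exact this.trans (le_max_left _ _)
  refine ⟨max K 0, le_max_right _ _, ?_, hloc⟩
  intro x y
  obtain ⟨l, hl, hl', hp⟩ := wl_exists hS.2 (x⁻¹ * y)
  rw [← hd.leftInvariant x⁻¹ x y, inv_mul_cancel, ← hl, ← hp]; clear hl hp
  induction l with
  | nil => simp [hd.isMetric.refl]
  | cons a l ih =>
    have h1 := ih (fun x hx => hl' x (by simp [hx]))
    have h2 := hloc 1 a (by simpa using hl' a (by simp))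
    have h3 := hd.isMetric.triangle 1 a (a * l.prod)
    have h4 := hd.leftInvariant a 1 l.prod
    rw [mul_one] at h4
    simp only [List.prod_cons, List.length_cons]; push_cast; linarith

lemma good_paths {d : Γ → Γ → ℝ} (hd : MemD d) {S : Set Γ} (hS : GeneratingSet S) : ∃ K ≥ (0:ℝ), 
    ∀ (n : ℕ) (p : ℕ → Γ), (∀ i < n, (p i)⁻¹ * p (i+1) ∈ S ∪ S⁻¹) →
    (∀ i j, i ≤ j → j ≤ n → j - i ≤ wordLength S ((p i)⁻¹ * p j)) →
    (∀ i < n, d (p i) (p (i+1)) ≤ K) ∧ ∀ i ≤ n, gromov d (p i) (p 0) (p n) ≤ K := by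
  obtain ⟨K, hK0, -, hK⟩ := memD_upper hd hS
  obtain ⟨L, hL, C, hLC⟩ := memD_lower hd hS
  obtain ⟨M, hM⟩ := morse hd.isMetric hd.hyperbolic K L C hK0 hL
  refine ⟨max K M, le_max_of_le_left hK0, fun n p h1 h2 => ?_⟩
  have h3 : ∀ i < n, d (p i) (p (i+1)) ≤ K := fun i hi => hK _ _ (h1 i hi)
  refine ⟨fun i hi => (h3 i hi).trans (le_max_left _ _), fun i hi => (hM n p h3 ?_ i hi).trans (le_max_right _ _)⟩
  intro i j hij hj
  refine le_trans ?_ (hLC _ _)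
  have h4 : ((j:ℝ) - i) ≤ wordLength S ((p i)⁻¹ * p j) := by
    rw [← Nat.cast_sub hij]; exact_mod_cast h2 i j hij hj
  have := mul_le_mul_of_nonneg_left h4 hL.le
  linarith

/-- discrete intermediate value along a path -/
lemma path_ivt {d : Γ → Γ → ℝ} (hm : IsMetric d) {K : ℝ} (hK : 0 ≤ K) (n : ℕ) (p : ℕ → Γ)
    (h : ∀ i < n, d (p i) (p (i+1)) ≤ K) (t : ℝ) (ht : 0 ≤ t) (ht' : t ≤ d (p 0) (p n)) :
    ∃ i ≤ n, |d (p 0) (p i) - t| ≤ K := by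
  classical
  have h0 : d (p 0) (p 0) ≤ t := by rw [hm.refl]; exact ht
  set j := Nat.findGreatest (fun i => d (p 0) (p i) ≤ t) n with hj
  have h1 : d (p 0) (p j) ≤ t := Nat.findGreatest_spec (P := fun i => d (p 0) (p i) ≤ t) (Nat.zero_le n) h0
  have h2 : j ≤ n := Nat.findGreatest_le _
  refine ⟨j, h2, ?_⟩
  rcases h2.eq_or_lt with e | e
  · rw [e] at h1 ⊢; rw [le_antisymm h1 ht']; simpa using hK
  · have h3 : ¬ d (p 0) (p (j+1)) ≤ t := Nat.findGreatest_is_greatest (Nat.lt_succ_self j) e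
    have h4 := h j e
    have h5 := hm.triangle (p 0) (p j) (p (j+1))
    rw [abs_le]; constructor <;> linarith

lemma fin_balls {d : Γ → Γ → ℝ} (hd : MemD d) (T : ℝ) : (ball d T).Finite := by
  obtain ⟨S, hS, _⟩ := hd.quasiIsom
  obtain ⟨L, hL, C, hLC⟩ := memD_lower hd hS
  obtain ⟨N, hN⟩ := exists_nat_gt ((T + C) / L)
  have hsub : (ball d T) ⊆ (fun l : List (S ∪ S⁻¹ : Set Γ) => (l.map Subtype.val).prod) '' {l | l.length < N} := by
    intro g hg
    obtain ⟨l, hl, hl', hp⟩ := wl_exists hS.2 g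
    refine ⟨l.attach.map (fun x => ⟨x.1, hl' x.1 x.2⟩), ?_, ?_⟩
    · have h1 := hLC 1 g
      have h2 : d 1 g < T := hg
      simp only [inv_one, one_mul] at h1
      simp only [Set.mem_setOf_eq, List.length_map, List.length_attach, hl]
      rw [div_lt_iff₀ hL] at hN
      have : (wordLength S g : ℝ) < N := by nlinarith
      exact_mod_cast this
    · simp [List.map_map, Function.comp_def, hp]
  haveI := (fin_letters hS.1).to_subtype
  exact ((List.finite_length_lt (S ∪ S⁻¹ : Set Γ) N).image _).subset hsub

end Words
end PaperCLT
end

section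
open Filter Set
namespace PaperCLT

/-- Everything the analytic part of the proof uses. -/
structure Setup (Γ : Type*) [Group Γ] where
  d : Γ → Γ → ℝ
  e : Γ → Γ → ℝ
  md : IsMetric d
  ld : ∀ g x y : Γ, d (g * x) (g * y) = d x y
  me : IsMetric e
  li : ∀ g x y : Γ, e (g * x) (g * y) = e x y
  δ : ℝ
  hδ : 1 ≤ δ
  hyp : ∀ x y z w : Γ, min (gromov d w x z) (gromov d w y z) - δ ≤ gromov d w x y
  C0 : ℝ
  hC0 : 1 ≤ C0
  rg : ∀ x y t, 0 ≤ t → t ≤ d x y → ∃ p, |d x p - t| ≤ C0 ∧ gromov d p x y ≤ C0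
  A : ℝ
  hA : 1 ≤ A
  eA : ∀ y, e 1 y ≤ A * d 1 y + A
  c : ℝ
  hc : 0 < c
  hc1 : c ≤ 1
  vd : ∀ ρ : ℝ, ∃ C > (0:ℝ), ∀ v y y', d 1 v ≤ ρ →
    |(d v y - d 1 y) - (d v y' - d 1 y')| ≤ C * Real.exp (-c * gromov d 1 y y')
  ve : ∀ ρ : ℝ, ∃ C > (0:ℝ), ∀ v y y', d 1 v ≤ ρ →
    |(e v y - e 1 y) - (e v y' - e 1 y')| ≤ C * Real.exp (-c * gromov d 1 y y')
  fin : ∀ T, (ball d T).Finite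
  up : ∀ ε > (0:ℝ), ∃ C > (0:ℝ), ∀ T, ((ball d T).ncard : ℝ) ≤ C * Real.exp ((1 + ε) * T)
  lo : ∀ ε > (0:ℝ), ∀ T0 : ℝ, ∃ T ≥ T0, Real.exp ((1 - ε) * T) ≤ ((ball d T).ncard : ℝ)
  sh : StronglyHyperbolic d

section
variable {Γ : Type*} [Group Γ]

lemma gromov_nonneg {d : Γ → Γ → ℝ} (hm : IsMetric d) (w x y : Γ) : 0 ≤ gromov d w x y := by
  unfold gromov
  have := hm.triangle x w y
  rw [hm.symm x w] at this; linarith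

lemma metric_nonneg {d : Γ → Γ → ℝ} (hm : IsMetric d) (x y : Γ) : 0 ≤ d x y := by
  have := hm.triangle x y x
  rw [hm.refl, hm.symm y x] at this; linarith

lemma ncard_mono {d : Γ → Γ → ℝ} (hf : ∀ T, (ball d T).Finite) {S T : ℝ} (h : S ≤ T) :
    (ball d S).ncard ≤ (ball d T).ncard :=
  ncard_le_ncard (fun g (hg : d 1 g < S) => (lt_of_lt_of_le hg h : d 1 g < T)) (hf T)

lemma growth_facts {d : Γ → Γ → ℝ} (hm : IsMetric d) (hf : ∀ T, (ball d T).Finite) (hv : growthRate d = 1) :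
    (∀ ε > (0:ℝ), ∃ C > (0:ℝ), ∀ T, ((ball d T).ncard : ℝ) ≤ C * Real.exp ((1 + ε) * T)) ∧
    (∀ ε > (0:ℝ), ∀ T0 : ℝ, ∃ T ≥ T0, Real.exp ((1 - ε) * T) ≤ ((ball d T).ncard : ℝ)) := by
  have hpos : ∀ T > 0, (0:ℝ) < (ball d T).ncard := by
    intro T hT
    have : 0 < (ball d T).ncard := (ncard_pos (hf T)).2 ⟨1, by simpa [ball, hm.refl] using hT⟩
    exact_mod_cast this
  unfold growthRate at hv
  rw [limsup_eq] at hv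
  set A := {a : ℝ | ∀ᶠ T : ℝ in atTop, Real.log ((ball d T).ncard) / T ≤ a} with hA
  have hne : A.Nonempty := by
    by_contra h
    rw [not_nonempty_iff_eq_empty] at h
    rw [h, Real.sInf_empty] at hv; norm_num at hv
  have hbdd : BddBelow A := by
    by_contra h
    rw [Real.sInf_of_not_bddBelow h] at hv; norm_num at hv
  constructor
  · intro ε hε
    obtain ⟨a, ha, ha'⟩ := exists_lt_of_csInf_lt hne (show sInf A < 1 + ε by rw [hv]; linarith)
    obtain ⟨T1, hT1⟩ := eventually_atTop.1 ha
    set T2 := max T1 1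
    refine ⟨1 + (ball d T2).ncard, by positivity, fun T => ?_⟩
    by_cases hT : T ≤ 0
    · have : (ball d T) = ∅ := by
        ext g; simp only [ball, mem_setOf_eq, mem_empty_iff_false, iff_false, not_lt]
        exact hT.trans (metric_nonneg hm _ _)
      rw [this]; simp; positivity
    push Not at hT
    by_cases hT2 : T ≤ T2
    · have h1 : ((ball d T).ncard:ℝ) ≤ (ball d T2).ncard := by exact_mod_cast ncard_mono hf hT2
      have h2 : 1 ≤ Real.exp ((1+ε) * T) := Real.one_le_exp (by positivity)
      have h3 : (0:ℝ) ≤ (ball d T2).ncard := Nat.cast_nonneg _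
      nlinarith
    · push Not at hT2
      have h1 := hT1 T ((le_max_left _ _).trans hT2.le)
      rw [div_le_iff₀ hT, Real.log_le_iff_le_exp (hpos T hT)] at h1
      have h2 : Real.exp (a * T) ≤ Real.exp ((1+ε) * T) := Real.exp_le_exp.2 (by nlinarith)
      have h3 : (0:ℝ) ≤ (ball d T2).ncard := Nat.cast_nonneg _
      nlinarith [Real.exp_pos ((1+ε) * T)]
  · intro ε hε T0
    by_contra hcon
    push Not at hcon
    have : 1 - ε ∈ A := by
      refine eventually_atTop.2 ⟨max T0 1, fun T hT => ?_⟩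
      have hT0 : 0 < T := lt_of_lt_of_le one_pos ((le_max_right _ _).trans hT)
      rw [div_le_iff₀ hT0, Real.log_le_iff_le_exp (hpos T hT0)]
      exact (hcon T ((le_max_left _ _).trans hT)).le
    have := csInf_le hbdd this
    rw [hv] at this; linarith

lemma vis_of_strong {d : Γ → Γ → ℝ} (hm : IsMetric d) (hs : StronglyHyperbolic d) : ∃ c > (0:ℝ), ∀ ρ : ℝ, ∃ C > (0:ℝ),
    ∀ v y y', d 1 v ≤ ρ → |(d v y - d 1 y) - (d v y' - d 1 y')| ≤ C * Real.exp (-c * gromov d 1 y y') := by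
  obtain ⟨c, hc, R0, hR0, h⟩ := hs
  refine ⟨2 * c, by positivity, fun ρ => ?_⟩
  refine ⟨(1 + 2 * |ρ|) * Real.exp (c * (R0 + 2 * |ρ|)), by positivity, fun v y y' hv => ?_⟩
  set g := gromov d 1 y y' with hg
  have hρ := le_abs_self ρ
  have hv1 := hm.symm v 1
  have t1 := hm.triangle 1 v y
  have t2 := hm.triangle v 1 y
  have t3 := hm.triangle 1 v y'
  have t4 := hm.triangle v 1 y'
  have e1 : Real.exp (c * (R0 + 2 * |ρ|)) * Real.exp (-(2*c) * g) = Real.exp (c * (R0 + 2 * |ρ| - 2 * g)) := by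
    rw [← Real.exp_add]; ring_nf
  rw [mul_assoc, e1]
  by_cases hR : R0 ≤ 2 * g - 2 * |ρ|
  · have := h (2 * g - 2 * |ρ|) hR v 1 y y' (by rw [hg]; unfold gromov; linarith)
    have e2 : (d v y - d 1 y) - (d v y' - d 1 y') = d v y - d 1 y - d v y' + d 1 y' := by ring
    rw [e2]
    refine this.trans ?_
    have : Real.exp (-c * (2 * g - 2 * |ρ|)) ≤ Real.exp (c * (R0 + 2 * |ρ| - 2 * g)) := 
      Real.exp_le_exp.2 (by nlinarith)
    nlinarith [abs_nonneg ρ, Real.exp_pos (c * (R0 + 2 * |ρ| - 2 * g))]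
  · push Not at hR
    have h1 : 1 ≤ Real.exp (c * (R0 + 2 * |ρ| - 2 * g)) := Real.one_le_exp (by 
      apply mul_nonneg hc.le; linarith)
    have h2 : |(d v y - d 1 y) - (d v y' - d 1 y')| ≤ 2 * |ρ| := by
      rw [abs_le]; constructor <;> linarith
    nlinarith [abs_nonneg ρ]

/-- Gromov products of two metrics in `𝒟` are comparable, and rough geodesics exist. -/
lemma coarse_facts {d e : Γ → Γ → ℝ} (hd : MemD d) (he : MemD e) :
    (∃ C0 : ℝ, ∀ x y t, 0 ≤ t → t ≤ d x y → ∃ p, |d x p - t| ≤ C0 ∧ gromov d p x y ≤ C0) ∧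
    (∃ A : ℝ, 1 ≤ A ∧ ∀ y, e 1 y ≤ A * d 1 y + A) ∧
    (∃ κ > (0:ℝ), ∃ C : ℝ, ∀ y y', κ * gromov d 1 y y' - C ≤ gromov e 1 y y') := by
  obtain ⟨S, hS, _⟩ := hd.quasiIsom
  obtain ⟨K, hK0, hK⟩ := good_paths hd hS
  obtain ⟨K', hK0', hK'⟩ := good_paths he hS
  obtain ⟨δ, hδ, hyp⟩ := he.hyperbolic
  have comp : ∀ {d e : Γ → Γ → ℝ}, MemD d → MemD e → ∃ A : ℝ, 1 ≤ A ∧ ∀ y, e 1 y ≤ A * d 1 y + A := by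
    intro d e hd he
    obtain ⟨L, hL, C, hLC⟩ := memD_lower hd hS
    obtain ⟨M, hM, hMM, -⟩ := memD_upper he hS
    refine ⟨1 + M / L + M / L * |C|, by have : 0 ≤ M / L := by positivity
                                        nlinarith [abs_nonneg C], fun y => ?_⟩
    have h1 := hLC 1 y
    have h2 := hMM 1 y
    have h0 := metric_nonneg hd.isMetric 1 y
    have h3 : (wordLength S (1⁻¹ * y) : ℝ) ≤ (d 1 y + |C|) / L := by
      rw [le_div_iff₀ hL]; linarith [le_abs_self C]
    have h4 : M * wordLength S (1⁻¹ * y) ≤ M * ((d 1 y + |C|) / L) := mul_le_mul_of_nonneg_left h3 hM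
    have h5 : M * ((d 1 y + |C|) / L) = M / L * d 1 y + M / L * |C| := by ring
    have h6 : 0 ≤ M / L := by positivity
    nlinarith [mul_nonneg (mul_nonneg h6 (abs_nonneg C)) h0]
  refine ⟨?_, comp hd he, ?_⟩
  · refine ⟨K, fun x y t ht ht' => ?_⟩
    obtain ⟨n, p, rfl, rfl, h1, h2⟩ := word_path hS.2 x y
    obtain ⟨h3, h4⟩ := hK n p h1 h2
    obtain ⟨i, hi, h5⟩ := path_ivt hd.isMetric hK0 n p h3 t ht ht'
    exact ⟨p i, h5, h4 i hi⟩
  · obtain ⟨A, hA, hAA⟩ := comp he hd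
    refine ⟨A⁻¹, by positivity, A⁻¹ * (A + K) + 3 * K' + 2 * δ, fun y y' => ?_⟩
    obtain ⟨n, p, rfl, rfl, h1, h2⟩ := word_path hS.2 y y'
    obtain ⟨h3, h4⟩ := hK n p h1 h2
    obtain ⟨h3', h4'⟩ := hK' n p h1 h2
    have hm := he.isMetric
    have tt := hm.triangle 1 (p n) (p 0)
    have e1 := hm.symm (p n) (p 0)
    have e2 := hm.symm (p 0) 1
    obtain ⟨i, hi, h5⟩ := path_ivt hm hK0' n p h3' (gromov e (p 0) 1 (p n)) (gromov_nonneg hm _ _ _)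
      (by unfold gromov; linarith)
    have h6 := h4 i hi
    have h7 := h4' i hi
    have fp := four_point hyp hm 1 (p i) (p 0) (p n)
    have e3 := hm.symm (p i) (p 0)
    have hmd := hd.isMetric
    have d1 := hmd.triangle 1 (p i) (p 0)
    have d2 := hmd.triangle 1 (p i) (p n)
    have h8 := hAA (p i)
    have h9 : e 1 (p i) ≤ gromov e 1 (p 0) (p n) + 3 * K' + 2 * δ := by
      rw [abs_le] at h5
      unfold gromov at h5 h7 ⊢
      rcases max_choice (e 1 (p 0) + e (p i) (p n)) (e 1 (p n) + e (p i) (p 0)) with q | q <;>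
        rw [q] at fp <;> linarith
    have h10 : gromov d 1 (p 0) (p n) ≤ A * e 1 (p i) + A + K := by
      unfold gromov at h6 ⊢; linarith
    have h11 : A⁻¹ * gromov d 1 (p 0) (p n) ≤ A⁻¹ * (A * e 1 (p i) + A + K) :=
      mul_le_mul_of_nonneg_left h10 (by positivity)
    have h12 : A⁻¹ * (A * e 1 (p i) + A + K) = e 1 (p i) + A⁻¹ * (A + K) := by
      field_simp; ring
    linarith

lemma exists_setup {d e : Γ → Γ → ℝ} (hd : MemD d) (he : MemD e) (hsd : StronglyHyperbolic d)
    (hse : StronglyHyperbolic e) (hv : growthRate d = 1) : ∃ s : Setup Γ, s.d = d ∧ s.e = e := by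
  obtain ⟨⟨C0, hrg⟩, ⟨A, hA, hAA⟩, κ, hκ, Cκ, hcomp⟩ := coarse_facts hd he
  obtain ⟨c1, hc1, hv1⟩ := vis_of_strong hd.isMetric hsd
  obtain ⟨c2, hc2, hv2⟩ := vis_of_strong he.isMetric hse
  obtain ⟨δ, hδ, hyp⟩ := hd.hyperbolic
  have hfin := fin_balls hd
  obtain ⟨hup, hlo⟩ := growth_facts hd.isMetric hfin hv
  set c := min (min c1 (c2 * κ)) 1 with hc
  have hcp : 0 < c := by positivity
  refine ⟨⟨d, e, hd.isMetric, hd.leftInvariant, he.isMetric, he.leftInvariant, max δ 1, le_max_right _ _,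
    fun x y z w => by linarith [hyp x y z w, le_max_left δ 1], max C0 1, le_max_right _ _, ?_, A, hA, hAA, c, hcp,
    min_le_right _ _, ?_, ?_, hfin, hup, hlo, hsd⟩, rfl, rfl⟩
  · intro x y t h1 h2
    obtain ⟨p, hp1, hp2⟩ := hrg x y t h1 h2
    exact ⟨p, hp1.trans (le_max_left _ _), hp2.trans (le_max_left _ _)⟩
  · intro ρ
    obtain ⟨C, hC, h⟩ := hv1 ρ
    refine ⟨C, hC, fun v y y' hv => (h v y y' hv).trans ?_⟩
    apply mul_le_mul_of_nonneg_left _ hC.le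
    apply Real.exp_le_exp.2
    have h1 : c ≤ c1 := (min_le_left _ _).trans (min_le_left _ _)
    nlinarith [gromov_nonneg hd.isMetric 1 y y']
  · intro ρ
    obtain ⟨C, hC, h⟩ := hv2 (A * ρ + A)
    refine ⟨C * Real.exp (c2 * Cκ), by positivity, fun v y y' hv => ?_⟩
    refine (h v y y' ((hAA v).trans (by nlinarith))).trans ?_
    rw [mul_assoc, ← Real.exp_add]
    apply mul_le_mul_of_nonneg_left _ hC.le
    apply Real.exp_le_exp.2
    have h1 : c ≤ c2 * κ := (min_le_left _ _).trans (min_le_right _ _)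
    have h2 := hcomp y y'
    nlinarith [gromov_nonneg hd.isMetric 1 y y']
end
end PaperCLT
end

section
open Filter Set
namespace PaperCLT

namespace Setup
variable {Γ : Type*} [Group Γ] (s : Setup Γ)

/-- norm, Gromov product at the identity, visual kernel -/
noncomputable def nm (y : Γ) : ℝ := s.d 1 y
noncomputable def gp (x y : Γ) : ℝ := gromov s.d 1 x y
noncomputable def E (x y : Γ) : ℝ := Real.exp (-s.c * s.gp x y)

lemma d_eq (x y : Γ) : s.d x y = s.nm (x⁻¹ * y) := by
  unfold nm; rw [← s.ld x 1 (x⁻¹ * y)]; simp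
lemma nm_nonneg (x : Γ) : 0 ≤ s.nm x := metric_nonneg s.md _ _
lemma nm_one : s.nm 1 = 0 := s.md.refl 1
lemma nm_inv (x : Γ) : s.nm x⁻¹ = s.nm x := by
  unfold nm; rw [← s.ld x 1 x⁻¹, s.md.symm]; simp
lemma nm_mul_le (x y : Γ) : s.nm (x * y) ≤ s.nm x + s.nm y := by
  have := s.md.triangle 1 x (x*y)
  rw [s.d_eq x (x*y)] at this; simpa [nm] using this
lemma gp_comm (x y : Γ) : s.gp x y = s.gp y x := gromov_comm s.md _ _ _
lemma gp_nonneg (x y : Γ) : 0 ≤ s.gp x y := gromov_nonneg s.md _ _ _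
lemma gp_def (x y : Γ) : s.gp x y = (s.nm x + s.nm y - s.nm (x⁻¹ * y)) / 2 := by
  unfold gp gromov; rw [s.d_eq x y]; rfl
lemma gp_le_left (x y : Γ) : s.gp x y ≤ s.nm x := by
  have := s.md.triangle 1 x y
  unfold gp gromov nm; linarith
lemma gp_le_right (x y : Γ) : s.gp x y ≤ s.nm y := by rw [gp_comm]; exact s.gp_le_left y x
lemma gp_hyp (x y z : Γ) : min (s.gp x z) (s.gp y z) - s.δ ≤ s.gp x y := s.hyp x y z 1
lemma hδ0 : 0 ≤ s.δ := by linarith [s.hδ]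
lemma nm_mul (g z : Γ) : s.nm (g * z) = s.nm g + s.nm z - 2 * s.gp g⁻¹ z := by
  rw [gp_def, nm_inv, inv_inv]; ring
lemma gp_mul_self (x y : Γ) : s.gp x (x * y) = s.nm x - s.gp x⁻¹ y := by
  rw [gp_def, gp_def, nm_inv, inv_inv, inv_mul_cancel_left]; ring
lemma gp_smul (g z z' : Γ) : s.gp (g * z) (g * z') =
    s.gp z z' + ((s.nm (g*z) - s.nm z) + (s.nm (g*z') - s.nm z')) / 2 := by
  rw [gp_def, gp_def, show (g*z)⁻¹ * (g*z') = z⁻¹ * z' by group]; ring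
lemma gp_smul_ge (g z z' : Γ) : s.gp z z' - s.nm g ≤ s.gp (g * z) (g * z') := by
  rw [gp_smul]
  have h1 := s.nm_mul_le g⁻¹ (g*z)
  have h2 := s.nm_mul_le g⁻¹ (g*z')
  rw [inv_mul_cancel_left, nm_inv] at h1 h2; linarith
lemma E_pos (x y : Γ) : 0 < s.E x y := Real.exp_pos _
lemma E_le_one (x y : Γ) : s.E x y ≤ 1 := by
  unfold E; rw [Real.exp_le_one_iff]; nlinarith [s.gp_nonneg x y, s.hc]
lemma E_le {x y x' y' : Γ} {K : ℝ} (h : s.gp x y + K ≤ s.gp x' y') :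
    s.E x' y' ≤ Real.exp (-s.c * K) * s.E x y := by
  unfold E; rw [← Real.exp_add]; apply Real.exp_le_exp.2; nlinarith [s.hc]
lemma E_ge {x y : Γ} {K : ℝ} (h : s.gp x y ≤ K) : Real.exp (-s.c * K) ≤ s.E x y := by
  unfold E; apply Real.exp_le_exp.2; nlinarith [s.hc]
lemma E_smul (g z z' : Γ) : s.E (g*z) (g*z') ≤ Real.exp (s.c * s.nm g) * s.E z z' := by
  have := s.E_le (x := z) (y := z') (x' := g*z) (y' := g*z') (K := -s.nm g) (by linarith [s.gp_smul_ge g z z'])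
  simpa using this
/-- point on a rough geodesic from 1 to z -/
lemma head (z : Γ) (t : ℝ) (h0 : 0 ≤ t) (h1 : t ≤ s.nm z) : ∃ x, |s.nm x - t| ≤ s.C0 ∧
    s.nm x - s.C0 ≤ s.gp x z := by
  obtain ⟨x, hx, hx'⟩ := s.rg 1 z t h0 h1
  refine ⟨x, hx, ?_⟩
  unfold gromov at hx'; unfold gp gromov nm
  rw [s.md.symm x 1] at hx'
  linarith

lemma ball_eq (T : ℝ) : ball s.d T = {g | s.nm g < T} := rfl

lemma count_dir (z : Γ) (ρ p : ℝ) (hp : 0 ≤ p) :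
    {f | s.nm f < ρ ∧ p < s.gp z f}.ncard ≤ (ball s.d (ρ - p + (5 * s.C0 + 2 * s.δ))).ncard := by
  by_cases hz : p ≤ s.nm z
  · obtain ⟨x, hx, hx'⟩ := s.head z p hp hz
    refine ncard_le_ncard_of_injOn (fun f => x⁻¹ * f) ?_ (fun a _ b _ h => mul_left_cancel h) (s.fin _)
    rintro f ⟨h1, h2⟩
    show s.nm (x⁻¹ * f) < _
    rw [nm_mul, nm_inv, inv_inv]
    have h3 := s.gp_hyp x f z
    rw [s.gp_comm f z] at h3
    rw [abs_le] at hx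
    rcases min_choice (s.gp x z) (s.gp z f) with e | e <;> rw [e] at h3 <;> linarith [s.hC0, s.hδ]
  · have : {f | s.nm f < ρ ∧ p < s.gp z f} = ∅ := by
      ext f; simp only [mem_setOf_eq, mem_empty_iff_false, iff_false]
      rintro ⟨_, h⟩; linarith [s.gp_le_left z f]
    rw [this]; simp

lemma E1 (m : ℕ) (M : ℝ) : ∃ ρ p : ℝ, 0 ≤ p ∧ ∀ Z W : Fin m → Γ, ∃ f, s.nm f ≤ ρ ∧ 2 * p + M ≤ s.nm f ∧
    (∀ i, s.gp (Z i) f ≤ p) ∧ ∀ i, s.gp f⁻¹ (W i) ≤ p := by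
  obtain ⟨C, hC, hup⟩ := s.up (1/100) (by norm_num)
  set C' := 5 * s.C0 + 2 * s.δ with hC'
  -- threshold
  have hlim : ∃ T0 : ℝ, ∀ ρ ≥ T0, C * Real.exp ((1+1/100) * (ρ/2)) + 
      2 * m * (C * Real.exp ((1+1/100) * (ρ - ρ/8 + C'))) < Real.exp ((1 - 1/100) * ρ) := by
    have h1 : Tendsto (fun ρ : ℝ => C * Real.exp (-(485/1000) * ρ) + 
        2 * m * C * Real.exp ((1+1/100) * C') * Real.exp (-(10625/100000) * ρ)) atTop (nhds (C * 0 + 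
        2 * m * C * Real.exp ((1+1/100) * C') * 0)) := by
      have hh : ∀ a : ℝ, 0 < a → Tendsto (fun ρ : ℝ => Real.exp (-a * ρ)) atTop (nhds 0) := by
        intro a ha
        refine Real.tendsto_exp_atBot.comp ?_
        exact tendsto_id.const_mul_atTop_of_neg (by linarith)
      exact ((hh _ (by norm_num)).const_mul _).add ((hh _ (by norm_num)).const_mul _)
    have h2 := h1.eventually (gt_mem_nhds (show C * 0 + 2 * m * C * Real.exp ((1+1/100) * C') * 0 < 1 by simp))
    obtain ⟨T0, hT0⟩ := eventually_atTop.1 h2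
    refine ⟨T0, fun ρ hρ => ?_⟩
    have h3 := hT0 ρ hρ
    have h4 := mul_lt_mul_of_pos_right h3 (Real.exp_pos ((1 - 1/100) * ρ))
    rw [one_mul, add_mul, mul_assoc, mul_assoc _ (Real.exp _) (Real.exp _), ← Real.exp_add, ← Real.exp_add] at h4
    refine lt_of_le_of_lt (le_of_eq ?_) h4
    have e1 : (1 + 1/100) * (ρ - ρ/8 + C') = (1+1/100) * C' + (-(10625/100000) * ρ + (1 - 1/100) * ρ) := by ring
    rw [e1, Real.exp_add]; ring_nf
  obtain ⟨T0, hT0⟩ := hlim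
  obtain ⟨ρ, hρ, hlo⟩ := s.lo (1/100) (by norm_num) (max T0 (max (4 * M) 1))
  have hρ1 : 1 ≤ ρ := (le_max_right _ _).trans ((le_max_right _ _).trans hρ)
  have hρM : 4 * M ≤ ρ := (le_max_left _ _).trans ((le_max_right _ _).trans hρ)
  refine ⟨ρ, ρ/8, by positivity, fun Z W => ?_⟩
  by_contra hcon
  push Not at hcon
  have hbig := hT0 ρ ((le_max_left _ _).trans hρ)
  have hfinsub : ∀ P : Γ → Prop, {f | s.nm f < ρ ∧ P f}.Finite := fun P =>
    (s.fin ρ).subset (fun f hf => hf.1)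
  classical
  set B := (s.fin ρ).toFinset
  set B1 := (hfinsub (fun f => s.nm f < ρ/2)).toFinset
  set B2 := fun i => (hfinsub (fun f => ρ/8 < s.gp (Z i) f)).toFinset
  set B3 := fun i => (hfinsub (fun f => ρ/8 < s.gp f⁻¹ (W i))).toFinset
  have hsub : B ⊆ B1 ∪ (Finset.univ.biUnion B2 ∪ Finset.univ.biUnion B3) := by
    intro f hf
    have hf' : s.nm f < ρ := by have := (s.fin ρ).mem_toFinset.1 hf; exact this
    by_cases h1 : s.nm f < ρ/2
    · apply Finset.mem_union_left; simp [B1, h1, hf']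
    apply Finset.mem_union_right
    by_cases h2 : ∃ i, ρ/8 < s.gp (Z i) f
    · obtain ⟨i, hi⟩ := h2
      apply Finset.mem_union_left; simp only [Finset.mem_biUnion]; exact ⟨i, by simp, by simp [B2, hi, hf']⟩
    push Not at h2
    obtain ⟨i, hi⟩ := hcon f hf'.le (by linarith) h2
    apply Finset.mem_union_right; simp only [Finset.mem_biUnion]; exact ⟨i, by simp, by simp [B3, hi, hf']⟩
  have c2 : ∀ i ∈ (Finset.univ : Finset (Fin m)), (B2 i).card ≤ (ball s.d (ρ - ρ/8 + C')).ncard := by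
    intro i _
    rw [← ncard_eq_toFinset_card _ (hfinsub _)]; exact s.count_dir (Z i) ρ (ρ/8) (by positivity)
  have c3 : ∀ i ∈ (Finset.univ : Finset (Fin m)), (B3 i).card ≤ (ball s.d (ρ - ρ/8 + C')).ncard := by
    intro i _
    rw [← ncard_eq_toFinset_card _ (hfinsub _)]
    refine le_trans ?_ (s.count_dir (W i) ρ (ρ/8) (by positivity))
    refine ncard_le_ncard_of_injOn (fun f => f⁻¹) ?_ (fun a _ b _ h => inv_injective h) (hfinsub _)
    rintro f ⟨h1, h2⟩
    exact ⟨by rw [nm_inv]; exact h1, by rw [gp_comm]; exact h2⟩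
  have c1 : B1.card ≤ (ball s.d (ρ/2)).ncard := by
    rw [← ncard_eq_toFinset_card _ (hfinsub _)]; exact ncard_le_ncard (fun f hf => hf.2) (s.fin _)
  have hcard : B.card ≤ (ball s.d (ρ/2)).ncard + (m * (ball s.d (ρ - ρ/8 + C')).ncard + m * (ball s.d (ρ - ρ/8 + C')).ncard) := by
    refine (Finset.card_le_card hsub).trans ((Finset.card_union_le _ _).trans (add_le_add c1
      ((Finset.card_union_le _ _).trans (add_le_add ?_ ?_))))
    · simpa using Finset.card_biUnion_le_card_mul _ _ _ c2
    · simpa using Finset.card_biUnion_le_card_mul _ _ _ c3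
  have hB : B.card = (ball s.d ρ).ncard := (ncard_eq_toFinset_card _ _).symm
  rw [hB] at hcard
  have hcardR : ((ball s.d ρ).ncard : ℝ) ≤ (ball s.d (ρ/2)).ncard + 2 * m * (ball s.d (ρ - ρ/8 + C')).ncard := by
    have : ((ball s.d ρ).ncard : ℝ) ≤ (((ball s.d (ρ/2)).ncard + (m * (ball s.d (ρ - ρ/8 + C')).ncard + m * (ball s.d (ρ - ρ/8 + C')).ncard) : ℕ) : ℝ) := by exact_mod_cast hcard
    push_cast at this; linarith
  have u1 := hup (ρ/2)
  have u2 := mul_le_mul_of_nonneg_left (hup (ρ - ρ/8 + C')) (show (0:ℝ) ≤ 2 * m by positivity)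
  linarith

/-- cone placement: consequence of the conditions in `E1`. -/
lemma cone {f z w : Γ} {p M : ℝ} (hM : s.δ < M) (h1 : 2 * p + M ≤ s.nm f) (h2 : s.gp z f ≤ p) (h3 : s.gp f⁻¹ w ≤ p) :
    s.gp z (f * w) ≤ p + s.δ ∧ p + M ≤ s.gp f (f * w) := by
  have e := s.gp_mul_self f w
  refine ⟨?_, by linarith⟩
  have h := s.gp_hyp z f (f*w)
  rcases min_choice (s.gp z (f*w)) (s.gp f (f*w)) with q | q <;> rw [q] at h
  · linarith
  · by_contra; linarith
end Setup
end PaperCLT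
end

section
open Filter Set
namespace PaperCLT

section
variable {Γ : Type*} [Group Γ]
/-- product of a word, last letter on the left -/
def wprod : List Γ → Γ
  | [] => 1
  | u :: l => wprod l * u
/-- all steps along the word have weight at least κ -/
def PathOK (U : Finset Γ) (k : Γ → Γ → ℝ) (κ : ℝ) : Γ → List Γ → Prop
  | _, [] => True
  | z, u :: l => u ∈ U ∧ κ ≤ k z u ∧ PathOK U k κ (u * z) l
lemma wprod_append (l l' : List Γ) : wprod (l ++ l') = wprod l' * wprod l := by
  induction l with
  | nil => simp [wprod]
  | cons u l ih => simp [wprod, ih, mul_assoc]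
lemma PathOK_append {U : Finset Γ} {k : Γ → Γ → ℝ} {κ : ℝ} (l l' : List Γ) (z : Γ) :
    PathOK U k κ z (l ++ l') ↔ PathOK U k κ z l ∧ PathOK U k κ (wprod l * z) l' := by
  induction l generalizing z with
  | nil => simp [wprod, PathOK]
  | cons u l ih => simp [wprod, PathOK, ih, mul_assoc, and_assoc]
end

structure Walk {Γ : Type*} [Group Γ] (s : Setup Γ) where
  U : Finset Γ
  k : Γ → Γ → ℝ
  k0 : ∀ z u, 0 ≤ k z u
  R : ℝ
  Bm : ℝ
  r1 : ℝ
  R1 : 1 ≤ R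
  kb : ∀ z u, k z u ≠ 0 → R ≤ s.nm (u * z) - s.nm z ∧ s.nm (u * z) - s.nm z ≤ Bm
  ks : ∀ y, r1 ≤ s.nm y → ∑ u ∈ U, k (u⁻¹ * y) u = 1
  ks0 : ∀ y u, s.nm y < r1 → k (u⁻¹ * y) u = 0
  Ck : ℝ
  kl : ∀ z z' u, u ∈ U → |k z u - k z' u| ≤ Ck * s.E z z'
  K0 : ℝ
  θ : ℝ
  θ0 : 0 < θ
  θ1 : θ ≤ 1/2
  kc : ∀ z z' u, K0 ≤ s.gp z z' → k z u ≠ 0 → s.E (u * z) (u * z') ≤ θ * s.E z z'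
  A1 : ℝ
  hA1 : ∀ z, ∑ u ∈ U, k z u * Real.exp (-(s.nm (u * z) - s.nm z)) ≤ A1
  A1θ : A1 * θ ≤ 1/2
  κ : ℝ
  κ0 : 0 < κ
  p : ℝ
  p0 : 0 ≤ p
  ρ : ℝ
  ρU : ℝ
  eone : ∀ Z W : Fin 4 → Γ, ∃ f, s.nm f ≤ ρ ∧ 2 * p + (s.δ + 1) ≤ s.nm f ∧
    (∀ i, s.gp (Z i) f ≤ p) ∧ ∀ i, s.gp f⁻¹ (W i) ≤ p
  θR : Real.exp (-s.c * (R/2)) ≤ θ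
  kU : ∀ u ∈ U, s.nm u ≤ ρU
  path : ∀ r : ℝ, ∃ N : ℕ, ∀ g, 5 * R ≤ s.nm g → s.nm g ≤ r → 
    ∃ l : List Γ, l.length ≤ N ∧ wprod l = g⁻¹ ∧ ∀ z, s.gp z g ≤ p + 8 * s.δ → PathOK U k κ z l

lemma clamp_lip (a b : ℝ) : |max 0 (min 1 a) - max 0 (min 1 b)| ≤ |a - b| := by
  have h1 := abs_max_sub_max_le_abs (min 1 a) (min 1 b) 0
  have h2 := abs_inf_sub_inf_le_abs a b 1
  rw [max_comm 0, max_comm 0]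
  refine h1.trans ?_
  rw [min_comm 1 a, min_comm 1 b]; exact h2

namespace Setup
variable {Γ : Type*} [Group Γ] (s : Setup Γ)

lemma fin_le (T : ℝ) : {g | s.nm g ≤ T}.Finite :=
  (s.fin (T + 1)).subset (fun g hg => by show s.nm g < T + 1; have : s.nm g ≤ T := hg; linarith)

lemma poincare (ε : ℝ) (hε : 0 < ε) : ∃ Z > (0:ℝ), ∀ U : Finset Γ, ∑ u ∈ U, Real.exp (-(1 + ε) * s.nm u) ≤ Z := by
  obtain ⟨C, hC, hup⟩ := s.up (ε/2) (by linarith)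
  have hsum : Summable (fun j : ℕ => C * Real.exp (1 + ε/2) * (Real.exp (-(ε/2))) ^ j) :=
    (summable_geometric_of_lt_one (Real.exp_pos _).le (by rw [Real.exp_lt_one_iff]; linarith)).mul_left _
  refine ⟨∑' j : ℕ, C * Real.exp (1 + ε/2) * (Real.exp (-(ε/2))) ^ j + 1, ?_, fun U => ?_⟩
  · have : 0 ≤ ∑' j : ℕ, C * Real.exp (1 + ε/2) * (Real.exp (-(ε/2))) ^ j := tsum_nonneg (fun j => by positivity)
    linarith
  classical
  rw [← Finset.sum_fiberwise_of_maps_to (t := U.image (fun u => ⌊s.nm u⌋₊)) (g := fun u => ⌊s.nm u⌋₊)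
    (fun u hu => Finset.mem_image_of_mem _ hu)]
  refine le_trans (Finset.sum_le_sum (g := fun j : ℕ => C * Real.exp (1 + ε/2) * (Real.exp (-(ε/2))) ^ j) fun j _ => ?_)
    ((hsum.sum_le_tsum _ (fun j _ => by positivity)).trans (by linarith))
  have h1 : ∀ u ∈ U.filter (fun u => ⌊s.nm u⌋₊ = j), Real.exp (-(1 + ε) * s.nm u) ≤ Real.exp (-(1+ε) * j) := by
    intro u hu
    rw [Finset.mem_filter] at hu
    apply Real.exp_le_exp.2
    have : (j:ℝ) ≤ s.nm u := by rw [← hu.2]; exact Nat.floor_le (s.nm_nonneg u)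
    nlinarith
  refine (Finset.sum_le_card_nsmul _ _ _ h1).trans ?_
  have h2 : ((U.filter (fun u => ⌊s.nm u⌋₊ = j)).card : ℝ) ≤ C * Real.exp ((1 + ε/2) * (j + 1)) := by
    refine le_trans ?_ (hup (j+1))
    rw [ncard_eq_toFinset_card _ (s.fin _)]
    norm_cast
    apply Finset.card_le_card
    intro u hu
    rw [Finset.mem_filter] at hu
    refine (s.fin _).mem_toFinset.2 ?_
    show s.nm u < (((j+1:ℕ)):ℝ)
    have := Nat.lt_floor_add_one (s.nm u)
    rw [hu.2] at this; push_cast; exact this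
  rw [nsmul_eq_mul]
  refine (mul_le_mul_of_nonneg_right h2 (Real.exp_pos _).le).trans (le_of_eq ?_)
  rw [← Real.exp_nat_mul, mul_assoc, mul_assoc, ← Real.exp_add, ← Real.exp_add]
  congr 2; ring
end Setup
end PaperCLT
end

section
open Filter Set
namespace PaperCLT
namespace Setup
variable {Γ : Type*} [Group Γ] (s : Setup Γ)

noncomputable def wt (R c2 : ℝ) (y u : Γ) : ℝ :=
  max 0 (min 1 (min ((s.nm y - s.d u y)/R - 1) (13 - (s.nm y - s.d u y)/R))) *
  max 0 (min 1 (c2 - (s.nm u - (s.nm y - s.d u y))))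

lemma wt_nonneg (R c2 : ℝ) (y u : Γ) : 0 ≤ s.wt R c2 y u := mul_nonneg (le_max_left _ _) (le_max_left _ _)
lemma wt_le_one (R c2 : ℝ) (y u : Γ) : s.wt R c2 y u ≤ 1 := by
  have h : ∀ a : ℝ, max 0 (min 1 a) ≤ 1 := fun a => max_le zero_le_one (min_le_left _ _)
  exact mul_le_one₀ (h _) (le_max_left _ _) (h _)
lemma clamp_pos {a : ℝ} (h : max 0 (min 1 a) ≠ 0) : 0 < a := by
  by_contra hh
  exact h (max_eq_left ((min_le_right _ _).trans (not_lt.1 hh)))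
lemma wt_ne {R c2 : ℝ} (hR : 0 < R) {y u : Γ} (h : s.wt R c2 y u ≠ 0) : R ≤ s.nm y - s.d u y ∧ s.nm y - s.d u y ≤ 13 * R ∧
    s.nm u - (s.nm y - s.d u y) ≤ c2 := by
  have h1 := clamp_pos (left_ne_zero_of_mul h)
  have h2 := clamp_pos (right_ne_zero_of_mul h)
  rw [lt_min_iff] at h1
  refine ⟨?_, ?_, by linarith⟩
  · have := h1.1; rw [sub_pos, lt_div_iff₀ hR] at this; linarith
  · have := h1.2; rw [sub_pos, div_lt_iff₀ hR] at this; linarith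
lemma wt_one {R c2 : ℝ} (hR : 0 < R) {y u : Γ} (h1 : 2 * R ≤ s.nm y - s.d u y) (h2 : s.nm y - s.d u y ≤ 12 * R)
    (h3 : s.nm u - (s.nm y - s.d u y) ≤ c2 - 1) : s.wt R c2 y u = 1 := by
  unfold wt
  have e1 : 1 ≤ (s.nm y - s.d u y)/R - 1 := by rw [le_sub_iff_add_le, le_div_iff₀ hR]; linarith
  have e2 : 1 ≤ 13 - (s.nm y - s.d u y)/R := by rw [le_sub_comm, div_le_iff₀ hR]; linarith
  rw [min_eq_left (le_min e1 e2), min_eq_left (by linarith)]; simp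
lemma wt_lip {R c2 : ℝ} (hR : 1 ≤ R) (y y' u : Γ) : |s.wt R c2 y u - s.wt R c2 y' u| ≤
    2 * |(s.nm y - s.d u y) - (s.nm y' - s.d u y')| := by
  unfold wt
  set a := s.nm y - s.d u y
  set a' := s.nm y' - s.d u y'
  have h : ∀ a : ℝ, |max 0 (min 1 a)| ≤ 1 := fun a => by
    rw [abs_of_nonneg (le_max_left _ _)]; exact max_le zero_le_one (min_le_left _ _)
  have hdiv : |a/R - a'/R| ≤ |a - a'| := by
    rw [← sub_div, abs_div, abs_of_pos (by linarith : 0 < R)]; exact div_le_self (abs_nonneg _) hR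
  have e1 := clamp_lip (min (a/R - 1) (13 - a/R)) (min (a'/R - 1) (13 - a'/R))
  have e1' : |min (a/R - 1) (13 - a/R) - min (a'/R - 1) (13 - a'/R)| ≤ |a - a'| := by
    refine (abs_min_sub_min_le_max _ _ _ _).trans (max_le ?_ ?_)
    · rwa [sub_sub_sub_cancel_right]
    · rwa [sub_sub_sub_cancel_left, abs_sub_comm]
  have e2 := clamp_lip (c2 - (s.nm u - a)) (c2 - (s.nm u - a'))
  have e2' : |c2 - (s.nm u - a) - (c2 - (s.nm u - a'))| = |a - a'| := by congr 1; ring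
  rw [e2'] at e2
  set x := max 0 (min 1 (min (a/R - 1) (13 - a/R)))
  set x' := max 0 (min 1 (min (a'/R - 1) (13 - a'/R)))
  set v := max 0 (min 1 (c2 - (s.nm u - a)))
  set v' := max 0 (min 1 (c2 - (s.nm u - a')))
  have : x * v - x' * v' = (x - x') * v + x' * (v - v') := by ring
  rw [this]
  refine (abs_add_le _ _).trans ?_
  rw [abs_mul, abs_mul]
  have f1 := mul_le_mul (e1.trans e1') (h (c2 - (s.nm u - a))) (abs_nonneg _) (abs_nonneg _)
  have f2 := mul_le_mul (h (min (a'/R - 1) (13 - a'/R))) e2 (abs_nonneg _) zero_le_one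
  linarith

lemma d_smul (u z : Γ) : s.d u (u * z) = s.nm z := by rw [d_eq, inv_mul_cancel_left]

/-- the steps used in PATH -/
lemma path_pts {tol : ℝ} {z g : Γ} (h : s.gp z g ≤ tol) {x : Γ} (hx : s.nm x - s.C0 ≤ s.gp x g) :
    s.gp x z ≤ tol + s.δ + s.C0 := by
  have h1 := s.gp_hyp z g x
  rw [s.gp_comm g x, s.gp_comm z x] at h1
  rcases min_choice (s.gp x z) (s.gp x g) with q | q <;> rw [q] at h1
  · linarith [s.hC0]
  · linarith [s.gp_le_left x z]

set_option maxHeartbeats 2000000 in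
theorem exists_walk : Nonempty (Walk s) := by
  classical
  obtain ⟨ρ, p, hp0, hE1⟩ := s.E1 4 (s.δ + 1)
  have hδ := s.hδ; have hC0 := s.hC0; have hc := s.hc; have hc1 := s.hc1
  obtain ⟨t1, ht1⟩ : ∃ x, x = p + 8 * s.δ + s.δ + s.C0 := ⟨_, rfl⟩
  obtain ⟨c2, hc2⟩ : ∃ x, x = 2 * s.C0 + 2 * s.δ + 2 * t1 + 1 := ⟨_, rfl⟩
  obtain ⟨Z, hZ, hZs⟩ := s.poincare (s.c/100) (by positivity)
  have hR : ∃ R : ℝ, 2 * s.C0 + 2 * t1 + c2 + 2 * s.δ + 5 * s.C0 ≤ R ∧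
      Real.exp (c2 + s.c/100 * (13 * R + c2)) * Z * Real.exp (-s.c * (R/2)) ≤ 1/2 ∧ Real.exp (-s.c * (R/2)) ≤ 1/2 := by
    have hh : ∀ a : ℝ, 0 < a → Tendsto (fun R : ℝ => Real.exp (-a * R)) atTop (nhds 0) := by
      intro a ha
      exact Real.tendsto_exp_atBot.comp (tendsto_id.const_mul_atTop_of_neg (by linarith))
    have h1 := (hh (s.c * 37/100) (by positivity)).const_mul (Real.exp (c2 + s.c/100 * c2) * Z)
    rw [mul_zero] at h1
    have h2 := hh (s.c/2) (by positivity)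
    obtain ⟨R, hR1, hR2, hR3⟩ := ((eventually_ge_atTop (2 * s.C0 + 2 * t1 + c2 + 2 * s.δ + 5 * s.C0)).and
      ((h1.eventually (gt_mem_nhds (show (0:ℝ) < 1/2 by norm_num))).and (h2.eventually (gt_mem_nhds (show (0:ℝ) < 1/2 by norm_num))))).exists
    refine ⟨R, hR1, le_trans (le_of_eq ?_) hR2.le, le_trans (le_of_eq (by congr 1; ring)) hR3.le⟩
    rw [mul_right_comm, mul_right_comm _ Z, ← Real.exp_add, ← Real.exp_add]; congr 2; ring
  obtain ⟨R, hRbig, hRA, hRθ⟩ := hR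
  have hR1 : 1 ≤ R := by linarith
  have hR0 : 0 < R := by linarith
  obtain ⟨U, hU⟩ : ∃ x, x = (s.fin_le (13 * R + c2)).toFinset := ⟨_, rfl⟩
  have memU : ∀ u, u ∈ U ↔ s.nm u ≤ 13 * R + c2 := fun u => by rw [hU]; exact (s.fin_le _).mem_toFinset
  obtain ⟨S, hS⟩ : ∃ S : Γ → ℝ, S = fun y => ∑ v ∈ U, s.wt R c2 y v := ⟨_, rfl⟩
  have hwU : ∀ y u, s.wt R c2 y u ≠ 0 → u ∈ U := by
    intro y u h
    obtain ⟨h1, h2, h3⟩ := s.wt_ne hR0 h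
    rw [memU]; linarith
  have hS0 : ∀ y, 0 ≤ S y := fun y => by rw [hS]; exact Finset.sum_nonneg (fun v _ => s.wt_nonneg _ _ _ _)
  have hwS : ∀ y u, s.wt R c2 y u ≤ S y := by
    intro y u
    by_cases h : s.wt R c2 y u = 0
    · rw [h]; exact hS0 y
    · rw [hS]; exact Finset.single_le_sum (f := fun v => s.wt R c2 y v) (fun v _ => s.wt_nonneg _ _ _ _) (hwU y u h)
  have hS1 : ∀ y, 4 * R ≤ s.nm y → 1 ≤ S y := by
    intro y hy
    obtain ⟨u, hu, hu'⟩ := s.head y (3 * R) (by positivity) (by linarith)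
    rw [abs_le] at hu
    have : s.wt R c2 y u = 1 := by
      have e : s.nm y - s.d u y = 2 * s.gp u y - s.nm u := by rw [gp_def, d_eq]; ring
      have := s.gp_le_left u y
      apply s.wt_one hR0 <;> rw [e] <;> linarith
    rw [← this]; exact hwS y u
  obtain ⟨k, hk⟩ : ∃ k : Γ → Γ → ℝ, k = fun z u => if 4 * R ≤ s.nm (u * z) then s.wt R c2 (u * z) u / S (u * z) else 0 := ⟨_, rfl⟩
  have kne : ∀ z u, k z u ≠ 0 → s.wt R c2 (u*z) u ≠ 0 ∧ 4 * R ≤ s.nm (u * z) := by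
    intro z u h
    simp only [hk] at h
    split_ifs at h with h1
    · exact ⟨fun h2 => h (by rw [h2, zero_div]), h1⟩
    · exact absurd rfl h
  have kne' : ∀ z u, k z u ≠ 0 → R ≤ s.nm (u * z) - s.nm z ∧ s.nm (u * z) - s.nm z ≤ 13 * R ∧
      s.nm u - (s.nm (u * z) - s.nm z) ≤ c2 := by
    intro z u h
    have := s.wt_ne hR0 (kne z u h).1
    rwa [d_smul] at this
  have kle : ∀ z u, k z u ≤ 1 := by
    intro z u
    simp only [hk]; split_ifs with h1
    · exact div_le_one_of_le₀ (hwS _ _) (hS0 _)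
    · exact zero_le_one
  have k0 : ∀ z u, 0 ≤ k z u := by
    intro z u; simp only [hk]; split_ifs with h1
    · exact div_nonneg (s.wt_nonneg _ _ _ _) (hS0 _)
    · exact le_rfl
  obtain ⟨Cv, hCv, hvd⟩ := s.vd (13 * R + c2)
  have hScard : ∀ y, S y ≤ U.card + 1 := by
    intro y
    have := Finset.sum_le_card_nsmul U (fun v => s.wt R c2 y v) 1 (fun v _ => s.wt_le_one _ _ _ _)
    rw [nsmul_eq_mul, mul_one] at this; rw [hS]; linarith
  have wl : ∀ y y' u, u ∈ U → |s.wt R c2 y u - s.wt R c2 y' u| ≤ 2 * (Cv * s.E y y') := by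
    intro y y' u hu
    refine (s.wt_lip hR1 y y' u).trans ?_
    have := hvd u y y' ((memU u).1 hu)
    rw [abs_sub_comm] at this
    have e : (s.nm y - s.d u y) - (s.nm y' - s.d u y') = (s.d u y' - s.d 1 y') - (s.d u y - s.d 1 y) := by unfold nm; ring
    rw [e]; exact mul_le_mul_of_nonneg_left this (by norm_num)
  have Sl : ∀ y y', |S y - S y'| ≤ U.card * (2 * (Cv * s.E y y')) := by
    intro y y'
    simp only [hS]; rw [← Finset.sum_sub_distrib]
    refine (Finset.abs_sum_le_sum_abs _ _).trans ?_
    refine (Finset.sum_le_card_nsmul U _ _ (fun v hv => wl y y' v hv)).trans (le_of_eq (nsmul_eq_mul _ _))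
  obtain ⟨c', hc'⟩ : ∃ x, x = Real.exp (s.c * (13 * R + c2)) := ⟨_, rfl⟩
  obtain ⟨C2, hC2⟩ : ∃ x, x = (1 + U.card) * (2 * Cv) + Real.exp (s.c * (4 * R)) := ⟨_, rfl⟩
  have kl0 : ∀ z z' u, u ∈ U → |k z u - k z' u| ≤ C2 * s.E (u * z) (u * z') := by
    intro z z' u hu
    have hEp := s.E_pos (u*z) (u*z')
    have hbig : s.gp (u*z) (u*z') ≤ 4 * R → |k z u - k z' u| ≤ C2 * s.E (u * z) (u * z') := by
      intro h
      have h1 := s.E_ge h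
      have h2 : 1 ≤ Real.exp (s.c * (4 * R)) * s.E (u*z) (u*z') := by
        refine le_trans (le_of_eq ?_) (mul_le_mul_of_nonneg_left h1 (Real.exp_pos _).le)
        rw [← Real.exp_add, neg_mul, add_neg_cancel, Real.exp_zero]
      have h3 : |k z u - k z' u| ≤ 1 := by
        rw [abs_le]; constructor <;> linarith [k0 z u, k0 z' u, kle z u, kle z' u]
      have h4 : 0 ≤ (1 + (U.card:ℝ)) * (2 * Cv) * s.E (u*z) (u*z') := by positivity
      rw [hC2, add_mul]; linarith
    by_cases h1 : 4 * R ≤ s.nm (u * z)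
    · by_cases h2 : 4 * R ≤ s.nm (u * z')
      · simp only [hk, if_pos h1, if_pos h2]
        set y := u * z; set y' := u * z'
        have hs1 := hS1 y h1; have hs2 := hS1 y' h2
        have e : s.wt R c2 y u / S y - s.wt R c2 y' u / S y' =
            (s.wt R c2 y u - s.wt R c2 y' u) / S y + (s.wt R c2 y' u / S y') * ((S y' - S y) / S y) := by
          field_simp; ring
        rw [e]
        have f1 : |(s.wt R c2 y u - s.wt R c2 y' u) / S y| ≤ 2 * (Cv * s.E y y') := by
          rw [abs_div, abs_of_nonneg (hS0 y)]; exact (div_le_self (abs_nonneg _) hs1).trans (wl y y' u hu)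
        have f2 : |(S y' - S y) / S y| ≤ U.card * (2 * (Cv * s.E y y')) := by
          rw [abs_div, abs_of_nonneg (hS0 y), abs_sub_comm]; exact (div_le_self (abs_nonneg _) hs1).trans (Sl y y')
        have f3 : |s.wt R c2 y' u / S y'| ≤ 1 := by
          rw [abs_of_nonneg (div_nonneg (s.wt_nonneg _ _ _ _) (hS0 _))]; exact div_le_one_of_le₀ (hwS _ _) (hS0 _)
        refine (abs_add_le _ _).trans ?_
        rw [abs_mul]
        have f4 := mul_le_mul f3 f2 (abs_nonneg _) zero_le_one
        have f5 : 0 ≤ Real.exp (s.c * (4*R)) * s.E y y' := by positivity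
        rw [hC2]; linarith
      · exact hbig ((s.gp_le_right _ _).trans (not_le.1 h2).le)
    · exact hbig ((s.gp_le_left _ _).trans (not_le.1 h1).le)
  refine ⟨{ U := U, k := k, k0 := k0, R := R, Bm := 13 * R, r1 := 4 * R, R1 := hR1
            kb := fun z u h => ⟨(kne' z u h).1, (kne' z u h).2.1⟩
            ks := ?_, ks0 := ?_, Ck := C2 * c', kl := ?_, K0 := c2 / 2 + s.δ + 1, θ := Real.exp (-s.c * (R/2))
            θ0 := Real.exp_pos _, θ1 := hRθ, kc := ?_
            A1 := Real.exp (c2 + s.c/100 * (13 * R + c2)) * Z, hA1 := ?_, A1θ := hRA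
            κ := (1:ℝ) / (U.card + 1), κ0 := by positivity, p := p, p0 := hp0, ρ := ρ, eone := hE1, path := ?_
            θR := le_rfl, ρU := 13 * R + c2, kU := fun u hu => (memU u).1 hu }⟩
  · intro y hy
    simp only [hk, mul_inv_cancel_left, if_pos hy]
    rw [← Finset.sum_div]; have := hS1 y hy; rw [hS] at this ⊢; exact div_self (by linarith)
  · intro y u hy
    simp only [hk, mul_inv_cancel_left, if_neg (not_le.2 hy)]
  · intro z z' u hu
    refine (kl0 z z' u hu).trans ?_
    rw [mul_assoc]
    refine mul_le_mul_of_nonneg_left ?_ (by rw [hC2]; positivity)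
    refine (s.E_smul u z z').trans (mul_le_mul_of_nonneg_right ?_ (s.E_pos _ _).le)
    rw [hc']; apply Real.exp_le_exp.2
    exact mul_le_mul_of_nonneg_left ((memU u).1 hu) hc.le
  · intro z z' u hzz h
    obtain ⟨h1, h2, h3⟩ := kne' z u h
    apply s.E_le
    rw [gp_smul]
    have e := s.nm_mul u z
    have e' := s.nm_mul u z'
    have g1 := s.gp_hyp u⁻¹ z z'
    rw [] at g1
    rcases min_choice (s.gp u⁻¹ z') (s.gp z z') with q | q <;> rw [q] at g1 <;> linarith
  · intro z
    have h1 : ∀ u ∈ U, k z u * Real.exp (-(s.nm (u * z) - s.nm z)) ≤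
        Real.exp (c2 + s.c/100 * (13 * R + c2)) * Real.exp (-(1 + s.c/100) * s.nm u) := by
      intro u hu
      by_cases h : k z u = 0
      · rw [h, zero_mul]; positivity
      · obtain ⟨h1, h2, h3⟩ := kne' z u h
        refine (mul_le_of_le_one_left (Real.exp_pos _).le (kle z u)).trans ?_
        rw [← Real.exp_add]
        apply Real.exp_le_exp.2
        have := (memU u).1 hu
        nlinarith
    refine (Finset.sum_le_sum h1).trans ?_
    rw [← Finset.mul_sum]; exact mul_le_mul_of_nonneg_left (hZs U) (Real.exp_pos _).le
  · intro r
    refine ⟨⌊r / (5*R)⌋₊ + 1, fun g h1 h2 => ?_⟩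
    obtain ⟨n, hn⟩ : ∃ x, x = ⌊s.nm g / (5*R)⌋₊ := ⟨_, rfl⟩
    have hn1 : 1 ≤ n := by
      rw [hn]; apply Nat.le_floor; rw [Nat.cast_one, le_div_iff₀ (by positivity)]; linarith
    have hn1' : (1:ℝ) ≤ n := by exact_mod_cast hn1
    have hnle : (n:ℝ) * (5*R) ≤ s.nm g := by
      have := Nat.floor_le (div_nonneg (s.nm_nonneg g) (by positivity : (0:ℝ) ≤ 5*R))
      rwa [← hn, le_div_iff₀ (by positivity)] at this
    have hnlt : s.nm g < (n + 1) * (5*R) := by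
      have := Nat.lt_floor_add_one (s.nm g / (5*R))
      rwa [← hn, div_lt_iff₀ (by positivity)] at this
    obtain ⟨σ, hσ⟩ : ∃ x, x = s.nm g / n := ⟨_, rfl⟩
    have hσ1 : 5 * R ≤ σ := by rw [hσ, le_div_iff₀ (by positivity)]; linarith
    have hσ2 : σ ≤ 10 * R := by rw [hσ, div_le_iff₀ (by positivity)]; nlinarith
    have hσn : n * σ = s.nm g := by rw [hσ]; field_simp
    have hpt : ∀ i : ℕ, ∃ x, i ≤ n → |s.nm x - i * σ| ≤ s.C0 ∧ s.nm x - s.C0 ≤ s.gp x g ∧ (i = 0 → x = 1) ∧ (i = n → x = g) := by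
      intro i
      by_cases hi : i = 0
      · refine ⟨1, fun _ => ⟨?_, ?_, fun _ => rfl, fun h => by omega⟩⟩
        · rw [hi, nm_one]; simp; linarith
        · rw [nm_one]; linarith [s.gp_nonneg 1 g]
      by_cases hi' : i = n
      · refine ⟨g, fun _ => ⟨?_, ?_, fun h => by omega, fun _ => rfl⟩⟩
        · rw [hi', hσn, sub_self, abs_zero]; linarith
        · have := s.gp_def g g
          rw [inv_mul_cancel, nm_one] at this; linarith
      by_cases hin : i ≤ n
      · have : (i:ℝ) ≤ n := by exact_mod_cast hin
        have hσ0 : 0 ≤ σ := by linarith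
        obtain ⟨x, hx⟩ := s.head g (i * σ) (by positivity) (by rw [← hσn]; gcongr)
        exact ⟨x, fun _ => ⟨hx.1, hx.2, fun h => absurd h hi, fun h => absurd h hi'⟩⟩
      · exact ⟨1, fun h => absurd h hin⟩
    choose x hx using hpt
    have key : ∀ z, s.gp z g ≤ p + 8 * s.δ → ∀ i, i + 1 ≤ n → 1 / ((U.card:ℝ) + 1) ≤ k ((x i)⁻¹ * z) ((x (i+1))⁻¹ * x i) ∧ (x (i+1))⁻¹ * x i ∈ U := by
      intro z h3 i hi
      obtain ⟨a1, a2, a3, a4⟩ := hx i (by omega)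
      obtain ⟨b1, b2, b3, b4⟩ := hx (i+1) hi
      have q1 := s.path_pts h3 a2
      have q2 := s.path_pts h3 b2
      have q1' := s.gp_nonneg (x i) z
      have q2' := s.gp_nonneg (x (i+1)) z
      rw [abs_le] at a1 b1
      push_cast at b1
      have e1 := s.nm_mul (x i)⁻¹ z
      have e2 := s.nm_mul (x (i+1))⁻¹ z
      rw [inv_inv, nm_inv] at e1 e2
      have g1 := s.gp_hyp (x (i+1)) (x i) g
      have g2 : s.nm (x i) - s.C0 ≤ min (s.gp (x (i+1)) g) (s.gp (x i) g) := by
        apply le_min <;> linarith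
      have e3 := s.gp_def (x (i+1)) (x i)
      set u := (x (i+1))⁻¹ * x i with hu
      have euz : u * ((x i)⁻¹ * z) = (x (i+1))⁻¹ * z := by rw [hu]; group
      have hw : s.wt R c2 (u * ((x i)⁻¹ * z)) u = 1 := by
        apply s.wt_one hR0 <;> rw [d_smul, euz] <;> linarith
      refine ⟨?_, hwU _ u (by rw [hw]; norm_num)⟩
      have h4 : 4 * R ≤ s.nm (u * ((x i)⁻¹ * z)) := by
        rw [euz]
        have : (5 * R) ≤ (i + 1) * σ := by nlinarith [(Nat.cast_nonneg i : (0:ℝ) ≤ i)]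
        have := s.gp_le_right (x (i+1)) z
        linarith
      simp only [hk, if_pos h4, hw]
      exact one_div_le_one_div_of_le (by have := hS1 _ h4; linarith) (hScard _)
    have hmain : ∀ m i, i + m = n → ∃ l : List Γ, l.length = m ∧ (∀ z, s.gp z g ≤ p + 8 * s.δ → PathOK U k (1 / ((U.card:ℝ) + 1)) ((x i)⁻¹ * z) l) ∧
        wprod l = g⁻¹ * x i := by
      intro m
      induction m with
      | zero =>
        intro i hi
        refine ⟨[], rfl, fun _ _ => trivial, ?_⟩
        rw [(hx i (by omega)).2.2.2 (by omega)]; simp [wprod]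
      | succ m ih =>
        intro i hi
        obtain ⟨l, l1, l2, l3⟩ := ih (i+1) (by omega)
        refine ⟨((x (i+1))⁻¹ * x i) :: l, by simp [l1], fun z hz => ⟨(key z hz i (by omega)).2, (key z hz i (by omega)).1, ?_⟩, ?_⟩
        · convert l2 z hz using 1; group
        · simp only [wprod, l3]; group
    obtain ⟨l, l1, l2, l3⟩ := hmain n 0 (by omega)
    have hx0 := (hx 0 (by omega)).2.2.1 rfl
    rw [hx0] at l2 l3
    rw [mul_one] at l3
    refine ⟨l, ?_, l3, fun z hz => by have := l2 z hz; rwa [inv_one, one_mul] at this⟩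
    rw [l1]
    have : n ≤ ⌊r / (5*R)⌋₊ := by rw [hn]; exact Nat.floor_le_floor (by gcongr)
    omega
end Setup
end PaperCLT
end

section
open Filter Set
namespace PaperCLT
namespace Walk
variable {Γ : Type*} [Group Γ] {s : Setup Γ} (W : Walk s)

def IsLip (s : Setup Γ) (f : Γ → ℝ) (M : ℝ) : Prop := ∀ z z', |f z - f z'| ≤ M * s.E z z'
lemma IsLip.mono {f : Γ → ℝ} {M M' : ℝ} (h : IsLip s f M) (hM : M ≤ M') : IsLip s f M' :=
  fun z z' => (h z z').trans (mul_le_mul_of_nonneg_right hM (s.E_pos _ _).le)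
lemma IsLip.nonneg {f : Γ → ℝ} {M : ℝ} (h : IsLip s f M) : 0 ≤ M := by
  have := (abs_nonneg _).trans (h 1 1)
  exact nonneg_of_mul_nonneg_left this (s.E_pos 1 1)
lemma IsLip.const (c : ℝ) : IsLip s (fun _ => c) 0 := fun z z' => by simp
lemma IsLip.add {f g : Γ → ℝ} {M M' : ℝ} (h : IsLip s f M) (h' : IsLip s g M') : IsLip s (fun z => f z + g z) (M + M') := by
  intro z z'
  rw [add_mul, add_sub_add_comm]; exact (abs_add_le _ _).trans (add_le_add (h z z') (h' z z'))
lemma IsLip.smul {f : Γ → ℝ} {M : ℝ} (c : ℝ) (h : IsLip s f M) : IsLip s (fun z => c * f z) (|c| * M) := by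
  intro z z'
  rw [← mul_sub, abs_mul, mul_assoc]; exact mul_le_mul_of_nonneg_left (h z z') (abs_nonneg _)
lemma IsLip.sub {f g : Γ → ℝ} {M M' : ℝ} (h : IsLip s f M) (h' : IsLip s g M') : IsLip s (fun z => f z - g z) (M + M') := by
  have := h.add (h'.smul (-1))
  simpa [sub_eq_add_neg] using this
lemma IsLip.sum {ι : Type*} (S : Finset ι) {f : ι → Γ → ℝ} {M : ι → ℝ} (h : ∀ i ∈ S, IsLip s (f i) (M i)) :
    IsLip s (fun z => ∑ i ∈ S, f i z) (∑ i ∈ S, M i) := by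
  intro z z'
  rw [← Finset.sum_sub_distrib, Finset.sum_mul]
  exact (Finset.abs_sum_le_sum_abs _ _).trans (Finset.sum_le_sum fun i hi => h i hi z z')
lemma IsLip.mul {f g : Γ → ℝ} {M M' B B' : ℝ} (h : IsLip s f M) (h' : IsLip s g M') (hf : ∀ z, |f z| ≤ B)
    (hg : ∀ z, |g z| ≤ B') : IsLip s (fun z => f z * g z) (M * B' + B * M') := by
  intro z z'
  have e : f z * g z - f z' * g z' = (f z - f z') * g z + f z' * (g z - g z') := by ring
  rw [e]
  refine (abs_add_le _ _).trans ?_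
  rw [abs_mul, abs_mul]
  have h1 := mul_le_mul (h z z') (hg z) (abs_nonneg _) (mul_nonneg h.nonneg (s.E_pos z z').le)
  have h2 := mul_le_mul (hf z') (h' z z') (abs_nonneg _) ((abs_nonneg _).trans (hf z'))
  nlinarith
lemma exp_lip {a b B : ℝ} (ha : a ≤ B) (hb : b ≤ B) : |Real.exp a - Real.exp b| ≤ Real.exp B * |a - b| := by
  have key : ∀ a b : ℝ, a ≤ B → b ≤ a → |Real.exp a - Real.exp b| ≤ Real.exp B * |a - b| := by
    intro a b ha hba
    rw [abs_of_nonneg (by linarith [Real.exp_le_exp.2 hba]), abs_of_nonneg (by linarith)]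
    have h1 := Real.add_one_le_exp (b - a)
    have h2 : Real.exp b = Real.exp a * Real.exp (b - a) := by rw [← Real.exp_add]; ring_nf
    have h3 := Real.exp_le_exp.2 ha
    have h4 := Real.exp_pos a
    nlinarith
  rcases le_total b a with h | h
  · exact key a b ha h
  · rw [abs_sub_comm, abs_sub_comm a b]; exact key b a hb h
lemma IsLip.exp {f : Γ → ℝ} {M B : ℝ} (h : IsLip s f M) (hf : ∀ z, f z ≤ B) :
    IsLip s (fun z => Real.exp (f z)) (Real.exp B * M) := by
  intro z z'
  refine (exp_lip (hf z) (hf z')).trans ?_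
  rw [mul_assoc]; exact mul_le_mul_of_nonneg_left (h z z') (Real.exp_pos _).le
lemma IsLip.inv {f : Γ → ℝ} {M c : ℝ} (h : IsLip s f M) (hc : 0 < c) (hf : ∀ z, c ≤ f z) :
    IsLip s (fun z => (f z)⁻¹) (M / c ^ 2) := by
  intro z z'
  have h1 := hf z; have h2 := hf z'
  rw [inv_sub_inv (by linarith) (by linarith), abs_div, abs_of_pos (mul_pos (by linarith : 0 < f z) (by linarith : 0 < f z')), abs_sub_comm]
  rw [div_mul_eq_mul_div]
  refine div_le_div₀ (mul_nonneg h.nonneg (s.E_pos z z').le) (h z z') (by positivity) (by nlinarith)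
lemma IsLip.comp {f : Γ → ℝ} {M : ℝ} (h : IsLip s f M) {u : Γ} (hu : u ∈ W.U) :
    IsLip s (fun z => f (u * z)) (Real.exp (s.c * W.ρU) * M) := by
  intro z z'
  refine (h _ _).trans ?_
  have h1 := s.E_smul u z z'
  have h2 : Real.exp (s.c * s.nm u) ≤ Real.exp (s.c * W.ρU) := Real.exp_le_exp.2 (mul_le_mul_of_nonneg_left (W.kU u hu) s.hc.le)
  have h3 := h.nonneg
  have h4 := (s.E_pos z z').le
  calc M * s.E (u*z) (u*z') ≤ M * (Real.exp (s.c * W.ρU) * s.E z z') :=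
        mul_le_mul_of_nonneg_left (h1.trans (mul_le_mul_of_nonneg_right h2 h4)) h3
    _ = _ := by ring

/-- the increment -/
noncomputable def b (s : Setup Γ) (z u : Γ) : ℝ := s.nm (u * z) - s.nm z
lemma b_abs (z u : Γ) : |b s z u| ≤ s.nm u := by
  unfold b
  have h1 := s.nm_mul_le u z
  have h2 := s.nm_mul_le u⁻¹ (u*z)
  rw [inv_mul_cancel_left, s.nm_inv] at h2
  rw [abs_le]; constructor <;> linarith
lemma b_lip : ∃ C, ∀ u ∈ W.U, IsLip s (fun z => b s z u) C := by
  obtain ⟨C, hC, h⟩ := s.vd W.ρU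
  refine ⟨C, fun u hu z z' => ?_⟩
  have := h u⁻¹ z z' (by have := W.kU u hu; rw [← s.nm_inv] at this; exact this)
  have e : ∀ z, b s z u = s.d u⁻¹ z - s.d 1 z := by intro z; unfold b; rw [s.d_eq u⁻¹, inv_inv]; rfl
  show |b s z u - b s z' u| ≤ _
  rw [e, e]; exact this

def Op (a : Γ → Γ → ℝ) (f : Γ → ℝ) (z : Γ) : ℝ := ∑ u ∈ W.U, a z u * f (u * z)
structure Ker (a : Γ → Γ → ℝ) (A C : ℝ) : Prop where
  nn : ∀ z u, 0 ≤ a z u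
  supp : ∀ z u, a z u ≠ 0 → W.k z u ≠ 0
  lip : ∀ u ∈ W.U, IsLip s (fun z => a z u) C
  sum : ∀ z, ∑ u ∈ W.U, a z u ≤ A

variable {W} {a : Γ → Γ → ℝ} {A C : ℝ}
lemma Op_mono (ha : ∀ z u, 0 ≤ a z u) {f g : Γ → ℝ} (h : ∀ z, f z ≤ g z) (z : Γ) : W.Op a f z ≤ W.Op a g z :=
  Finset.sum_le_sum fun u _ => mul_le_mul_of_nonneg_left (h _) (ha _ _)
lemma Op_nonneg (ha : ∀ z u, 0 ≤ a z u) {f : Γ → ℝ} (h : ∀ z, 0 ≤ f z) (z : Γ) : 0 ≤ W.Op a f z :=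
  Finset.sum_nonneg fun u _ => mul_nonneg (ha _ _) (h _)
lemma Op_add (f g : Γ → ℝ) (z : Γ) : W.Op a (fun z => f z + g z) z = W.Op a f z + W.Op a g z := by
  unfold Op; rw [← Finset.sum_add_distrib]; exact Finset.sum_congr rfl fun u _ => by ring
lemma Op_sub (f g : Γ → ℝ) (z : Γ) : W.Op a (fun z => f z - g z) z = W.Op a f z - W.Op a g z := by
  unfold Op; rw [← Finset.sum_sub_distrib]; exact Finset.sum_congr rfl fun u _ => by ring
lemma Op_smul (c : ℝ) (f : Γ → ℝ) (z : Γ) : W.Op a (fun z => c * f z) z = c * W.Op a f z := by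
  unfold Op; rw [Finset.mul_sum]; exact Finset.sum_congr rfl fun u _ => by ring
lemma Ker.A0 (h : W.Ker a A C) : 0 ≤ A := (Finset.sum_nonneg fun u _ => h.nn 1 u).trans (h.sum 1)
lemma Ker.bd (h : W.Ker a A C) {f : Γ → ℝ} {B : ℝ} (hB : ∀ z, |f z| ≤ B) (z : Γ) : |W.Op a f z| ≤ A * B := by
  have hB0 : 0 ≤ B := (abs_nonneg _).trans (hB 1)
  refine (Finset.abs_sum_le_sum_abs _ _).trans ?_
  calc ∑ u ∈ W.U, |a z u * f (u*z)| ≤ ∑ u ∈ W.U, a z u * B := Finset.sum_le_sum fun u _ => by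
        rw [abs_mul, abs_of_nonneg (h.nn z u)]; exact mul_le_mul_of_nonneg_left (hB _) (h.nn _ _)
    _ ≤ A * B := by rw [← Finset.sum_mul]; exact mul_le_mul_of_nonneg_right (h.sum z) hB0
lemma iter_nonneg (ha : ∀ z u, 0 ≤ a z u) {f : Γ → ℝ} (h : ∀ z, 0 ≤ f z) (n : ℕ) : ∀ z, 0 ≤ (W.Op a)^[n] f z := by
  induction n with
  | zero => exact h
  | succ n ih => intro z; rw [Function.iterate_succ_apply']; exact Op_nonneg ha ih z
lemma iter_mono (ha : ∀ z u, 0 ≤ a z u) {f g : Γ → ℝ} (h : ∀ z, f z ≤ g z) (n : ℕ) : ∀ z, (W.Op a)^[n] f z ≤ (W.Op a)^[n] g z := by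
  induction n with
  | zero => exact h
  | succ n ih => intro z; rw [Function.iterate_succ_apply', Function.iterate_succ_apply']; exact Op_mono ha ih z

noncomputable def LYc (W : Walk s) (A C : ℝ) : ℝ := W.U.card * C + 2 * A * Real.exp (s.c * W.K0)
lemma Ker.LY (h : W.Ker a A C) {f : Γ → ℝ} {M B : ℝ} (hf : IsLip s f M) (hB : ∀ z, |f z| ≤ B) :
    IsLip s (W.Op a f) (A * W.θ * M + W.LYc A C * B) := by
  intro z z'
  have hB0 : 0 ≤ B := (abs_nonneg _).trans (hB 1)
  have hM := hf.nonneg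
  have hE := s.E_pos z z'
  have hA := h.A0
  have h3 : 0 ≤ (W.U.card * C) * B := by
    by_cases hne : W.U.Nonempty
    · obtain ⟨u, hu⟩ := hne
      exact mul_nonneg (mul_nonneg (Nat.cast_nonneg _) (h.lip u hu).nonneg) hB0
    · rw [Finset.not_nonempty_iff_eq_empty.1 hne]; simp
  by_cases hK : W.K0 ≤ s.gp z z'
  · have e : W.Op a f z - W.Op a f z' = ∑ u ∈ W.U, (a z u * (f (u*z) - f (u*z')) + (a z u - a z' u) * f (u*z')) := by
      unfold Op; rw [← Finset.sum_sub_distrib]; exact Finset.sum_congr rfl fun u _ => by ring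
    rw [e]
    refine (Finset.abs_sum_le_sum_abs _ _).trans ?_
    have h1 : ∀ u ∈ W.U, |a z u * (f (u*z) - f (u*z')) + (a z u - a z' u) * f (u*z')| ≤
        a z u * (W.θ * M * s.E z z') + C * s.E z z' * B := by
      intro u hu
      refine (abs_add_le _ _).trans (add_le_add ?_ ?_)
      · rw [abs_mul, abs_of_nonneg (h.nn z u)]
        by_cases h0 : a z u = 0
        · rw [h0]; simp
        · refine mul_le_mul_of_nonneg_left ?_ (h.nn z u)
          refine (hf _ _).trans ?_
          have := W.kc z z' u hK (h.supp z u h0)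
          nlinarith
      · rw [abs_mul]
        exact mul_le_mul (h.lip u hu z z') (hB _) (abs_nonneg _) ((abs_nonneg _).trans (h.lip u hu z z'))
    refine (Finset.sum_le_sum h1).trans ?_
    rw [Finset.sum_add_distrib, ← Finset.sum_mul, Finset.sum_const, nsmul_eq_mul]
    have h2 := mul_le_mul_of_nonneg_right (h.sum z) (show 0 ≤ W.θ * M * s.E z z' from mul_nonneg (mul_nonneg W.θ0.le hM) hE.le)
    have h4 : 0 ≤ 2 * A * Real.exp (s.c * W.K0) * B * s.E z z' := by positivity
    unfold LYc; nlinarith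
  · have h1 := h.bd hB z
    have h2 := h.bd hB z'
    have h4 := s.E_ge (not_le.1 hK).le
    have h5 : 1 ≤ Real.exp (s.c * W.K0) * s.E z z' := by
      refine le_trans (le_of_eq ?_) (mul_le_mul_of_nonneg_left h4 (Real.exp_pos _).le)
      rw [← Real.exp_add, neg_mul, add_neg_cancel, Real.exp_zero]
    have h6 : |W.Op a f z - W.Op a f z'| ≤ 2 * A * B := (abs_sub _ _).trans (by linarith)
    have h7 := mul_le_mul_of_nonneg_left h5 (show 0 ≤ 2 * A * B by positivity)
    have h8 : 0 ≤ A * W.θ * M * s.E z z' := mul_nonneg (mul_nonneg (mul_nonneg hA W.θ0.le) hM) hE.le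
    have h9 := mul_nonneg h3 hE.le
    unfold LYc; nlinarith

lemma path_lower (ha : ∀ z u, 0 ≤ a z u) {α : ℝ} (hα : 0 ≤ α) (haα : ∀ z, ∀ u ∈ W.U, W.κ ≤ W.k z u → α ≤ a z u) {f : Γ → ℝ}
    (hf : ∀ z, 0 ≤ f z) (l : List Γ) : ∀ z, PathOK W.U W.k W.κ z l → α ^ l.length * f (wprod l * z) ≤ (W.Op a)^[l.length] f z := by
  induction l with
  | nil => intro z _; simp [wprod]
  | cons u l ih =>
    intro z h
    obtain ⟨hu, hk, hl⟩ := h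
    have h1 := ih (u * z) hl
    rw [List.length_cons, Function.iterate_succ_apply']
    have h2 : a z u * (W.Op a)^[l.length] f (u*z) ≤ W.Op a ((W.Op a)^[l.length] f) z :=
      Finset.single_le_sum (f := fun u => a z u * (W.Op a)^[l.length] f (u*z)) (fun v _ => mul_nonneg (ha _ _) (iter_nonneg ha hf _ _)) hu
    refine le_trans ?_ h2
    have h3 := haα z u hu hk
    rw [pow_succ, mul_comm (α ^ _) α, mul_assoc]
    simp only [wprod]; rw [mul_assoc (wprod l)]
    exact mul_le_mul h3 h1 (mul_nonneg (pow_nonneg hα _) (hf _)) (ha _ _)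

variable (W)
lemma reach : ∃ C : ℝ, 0 ≤ C ∧ ∀ r : ℝ, ∃ N : ℕ, ∀ x z z', 5 * W.R ≤ s.nm x → s.nm x ≤ r → ∃ l : List Γ, l.length ≤ N ∧
    PathOK W.U W.k W.κ z l ∧ PathOK W.U W.k W.κ z' l ∧ s.nm x - C ≤ s.gp (wprod l * z) x ∧ s.nm x - C ≤ s.gp (wprod l * z') x := by
  refine ⟨W.p + s.δ, by linarith [W.p0, s.hδ], fun r => ?_⟩
  obtain ⟨N, hN⟩ := W.path (r + W.ρ)
  refine ⟨N, fun x z z' h1 h2 => ?_⟩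
  obtain ⟨f, f1, f2, f3, f4⟩ := W.eone (fun i => if i = 0 then z else z') (fun _ => x⁻¹)
  have fz := f3 0; have fz' := f3 1; have fx := f4 0
  simp at fz fz' fx
  have e1 := s.nm_mul f x⁻¹
  rw [s.nm_inv] at e1
  obtain ⟨l, l1, l2, l3⟩ := hN (f * x⁻¹) (by linarith [s.hδ]) (by linarith [s.gp_nonneg f⁻¹ x⁻¹])
  have main : ∀ y, s.gp y f ≤ W.p → PathOK W.U W.k W.κ y l ∧ s.nm x - (W.p + s.δ) ≤ s.gp (wprod l * y) x := by
    intro y hy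
    refine ⟨l3 y ((s.cone (by linarith) f2 hy fx).1.trans (by linarith [s.hδ])), ?_⟩
    have h := (s.cone (f := f⁻¹) (z := x⁻¹) (w := y) (p := W.p) (M := s.δ + 1) (by linarith) (by rw [s.nm_inv]; exact f2)
      (by rw [s.gp_comm]; exact fx) (by rw [inv_inv, s.gp_comm]; exact hy)).1
    rw [l2, mul_inv_rev, inv_inv, s.gp_comm, mul_assoc, s.gp_mul_self]; linarith
  exact ⟨l, l1, (main z fz).1, (main z' fz').1, (main z fz).2, (main z' fz').2⟩

lemma mass1 {G : Γ → ℝ} (hG : (Function.support G).Finite) :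
    ∑ᶠ z, W.Op W.k G z = ∑ᶠ z, (if W.r1 ≤ s.nm z then G z else 0) := by
  unfold Op
  rw [finsum_sum_comm]
  · have h1 : ∀ u ∈ W.U, ∑ᶠ z, W.k z u * G (u*z) = ∑ᶠ y, W.k (u⁻¹ * y) u * G y := by
      intro u _
      rw [← finsum_comp_equiv (Equiv.mulLeft u) (f := fun y => W.k (u⁻¹ * y) u * G y)]
      simp
    rw [Finset.sum_congr rfl h1, ← finsum_sum_comm]
    · apply finsum_congr; intro y
      rw [← Finset.sum_mul]
      split_ifs with h
      · rw [W.ks y h, one_mul]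
      · rw [Finset.sum_eq_zero (fun u _ => W.ks0 y u (not_le.1 h)), zero_mul]
    · intro u _; exact hG.subset (fun y hy => right_ne_zero_of_mul hy)
  · intro u _
    refine (hG.preimage (f := fun z => u * z) (fun a _ b _ h => mul_left_cancel h)).subset (fun y hy => right_ne_zero_of_mul hy)

lemma Opk_supp {G : Γ → ℝ} {T : ℝ} (hG : ∀ z, T ≤ s.nm z → G z = 0) (z : Γ) (h : T - W.R ≤ s.nm z) : W.Op W.k G z = 0 := by
  apply Finset.sum_eq_zero; intro u _
  by_cases hk : W.k z u = 0
  · rw [hk, zero_mul]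
  · rw [hG _ (by have := (W.kb z u hk).1; linarith), mul_zero]
lemma Opk_iter_supp {G : Γ → ℝ} {T : ℝ} (hG : ∀ z, T ≤ s.nm z → G z = 0) (n : ℕ) : ∀ z, T - n * W.R ≤ s.nm z → (W.Op W.k)^[n] G z = 0 := by
  induction n with
  | zero => simpa using hG
  | succ n ih =>
    intro z h
    rw [Function.iterate_succ_apply']
    exact W.Opk_supp (T := T - n * W.R) ih z (by push_cast at h; linarith)
lemma supp_fin {G : Γ → ℝ} {T : ℝ} (hG : ∀ z, T ≤ s.nm z → G z = 0) : (Function.support G).Finite :=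
  (s.fin T).subset (fun z hz => by by_contra h; exact hz (hG z (not_lt.1 h)))

noncomputable def F0 : Finset Γ := (s.fin W.r1).toFinset
lemma mem_F0 {x : Γ} : x ∈ W.F0 ↔ s.nm x < W.r1 := (s.fin W.r1).mem_toFinset
lemma mass_step {G : Γ → ℝ} (hG : (Function.support G).Finite) : ∑ᶠ z, G z = ∑ x ∈ W.F0, G x + ∑ᶠ z, W.Op W.k G z := by
  rw [W.mass1 hG]
  have h : ∑ x ∈ W.F0, G x = ∑ᶠ z, (if W.r1 ≤ s.nm z then 0 else G z) := by
    rw [finsum_eq_sum_of_support_subset (s := W.F0)]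
    · exact Finset.sum_congr rfl fun x hx => by rw [if_neg (not_le.2 (W.mem_F0.1 hx))]
    · intro z hz
      rw [Finset.mem_coe, W.mem_F0]
      by_contra h; exact hz (if_pos (not_lt.1 h))
  rw [h, ← finsum_add_distrib]
  · apply finsum_congr; intro z; split_ifs <;> simp
  · exact hG.subset fun z hz h => hz (by simp [h])
  · exact hG.subset fun z hz h => hz (by simp [h])
lemma mass_iter {G : Γ → ℝ} {T : ℝ} (hG : ∀ z, T ≤ s.nm z → G z = 0) (N : ℕ) :
    ∑ᶠ z, G z = ∑ x ∈ W.F0, ∑ n ∈ Finset.range N, (W.Op W.k)^[n] G x + ∑ᶠ z, (W.Op W.k)^[N] G z := by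
  have hs : ∀ n z, T ≤ s.nm z → (W.Op W.k)^[n] G z = 0 := fun n z h => W.Opk_iter_supp hG n z (by
    have := W.R1; have : (0:ℝ) ≤ n * W.R := by positivity
    linarith)
  induction N with
  | zero => simp
  | succ N ih =>
    rw [ih, W.mass_step (supp_fin (hs N)), Function.iterate_succ_apply', ← add_assoc, ← Finset.sum_add_distrib]
    congr 1
    exact Finset.sum_congr rfl fun x _ => (Finset.sum_range_succ _ _).symm
end Walk
end PaperCLT
end

section
open Filter Set
namespace PaperCLT
namespace Walk
variable {Γ : Type*} [Group Γ] {s : Setup Γ} (W : Walk s)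

lemma ulim_exists {ι : Type*} (𝒰 : Ultrafilter ι) (F : ι → ℝ) {a b : ℝ} (h : ∀ i, F i ∈ Icc a b) :
    ∃ l ∈ Icc a b, Tendsto F 𝒰 (nhds l) := by
  obtain ⟨l, hl, h2⟩ := isCompact_Icc.ultrafilter_le_nhds (𝒰.map F) (by
    rw [le_principal_iff]; exact Filter.mem_map.2 (Filter.univ_mem' h))
  exact ⟨l, hl, h2⟩
lemma exp_tendsto_zero {a : ℝ} (ha : 0 < a) : Tendsto (fun R : ℝ => Real.exp (-a * R)) atTop (nhds 0) :=
  Real.tendsto_exp_atBot.comp (tendsto_id.const_mul_atTop_of_neg (by linarith))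

noncomputable def kL (z u : Γ) : ℝ := W.k z u * Real.exp (-b s z u)
lemma kL0 (z u : Γ) : 0 ≤ W.kL z u := mul_nonneg (W.k0 _ _) (Real.exp_pos _).le
lemma k_le_one (z u : Γ) (hu : u ∈ W.U) : W.k z u ≤ 1 := by
  have h := W.ks0 (u*z) u; rw [inv_mul_cancel_left] at h
  by_cases h1 : W.r1 ≤ s.nm (u*z)
  · rw [← W.ks _ h1]
    have := Finset.single_le_sum (f := fun v => W.k (v⁻¹ * (u*z)) v) (fun v _ => W.k0 _ _) hu
    simpa using this
  · rw [h (not_le.1 h1)]; exact zero_le_one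
lemma kL_ker : ∃ C, W.Ker W.kL W.A1 C := by
  obtain ⟨C, hC⟩ := W.b_lip
  refine ⟨W.Ck * Real.exp W.ρU + 1 * (Real.exp W.ρU * C), W.kL0, fun z u h => left_ne_zero_of_mul h, fun u hu => ?_, W.hA1⟩
  have h1 : IsLip s (fun z => -b s z u) C := by simpa using (hC u hu).smul (-1)
  have hb : ∀ z, -b s z u ≤ W.ρU := fun z => by
    have := (abs_le.1 (b_abs (s := s) z u)).1; have := W.kU u hu; linarith
  have h2 := h1.exp hb
  have h3 : IsLip s (fun z => W.k z u) W.Ck := fun z z' => W.kl z z' u hu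
  refine h3.mul h2 (fun z => ?_) (fun z => ?_)
  · rw [abs_of_nonneg (W.k0 _ _)]; exact W.k_le_one z u hu
  · rw [abs_of_pos (Real.exp_pos _)]; exact Real.exp_le_exp.2 (hb z)
lemma kL_low (z u : Γ) (h : W.κ ≤ W.k z u) : W.κ * Real.exp (-W.Bm) ≤ W.kL z u := by
  have h1 := (W.kb z u (by have := W.κ0; linarith)).2
  exact mul_le_mul h (Real.exp_le_exp.2 (by unfold b; linarith)) (Real.exp_pos _).le (W.k0 _ _)
lemma A1_nn : 0 ≤ W.A1 := by obtain ⟨C, h⟩ := W.kL_ker; exact h.A0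

noncomputable def Sn (t : ℝ) (n : ℕ) (z : Γ) : ℝ := ∑ k ∈ Finset.range n, t ^ k * (W.Op W.kL)^[k] (fun _ => 1) z
lemma Op_sum {a : Γ → Γ → ℝ} {ι : Type*} (S : Finset ι) (f : ι → Γ → ℝ) (z : Γ) :
    W.Op a (fun z => ∑ i ∈ S, f i z) z = ∑ i ∈ S, W.Op a (f i) z := by
  unfold Op; rw [Finset.sum_comm]; exact Finset.sum_congr rfl fun u _ => by rw [Finset.mul_sum]
lemma L1_nn (n : ℕ) (z : Γ) : 0 ≤ (W.Op W.kL)^[n] (fun _ => 1) z := iter_nonneg W.kL0 (fun _ => zero_le_one) n z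
lemma Sn_succ (t : ℝ) (n : ℕ) (z : Γ) : W.Sn t (n+1) z = 1 + t * W.Op W.kL (W.Sn t n) z := by
  have : W.Op W.kL (W.Sn t n) z = ∑ k ∈ Finset.range n, t ^ k * (W.Op W.kL)^[k+1] (fun _ => 1) z := by
    unfold Sn; rw [W.Op_sum]; exact Finset.sum_congr rfl fun k _ => by rw [Op_smul, Function.iterate_succ_apply']
  rw [this, Sn, Finset.sum_range_succ', add_comm, Finset.mul_sum]
  simp only [pow_zero, Function.iterate_zero, id, mul_one]
  congr 1; exact Finset.sum_congr rfl fun k _ => by ring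
lemma Sn_mono {t : ℝ} (ht : 0 ≤ t) (z : Γ) : Monotone (fun n => W.Sn t n z) := by
  refine monotone_nat_of_le_succ fun n => ?_
  unfold Sn; rw [Finset.sum_range_succ]; linarith [mul_nonneg (pow_nonneg ht n) (W.L1_nn n z)]
lemma Sn_mono_t {t t' : ℝ} (ht : 0 ≤ t) (h : t ≤ t') (n : ℕ) (z : Γ) : W.Sn t n z ≤ W.Sn t' n z :=
  Finset.sum_le_sum fun k _ => mul_le_mul_of_nonneg_right (pow_le_pow_left₀ ht h k) (W.L1_nn k z)
def TT : Set ℝ := {t | 0 ≤ t ∧ ∃ B, ∀ n z, W.Sn t n z ≤ B}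

lemma TT_le_one {t : ℝ} (h : t ∈ W.TT) : t ≤ 1 := by
  by_contra ht
  push Not at ht
  obtain ⟨h0, B, hB⟩ := h
  set D := max W.Bm 1
  have hD : 0 < D := lt_of_lt_of_le one_pos (le_max_right _ _)
  set ε := min (1/2) (Real.log t / D)
  have hε : 0 < ε := lt_min (by norm_num) (div_pos (Real.log_pos ht) hD)
  have hεD : ε * D ≤ Real.log t := by
    have := min_le_right (1/2) (Real.log t / D); rwa [le_div_iff₀ hD] at this
  have hε2 : ε ≤ 1/2 := min_le_left _ _
  -- bound for truncated sums
  have key : ∀ T : ℝ, ((ball s.d T).ncard : ℝ) * Real.exp (-(1-ε) * T) ≤ W.F0.card * B := by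
    intro T
    classical
    set G : Γ → ℝ := fun y => if s.nm y < T then Real.exp (-(1-ε) * s.nm y) else 0 with hGdef
    have hG : ∀ z, T ≤ s.nm z → G z = 0 := fun z hz => if_neg (not_lt.2 hz)
    have hit : ∀ n z, (W.Op W.k)^[n] G z ≤ Real.exp (-(1-ε) * s.nm z) * (t ^ n * (W.Op W.kL)^[n] (fun _ => 1) z) := by
      intro n
      induction n with
      | zero => intro z; simp only [Function.iterate_zero, id, hGdef, pow_zero, mul_one]; split_ifs; exacts [le_rfl, (Real.exp_pos _).le]
      | succ n ih =>
        intro z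
        rw [Function.iterate_succ_apply', Function.iterate_succ_apply']
        refine (Op_mono W.k0 ih z).trans ?_
        generalize hFd : (W.Op W.kL)^[n] (fun _ => 1) = F
        have hF0 : ∀ z, 0 ≤ F z := fun z => by rw [← hFd]; exact W.L1_nn _ _
        unfold Op; rw [Finset.mul_sum, Finset.mul_sum]
        refine Finset.sum_le_sum fun u _ => ?_
        by_cases hk : W.k z u = 0
        · simp [hk, kL]
        · have hb := (W.kb z u hk).2
          have e : Real.exp (-(1-ε) * s.nm (u*z)) ≤ Real.exp (-(1-ε) * s.nm z) * Real.exp (-b s z u) * t := by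
            have htl := Real.exp_log (by linarith : 0 < t)
            refine le_trans ?_ (le_of_eq (congrArg (fun x => Real.exp (-(1-ε) * s.nm z) * Real.exp (-b s z u) * x) htl))
            show _ ≤ Real.exp (-(1-ε) * s.nm z) * Real.exp (-b s z u) * Real.exp (Real.log t)
            rw [← Real.exp_add, ← Real.exp_add]; apply Real.exp_le_exp.2
            have : ε * b s z u ≤ ε * D := mul_le_mul_of_nonneg_left (hb.trans (le_max_left _ _)) hε.le
            unfold b at *; linarith
          have := mul_le_mul_of_nonneg_right e (show 0 ≤ W.k z u * (t ^ n * F (u*z)) from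
            mul_nonneg (W.k0 _ _) (mul_nonneg (pow_nonneg h0 _) (hF0 _)))
          unfold kL; rw [pow_succ]; refine le_trans (le_of_eq ?_) (this.trans (le_of_eq ?_)) <;> ring
    obtain ⟨N, hN⟩ := exists_nat_ge T
    have hm := W.mass_iter hG N
    have hz : ∑ᶠ z, (W.Op W.k)^[N] G z = 0 := by
      rw [show (W.Op W.k)^[N] G = fun _ => 0 from funext fun z => W.Opk_iter_supp hG N z (by
        have := W.R1; have := s.nm_nonneg z; nlinarith [(Nat.cast_nonneg N : (0:ℝ) ≤ N)])]
      simp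
    rw [hz, add_zero] at hm
    have hup : ∑ᶠ z, G z ≤ W.F0.card * B := by
      rw [hm, ← nsmul_eq_mul]
      refine Finset.sum_le_card_nsmul _ _ _ fun x _ => ?_
      refine le_trans (Finset.sum_le_sum fun n _ => (hit n x).trans (mul_le_of_le_one_left (mul_nonneg (pow_nonneg h0 _) (W.L1_nn _ _)) ?_)) (hB N x)
      rw [Real.exp_le_one_iff]; nlinarith [s.nm_nonneg x]
    refine le_trans ?_ hup
    rw [finsum_eq_sum_of_support_subset (s := (s.fin T).toFinset)]
    · rw [ncard_eq_toFinset_card _ (s.fin T), ← nsmul_eq_mul]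
      refine Finset.card_nsmul_le_sum _ _ _ fun x hx => ?_
      have hx' : s.nm x < T := (s.fin T).mem_toFinset.1 hx
      simp only [hGdef, if_pos hx']
      apply Real.exp_le_exp.2; nlinarith
    · intro z hz; rw [Finset.mem_coe, (s.fin T).mem_toFinset]
      by_contra h; exact hz (hG z (not_lt.1 h))
  have hlim : ∀ᶠ T : ℝ in atTop, W.F0.card * B < Real.exp (ε/2 * T) :=
    (Real.tendsto_exp_atTop.comp (tendsto_id.const_mul_atTop (by linarith))).eventually (eventually_gt_atTop _)
  obtain ⟨T0, hT0⟩ := eventually_atTop.1 hlim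
  obtain ⟨T, hT, hlo⟩ := s.lo (ε/2) (by linarith) T0
  have h1 := mul_le_mul_of_nonneg_right hlo (Real.exp_pos (-(1-ε) * T)).le
  rw [← Real.exp_add] at h1
  have h2 := hT0 T hT
  have h3 := key T
  rw [show (1 - ε/2) * T + -(1-ε) * T = ε/2 * T by ring] at h1
  linarith

/-- pointwise limit of the partial sums -/
lemma TT_lim {t B : ℝ} (h0 : 0 ≤ t) (hB : ∀ n z, W.Sn t n z ≤ B) : ∃ f : Γ → ℝ, (∀ z, Tendsto (fun n => W.Sn t n z) atTop (nhds (f z))) ∧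
    (∀ n z, W.Sn t n z ≤ f z) ∧ ∀ z, f z = 1 + t * W.Op W.kL f z := by
  have hl : ∀ z, Tendsto (fun n => W.Sn t n z) atTop (nhds (⨆ n, W.Sn t n z)) := fun z =>
    tendsto_atTop_ciSup (W.Sn_mono h0 z) ⟨B, by rintro _ ⟨n, rfl⟩; exact hB n z⟩
  refine ⟨fun z => ⨆ n, W.Sn t n z, hl, fun n z => le_ciSup (f := fun n => W.Sn t n z) ⟨B, by rintro _ ⟨n, rfl⟩; exact hB n z⟩ n, fun z => ?_⟩
  have h1 := (hl z).comp (tendsto_add_atTop_nat 1)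
  have h2 : Tendsto (fun n => 1 + t * W.Op W.kL (W.Sn t n) z) atTop (nhds (1 + t * W.Op W.kL (fun z => ⨆ n, W.Sn t n z) z)) := by
    refine (Tendsto.const_mul t ?_).const_add 1
    exact tendsto_finsetSum _ fun u _ => (hl (u*z)).const_mul _
  refine tendsto_nhds_unique h1 (h2.congr fun n => ?_)
  simp only [Function.comp]; rw [W.Sn_succ]

lemma TT_extend {t : ℝ} (ht : t ∈ W.TT) (ht0 : 0 < t) : ∃ t' > t, t' ∈ W.TT := by
  obtain ⟨h0, B0, hB0⟩ := ht
  set B := max B0 1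
  have hB1 : 1 ≤ B := le_max_right _ _
  have hB : ∀ n z, W.Sn t n z ≤ B := fun n z => (hB0 n z).trans (le_max_left _ _)
  obtain ⟨f, f1, f2, f3⟩ := W.TT_lim h0 hB
  have fB : ∀ z, f z ≤ B := fun z => le_of_tendsto' (f1 z) fun n => hB n z
  have f1' : ∀ z, 1 ≤ f z := fun z => by have := f2 1 z; simpa [Sn] using this
  set r := 1 - 1/B
  have hr0 : 0 ≤ r := by have : 1/B ≤ 1 := div_le_one_of_le₀ hB1 (by linarith); simp only [r]; linarith
  have hit : ∀ n z, t ^ n * (W.Op W.kL)^[n] (fun _ => 1) z ≤ r ^ n * f z := by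
    intro n
    induction n with
    | zero => intro z; simpa using f1' z
    | succ n ih =>
      intro z
      rw [Function.iterate_succ_apply']
      have h1 := Op_mono (W := W) W.kL0 ih z
      rw [Op_smul, Op_smul] at h1
      have h2 : t * W.Op W.kL f z ≤ r * f z := by
        have h3 := f3 z
        have h4 : f z / B ≤ 1 := div_le_one_of_le₀ (fB z) (by linarith)
        have : r * f z = f z - f z / B := by simp only [r]; ring
        linarith
      calc t ^ (n+1) * W.Op W.kL ((W.Op W.kL)^[n] fun _ => 1) z = t * (t ^ n * W.Op W.kL ((W.Op W.kL)^[n] fun _ => 1) z) := by ring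
        _ ≤ t * (r ^ n * W.Op W.kL f z) := mul_le_mul_of_nonneg_left h1 h0
        _ = r ^ n * (t * W.Op W.kL f z) := by ring
        _ ≤ r ^ n * (r * f z) := mul_le_mul_of_nonneg_left h2 (pow_nonneg hr0 n)
        _ = _ := by ring
  have hB' : 0 < 1/(2*B) := by positivity
  set x := (1 + 1/(2*B)) * r
  have hx0 : 0 ≤ x := by positivity
  have hx1 : x < 1 := by
    simp only [x, r]
    have : (1:ℝ)/B = 2 * (1/(2*B)) := by field_simp
    rw [this]; nlinarith
  refine ⟨t * (1 + 1/(2*B)), by nlinarith, by positivity, B * (1 - x)⁻¹, fun n z => ?_⟩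
  have h1 : W.Sn (t * (1 + 1/(2*B))) n z ≤ ∑ k ∈ Finset.range n, B * x ^ k := by
    refine Finset.sum_le_sum fun k _ => ?_
    have h2 := mul_le_mul_of_nonneg_left ((hit k z).trans (mul_le_mul_of_nonneg_left (fB z) (pow_nonneg hr0 k)))
      (show 0 ≤ (1 + 1/(2*B))^k by positivity)
    calc _ = (1 + 1/(2*B))^k * (t ^ k * (W.Op W.kL)^[k] (fun _ => 1) z) := by rw [mul_pow]; ring
      _ ≤ _ := h2
      _ = B * x ^ k := by simp only [x]; rw [mul_pow]; ring
  refine h1.trans ?_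
  rw [← Finset.mul_sum]
  refine mul_le_mul_of_nonneg_left ?_ (by linarith)
  rw [← tsum_geometric_of_lt_one hx0 hx1]
  exact (summable_geometric_of_lt_one hx0 hx1).sum_le_tsum _ (fun _ _ => by positivity)

lemma TT_small : ∃ t > 0, t ∈ W.TT := by
  obtain ⟨C, hK⟩ := W.kL_ker
  have hA := W.A1_nn
  refine ⟨1/(2 * (W.A1 + 1)), by positivity, by positivity, 2, fun n z => ?_⟩
  have h1 : ∀ k z, (W.Op W.kL)^[k] (fun _ => 1) z ≤ W.A1 ^ k := by
    intro k
    induction k with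
    | zero => intro z; simp
    | succ k ih =>
      intro z; rw [Function.iterate_succ_apply', pow_succ, mul_comm]
      refine (le_abs_self _).trans (hK.bd (fun z => ?_) z)
      rw [abs_of_nonneg (W.L1_nn k z)]; exact ih z
  have h2 : W.Sn (1/(2 * (W.A1 + 1))) n z ≤ ∑ k ∈ Finset.range n, (1/2:ℝ) ^ k := by
    refine Finset.sum_le_sum fun k _ => ?_
    refine (mul_le_mul_of_nonneg_left (h1 k z) (by positivity)).trans ?_
    rw [← mul_pow]; refine pow_le_pow_left₀ (by positivity) ?_ k
    rw [div_mul_eq_mul_div, div_le_div_iff₀ (by positivity) (by norm_num)]; linarith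
  refine h2.trans ?_
  exact (summable_geometric_two.sum_le_tsum _ (fun _ _ => by positivity)).trans tsum_geometric_two.le

lemma TT_crit : ∃ τ : ℝ, 0 < τ ∧ τ ≤ 1 ∧ ∀ t0 < τ, ∀ M : ℝ, ∃ t ∈ W.TT, t0 ≤ t ∧ t ≤ τ ∧ ∃ n z, M < W.Sn t n z := by
  have hbdd : BddAbove W.TT := ⟨1, fun t h => W.TT_le_one h⟩
  obtain ⟨ts, hts0, hts⟩ := W.TT_small
  set τ := sSup W.TT
  have hτ0 : 0 < τ := hts0.trans_le (le_csSup hbdd hts)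
  refine ⟨τ, hτ0, csSup_le ⟨ts, hts⟩ fun t h => W.TT_le_one h, ?_⟩
  intro t0 ht0 M
  by_contra hcon
  push Not at hcon
  have hM : ∀ n z, W.Sn τ n z ≤ M := by
    intro n z
    have hc : Continuous fun t => W.Sn t n z := by unfold Sn; fun_prop
    have hl : Tendsto (fun t => W.Sn t n z) (nhdsWithin τ (Iio τ)) (nhds (W.Sn τ n z)) := hc.continuousAt.tendsto.mono_left nhdsWithin_le_nhds
    refine le_of_tendsto hl ?_
    filter_upwards [self_mem_nhdsWithin, mem_nhdsWithin_of_mem_nhds (Ioi_mem_nhds (max_lt ht0 hτ0))] with t h1 h2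
    obtain ⟨t', ht', hlt⟩ := exists_lt_of_lt_csSup ⟨ts, hts⟩ (show t < sSup W.TT from h1)
    have h2' : max t0 0 < t := h2
    rw [max_lt_iff] at h2'
    exact (W.Sn_mono_t h2'.2.le hlt.le n z).trans (hcon t' ht' (by linarith) (le_csSup hbdd ht') n z)
  obtain ⟨t', h1, h2⟩ := W.TT_extend ⟨hτ0.le, M, hM⟩ hτ0
  exact absurd (le_csSup hbdd h2) (not_le.2 h1)
end Walk
end PaperCLT
end

section
open Filter Set
namespace PaperCLT
namespace Walk
variable {Γ : Type*} [Group Γ] {s : Setup Γ} {W : Walk s}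

lemma Ker.LYc_nn {a : Γ → Γ → ℝ} {A C : ℝ} (h : W.Ker a A C) : 0 ≤ W.LYc A C := by
  have := (h.LY (IsLip.const (s := s) 0) (B := 1) (fun z => by simp)).nonneg
  linarith
lemma lip_lim {ι : Type*} {l : Filter ι} [l.NeBot] {F : ι → Γ → ℝ} {f : Γ → ℝ} {M : ℝ} (h : ∀ i, IsLip s (F i) M)
    (hl : ∀ z, Tendsto (fun i => F i z) l (nhds (f z))) : IsLip s f M := fun z z' =>
  le_of_tendsto' ((hl z).sub (hl z')).abs fun i => h i z z'
lemma iter_le {a : Γ → Γ → ℝ} (ha : ∀ z u, 0 ≤ a z u) {g : Γ → ℝ} (hg : ∀ z, W.Op a g z ≤ g z) (n : ℕ) : ∀ z, (W.Op a)^[n] g z ≤ g z := by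
  induction n with
  | zero => intro z; exact le_rfl
  | succ n ih => intro z; rw [Function.iterate_succ_apply']; exact (Op_mono ha ih z).trans (hg z)
variable (W)

structure Good (Cg t β : ℝ) (g : Γ → ℝ) : Prop where
  nn : ∀ z, 0 ≤ g z
  le : ∀ z, g z ≤ 1
  half : ∃ z, 1/2 ≤ g z
  lip : IsLip s g Cg
  eq : ∀ z, g z = β + t * W.Op W.kL g z

lemma good_exists : ∃ Cg, ∀ t ∈ W.TT, ∀ M ≥ (1:ℝ), (∃ n z, M < W.Sn t n z) → ∃ β g, 0 ≤ β ∧ β ≤ 1/M ∧ W.Good Cg t β g := by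
  obtain ⟨C, hK⟩ := W.kL_ker
  have hL := hK.LYc_nn
  refine ⟨2 * W.LYc W.A1 C, fun t ht M hM ⟨n0, z0, hz0⟩ => ?_⟩
  have ht1 := W.TT_le_one ht
  obtain ⟨h0, B0, hB0⟩ := ht
  obtain ⟨f, f1, f2, f3⟩ := W.TT_lim h0 hB0
  have fB0 : ∀ z, f z ≤ B0 := fun z => le_of_tendsto' (f1 z) fun n => hB0 n z
  have bdd : BddAbove (range f) := ⟨B0, by rintro _ ⟨z, rfl⟩; exact fB0 z⟩
  obtain ⟨B, hBd⟩ : ∃ B, B = ⨆ z, f z := ⟨_, rfl⟩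
  have fB : ∀ z, f z ≤ B := fun z => hBd ▸ le_ciSup bdd z
  have hMB : M < B := hz0.trans_le ((f2 _ _).trans (fB _))
  have hB : 0 < B := by linarith
  have fnn : ∀ z, 0 ≤ f z := fun z => by have := f2 0 z; simpa [Sn] using this
  have hS0 : ∀ n z, 0 ≤ W.Sn t n z := fun n z => Finset.sum_nonneg fun k _ => mul_nonneg (pow_nonneg h0 k) (W.L1_nn k z)
  have hlip : ∀ n, IsLip s (W.Sn t n) (2 * W.LYc W.A1 C * B) := by
    intro n
    induction n with
    | zero =>
      have : W.Sn t 0 = fun _ => 0 := funext fun z => by simp [Sn]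
      rw [this]; exact (IsLip.const 0).mono (by positivity)
    | succ n ih =>
      have h1 := hK.LY ih (B := B) (fun z => by rw [abs_of_nonneg (hS0 n z)]; exact (f2 n z).trans (fB z))
      have : W.Sn t (n+1) = fun z => 1 + t * W.Op W.kL (W.Sn t n) z := funext fun z => W.Sn_succ t n z
      rw [this]
      refine ((IsLip.const 1).add (h1.smul t)).mono ?_
      rw [abs_of_nonneg h0, zero_add]
      have h2 : W.A1 * W.θ * (2 * W.LYc W.A1 C * B) ≤ 1/2 * (2 * W.LYc W.A1 C * B) :=
        mul_le_mul_of_nonneg_right W.A1θ (by positivity)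
      refine (mul_le_mul_of_nonneg_right ht1 h1.nonneg).trans ?_
      linarith
  have hfl := lip_lim hlip f1
  refine ⟨1/B, fun z => 1/B * f z, by positivity, one_div_le_one_div_of_le (by linarith) hMB.le, ⟨fun z => by have := fnn z; positivity, ?_, ?_, ?_, ?_⟩⟩
  · intro z; rw [one_div_mul_eq_div]; exact div_le_one_of_le₀ (fB z) hB.le
  · obtain ⟨z, hz⟩ := exists_lt_of_lt_ciSup (show B/2 < ⨆ z, f z by rw [← hBd]; linarith)
    refine ⟨z, ?_⟩
    rw [one_div_mul_eq_div, le_div_iff₀ hB]; linarith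
  · refine (hfl.smul (1/B)).mono (le_of_eq ?_)
    rw [abs_of_pos (by positivity)]; field_simp
  · intro z
    show 1/B * f z = 1/B + t * W.Op W.kL (fun z => 1/B * f z) z
    rw [Op_smul, f3 z]; ring

lemma good_lower (Cg t0 : ℝ) (ht0 : 0 < t0) : ∃ c0 > 0, ∃ β0 > 0, ∀ t β g, t0 ≤ t → t ≤ 1 → 0 ≤ β → β ≤ β0 → W.Good Cg t β g → ∀ z, c0 ≤ g z := by
  obtain ⟨C, hC, hr⟩ := W.reach
  obtain ⟨D, hD⟩ : ∃ D, D = 2 * s.C0 + C + s.δ := ⟨_, rfl⟩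
  have hc := s.hc
  have hR := W.R1
  have hA := W.A1_nn
  obtain ⟨K, hKd⟩ : ∃ K, K = Real.exp (-s.c * (W.R/2)) / (8 * |Cg| * Real.exp (s.c * D) + 1) := ⟨_, rfl⟩
  have hden : 0 < 8 * |Cg| * Real.exp (s.c * D) + 1 := by positivity
  have hKp : 0 < K := by rw [hKd]; positivity
  obtain ⟨r, hr1, hr2⟩ := (((exp_tendsto_zero (show 0 < s.c/2 by linarith)).eventually (gt_mem_nhds hKp)).and
    (eventually_ge_atTop (5 * W.R + s.C0))).exists
  obtain ⟨N, hN⟩ := hr (r + s.C0)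
  obtain ⟨c1, hc1⟩ : ∃ c1, c1 = 1/4 * Real.exp (-(s.c * (r + W.R) / 2)) := ⟨_, rfl⟩
  have hc1p : 0 < c1 := by rw [hc1]; positivity
  obtain ⟨α, hα⟩ : ∃ α, α = min 1 (t0 * (W.κ * Real.exp (-W.Bm))) := ⟨_, rfl⟩
  have hαp : 0 < α := by rw [hα]; exact lt_min one_pos (mul_pos ht0 (mul_pos W.κ0 (Real.exp_pos _)))
  have hα1 : α ≤ 1 := by rw [hα]; exact min_le_left _ _
  refine ⟨α ^ N * (c1/2), by positivity, c1/2, by positivity, fun t β g h1 h2 h3 h4 hg z => ?_⟩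
  have hz1 : ∃ z1, r ≤ s.nm z1 ∧ c1 ≤ g z1 := by
    by_contra hcon
    push Not at hcon
    have ind : ∀ m : ℕ, ∀ z, r - m * W.R ≤ s.nm z → g z ≤ (β + c1) * (1 + W.A1)^m := by
      intro m
      induction m with
      | zero => intro z hz; have := hcon z (by simpa using hz); simp; linarith
      | succ m ih =>
        intro z hz
        have hb : W.Op W.kL g z ≤ W.A1 * ((β + c1) * (1 + W.A1)^m) := by
          have : W.Op W.kL g z ≤ ∑ u ∈ W.U, W.kL z u * ((β + c1) * (1 + W.A1)^m) := by
            refine Finset.sum_le_sum fun u hu => ?_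
            by_cases hk : W.k z u = 0
            · simp [kL, hk]
            · refine mul_le_mul_of_nonneg_left (ih _ ?_) (W.kL0 _ _)
              have := (W.kb z u hk).1; push_cast at hz; linarith
          rw [← Finset.sum_mul] at this
          refine this.trans (mul_le_mul_of_nonneg_right (W.hA1 z) (by positivity))
        have hb0 := Op_nonneg (W := W) W.kL0 hg.nn z
        have h5 : t * W.Op W.kL g z ≤ W.Op W.kL g z := mul_le_of_le_one_left hb0 h2
        have h6 : (1:ℝ) ≤ (1 + W.A1)^m := one_le_pow₀ (by linarith)
        have h7 : β ≤ (β + c1) * (1 + W.A1)^m := by nlinarith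
        rw [hg.eq z, pow_succ]; nlinarith
    obtain ⟨z0, hz0⟩ := hg.half
    have h5 := ind ⌈r / W.R⌉₊ z0 (by
      have := Nat.le_ceil (r / W.R); rw [div_le_iff₀ (by linarith)] at this; linarith [s.nm_nonneg z0])
    obtain ⟨m, hm⟩ : ∃ m, m = ⌈r / W.R⌉₊ := ⟨_, rfl⟩
    rw [← hm] at h5
    have hm2 : m * W.R ≤ r + W.R := by
      have := (Nat.ceil_lt_add_one (show 0 ≤ r / W.R by have := s.hC0; apply div_nonneg <;> linarith)).le
      rw [← hm] at this
      calc m * W.R ≤ (r / W.R + 1) * W.R := mul_le_mul_of_nonneg_right this (by linarith)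
        _ = _ := by field_simp
    have h6 : (1 + W.A1)^m * Real.exp (-(s.c * (r + W.R) / 2)) ≤ 1 := by
      have e1 : Real.exp (-(s.c * (r + W.R) / 2)) ≤ W.θ ^ m := by
        refine le_trans ?_ (pow_le_pow_left₀ (Real.exp_pos _).le W.θR m)
        rw [← Real.exp_nat_mul]; apply Real.exp_le_exp.2; nlinarith
      have e2 : (1 + W.A1) * W.θ ≤ 1 := by have := W.A1θ; have := W.θ1; linarith
      refine (mul_le_mul_of_nonneg_left e1 (by positivity)).trans ?_
      rw [← mul_pow]; exact pow_le_one₀ (mul_nonneg (by linarith) W.θ0.le) e2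
    have h8 : (β + c1) * (1 + W.A1)^m ≤ 3/2 * c1 * (1 + W.A1)^m := mul_le_mul_of_nonneg_right (by linarith) (by positivity)
    have h9 : 3/2 * c1 * (1 + W.A1)^m ≤ 3/8 := by rw [hc1]; linarith
    linarith
  obtain ⟨z1, hz1, hgz1⟩ := hz1
  obtain ⟨x, x1, x2⟩ := s.head z1 r (by have := s.hC0; linarith) hz1
  rw [abs_le] at x1
  obtain ⟨l, l1, l2, -, l4, -⟩ := hN x z z (by linarith) (by linarith)
  have hgp : r - D ≤ s.gp (wprod l * z) z1 := by
    have := s.gp_hyp (wprod l * z) z1 x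
    have h5 : r - 2 * s.C0 - C ≤ min (s.gp (wprod l * z) x) (s.gp z1 x) := by
      rw [s.gp_comm z1 x]; have := s.hC0; apply le_min <;> linarith
    linarith
  have hy : c1/2 ≤ g (wprod l * z) := by
    have h5 := (abs_le.1 (hg.lip (wprod l * z) z1)).1
    have h6 : Cg * s.E (wprod l * z) z1 ≤ c1/2 := by
      have e1 : s.E (wprod l * z) z1 ≤ Real.exp (-s.c * (r - D)) := Real.exp_le_exp.2 (by nlinarith)
      have e2 : Cg * s.E (wprod l * z) z1 ≤ |Cg| * Real.exp (-s.c * (r - D)) :=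
        mul_le_mul (le_abs_self _) e1 (s.E_pos _ _).le (abs_nonneg _)
      refine e2.trans ?_
      have e3 : Real.exp (-s.c * (r - D)) = Real.exp (s.c * D) * Real.exp (-(s.c/2) * r) * Real.exp (-(s.c/2) * r) := by
        rw [← Real.exp_add, ← Real.exp_add]; ring_nf
      have e4 : c1 = 1/4 * (Real.exp (-s.c * (W.R/2)) * Real.exp (-(s.c/2) * r)) := by rw [hc1, ← Real.exp_add]; ring_nf
      have e5 : (8 * |Cg| * Real.exp (s.c * D) + 1) * Real.exp (-(s.c/2) * r) ≤ Real.exp (-s.c * (W.R/2)) := by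
        have := hr1.le; rw [hKd, le_div_iff₀ hden] at this; linarith
      have e6 := mul_le_mul_of_nonneg_right e5 (Real.exp_pos (-(s.c/2) * r)).le
      have e7 := Real.exp_pos (-(s.c/2) * r)
      rw [e3, e4]; nlinarith
    linarith
  have hat : ∀ z u, 0 ≤ t * W.kL z u := fun z u => mul_nonneg (by linarith) (W.kL0 _ _)
  have hOp : ∀ z, W.Op (fun z u => t * W.kL z u) g z ≤ g z := fun z => by
    have : W.Op (fun z u => t * W.kL z u) g z = t * W.Op W.kL g z := by
      unfold Op; rw [Finset.mul_sum]; exact Finset.sum_congr rfl fun u _ => by ring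
    rw [this, hg.eq z]; linarith
  have h5 := path_lower (W := W) hat hαp.le (fun z u _ hk => by
    rw [hα]; refine (min_le_right _ _).trans ?_
    exact mul_le_mul h1 (W.kL_low z u hk) (mul_pos W.κ0 (Real.exp_pos _)).le (by linarith)) hg.nn l z l2
  refine le_trans ?_ (h5.trans (iter_le hat hOp _ z))
  exact mul_le_mul (pow_le_pow_of_le_one hαp.le hα1 l1) hy (by positivity) (by positivity)

lemma eig0 : ∃ τ : ℝ, 0 < τ ∧ τ ≤ 1 ∧ ∃ c0 > 0, ∃ Cg, ∃ h : Γ → ℝ, (∀ z, c0 ≤ h z) ∧ (∀ z, h z ≤ 1) ∧ IsLip s h Cg ∧ ∀ z, h z = τ * W.Op W.kL h z := by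
  obtain ⟨τ, τ0, τ1, hτ⟩ := W.TT_crit
  obtain ⟨Cg, hg⟩ := W.good_exists
  obtain ⟨c0, hc0, β0, hβ0, hlow⟩ := W.good_lower Cg (τ/2) (by linarith)
  have H : ∀ j : ℕ, ∃ (t β : ℝ) (g : Γ → ℝ), τ - τ/2 * (1/(j+1)) ≤ t ∧ t ≤ τ ∧ 0 ≤ β ∧ β ≤ 1/((j:ℝ)+1) ∧ W.Good Cg t β g := by
    intro j
    obtain ⟨t, ht, h1, h2, h3⟩ := hτ (τ - τ/2 * (1/((j:ℝ)+1))) (by have : 0 < τ/2 * (1/((j:ℝ)+1)) := by positivity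
                                                                   linarith) (j+1)
    obtain ⟨β, g, b1, b2, b3⟩ := hg t ht (j+1) (by linarith [(Nat.cast_nonneg j : (0:ℝ) ≤ j)]) h3
    exact ⟨t, β, g, h1, h2, b1, b2, b3⟩
  choose t β g h1 h2 h3 h4 h5 using H
  have hlim : ∀ z, ∃ l ∈ Icc (0:ℝ) 1, Tendsto (fun j => g j z) (hyperfilter ℕ : Filter ℕ) (nhds l) := fun z =>
    ulim_exists _ _ fun j => ⟨(h5 j).nn z, (h5 j).le z⟩
  choose h hI hl using hlim
  have h1j : Tendsto (fun j : ℕ => 1/((j:ℝ)+1)) (hyperfilter ℕ : Filter ℕ) (nhds 0) :=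
    tendsto_one_div_add_atTop_nhds_zero_nat.mono_left Nat.hyperfilter_le_atTop
  have tl : Tendsto t (hyperfilter ℕ : Filter ℕ) (nhds τ) := by
    have : Tendsto (fun j : ℕ => τ - τ/2 * (1/((j:ℝ)+1))) (hyperfilter ℕ : Filter ℕ) (nhds (τ - τ/2*0)) := (h1j.const_mul _).const_sub _
    rw [mul_zero, sub_zero] at this
    exact tendsto_of_tendsto_of_tendsto_of_le_of_le this tendsto_const_nhds h1 h2
  have bl : Tendsto β (hyperfilter ℕ : Filter ℕ) (nhds 0) := squeeze_zero h3 h4 h1j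
  refine ⟨τ, τ0, τ1, c0, hc0, Cg, h, fun z => ?_, fun z => (hI z).2, lip_lim (fun j => (h5 j).lip) hl, fun z => ?_⟩
  · refine ge_of_tendsto (hl z) ?_
    filter_upwards [bl.eventually (gt_mem_nhds hβ0)] with j hj
    refine hlow (t j) (β j) (g j) ?_ ((h2 j).trans τ1) (h3 j) hj.le (h5 j) z
    refine le_trans ?_ (h1 j)
    have : (1:ℝ)/((j:ℝ)+1) ≤ 1 := div_le_one_of_le₀ (by linarith [(Nat.cast_nonneg j : (0:ℝ) ≤ j)]) (by positivity)
    nlinarith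
  · have e : Tendsto (fun j => β j + t j * W.Op W.kL (g j) z) (hyperfilter ℕ : Filter ℕ) (nhds (0 + τ * W.Op W.kL h z)) :=
      bl.add (tl.mul (tendsto_finsetSum _ fun u _ => (hl (u*z)).const_mul _))
    rw [zero_add] at e
    exact tendsto_nhds_unique ((hl z).congr fun j => (h5 j).eq z) e

lemma eig : ∃ c0 > 0, ∃ Cg, ∃ h : Γ → ℝ, (∀ z, c0 ≤ h z) ∧ (∀ z, h z ≤ 1) ∧ IsLip s h Cg ∧ ∀ z, h z = W.Op W.kL h z := by
  obtain ⟨τ, τ0, τ1, c0, hc0, Cg, h, h1, h2, h3, h4⟩ := W.eig0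
  have : τ = 1 := by
    by_contra hne
    have hlt : τ < 1 := lt_of_le_of_ne τ1 hne
    have hlog : Real.log τ < 0 := Real.log_neg τ0 hlt
    obtain ⟨D, hD⟩ : ∃ D, D = max W.Bm 1 := ⟨_, rfl⟩
    have hD1 : 1 ≤ D := hD ▸ le_max_right _ _
    have hDB : W.Bm ≤ D := hD ▸ le_max_left _ _
    obtain ⟨ε, hε⟩ : ∃ ε, ε = -Real.log τ / (2 * D) := ⟨_, rfl⟩
    have hεp : 0 < ε := by rw [hε]; apply div_pos <;> linarith
    have hεD : ε * D = -Real.log τ / 2 := by rw [hε]; field_simp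
    obtain ⟨Z, hZ, hP⟩ := s.poincare ε hεp
    have key : ∀ N : ℕ, (τ⁻¹)^N * c0 ≤ Z * Real.exp (ε * (N * D + 1)) := by
      intro N
      classical
      obtain ⟨T, hT⟩ : ∃ T, T = N * D + 1 := ⟨_, rfl⟩
      obtain ⟨G, hGd⟩ : ∃ G : Γ → ℝ, G = fun y => if s.nm y < T then h y * Real.exp (-s.nm y) else 0 := ⟨_, rfl⟩
      have hG : ∀ z, T ≤ s.nm z → G z = 0 := fun z hz => by rw [hGd]; exact if_neg (not_lt.2 hz)
      have hG0 : ∀ z, 0 ≤ G z := fun z => by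
        rw [hGd]; dsimp; split_ifs; exacts [mul_nonneg (hc0.le.trans (h1 z)) (Real.exp_pos _).le, le_rfl]
      have hit : ∀ (n : ℕ) z, s.nm z + n * D < T → (τ⁻¹)^n * (h z * Real.exp (-s.nm z)) ≤ (W.Op W.k)^[n] G z := by
        intro n
        induction n with
        | zero => intro z hz; simp at hz; simp [hGd, hz]
        | succ n ih =>
          intro z hz
          rw [Function.iterate_succ_apply']
          push_cast at hz
          have e1 : (τ⁻¹)^(n+1) * (h z * Real.exp (-s.nm z)) = ∑ u ∈ W.U, W.k z u * ((τ⁻¹)^n * (h (u*z) * Real.exp (-s.nm (u*z)))) := by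
            have e2 : τ⁻¹ * h z = W.Op W.kL h z := by rw [h4 z, inv_mul_cancel_left₀ τ0.ne']
            rw [pow_succ, show τ⁻¹ ^ n * τ⁻¹ * (h z * Real.exp (-s.nm z)) = τ⁻¹ ^ n * (τ⁻¹ * h z) * Real.exp (-s.nm z) by ring, e2]
            unfold Op; rw [Finset.mul_sum, Finset.sum_mul]
            refine Finset.sum_congr rfl fun u _ => ?_
            have : Real.exp (-s.nm (u*z)) = Real.exp (-b s z u) * Real.exp (-s.nm z) := by rw [← Real.exp_add]; unfold b; ring_nf
            rw [this, kL]; ring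
          rw [e1]
          refine Finset.sum_le_sum fun u _ => ?_
          by_cases hk : W.k z u = 0
          · simp [hk]
          · refine mul_le_mul_of_nonneg_left (ih _ ?_) (W.k0 _ _)
            have := (W.kb z u hk).2; linarith
      have hm := W.mass_iter hG N
      have hs : ∀ z, T ≤ s.nm z → (W.Op W.k)^[N] G z = 0 := fun z hz => W.Opk_iter_supp hG N z (by
        have := W.R1; have : (0:ℝ) ≤ N * W.R := by positivity
        linarith)
      have l1 : (τ⁻¹)^N * c0 ≤ ∑ᶠ z, G z := by
        have a1 := hit N 1 (by rw [s.nm_one]; linarith)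
        rw [s.nm_one, neg_zero, Real.exp_zero, mul_one] at a1
        have a2 : (τ⁻¹)^N * c0 ≤ (τ⁻¹)^N * h 1 := mul_le_mul_of_nonneg_left (h1 1) (by positivity)
        have a3 : (W.Op W.k)^[N] G 1 ≤ ∑ᶠ z, (W.Op W.k)^[N] G z := by
          exact single_le_finsum 1 (supp_fin hs) (iter_nonneg W.k0 hG0 N)
        have a4 : 0 ≤ ∑ x ∈ W.F0, ∑ n ∈ Finset.range N, (W.Op W.k)^[n] G x :=
          Finset.sum_nonneg fun x _ => Finset.sum_nonneg fun n _ => iter_nonneg W.k0 hG0 n x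
        linarith
      refine l1.trans ?_
      rw [finsum_eq_sum_of_support_subset (s := (s.fin T).toFinset) _ (fun z hz => by
        rw [Finset.mem_coe, (s.fin T).mem_toFinset]; by_contra h; exact hz (hG z (not_lt.1 h)))]
      refine le_trans (Finset.sum_le_sum (g := fun y => Real.exp (-(1+ε) * s.nm y) * Real.exp (ε * T)) fun y hy => ?_) ?_
      · have hy' : s.nm y < T := (s.fin T).mem_toFinset.1 hy
        rw [hGd]; dsimp; rw [if_pos hy', ← Real.exp_add]
        refine (mul_le_of_le_one_left (Real.exp_pos _).le (h2 y)).trans (Real.exp_le_exp.2 (by nlinarith))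
      · rw [← Finset.sum_mul, hT]; exact mul_le_mul_of_nonneg_right (hP _) (Real.exp_pos _).le
    have hlim : Tendsto (fun N : ℕ => Real.exp (-Real.log τ / 2 * N)) atTop atTop :=
      Real.tendsto_exp_atTop.comp (tendsto_natCast_atTop_atTop.const_mul_atTop (by linarith))
    obtain ⟨N, hN⟩ := (hlim.eventually (eventually_gt_atTop (Z * Real.exp ε / c0))).exists
    rw [div_lt_iff₀ hc0] at hN
    have h5 := key N
    have e1 : (τ⁻¹)^N = Real.exp (-Real.log τ / 2 * N) * Real.exp (-Real.log τ / 2 * N) := by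
      rw [← Real.exp_add, ← Real.exp_log τ0, ← Real.exp_neg, ← Real.exp_nat_mul, Real.log_exp]; ring_nf
    have e2 : Real.exp (ε * (N * D + 1)) = Real.exp (-Real.log τ / 2 * N) * Real.exp ε := by
      rw [← Real.exp_add, ← hεD]; ring_nf
    rw [e1, e2] at h5
    have := mul_lt_mul_of_pos_left hN (Real.exp_pos (-Real.log τ / 2 * N))
    linarith
  subst this
  exact ⟨c0, hc0, Cg, h, h1, h2, h3, fun z => by rw [← one_mul (W.Op W.kL h z)]; exact h4 z⟩
end Walk
end PaperCLT
end

section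
open Filter Set
namespace PaperCLT
open Walk
structure Eig {Γ : Type*} [Group Γ] {s : Setup Γ} (W : Walk s) where
  h : Γ → ℝ
  c0 : ℝ
  hc0 : 0 < c0
  lo : ∀ z, c0 ≤ h z
  up : ∀ z, h z ≤ 1
  Ch : ℝ
  lip : IsLip s h Ch
  eq : ∀ z, h z = W.Op W.kL h z
lemma Walk.exists_eig {Γ : Type*} [Group Γ] {s : Setup Γ} (W : Walk s) : Nonempty (Eig W) := by
  obtain ⟨c0, hc0, Cg, h, h1, h2, h3, h4⟩ := W.eig
  exact ⟨⟨h, c0, hc0, h1, h2, Cg, h3, h4⟩⟩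
namespace Eig
variable {Γ : Type*} [Group Γ] {s : Setup Γ} {W : Walk s} (X : Eig W)
lemma hp (z : Γ) : 0 < X.h z := X.hc0.trans_le (X.lo z)
noncomputable def kP (z u : Γ) : ℝ := W.kL z u * (X.h (u*z) * (X.h z)⁻¹)
noncomputable abbrev P (f : Γ → ℝ) : Γ → ℝ := W.Op X.kP f
lemma kP0 (z u : Γ) : 0 ≤ X.kP z u := mul_nonneg (W.kL0 _ _) (mul_nonneg (X.hp _).le (inv_pos.2 (X.hp _)).le)
lemma kP_sum (z : Γ) : ∑ u ∈ W.U, X.kP z u = 1 := by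
  have h1 : ∑ u ∈ W.U, X.kP z u = W.Op W.kL X.h z * (X.h z)⁻¹ := by
    unfold Walk.Op; rw [Finset.sum_mul]; exact Finset.sum_congr rfl fun u _ => by unfold kP; ring
  rw [h1, ← X.eq, mul_inv_cancel₀ (X.hp z).ne']
lemma kP_supp {z u : Γ} (h : X.kP z u ≠ 0) : W.k z u ≠ 0 := left_ne_zero_of_mul (left_ne_zero_of_mul h)
lemma kP_ker : ∃ C, W.Ker X.kP 1 C := by
  obtain ⟨C, hC⟩ := W.kL_ker
  have hA := W.A1_nn
  have hinv := X.lip.inv X.hc0 X.lo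
  have hb : ∀ z, |(X.h z)⁻¹| ≤ X.c0⁻¹ := fun z => by
    rw [abs_of_pos (inv_pos.2 (X.hp z))]; exact inv_anti₀ X.hc0 (X.lo z)
  refine ⟨C * X.c0⁻¹ + W.A1 * (Real.exp (s.c * W.ρU) * X.Ch * X.c0⁻¹ + 1 * (X.Ch / X.c0 ^ 2)), (Walk.Ker.mk X.kP0 (fun z u => X.kP_supp) (fun u hu => ?_) fun z => (X.kP_sum z).le)⟩
  have h1 := (X.lip.comp W hu).mul hinv (B := 1) (fun z => by rw [abs_of_pos (X.hp _)]; exact X.up _) hb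
  refine (hC.lip u hu).mul h1 (B := W.A1) (B' := X.c0⁻¹) (fun z => ?_) (fun z => ?_)
  · rw [abs_of_nonneg (W.kL0 _ _)]
    exact (Finset.single_le_sum (f := fun u => W.kL z u) (fun u _ => W.kL0 _ _) hu).trans (hC.sum z)
  · rw [abs_mul, abs_of_pos (X.hp _)]
    exact (mul_le_of_le_one_left (abs_nonneg _) (X.up _)).trans (hb z)
noncomputable def α : ℝ := min 1 (W.κ * Real.exp (-W.Bm) * X.c0)
lemma α0 : 0 < X.α := lt_min one_pos (mul_pos (mul_pos W.κ0 (Real.exp_pos _)) X.hc0)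
lemma α1 : X.α ≤ 1 := min_le_left _ _
lemma kP_low {z u : Γ} (hk : W.κ ≤ W.k z u) : X.α ≤ X.kP z u := by
  refine (min_le_right _ _).trans (mul_le_mul (W.kL_low z u hk) ?_ X.hc0.le (W.kL0 _ _))
  have h1 : 1 ≤ (X.h z)⁻¹ := (one_le_inv₀ (X.hp z)).2 (X.up z)
  have := X.lo (u*z); have := X.hc0; nlinarith
lemma P_const (c : ℝ) (z : Γ) : X.P (fun _ => c) z = c := by
  show ∑ u ∈ W.U, X.kP z u * c = c
  rw [← Finset.sum_mul, X.kP_sum, one_mul]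
lemma P_le {f : Γ → ℝ} {c : ℝ} (h : ∀ z, f z ≤ c) (z : Γ) : X.P f z ≤ c :=
  (Op_mono X.kP0 h z).trans (X.P_const c z).le
lemma P_ge {f : Γ → ℝ} {c : ℝ} (h : ∀ z, c ≤ f z) (z : Γ) : c ≤ X.P f z :=
  (X.P_const c z).ge.trans (Op_mono X.kP0 h z)
lemma Pn_le {f : Γ → ℝ} {c : ℝ} (h : ∀ z, f z ≤ c) (n : ℕ) : ∀ z, X.P^[n] f z ≤ c := by
  induction n with
  | zero => exact h
  | succ n ih => intro z; rw [Function.iterate_succ_apply']; exact X.P_le ih z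
lemma Pn_ge {f : Γ → ℝ} {c : ℝ} (h : ∀ z, c ≤ f z) (n : ℕ) : ∀ z, c ≤ X.P^[n] f z := by
  induction n with
  | zero => exact h
  | succ n ih => intro z; rw [Function.iterate_succ_apply']; exact X.P_ge ih z
lemma Pn_sub (f g : Γ → ℝ) (n : ℕ) : ∀ z, X.P^[n] (fun z => f z - g z) z = X.P^[n] f z - X.P^[n] g z := by
  induction n with
  | zero => intro z; rfl
  | succ n ih =>
    intro z; simp only [Function.iterate_succ_apply']
    rw [show X.P^[n] (fun z => f z - g z) = fun z => X.P^[n] f z - X.P^[n] g z from funext ih]; exact Op_sub _ _ z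
lemma Pn_add (f g : Γ → ℝ) (n : ℕ) : ∀ z, X.P^[n] (fun z => f z + g z) z = X.P^[n] f z + X.P^[n] g z := by
  induction n with
  | zero => intro z; rfl
  | succ n ih =>
    intro z; simp only [Function.iterate_succ_apply']
    rw [show X.P^[n] (fun z => f z + g z) = fun z => X.P^[n] f z + X.P^[n] g z from funext ih]; exact Op_add _ _ z
lemma Pn_smul (c : ℝ) (f : Γ → ℝ) (n : ℕ) : ∀ z, X.P^[n] (fun z => c * f z) z = c * X.P^[n] f z := by
  induction n with
  | zero => intro z; rfl
  | succ n ih =>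
    intro z; simp only [Function.iterate_succ_apply']
    rw [show X.P^[n] (fun z => c * f z) = fun z => c * X.P^[n] f z from funext ih]; exact Op_smul _ _ z
lemma Pn_const (c : ℝ) (n : ℕ) (z : Γ) : X.P^[n] (fun _ => c) z = c :=
  le_antisymm (X.Pn_le (fun _ => le_rfl) n z) (X.Pn_ge (fun _ => le_rfl) n z)
lemma Pn_mono {f g : Γ → ℝ} (h : ∀ z, f z ≤ g z) (n : ℕ) (z : Γ) : X.P^[n] f z ≤ X.P^[n] g z := iter_mono X.kP0 h n z
lemma P_osc {f : Γ → ℝ} {D : ℝ} (h : ∀ z z', f z - f z' ≤ D) (n : ℕ) (z z' : Γ) : X.P^[n] f z - f z' ≤ D ∧ f z' - X.P^[n] f z ≤ D := by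
  have h1 := X.Pn_le (fun z => (by linarith [h z z'] : f z ≤ f z' + D)) n z
  have h2 := X.Pn_ge (fun z => (by linarith [h z' z] : f z' - D ≤ f z)) n z
  constructor <;> linarith

lemma osc2 {f : Γ → ℝ} {D : ℝ} (h : ∀ z z', f z - f z' ≤ D) (n : ℕ) (z z' : Γ) : X.P^[n] f z - X.P^[n] f z' ≤ D := by
  have h1 := X.Pn_le (fun w => (by linarith [(X.P_osc h n z' w).2] : f w ≤ X.P^[n] f z' + D)) n z
  linarith

def Cl (s : Setup Γ) (l : ℝ) (f : Γ → ℝ) (D : ℝ) : Prop := (∀ z z', f z - f z' ≤ D) ∧ IsLip s f (l * D)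

theorem mix : ∃ l ≥ (1:ℝ), ∃ ε : ℕ → ℝ, Summable ε ∧ (∀ n, 0 ≤ ε n) ∧ ∀ f D, Cl s l f D → ∀ n, Cl s l (X.P^[n] f) (ε n * D) := by
  obtain ⟨C, hK⟩ := X.kP_ker
  obtain ⟨L, hL⟩ : ∃ L, L = max (W.LYc 1 C) 1 := ⟨_, rfl⟩
  have hL1 : 1 ≤ L := hL ▸ le_max_right _ _
  have LY : ∀ f M D, IsLip s f M → (∀ z z', f z - f z' ≤ D) → IsLip s (X.P f) (1/2 * M + L * D) := by
    intro f M D h1 h2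
    have hD : 0 ≤ D := by have := h2 1 1; linarith
    have h3 := hK.LY (h1.sub (IsLip.const (f 1))) (B := D) (fun z => abs_le.2 ⟨by linarith [h2 1 z], h2 z 1⟩)
    have h4 : W.Op X.kP (fun z => f z - f 1) = fun z => X.P f z - f 1 := funext fun z => by
      rw [Op_sub]; congr 1; exact X.P_const _ z
    rw [h4] at h3
    have h5 : IsLip s (X.P f) (1 * W.θ * (M + 0) + W.LYc 1 C * D) := fun z z' => by have := h3 z z'; simpa using this
    refine h5.mono ?_
    have := h1.nonneg; have := W.θ1; have : W.LYc 1 C ≤ L := hL ▸ le_max_left _ _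
    nlinarith
  have LYn : ∀ f M D, IsLip s f M → (∀ z z', f z - f z' ≤ D) → ∀ n, IsLip s (X.P^[n] f) (M + 2 * L * D) := by
    intro f M D h1 h2 n
    have hD : 0 ≤ D := by have := h2 1 1; linarith
    induction n with
    | zero => exact h1.mono (by nlinarith)
    | succ n ih =>
      rw [Function.iterate_succ_apply']
      refine (LY _ _ D ih (X.osc2 h2 n)).mono ?_
      have := h1.nonneg; linarith
  obtain ⟨C', hC', hr⟩ := W.reach
  have hlim : Tendsto (fun r : ℝ => 6 * L * Real.exp (-s.c * r)) atTop (nhds (6 * L * 0)) := (exp_tendsto_zero s.hc).const_mul _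
  rw [mul_zero] at hlim
  obtain ⟨r, hr1, hr2⟩ := ((hlim.eventually (gt_mem_nhds (show (0:ℝ) < 1/2 by norm_num))).and (eventually_ge_atTop (5 * W.R))).exists
  -- choose a reference point x of norm about r + C' + δ
  obtain ⟨x, hx⟩ : ∃ x, r + C' + s.δ ≤ s.nm x := by
    by_contra hcon
    push Not at hcon
    obtain ⟨T, hT, hlo⟩ := s.lo (1/2) (by norm_num) (max (r + C' + s.δ) (2 * Real.log ((ball s.d (r + C' + s.δ)).ncard + 1)))
    have e : (ball s.d T).ncard ≤ (ball s.d (r + C' + s.δ)).ncard := ncard_le_ncard (fun g _ => hcon g) (s.fin _)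
    have e2 : Real.log ((ball s.d (r + C' + s.δ)).ncard + 1) ≤ (1 - 1/2) * T := by have := (le_max_right _ _).trans hT; linarith
    have e3 := Real.exp_le_exp.2 e2
    rw [Real.exp_log (by positivity)] at e3
    have : ((ball s.d T).ncard : ℝ) ≤ (ball s.d (r + C' + s.δ)).ncard := by exact_mod_cast e
    linarith
  obtain ⟨N, hN⟩ := hr (s.nm x)
  obtain ⟨q, hq⟩ : ∃ q, q = X.α ^ N := ⟨_, rfl⟩
  have hq0 : 0 < q := hq ▸ pow_pos X.α0 N
  have hq1 : q ≤ 1 := hq ▸ pow_le_one₀ X.α0.le X.α1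
  have hδ := s.hδ
  have oscN : ∀ f D, (∀ z z', f z - f z' ≤ D) → IsLip s f (4 * L * D) → ∀ z z', X.P^[N] f z - X.P^[N] f z' ≤ (1 - q/2) * D := by
    intro f D h1 h2 z z'
    have hD : 0 ≤ D := by have := h1 1 1; linarith
    obtain ⟨l, l1, l2, l3, l4, l5⟩ := hN x z z' (by linarith) le_rfl
    obtain ⟨F, hF⟩ : ∃ F, F = X.P^[N - l.length] f := ⟨_, rfl⟩
    have FN : X.P^[N] f = X.P^[l.length] F := by rw [hF, ← Function.iterate_add_apply]; congr; omega
    have F1 : ∀ z z', F z - F z' ≤ D := by rw [hF]; exact X.osc2 h1 _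
    have F2 : IsLip s F (6 * L * D) := by rw [hF]; exact (LYn f _ D h2 h1 _).mono (by linarith)
    obtain ⟨a, ha⟩ : ∃ a, a = sSup (range F) := ⟨_, rfl⟩
    have bdd : BddAbove (range F) := ⟨F 1 + D, by rintro _ ⟨z, rfl⟩; linarith [F1 z 1]⟩
    have Fa : ∀ z, F z ≤ a := fun z => ha ▸ le_csSup bdd ⟨z, rfl⟩
    have Fb : ∀ z, a - D ≤ F z := fun z => by
      have : a ≤ F z + D := ha ▸ csSup_le (range_nonempty F) (by rintro _ ⟨w, rfl⟩; linarith [F1 w z])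
      linarith
    have p1 := path_lower (W := W) X.kP0 X.α0.le (fun z u _ hk => X.kP_low hk) (f := fun w => a - F w) (fun w => by linarith [Fa w]) l z l2
    have p2 := path_lower (W := W) X.kP0 X.α0.le (fun z u _ hk => X.kP_low hk) (f := fun w => F w - (a - D)) (fun w => by linarith [Fb w]) l z' l3
    rw [X.Pn_sub (fun _ => a) F, X.Pn_const] at p1
    rw [X.Pn_sub F (fun _ => a - D), X.Pn_const] at p2
    rw [FN]
    have hg : s.nm x - C' - s.δ ≤ s.gp (wprod l * z) (wprod l * z') := by
      have := s.gp_hyp (wprod l * z) (wprod l * z') x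
      have h5 : s.nm x - C' ≤ min (s.gp (wprod l * z) x) (s.gp (wprod l * z') x) := le_min l4 l5
      linarith
    have hE : s.E (wprod l * z) (wprod l * z') ≤ Real.exp (-s.c * r) := Real.exp_le_exp.2 (by have := s.hc; nlinarith)
    have hFF : F (wprod l * z) - F (wprod l * z') ≤ 1/2 * D := by
      have := (le_abs_self _).trans (F2 (wprod l * z) (wprod l * z'))
      have h6 : 6 * L * D * s.E (wprod l * z) (wprod l * z') ≤ 6 * L * D * Real.exp (-s.c * r) := mul_le_mul_of_nonneg_left hE (by positivity)
      nlinarith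
    have hqa : q ≤ X.α ^ l.length := hq ▸ pow_le_pow_of_le_one X.α0.le X.α1 l1
    have h7 : X.α ^ l.length * (1/2 * D) ≤ X.α ^ l.length * (D - (F (wprod l * z) - F (wprod l * z'))) :=
      mul_le_mul_of_nonneg_left (by linarith) (pow_pos X.α0 _).le
    have h8 : q * (1/2 * D) ≤ X.α ^ l.length * (1/2 * D) := mul_le_mul_of_nonneg_right hqa (by positivity)
    nlinarith
  obtain ⟨l, hl⟩ : ∃ l, l = 4 * L := ⟨_, rfl⟩
  have step : ∀ f D, Cl s l f D → Cl s l (X.P f) D := by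
    intro f D ⟨h1, h2⟩
    have hD : 0 ≤ D := by have := h1 1 1; linarith
    exact ⟨X.osc2 h1 1, (LY f _ D h2 h1).mono (by rw [hl]; nlinarith)⟩
  have stepn : ∀ f D, Cl s l f D → ∀ n, Cl s l (X.P^[n] f) D := by
    intro f D h n
    induction n with
    | zero => exact h
    | succ n ih => rw [Function.iterate_succ_apply']; exact step _ _ ih
  have big : ∀ f D, Cl s l f D → Cl s l (X.P^[N+1] f) ((1 - q/4) * D) := by
    intro f D h
    have hD : 0 ≤ D := by have := h.1 1 1; linarith
    have h1 := oscN f D h.1 (hl ▸ h.2)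
    rw [Function.iterate_succ_apply']
    refine ⟨fun z z' => (X.osc2 h1 1 z z').trans (by nlinarith), ?_⟩
    refine (LY _ _ _ (stepn f D h N).2 h1).mono ?_
    rw [hl]; nlinarith [mul_nonneg (by linarith : 0 ≤ L) hD]
  have bigm : ∀ f D, Cl s l f D → ∀ m : ℕ, Cl s l (X.P^[(N+1)*m] f) ((1 - q/4)^m * D) := by
    intro f D h m
    induction m with
    | zero => simpa using h
    | succ m ih =>
      rw [mul_add, mul_one, add_comm, Function.iterate_add_apply, pow_succ, mul_comm ((1 - q/4)^m), mul_assoc]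
      exact big _ _ ih
  refine ⟨l, by linarith, fun n => (1 - q/4)^(n / (N+1)), ?_, fun n => pow_nonneg (by linarith) _, ?_⟩
  · have hx0 : 0 ≤ 1 - q/4 := by linarith
    have hx1 : 1 - q/4 < 1 := by linarith
    refine summable_of_sum_range_le (c := (N+1) * (1 - (1 - q/4))⁻¹) (fun n => pow_nonneg hx0 _) fun n => ?_
    have h1 : ∑ i ∈ Finset.range n, (1 - q/4)^(i / (N+1)) ≤ ∑ i ∈ Finset.range ((N+1) * n), (1 - q/4)^(i / (N+1)) :=
      Finset.sum_le_sum_of_subset_of_nonneg (Finset.range_mono (by nlinarith)) (fun _ _ _ => pow_nonneg hx0 _)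
    have h2 : ∀ n, ∑ i ∈ Finset.range ((N+1) * n), (1 - q/4)^(i / (N+1)) = (N+1) * ∑ j ∈ Finset.range n, (1 - q/4)^j := by
      intro n
      induction n with
      | zero => simp
      | succ n ih =>
        rw [mul_add, mul_one, Finset.sum_range_add, ih, Finset.sum_range_succ _ n, mul_add]
        congr 1
        rw [Finset.sum_congr rfl (g := fun _ => (1 - q/4)^n) (fun i hi => by
          congr 1; rw [Nat.mul_add_div (by omega), Nat.div_eq_of_lt (Finset.mem_range.1 hi), add_zero])]
        simp
    refine h1.trans ?_
    rw [h2]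
    refine mul_le_mul_of_nonneg_left ?_ (by positivity)
    rw [← tsum_geometric_of_lt_one hx0 hx1]
    exact (summable_geometric_of_lt_one hx0 hx1).sum_le_tsum _ (fun _ _ => pow_nonneg hx0 _)
  · intro f D h n
    have h1 := bigm f D h (n / (N+1))
    have h2 := stepn _ _ h1 (n % (N+1))
    rwa [← Function.iterate_add_apply, Nat.mod_add_div] at h2
end Eig
end PaperCLT
end

section
open Filter Set
namespace PaperCLT
open Walk Eig
structure Mix {Γ : Type*} [Group Γ] {s : Setup Γ} {W : Walk s} (X : Eig W) where
  l : ℝ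
  hl : 1 ≤ l
  ε : ℕ → ℝ
  εs : Summable ε
  ε0 : ∀ n, 0 ≤ ε n
  cl : ∀ f D, Cl s l f D → ∀ n, Cl s l (X.P^[n] f) (ε n * D)
lemma Eig.exists_mix {Γ : Type*} [Group Γ] {s : Setup Γ} {W : Walk s} (X : Eig W) : Nonempty (Mix X) := by
  obtain ⟨l, h1, ε, h2, h3, h4⟩ := X.mix
  exact ⟨⟨l, h1, ε, h2, h3, h4⟩⟩
namespace Mix
variable {Γ : Type*} [Group Γ] {s : Setup Γ} {W : Walk s} {X : Eig W} (Y : Mix X)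
noncomputable def _root_.PaperCLT.Eig.ν (X : Eig W) (f : Γ → ℝ) : ℝ := limUnder atTop (fun n => X.P^[n] f 1)
lemma Cl_of {f : Γ → ℝ} {M B : ℝ} (h : IsLip s f M) (hB : ∀ z, |f z| ≤ B) : Cl s Y.l f (2 * B + M) := by
  have hB0 := (abs_nonneg _).trans (hB 1)
  have hM := h.nonneg
  refine ⟨fun z z' => by linarith [(abs_le.1 (hB z)).2, (abs_le.1 (hB z')).1], h.mono ?_⟩
  nlinarith [Y.hl]
lemma εlim (D : ℝ) : Tendsto (fun n => Y.ε n * D) atTop (nhds 0) := by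
  have := Y.εs.tendsto_atTop_zero.mul_const D; rwa [zero_mul] at this
variable {f g : Γ → ℝ} {D D' : ℝ}
lemma step (h : Cl s Y.l f D) (n m : ℕ) (z z' : Γ) : |X.P^[n+m] f z - X.P^[n] f z'| ≤ Y.ε n * D := by
  have := X.P_osc (Y.cl f D h n).1 m z z'
  rw [← Function.iterate_add_apply, add_comm] at this
  rw [abs_le]; constructor <;> linarith
lemma νlim (h : Cl s Y.l f D) : Tendsto (fun n => X.P^[n] f 1) atTop (nhds (X.ν f)) := by
  apply CauchySeq.tendsto_limUnder
  refine cauchySeq_of_le_tendsto_0 (fun n => Y.ε n * D + Y.ε n * D) (fun n m N hn hm => ?_) (by simpa using (Y.εlim D).add (Y.εlim D))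
  rw [Real.dist_eq]
  have h1 := Y.step h N (n - N) 1 1
  have h2 := Y.step h N (m - N) 1 1
  rw [Nat.add_sub_cancel' hn] at h1; rw [Nat.add_sub_cancel' hm] at h2
  rw [abs_le] at *; constructor <;> linarith
lemma νbd (h : Cl s Y.l f D) (n : ℕ) (z : Γ) : |X.P^[n] f z - X.ν f| ≤ Y.ε n * D := by
  have h1 : Tendsto (fun m => |X.P^[n+m] f 1 - X.P^[n] f z|) atTop (nhds |X.ν f - X.P^[n] f z|) := by
    have := (Y.νlim h).comp (tendsto_add_atTop_nat n)
    exact ((this.congr fun m => by simp [add_comm]).sub_const _).abs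
  rw [abs_sub_comm]; exact le_of_tendsto' h1 fun m => Y.step h n m 1 z
lemma νz (h : Cl s Y.l f D) (z : Γ) : Tendsto (fun n => X.P^[n] f z) atTop (nhds (X.ν f)) := by
  rw [tendsto_iff_dist_tendsto_zero]
  exact squeeze_zero (fun _ => dist_nonneg) (fun n => by rw [Real.dist_eq]; exact Y.νbd h n z) (Y.εlim D)
lemma ν_ge {c : ℝ} (h : Cl s Y.l f D) (hc : ∀ z, c ≤ f z) : c ≤ X.ν f := ge_of_tendsto' (Y.νlim h) fun n => X.Pn_ge hc n 1
lemma ν_le {c : ℝ} (h : Cl s Y.l f D) (hc : ∀ z, f z ≤ c) : X.ν f ≤ c := le_of_tendsto' (Y.νlim h) fun n => X.Pn_le hc n 1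
lemma ν_sub (h : Cl s Y.l f D) (h' : Cl s Y.l g D') : X.ν (fun z => f z - g z) = X.ν f - X.ν g :=
  (((Y.νlim h).sub (Y.νlim h')).congr fun n => (X.Pn_sub f g n 1).symm).limUnder_eq
lemma ν_add (h : Cl s Y.l f D) (h' : Cl s Y.l g D') : X.ν (fun z => f z + g z) = X.ν f + X.ν g :=
  (((Y.νlim h).add (Y.νlim h')).congr fun n => (X.Pn_add f g n 1).symm).limUnder_eq
lemma ν_smul (c : ℝ) (h : Cl s Y.l f D) : X.ν (fun z => c * f z) = c * X.ν f :=
  (((Y.νlim h).const_mul c).congr fun n => (X.Pn_smul c f n 1).symm).limUnder_eq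
lemma ν_P (h : Cl s Y.l f D) : X.ν (X.P f) = X.ν f :=
  ((Y.νlim h).comp (tendsto_add_atTop_nat 1)).limUnder_eq
noncomputable def ε1 : ℝ := ∑' n, Y.ε n
lemma poisson (h : Cl s Y.l f D) : ∃ χ : Γ → ℝ, IsLip s χ (Y.ε1 * (Y.l * D)) ∧ (∀ z, |χ z| ≤ Y.ε1 * D) ∧ ∀ z, f z - X.ν f = χ z - X.P χ z := by
  have hD : 0 ≤ D := by have := h.1 1 1; linarith
  have sm : ∀ z, Summable fun n => X.P^[n] f z - X.ν f := fun z =>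
    Summable.of_norm_bounded (Y.εs.mul_right D) fun n => Y.νbd h n z
  refine ⟨fun z => ∑' n, (X.P^[n] f z - X.ν f), fun z z' => ?_, fun z => ?_, fun z => ?_⟩
  · show |(∑' n, (X.P^[n] f z - X.ν f)) - ∑' n, (X.P^[n] f z' - X.ν f)| ≤ _
    rw [← (sm z).tsum_sub (sm z'), ε1, ← Real.norm_eq_abs, ← tsum_mul_right, ← tsum_mul_right]
    refine tsum_of_norm_bounded ((Y.εs.mul_right (Y.l * D)).mul_right _).hasSum fun n => ?_
    have := (Y.cl f D h n).2 z z'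
    rw [sub_sub_sub_cancel_right, Real.norm_eq_abs]; refine this.trans (le_of_eq ?_); ring
  · rw [ε1, ← tsum_mul_right, ← Real.norm_eq_abs]
    exact tsum_of_norm_bounded (Y.εs.mul_right D).hasSum fun n => Y.νbd h n z
  · have e : X.P (fun z => ∑' n, (X.P^[n] f z - X.ν f)) z = ∑' n, (X.P^[n+1] f z - X.ν f) := by
      show ∑ u ∈ W.U, X.kP z u * ∑' n, (X.P^[n] f (u*z) - X.ν f) = _
      simp_rw [← tsum_mul_left]
      rw [← Summable.tsum_finsetSum (fun u _ => (sm (u*z)).mul_left _)]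
      refine tsum_congr fun n => ?_
      rw [Function.iterate_succ_apply']
      simp_rw [mul_sub]; rw [Finset.sum_sub_distrib, ← Finset.sum_mul, X.kP_sum, one_mul]; rfl
    rw [e]; show _ = (∑' n, (X.P^[n] f z - X.ν f)) - _
    rw [(sm z).tsum_eq_zero_add]; simp
end Mix
end PaperCLT
end

section
open Filter Set
namespace PaperCLT
open Walk Eig
namespace Eig
variable {Γ : Type*} [Group Γ] {s : Setup Γ} {W : Walk s} (X : Eig W)
noncomputable def J (W : Walk s) (F : Γ → ℝ) (T : ℝ) (z : Γ) : ℝ :=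
  ∑ n ∈ Finset.range (⌈T⌉₊ + 1), (W.Op W.k)^[n] F z
lemma J_eq {F : Γ → ℝ} {T : ℝ} (hF : ∀ z, T ≤ s.nm z → F z = 0) (z : Γ) : J W F T z = F z + W.Op W.k (J W F T) z := by
  have h1 : W.Op W.k (J W F T) z = ∑ n ∈ Finset.range (⌈T⌉₊ + 1), (W.Op W.k)^[n+1] F z := by
    unfold J; rw [W.Op_sum]; exact Finset.sum_congr rfl fun n _ => by rw [Function.iterate_succ_apply']
  rw [h1, Finset.sum_range_succ, W.Opk_iter_supp hF (⌈T⌉₊+1) z, J, Finset.sum_range_succ']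
  · simp [add_comm]
  · have h2 := Nat.le_ceil T; have h3 := W.R1; have h4 := s.nm_nonneg z
    have h5 : (⌈T⌉₊ : ℝ) ≤ (⌈T⌉₊ + 1 : ℕ) * W.R := by push_cast; nlinarith [(Nat.cast_nonneg ⌈T⌉₊ : (0:ℝ) ≤ ⌈T⌉₊)]
    linarith
lemma J_zero {F : Γ → ℝ} {T : ℝ} (hF : ∀ z, T ≤ s.nm z → F z = 0) {z : Γ} (hz : T ≤ s.nm z) : J W F T z = 0 :=
  Finset.sum_eq_zero fun n _ => W.Opk_iter_supp hF n z (by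
    have := W.R1; have : (0:ℝ) ≤ n * W.R := by positivity
    linarith)
lemma J_nn {F : Γ → ℝ} {T : ℝ} (hF : ∀ z, 0 ≤ F z) (z : Γ) : 0 ≤ J W F T z :=
  Finset.sum_nonneg fun n _ => iter_nonneg W.k0 hF n z
lemma J_total {F : Γ → ℝ} {T : ℝ} (hF : ∀ z, T ≤ s.nm z → F z = 0) : ∑ᶠ z, F z = ∑ x ∈ W.F0, J W F T x := by
  have h := W.mass_iter hF (⌈T⌉₊ + 1)
  rw [show (W.Op W.k)^[⌈T⌉₊+1] F = fun _ => 0 from funext fun z => W.Opk_iter_supp hF _ z (by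
    have h2 := Nat.le_ceil T; have h3 := W.R1; have h4 := s.nm_nonneg z
    have h5 : (⌈T⌉₊ : ℝ) ≤ (⌈T⌉₊ + 1 : ℕ) * W.R := by push_cast; nlinarith [(Nat.cast_nonneg ⌈T⌉₊ : (0:ℝ) ≤ ⌈T⌉₊)]
    linarith)] at h
  rw [finsum_zero, add_zero] at h
  rw [h]
  rfl
/-- uniqueness/monotonicity principle for the backward recursion -/
lemma ind {Q : Γ → ℝ → Prop} (h0 : ∀ z S, S ≤ 0 → Q z S) (h1 : ∀ z S, 0 < S → (∀ z' S', S' ≤ S - 1 → Q z' S') → Q z S) (z : Γ) (S : ℝ) : Q z S := by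
  have : ∀ n : ℕ, ∀ (z : Γ) (S : ℝ), S ≤ n → Q z S := by
    intro n
    induction n with
    | zero => intro z S h; exact h0 z S (by simpa using h)
    | succ n ih =>
      intro z S h
      by_cases hS : S ≤ 0
      · exact h0 z S hS
      · exact h1 z S (not_le.1 hS) fun z' S' h' => ih z' S' (by push_cast at h; linarith)
  obtain ⟨n, hn⟩ := exists_nat_ge S
  exact this n z S hn
lemma kP_b {z u : Γ} (h : X.kP z u ≠ 0) : 1 ≤ b s z u ∧ b s z u ≤ W.Bm :=
  ⟨W.R1.trans (W.kb z u (X.kP_supp h)).1, (W.kb z u (X.kP_supp h)).2⟩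
lemma kP_sum_le {z : Γ} {f : Γ → ℝ} {c : ℝ} (h : ∀ u, X.kP z u ≠ 0 → f u ≤ c) : ∑ u ∈ W.U, X.kP z u * f u ≤ c := by
  calc _ ≤ ∑ u ∈ W.U, X.kP z u * c := Finset.sum_le_sum fun u _ => by
        by_cases h0 : X.kP z u = 0
        · simp [h0]
        · exact mul_le_mul_of_nonneg_left (h u h0) (X.kP0 _ _)
    _ = c := by rw [← Finset.sum_mul, X.kP_sum, one_mul]
lemma comp {f : Γ → ℝ → ℝ} {m : ℝ} (hm : 0 ≤ m) (h0 : ∀ z S, S ≤ 0 → f z S ≤ m)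
    (h1 : ∀ z S, 0 < S → f z S ≤ m * Real.exp (-S) + ∑ u ∈ W.U, X.kP z u * f (u*z) (S - b s z u)) (z : Γ) (S : ℝ) : f z S ≤ 4 * m := by
  have key := ind (Q := fun z S => f z S ≤ m ∨ (0 < S ∧ f z S ≤ m * (4 - 2 * Real.exp (-S)))) (fun z S h => Or.inl (h0 z S h)) (fun z S hS ih => by
    right; refine ⟨hS, ?_⟩
    have hE := Real.exp_pos (-S)
    have hE1 : Real.exp (-S) ≤ 1 := Real.exp_le_one_iff.2 (by linarith)
    have e : Real.exp (-(S-1)) = Real.exp 1 * Real.exp (-S) := by rw [← Real.exp_add]; ring_nf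
    have e1 : (2:ℝ) ≤ Real.exp 1 := by linarith [Real.add_one_le_exp 1]
    refine (h1 z S hS).trans ?_
    have h2 : ∑ u ∈ W.U, X.kP z u * f (u*z) (S - b s z u) ≤ m * (4 - 3 * Real.exp (-S)) := by
      refine X.kP_sum_le fun u hu => ?_
      rcases ih (u*z) (S - b s z u) (by linarith [(X.kP_b hu).1]) with h | ⟨h, h'⟩
      · nlinarith
      · refine h'.trans (mul_le_mul_of_nonneg_left ?_ hm)
        have : Real.exp (-(S-1)) ≤ Real.exp (-(S - b s z u)) := Real.exp_le_exp.2 (by linarith [(X.kP_b hu).1])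
        nlinarith
    nlinarith) z S
  rcases key with h | ⟨_, h⟩
  · linarith
  · nlinarith [Real.exp_pos (-S)]

structure Tst (φ : ℝ → ℝ) : Prop where
  z : ∀ t, t ≤ 0 → φ t = 0
  nn : ∀ t, 0 ≤ φ t
  le : ∀ t, φ t ≤ 1
noncomputable def v (φ : ℝ → ℝ) (z : Γ) (S : ℝ) : ℝ := Real.exp (-S) * J W (fun y => φ (s.nm z + S - s.nm y)) (s.nm z + S) z * (X.h z)⁻¹
variable {φ : ℝ → ℝ} (hφ : Tst φ)
lemma v_neg (hφ : Tst φ) {z : Γ} {S : ℝ} (hS : S ≤ 0) : X.v φ z S = 0 := by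
  unfold v; rw [J_zero (fun y hy => hφ.z _ (by linarith)) (by linarith)]; simp
lemma v_nn (hφ : Tst φ) (z : Γ) (S : ℝ) : 0 ≤ X.v φ z S :=
  mul_nonneg (mul_nonneg (Real.exp_pos _).le (J_nn (fun y => hφ.nn _) z)) (inv_pos.2 (X.hp z)).le
lemma v_eq (hφ : Tst φ) (z : Γ) (S : ℝ) : X.v φ z S = Real.exp (-S) * φ S * (X.h z)⁻¹ + ∑ u ∈ W.U, X.kP z u * X.v φ (u*z) (S - b s z u) := by
  have e : ∀ u, s.nm (u*z) + (S - b s z u) = s.nm z + S := fun u => by unfold b; ring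
  unfold v
  rw [J_eq (fun y hy => hφ.z _ (by linarith)), add_sub_cancel_left, mul_add, add_mul]
  congr 1
  unfold Walk.Op
  rw [Finset.mul_sum, Finset.sum_mul]
  refine Finset.sum_congr rfl fun u _ => ?_
  rw [e, kP, kL, neg_sub, sub_eq_add_neg, Real.exp_add, Real.exp_neg (b s z u)]
  have := (X.hp (u*z)).ne'; have := (X.hp z).ne'
  field_simp
lemma v_le (hφ : Tst φ) (z : Γ) (S : ℝ) : X.v φ z S ≤ 4 * X.c0⁻¹ := by
  have hc := inv_pos.2 X.hc0
  refine X.comp hc.le (fun z S h => by rw [X.v_neg hφ h]; exact hc.le) (fun z S hS => ?_) z S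
  rw [X.v_eq hφ z S]
  refine add_le_add ?_ le_rfl
  rw [mul_comm X.c0⁻¹]
  exact mul_le_mul (mul_le_of_le_one_right (Real.exp_pos _).le (hφ.le S)) (inv_anti₀ X.hc0 (X.lo z)) (inv_pos.2 (X.hp z)).le (Real.exp_pos _).le
lemma v_lipS (hφ : Tst φ) {L : ℝ} (hL : ∀ t t', |φ t - φ t'| ≤ L * |t - t'|) : ∃ K, ∀ z S S', |X.v φ z S - X.v φ z S'| ≤ K * |S - S'| := by
  have hc := inv_pos.2 X.hc0
  have hL0 : 0 ≤ L := by have := (abs_nonneg _).trans (hL 0 1); simpa using this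
  have small : ∀ η : ℝ, 0 ≤ η → η ≤ 1 → ∀ z S, |X.v φ z (S+η) - X.v φ z S| ≤ 4 * ((L+1) * η * X.c0⁻¹) := by
    intro η h0 h1
    have hm : 0 ≤ (L+1) * η * X.c0⁻¹ := by positivity
    have hin : ∀ z, (X.h z)⁻¹ ≤ X.c0⁻¹ := fun z => inv_anti₀ X.hc0 (X.lo z)
    have H0 : ∀ z S, S ≤ 0 → |X.v φ z (S+η) - X.v φ z S| ≤ (L+1) * η * X.c0⁻¹ := by
      intro z S hS
      rw [X.v_neg hφ hS, sub_zero, abs_of_nonneg (X.v_nn hφ _ _)]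
      by_cases h2 : S + η ≤ 0
      · rw [X.v_neg hφ h2]; exact hm
      rw [X.v_eq hφ, Finset.sum_eq_zero, add_zero]
      · have h3 : φ (S+η) ≤ L * η := by
          have := (le_abs_self _).trans (hL (S+η) 0); rw [hφ.z 0 le_rfl, sub_zero, sub_zero, abs_of_pos (not_le.1 h2)] at this
          nlinarith
        have h4 : Real.exp (-(S+η)) ≤ 1 := Real.exp_le_one_iff.2 (by linarith [not_le.1 h2])
        have h5 : Real.exp (-(S+η)) * φ (S+η) ≤ (L+1)*η := by nlinarith [hφ.nn (S+η)]
        exact mul_le_mul h5 (hin z) (inv_pos.2 (X.hp z)).le (by positivity)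
      · intro u _
        by_cases hu : X.kP z u = 0
        · rw [hu, zero_mul]
        · rw [X.v_neg hφ (by linarith [(X.kP_b hu).1]), mul_zero]
    have H1 : ∀ z S, 0 < S → |Real.exp (-(S+η)) * φ (S+η) * (X.h z)⁻¹ - Real.exp (-S) * φ S * (X.h z)⁻¹| ≤ (L+1) * η * X.c0⁻¹ * Real.exp (-S) := by
      intro z S hS
      have e1 : Real.exp (-(S+η)) = Real.exp (-S) * Real.exp (-η) := by rw [← Real.exp_add]; ring_nf
      have e2 : 1 - η ≤ Real.exp (-η) := by linarith [Real.add_one_le_exp (-η)]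
      have e3 : Real.exp (-η) ≤ 1 := Real.exp_le_one_iff.2 (by linarith)
      have e4 := hL (S+η) S
      rw [add_sub_cancel_left, abs_of_nonneg h0] at e4
      have e5 : |Real.exp (-η) * φ (S+η) - φ S| ≤ (L+1)*η := by
        have : Real.exp (-η) * φ (S+η) - φ S = (Real.exp (-η) - 1) * φ (S+η) + (φ (S+η) - φ S) := by ring
        rw [this]; refine (abs_add_le _ _).trans ?_
        rw [abs_mul, abs_of_nonneg (hφ.nn _), abs_of_nonpos (by linarith)]
        nlinarith [hφ.nn (S+η), hφ.le (S+η)]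
      have e6 : Real.exp (-(S+η)) * φ (S+η) * (X.h z)⁻¹ - Real.exp (-S) * φ S * (X.h z)⁻¹ = (Real.exp (-η) * φ (S+η) - φ S) * ((X.h z)⁻¹ * Real.exp (-S)) := by
        rw [e1]; ring
      rw [e6, abs_mul, abs_of_pos (mul_pos (inv_pos.2 (X.hp z)) (Real.exp_pos (-S))), mul_assoc]
      exact mul_le_mul e5 (mul_le_mul_of_nonneg_right (hin z) (Real.exp_pos _).le) (mul_pos (inv_pos.2 (X.hp z)) (Real.exp_pos _)).le (by positivity)
    have H2 : ∀ z S, ∑ u ∈ W.U, X.kP z u * X.v φ (u*z) (S + η - b s z u) - ∑ u ∈ W.U, X.kP z u * X.v φ (u*z) (S - b s z u) =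
        ∑ u ∈ W.U, X.kP z u * (X.v φ (u*z) (S - b s z u + η) - X.v φ (u*z) (S - b s z u)) := by
      intro z S; rw [← Finset.sum_sub_distrib]; exact Finset.sum_congr rfl fun u _ => by rw [mul_sub, show S + η - b s z u = S - b s z u + η by ring]
    intro z S
    have U1 := X.comp (f := fun z S => X.v φ z (S+η) - X.v φ z S) hm (fun z S h => (le_abs_self _).trans (H0 z S h)) (fun z S hS => by
      rw [← H2, X.v_eq hφ z (S+η), X.v_eq hφ z S]; linarith [(le_abs_self _).trans (H1 z S hS)]) z S
    have U2 := X.comp (f := fun z S => -(X.v φ z (S+η) - X.v φ z S)) hm (fun z S h => (neg_le_abs _).trans (H0 z S h)) (fun z S hS => by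
      simp only [mul_neg, Finset.sum_neg_distrib]
      rw [← H2, X.v_eq hφ z (S+η), X.v_eq hφ z S]; linarith [(neg_le_abs _).trans (H1 z S hS)]) z S
    rw [abs_le]; constructor <;> linarith
  have main : ∀ z S S', S ≤ S' → |X.v φ z S - X.v φ z S'| ≤ (4 * ((L+1) * X.c0⁻¹)) * |S - S'| := by
    intro z S S' h
    have hs : |S - S'| = S' - S := by rw [abs_sub_comm, abs_of_nonneg (by linarith)]
    by_cases h1 : S' - S ≤ 1
    · have := small (S'-S) (by linarith) h1 z S
      rw [add_sub_cancel, abs_sub_comm] at this; rw [hs]; refine this.trans (le_of_eq (by ring))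
    · have b1 := X.v_le hφ z S; have b2 := X.v_le hφ z S'
      have n1 := X.v_nn hφ z S; have n2 := X.v_nn hφ z S'
      have h3 : |X.v φ z S - X.v φ z S'| ≤ 4 * X.c0⁻¹ := abs_le.2 ⟨by linarith, by linarith⟩
      rw [hs]; push Not at h1
      have : (0:ℝ) ≤ L * X.c0⁻¹ := by positivity
      nlinarith
  refine ⟨4 * ((L+1) * X.c0⁻¹), fun z S S' => ?_⟩
  rcases le_total S S' with h | h
  · exact main z S S' h
  · rw [abs_sub_comm, abs_sub_comm S]; exact main z S' S h
lemma v_lipz (hφ : Tst φ) {L : ℝ} (hL : ∀ t t', |φ t - φ t'| ≤ L * |t - t'|) : ∃ M, ∀ S, IsLip s (fun z => X.v φ z S) M := by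
  obtain ⟨K, hK⟩ := X.v_lipS hφ hL
  obtain ⟨C, hC⟩ := W.b_lip
  obtain ⟨Ck, hk⟩ := X.kP_ker
  have hc := inv_pos.2 X.hc0
  have hK0 : 0 ≤ K := by have := (abs_nonneg _).trans (hK 1 0 1); simpa using this
  have hi := X.lip.inv X.hc0 X.lo
  have hCk : 0 ≤ W.U.card * Ck := by
    by_cases hne : W.U.Nonempty
    · obtain ⟨u, hu⟩ := hne; exact mul_nonneg (Nat.cast_nonneg _) (hk.lip u hu).nonneg
    · rw [Finset.not_nonempty_iff_eq_empty.1 hne]; simp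
  have hCC : 0 ≤ |C| := abs_nonneg _
  obtain ⟨M, hM⟩ : ∃ M, M = 2 * (X.Ch / X.c0^2 + K * |C| + W.U.card * Ck * (4 * X.c0⁻¹)) + 4 * X.c0⁻¹ * Real.exp (s.c * W.K0) := ⟨_, rfl⟩
  have hM1 : X.Ch / X.c0^2 + K * |C| + W.U.card * Ck * (4 * X.c0⁻¹) ≤ M / 2 := by
    have : 0 < 4 * X.c0⁻¹ * Real.exp (s.c * W.K0) := by positivity
    linarith
  have hM2 : 4 * X.c0⁻¹ * Real.exp (s.c * W.K0) ≤ M := by have := hi.nonneg; have : 0 ≤ K * |C| := by positivity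
                                                          have : 0 ≤ W.U.card * Ck * (4 * X.c0⁻¹) := by positivity
                                                          linarith
  have hM0 : 0 ≤ M := le_trans (by positivity) hM2
  refine ⟨M, fun S z z' => ?_⟩
  have key := ind (Q := fun (_ : Γ) S => ∀ z z', X.v φ z S - X.v φ z' S ≤ M * s.E z z') (fun _ S h z z' => by
    rw [X.v_neg hφ h, X.v_neg hφ h, sub_zero]; exact mul_nonneg hM0 (s.E_pos _ _).le) (fun w S hS ih z z' => by
    have hE := s.E_pos z z'
    by_cases hg : W.K0 ≤ s.gp z z'
    · have t1 : Real.exp (-S) * φ S * (X.h z)⁻¹ - Real.exp (-S) * φ S * (X.h z')⁻¹ ≤ X.Ch / X.c0^2 * s.E z z' := by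
        rw [← mul_sub]
        have e1 : Real.exp (-S) * φ S ≤ 1 := mul_le_one₀ (Real.exp_le_one_iff.2 (by linarith)) (hφ.nn _) (hφ.le _)
        have e0 : 0 ≤ Real.exp (-S) * φ S := mul_nonneg (Real.exp_pos _).le (hφ.nn _)
        refine (mul_le_mul_of_nonneg_left (le_abs_self _) e0).trans ((mul_le_of_le_one_left (abs_nonneg _) e1).trans (hi z z'))
      have t2 : ∑ u ∈ W.U, X.kP z u * X.v φ (u*z) (S - b s z u) - ∑ u ∈ W.U, X.kP z' u * X.v φ (u*z') (S - b s z' u) =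
          ∑ u ∈ W.U, X.kP z u * (X.v φ (u*z) (S - b s z u) - X.v φ (u*z') (S - b s z' u)) + ∑ u ∈ W.U, (X.kP z u - X.kP z' u) * X.v φ (u*z') (S - b s z' u) := by
        rw [← Finset.sum_sub_distrib, ← Finset.sum_add_distrib]; exact Finset.sum_congr rfl fun u _ => by ring
      have t3 : ∑ u ∈ W.U, X.kP z u * (X.v φ (u*z) (S - b s z u) - X.v φ (u*z') (S - b s z' u)) ≤ M/2 * s.E z z' + K * |C| * s.E z z' := by
        have : ∀ u ∈ W.U, X.kP z u * (X.v φ (u*z) (S - b s z u) - X.v φ (u*z') (S - b s z' u)) ≤ X.kP z u * (M/2 * s.E z z' + K * |C| * s.E z z') := by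
          intro u hu
          by_cases h0 : X.kP z u = 0
          · simp [h0]
          · refine mul_le_mul_of_nonneg_left ?_ (X.kP0 _ _)
            have a1 := ih w (S - b s z u) (by linarith [(X.kP_b h0).1]) (u*z) (u*z')
            have a2 := (le_abs_self _).trans (hK (u*z') (S - b s z u) (S - b s z' u))
            have a3 := W.kc z z' u hg (X.kP_supp h0)
            have a4 := hC u hu z' z
            have a5 : |S - b s z u - (S - b s z' u)| ≤ |C| * s.E z z' := by
              rw [sub_sub_sub_cancel_left]; refine a4.trans ?_
              rw [show s.E z' z = s.E z z' by unfold Setup.E; rw [s.gp_comm]]; exact mul_le_mul_of_nonneg_right (le_abs_self _) hE.le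
            have a6 := mul_le_mul_of_nonneg_left a5 hK0
            have a7 : M * s.E (u*z) (u*z') ≤ M * (1/2 * s.E z z') := mul_le_mul_of_nonneg_left (a3.trans (mul_le_mul_of_nonneg_right W.θ1 hE.le)) hM0
            linarith
        refine (Finset.sum_le_sum this).trans ?_
        rw [← Finset.sum_mul, X.kP_sum, one_mul]
      have t4 : ∑ u ∈ W.U, (X.kP z u - X.kP z' u) * X.v φ (u*z') (S - b s z' u) ≤ W.U.card * Ck * (4 * X.c0⁻¹) * s.E z z' := by
        calc _ ≤ ∑ u ∈ W.U, Ck * s.E z z' * (4 * X.c0⁻¹) := Finset.sum_le_sum fun u hu => by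
              have l := hk.lip u hu z z'
              exact (mul_le_mul_of_nonneg_right ((le_abs_self _).trans l) (X.v_nn hφ _ _)).trans (mul_le_mul_of_nonneg_left (X.v_le hφ _ _) ((abs_nonneg _).trans l))
          _ = _ := by rw [Finset.sum_const, nsmul_eq_mul]; ring
      rw [X.v_eq hφ z S, X.v_eq hφ z' S]
      have := mul_le_mul_of_nonneg_right hM1 hE.le
      linarith
    · have e1 := s.E_ge (not_le.1 hg).le
      have e2 : 1 ≤ Real.exp (s.c * W.K0) * s.E z z' := by
        refine le_trans (le_of_eq ?_) (mul_le_mul_of_nonneg_left e1 (Real.exp_pos _).le)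
        rw [← Real.exp_add, neg_mul, add_neg_cancel, Real.exp_zero]
      have e3 := mul_le_mul_of_nonneg_right hM2 hE.le
      have e4 := mul_le_mul_of_nonneg_left e2 (show 0 ≤ 4 * X.c0⁻¹ by positivity)
      linarith [X.v_le hφ z S, X.v_nn hφ z' S])
  have k1 := key 1 S z z'
  have k2 := key 1 S z' z
  rw [show s.E z' z = s.E z z' by unfold Setup.E; rw [s.gp_comm]] at k2
  exact abs_le.2 ⟨by linarith, k1⟩
end Eig
end PaperCLT
end

section
open Filter Set
namespace PaperCLT
open Walk Eig
namespace Eig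
variable {Γ : Type*} [Group Γ] {s : Setup Γ} {W : Walk s} (X : Eig W)
structure Har (V : Γ → ℝ → ℝ) (K : ℝ) : Prop where
  nn : ∀ z t, 0 ≤ V z t
  le : ∀ z t, V z t ≤ K
  eq : ∀ z t, V z t = ∑ u ∈ W.U, X.kP z u * V (u*z) (t - b s z u)
  lt : ∀ z t t', |V z t - V z t'| ≤ K * |t - t'|
  lz : ∀ t, IsLip s (fun z => V z t) K
variable {X}
lemma Har.K0 {V : Γ → ℝ → ℝ} {K : ℝ} (h : X.Har V K) : 0 ≤ K := (h.nn 1 0).trans (h.le 1 0)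
lemma Har.neg {V : Γ → ℝ → ℝ} {K : ℝ} (h : X.Har V K) : X.Har (fun z t => K - V z t) K where
  nn := fun z t => by linarith [h.le z t]
  le := fun z t => by linarith [h.nn z t]
  eq := fun z t => by
    simp only [mul_sub, Finset.sum_sub_distrib]; rw [← Finset.sum_mul, X.kP_sum, one_mul, ← h.eq]
  lt := fun z t t' => by
    rw [sub_sub_sub_cancel_left, abs_sub_comm]; exact h.lt z t t'
  lz := fun t z z' => by
    show |K - V z t - (K - V z' t)| ≤ _
    rw [sub_sub_sub_cancel_left, abs_sub_comm]; exact h.lz t z z'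
lemma har_lim {φ : ℝ → ℝ} (hφ : Tst φ) {L : ℝ} (hL : ∀ t t', |φ t - φ t'| ≤ L * |t - t'|) : ∃ K, ∀ 𝒰 : Ultrafilter ℝ, (𝒰 : Filter ℝ) ≤ atTop →
    ∃ V, X.Har V K ∧ ∀ z t, Tendsto (fun S => X.v φ z (S + t)) 𝒰 (nhds (V z t)) := by
  obtain ⟨K1, h1⟩ := X.v_lipS hφ hL
  obtain ⟨K2, h2⟩ := X.v_lipz hφ hL
  refine ⟨max (4 * X.c0⁻¹) (max K1 K2), fun 𝒰 hU => ?_⟩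
  have : ∀ z t, ∃ y, Tendsto (fun S => X.v φ z (S + t)) 𝒰 (nhds y) := fun z t => by
    obtain ⟨y, hy, hy'⟩ := ulim_exists 𝒰 (fun S => X.v φ z (S + t)) (a := 0) (b := 4 * X.c0⁻¹) (fun S => ⟨X.v_nn hφ _ _, X.v_le hφ _ _⟩)
    first | exact ⟨y, hy'⟩ | exact ⟨y, hy⟩
  choose V hV using this
  refine ⟨V, ⟨fun z t => ge_of_tendsto' (hV z t) fun S => X.v_nn hφ _ _, fun z t => (le_of_tendsto' (hV z t) fun S => X.v_le hφ _ _).trans (le_max_left _ _),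
    fun z t => ?_, fun z t t' => ?_, fun t => ?_⟩, hV⟩
  · have e1 : Tendsto (fun S : ℝ => Real.exp (-(S+t)) * φ (S+t) * (X.h z)⁻¹ + ∑ u ∈ W.U, X.kP z u * X.v φ (u*z) (S + t - b s z u)) 𝒰
        (nhds (0 * (X.h z)⁻¹ + ∑ u ∈ W.U, X.kP z u * V (u*z) (t - b s z u))) := by
      refine (Tendsto.mul_const _ ?_).add (tendsto_finset_sum _ fun u _ => ((hV (u*z) (t - b s z u)).congr fun S => by rw [add_sub_assoc]).const_mul _)
      refine Tendsto.mono_left ?_ hU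
      refine squeeze_zero (fun S => mul_nonneg (Real.exp_pos _).le (hφ.nn _)) (fun S => mul_le_of_le_one_right (Real.exp_pos _).le (hφ.le _)) ?_
      exact Real.tendsto_exp_atBot.comp (tendsto_neg_atTop_atBot.comp (tendsto_atTop_add_const_right _ _ tendsto_id))
    rw [zero_mul, zero_add] at e1
    exact tendsto_nhds_unique ((hV z t).congr fun S => X.v_eq hφ z (S+t)) e1
  · refine (le_of_tendsto' ((hV z t).sub (hV z t')).abs fun S => ?_ : |V z t - V z t'| ≤ K1 * |t - t'|).trans (mul_le_mul_of_nonneg_right ((le_max_left _ _).trans (le_max_right _ _)) (abs_nonneg _))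
    have := h1 z (S+t) (S+t'); rwa [add_sub_add_left_eq_sub] at this
  · exact IsLip.mono (lip_lim (F := fun S z => X.v φ z (S+t)) (l := (𝒰 : Filter ℝ)) (fun S => h2 (S+t)) (fun z => hV z t)) ((le_max_right _ _).trans (le_max_right _ _))

def Nice (W : Walk s) (M0 : ℝ) (g : Γ) : Prop := s.gp g g⁻¹ ≤ W.p + 3 * s.δ ∧ M0 ≤ s.nm g
/-- admissible points for the powers of g -/
lemma nice_step {M0 : ℝ} (hM : 2 * W.p + 8 * s.δ + 1 ≤ M0) {g : Γ} (hg : Nice W M0 g) {z : Γ} (hz : s.gp z g⁻¹ ≤ W.p + 4 * s.δ) :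
    s.gp (g*z) g⁻¹ ≤ W.p + 4 * s.δ ∧ 1 ≤ b s z g := by
  obtain ⟨h1, h2⟩ := hg
  have e := s.gp_mul_self g z
  have e2 := s.nm_mul g z
  rw [s.gp_comm g⁻¹ z] at e e2
  refine ⟨?_, by unfold b; linarith [s.hδ]⟩
  have h := s.gp_hyp g⁻¹ g (g*z)
  rw [s.gp_comm g⁻¹ g, s.gp_comm g⁻¹ (g*z)] at h
  rcases min_choice (s.gp (g*z) g⁻¹) (s.gp g (g*z)) with q | q <;> rw [q] at h
  · linarith
  · linarith [s.hδ]
lemma nice_pow {M0 : ℝ} (hM : 2 * W.p + 8 * s.δ + 1 ≤ M0) {g : Γ} (hg : Nice W M0 g) {z : Γ} (hz : s.gp z g⁻¹ ≤ W.p + 4 * s.δ) (j : ℕ) :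
    s.gp (g^j*z) g⁻¹ ≤ W.p + 4 * s.δ ∧ j ≤ s.gp (g^j*z) (g^(j+1)*z) := by
  have A : ∀ j, s.gp (g^j*z) g⁻¹ ≤ W.p + 4 * s.δ := by
    intro j
    induction j with
    | zero => simpa using hz
    | succ j ih => rw [pow_succ', mul_assoc]; exact (nice_step hM hg ih).1
  refine ⟨A j, ?_⟩
  induction j with
  | zero => simpa using s.gp_nonneg _ _
  | succ j ih =>
    have h1 := (nice_step hM hg (A j)).2
    have h2 := (nice_step hM hg (A (j+1))).2
    unfold b at h1 h2
    rw [pow_succ' g (j+1), mul_assoc, pow_succ' g j, mul_assoc, s.gp_smul]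
    rw [pow_succ' g j, mul_assoc] at h2 ih
    push_cast; linarith
lemma nice_len {M0 : ℝ} (hM : 2 * W.p + 8 * s.δ + 1 ≤ M0) {g : Γ} (hg : Nice W M0 g) : ∃ C, 0 ≤ C ∧ ∀ z, s.gp z g⁻¹ ≤ W.p + 4 * s.δ → ∀ j : ℕ,
    |b s (g^j*z) g - translationLength s.d g| ≤ C * Real.exp (-s.c * j) := by
  obtain ⟨C, hC, hv⟩ := s.vd (s.nm g)
  have hr : Real.exp (-s.c) < 1 := by rw [Real.exp_lt_one_iff]; linarith [s.hc]
  have hpw : ∀ j : ℕ, Real.exp (-s.c * j) = Real.exp (-s.c) ^ j := fun j => by rw [← Real.exp_nat_mul]; ring_nf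
  refine ⟨C / (1 - Real.exp (-s.c)), div_nonneg hC.le (by linarith), fun z hz j => ?_⟩
  have hstep : ∀ j : ℕ, dist (b s (g^j*z) g) (b s (g^(j+1)*z) g) ≤ C * Real.exp (-s.c) ^ j := by
    intro j
    have := hv g⁻¹ (g^j*z) (g^(j+1)*z) (by have := s.nm_inv g; exact this.le)
    have e : ∀ y, b s y g = s.d g⁻¹ y - s.d 1 y := by intro y; unfold b; rw [s.d_eq g⁻¹, inv_inv]; rfl
    rw [Real.dist_eq, e, e]; refine this.trans (mul_le_mul_of_nonneg_left ?_ hC.le)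
    rw [← hpw]; refine Real.exp_le_exp.2 ?_
    have := (nice_pow hM hg hz j).2; unfold Setup.gp at this; nlinarith [s.hc]
  have hcs := cauchySeq_of_le_geometric _ _ hr hstep
  obtain ⟨a, ha⟩ := cauchySeq_tendsto_of_complete hcs
  have hd := dist_le_of_le_geometric_of_tendsto _ _ hr hstep ha j
  have hces : Tendsto (fun n : ℕ => s.d 1 (g^n) / n) atTop (nhds a) := by
    have h1 := ha.cesaro
    have h2 : ∀ n : ℕ, ∑ i ∈ Finset.range n, b s (g^i*z) g = s.nm (g^n*z) - s.nm z := by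
      intro n
      have := Finset.sum_range_sub (fun i => s.nm (g^i*z)) n
      rw [pow_zero, one_mul] at this; rw [← this]
      exact Finset.sum_congr rfl fun i _ => by unfold b; rw [pow_succ', mul_assoc]
    have h3 : Tendsto (fun n : ℕ => s.d 1 (g^n) / n - (n:ℝ)⁻¹ • ∑ i ∈ Finset.range n, b s (g^i*z) g) atTop (nhds 0) := by
      refine squeeze_zero_norm (a := fun n : ℕ => (2 * s.nm z) / n) (fun n => ?_) (tendsto_const_div_atTop_nhds_zero_nat _)
      rw [h2, smul_eq_mul, div_eq_mul_inv, mul_comm (n:ℝ)⁻¹, ← sub_mul, ← div_eq_mul_inv, norm_div, Real.norm_eq_abs, Real.norm_natCast]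
      refine div_le_div_of_nonneg_right ?_ (Nat.cast_nonneg _)
      have a1 := s.nm_mul_le (g^n) z
      have a2 := s.nm_mul_le (g^n*z) z⁻¹
      rw [mul_inv_cancel_right, s.nm_inv] at a2
      have : s.d 1 (g^n) = s.nm (g^n) := rfl
      rw [this, abs_le]; constructor <;> linarith [s.nm_nonneg z]
    have := h3.add h1
    rw [zero_add] at this; exact this.congr fun n => sub_add_cancel _ _
  have ea : translationLength s.d g = a := hces.limUnder_eq
  rw [ea, hpw]; rw [Real.dist_eq] at hd
  refine hd.trans (le_of_eq ?_); ring
lemma per_le : ∃ M0 : ℝ, 2 * W.p + 8 * s.δ + 1 ≤ M0 ∧ ∀ V K, X.Har V K → ∀ g, Nice W M0 g → ∀ z t, V z (t + translationLength s.d g) ≤ V z t := by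
  obtain ⟨Cr, hCr, hreach⟩ := W.reach
  obtain ⟨M0, hM0⟩ : ∃ M0, M0 = 2 * W.p + 8 * s.δ + 1 + 5 * W.R + Cr := ⟨_, rfl⟩
  have hM : 2 * W.p + 8 * s.δ + 1 ≤ M0 := by linarith [W.R1]
  refine ⟨M0, hM, fun V K hV g hg z t => ?_⟩
  obtain ⟨C, hC, hlen⟩ := nice_len hM hg
  obtain ⟨N1, hN1⟩ := hreach (s.nm g)
  obtain ⟨N2, hN2⟩ := W.path (s.nm g)
  obtain ⟨lg, lg1, lg2, lg3⟩ := hN2 g⁻¹ (by rw [s.nm_inv]; linarith [hg.2, W.R1, W.p0, s.hδ]) (s.nm_inv g).le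
  rw [inv_inv] at lg2
  obtain ⟨a, ha⟩ : ∃ a, a = translationLength s.d g := ⟨_, rfl⟩
  rw [← ha] at hlen ⊢
  by_contra hcon
  push Not at hcon
  obtain ⟨w, hw⟩ : ∃ w : Γ × ℝ → ℝ, w = fun q => V q.1 (q.2 + a) - V q.1 q.2 := ⟨_, rfl⟩
  have hbd : BddAbove (range w) := ⟨K, by rintro _ ⟨q, rfl⟩; rw [hw]; dsimp only; linarith [hV.le q.1 (q.2+a), hV.nn q.1 q.2]⟩
  obtain ⟨M, hMd⟩ : ∃ M, M = iSup w := ⟨_, rfl⟩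
  have hle : ∀ z t, V z (t+a) - V z t ≤ M := fun z t => by
    rw [hMd]; have := le_ciSup hbd (z, t); rw [hw] at this ⊢; exact this
  have hMp : 0 < M := by linarith [hle z t]
  -- number of steps
  have hr : Real.exp (-s.c) < 1 := by rw [Real.exp_lt_one_iff]; linarith [s.hc]
  have hr0 := Real.exp_pos (-s.c)
  obtain ⟨C3, hC3⟩ : ∃ C3, C3 = K * C + K := ⟨_, rfl⟩
  have hC3n : 0 ≤ C3 := by rw [hC3]; have := hV.K0; positivity
  obtain ⟨N, hN⟩ := exists_nat_gt ((K + C3 * (1 - Real.exp (-s.c))⁻¹) / (M/2))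
  rw [div_lt_iff₀ (by linarith)] at hN
  obtain ⟨η, hη⟩ : ∃ η, η = M/2 * X.α ^ (N1 + N * N2) := ⟨_, rfl⟩
  have hηp : 0 < η := by rw [hη]; have := X.α0; positivity
  obtain ⟨⟨z1, t1⟩, h1⟩ := exists_lt_of_lt_ciSup (show M - η < iSup w by linarith)
  rw [hw] at h1; dsimp only at h1
  obtain ⟨τ, hτ⟩ : ∃ τ, τ = t1 + s.nm z1 := ⟨_, rfl⟩
  obtain ⟨F, hF⟩ : ∃ F : Γ → ℝ, F = fun z => M - (V z (τ - s.nm z + a) - V z (τ - s.nm z)) := ⟨_, rfl⟩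
  have hF0 : ∀ z, 0 ≤ F z := fun z => by rw [hF]; dsimp only; linarith [hle z (τ - s.nm z)]
  have hFP : X.P F = F := by
    funext y
    rw [hF]; unfold Eig.P Walk.Op
    simp only [mul_sub, Finset.sum_sub_distrib]
    rw [← Finset.sum_mul, X.kP_sum, one_mul, hV.eq y, hV.eq y (τ - s.nm y)]
    have e : ∀ u, τ - s.nm y - b s y u = τ - s.nm (u*y) := fun u => by unfold b; ring
    have e' : ∀ u, τ - s.nm y + a - b s y u = τ - s.nm (u*y) + a := fun u => by unfold b; ring
    simp only [e, e']
  have hFn : ∀ n, X.P^[n] F = F := fun n => Function.iterate_fixed hFP n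
  obtain ⟨l1, l1a, l1b, _, l1c, _⟩ := hN1 g z1 z1 (by linarith [hg.2, W.p0, s.hδ]) le_rfl
  obtain ⟨z0, hz0⟩ : ∃ z0, z0 = wprod l1 * z1 := ⟨_, rfl⟩
  rw [← hz0] at l1c
  have hz0g : s.gp z0 g⁻¹ ≤ W.p + 4 * s.δ := by
    have h := s.gp_hyp g⁻¹ g z0
    rw [s.gp_comm g⁻¹ g, s.gp_comm g⁻¹ z0, s.gp_comm g z0] at h
    rcases min_choice (s.gp z0 g⁻¹) (s.gp z0 g) with q | q <;> rw [q] at h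
    · linarith [hg.1]
    · linarith [hg.1, hg.2, W.p0, s.hδ, W.R1]
  have hlow : ∀ (l : List Γ) y, PathOK W.U W.k W.κ y l → X.α ^ l.length * F (wprod l * y) ≤ F y := by
    intro l y h
    have := path_lower (W := W) X.kP0 X.α0.le (fun z u _ hk => X.kP_low hk) hF0 l y h
    rwa [show (W.Op X.kP)^[l.length] F = F from hFn _] at this
  have hαN : ∀ {m n : ℕ}, m ≤ n → X.α ^ n ≤ X.α ^ m := fun h => pow_le_pow_of_le_one X.α0.le X.α1 h
  have hFj : ∀ j : ℕ, X.α ^ (N1 + j * N2) * F (g^j*z0) ≤ F z1 := by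
    intro j
    induction j with
    | zero =>
      rw [pow_zero, one_mul, hz0, zero_mul, add_zero]
      exact (mul_le_mul_of_nonneg_right (hαN l1a) (hF0 _)).trans (hlow l1 z1 l1b)
    | succ j ih =>
      have h := hlow lg (g^j*z0) (lg3 _ ((nice_pow hM hg hz0g j).1.trans (by linarith [s.hδ])))
      rw [lg2, ← mul_assoc, ← pow_succ'] at h
      refine le_trans ?_ ih
      rw [show N1 + (j+1)*N2 = (N1 + j*N2) + N2 by ring, pow_add, mul_assoc]
      exact mul_le_mul_of_nonneg_left ((mul_le_mul_of_nonneg_right (hαN lg1) (hF0 _)).trans h) (pow_pos X.α0 _).le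
  have hFz1 : F z1 < η := by rw [hF]; dsimp only; rw [hτ, add_sub_cancel_right]; linarith
  have hFM : ∀ j ≤ N, F (g^j*z0) ≤ M/2 := by
    intro j hj
    have h3 : X.α ^ (N1 + N * N2) * F (g^j*z0) ≤ X.α ^ (N1 + j*N2) * F (g^j*z0) := mul_le_mul_of_nonneg_right (hαN (by gcongr)) (hF0 _)
    have h4 := hFj j
    have h5 : X.α ^ (N1 + N * N2) * F (g^j*z0) < X.α ^ (N1 + N * N2) * (M/2) := by rw [mul_comm _ (M/2), ← hη]; linarith
    exact (lt_of_mul_lt_mul_left h5 (pow_pos X.α0 _).le).le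
  -- telescoping
  have tel : ∀ j < N, M/2 - C3 * Real.exp (-s.c) ^ j ≤ V (g^j*z0) (τ - s.nm (g^j*z0)) - V (g^(j+1)*z0) (τ - s.nm (g^(j+1)*z0)) := by
    intro j hj
    have f1 := hFM (j+1) hj
    rw [hF] at f1; dsimp only at f1
    have e1 := hlen z0 hz0g j
    have e2 : b s (g^j*z0) g = s.nm (g^(j+1)*z0) - s.nm (g^j*z0) := by unfold b; rw [pow_succ', mul_assoc]
    have hpw : Real.exp (-s.c * j) = Real.exp (-s.c) ^ j := by rw [← Real.exp_nat_mul]; ring_nf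
    rw [e2, hpw] at e1
    have e3 := hV.lt (g^(j+1)*z0) (τ - s.nm (g^(j+1)*z0) + a) (τ - s.nm (g^j*z0))
    rw [show τ - s.nm (g^(j+1)*z0) + a - (τ - s.nm (g^j*z0)) = -(s.nm (g^(j+1)*z0) - s.nm (g^j*z0) - a) by ring, abs_neg] at e3
    have e4 := hV.lz (τ - s.nm (g^j*z0)) (g^j*z0) (g^(j+1)*z0)
    dsimp only at e4
    have e5 : s.E (g^j*z0) (g^(j+1)*z0) ≤ Real.exp (-s.c) ^ j := by
      rw [← hpw]; exact Real.exp_le_exp.2 (by nlinarith [(nice_pow hM hg hz0g j).2, s.hc])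
    have e6 := mul_le_mul_of_nonneg_left e1 hV.K0
    have e7 := mul_le_mul_of_nonneg_left e5 hV.K0
    have e8 := (abs_le.1 (e3.trans e6)).2
    have e9 := (abs_le.1 (e4.trans e7)).1
    rw [hC3]; linarith
  have hsum := Finset.sum_le_sum fun j hj => tel j (Finset.mem_range.1 hj)
  have hts := Finset.sum_range_sub' (fun j => V (g^j*z0) (τ - s.nm (g^j*z0))) N
  rw [hts, Finset.sum_sub_distrib, ← Finset.mul_sum, Finset.sum_const, Finset.card_range, nsmul_eq_mul] at hsum
  have hgs : ∑ i ∈ Finset.range N, Real.exp (-s.c) ^ i ≤ (1 - Real.exp (-s.c))⁻¹ := by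
    rw [← tsum_geometric_of_lt_one hr0.le hr]
    exact (summable_geometric_of_lt_one hr0.le hr).sum_le_tsum _ (fun _ _ => by positivity)
  have := mul_le_mul_of_nonneg_left hgs hC3n
  linarith [hV.le (g^0*z0) (τ - s.nm (g^0*z0)), hV.nn (g^N*z0) (τ - s.nm (g^N*z0))]
lemma per : ∃ M0 : ℝ, 2 * W.p + 8 * s.δ + 1 ≤ M0 ∧ ∀ V K, X.Har V K → ∀ g, Nice W M0 g → ∀ z t, V z (t + translationLength s.d g) = V z t := by
  obtain ⟨M0, h0, h⟩ := per_le (X := X)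
  exact ⟨M0, h0, fun V K hV g hg z t => le_antisymm (h V K hV g hg z t) (by linarith [h _ K hV.neg g hg z t])⟩
end Eig
end PaperCLT
end

section
open Filter Set
namespace PaperCLT
open Walk Eig
namespace Eig
variable {Γ : Type*} [Group Γ] {s : Setup Γ} {W : Walk s} {X : Eig W}
/-- non-arithmeticity of the walk -/
def NA (W : Walk s) : Prop := ∀ M0 : ℝ, ¬ ∃ a0 > (0:ℝ), ∀ g, Nice W M0 g → ∃ k : ℤ, translationLength s.d g = a0 * k
lemma har_const (Y : Mix X) (H : NA W) {V : Γ → ℝ → ℝ} {K : ℝ} (hV : X.Har V K) (z : Γ) (t : ℝ) : V z t = V 1 0 := by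
  obtain ⟨M0, hM0, hper⟩ := per (X := X)
  obtain ⟨S, hS⟩ : ∃ S : AddSubgroup ℝ, S = AddSubgroup.closure {a | ∃ g, Nice W M0 g ∧ translationLength s.d g = a} := ⟨_, rfl⟩
  have hd : Dense (S : Set ℝ) := by
    rcases S.dense_or_cyclic with h | ⟨a, h⟩
    · exact h
    exfalso
    refine H M0 ⟨if a = 0 then 1 else |a|, ?_, fun g hg => ?_⟩
    · split_ifs with h0
      · exact one_pos
      · exact abs_pos.2 h0
    · have h1 : translationLength s.d g ∈ S := by rw [hS]; exact AddSubgroup.subset_closure ⟨g, hg, rfl⟩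
      rw [h, AddSubgroup.mem_closure_singleton] at h1
      obtain ⟨n, hn⟩ := h1
      rw [← hn, zsmul_eq_mul]
      split_ifs with h0
      · exact ⟨0, by simp [h0]⟩
      · rcases abs_choice a with e | e <;> rw [e]
        · exact ⟨n, by ring⟩
        · exact ⟨-n, by push_cast; ring⟩
  have hSp : ∀ p ∈ S, ∀ z t, V z (t + p) = V z t := by
    intro p hp
    rw [hS] at hp
    induction hp using AddSubgroup.closure_induction with
    | mem p h => obtain ⟨g, hg, rfl⟩ := h; exact hper V K hV g hg
    | zero => intro z t; rw [add_zero]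
    | add p q _ _ hp hq => intro z t; rw [← add_assoc, hq, hp]
    | neg p _ hp => intro z t; rw [← hp z (t + -p), neg_add_cancel_right]
  have hcont : ∀ z, Continuous (V z) := fun z => by
    have : LipschitzWith ⟨K, hV.K0⟩ (V z) := LipschitzWith.of_dist_le_mul fun a b => by rw [Real.dist_eq, Real.dist_eq]; exact hV.lt z a b
    exact this.continuous
  have ht : ∀ z t, V z t = V z 0 := by
    intro z
    have := Continuous.ext_on hd (hcont z) (continuous_const (y := V z 0)) (fun p hp => by simpa using hSp p hp z 0)
    intro t; exact congrFun this t
  have hP : X.P (fun z => V z 0) = fun z => V z 0 := by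
    funext z
    have := hV.eq z 0
    simp only [ht _ (0 - _)] at this
    exact this.symm
  have hcl := Y.Cl_of (hV.lz 0) (fun z => abs_le.2 ⟨by linarith [hV.nn z 0, hV.K0], hV.le z 0⟩)
  have h1 : ∀ n, V z 0 - V 1 0 ≤ Y.ε n * (2 * K + K) ∧ V 1 0 - V z 0 ≤ Y.ε n * (2*K+K) := fun n => by
    have := (Y.cl _ _ hcl n).1
    rw [show X.P^[n] (fun z => V z 0) = fun z => V z 0 from Function.iterate_fixed hP n] at this
    exact ⟨this z 1, this 1 z⟩
  have a1 := ge_of_tendsto' (Y.εlim (2*K+K)) fun n => (h1 n).1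
  have a2 := ge_of_tendsto' (Y.εlim (2*K+K)) fun n => (h1 n).2
  rw [ht]; linarith
variable {φ : ℝ → ℝ} {L : ℝ}
lemma v_conv (Y : Mix X) (H : NA W) (hφ : Tst φ) (hL : ∀ t t', |φ t - φ t'| ≤ L * |t - t'|) (z : Γ) (t : ℝ) :
    Tendsto (fun S => X.v φ z (S + t) - X.v φ 1 S) atTop (nhds 0) := by
  obtain ⟨K, hK⟩ := har_lim (X := X) hφ hL
  rw [tendsto_iff_ultrafilter]
  intro 𝒰 hU
  obtain ⟨V, hV, hl⟩ := hK 𝒰 hU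
  have h1 := (hl z t).sub (hl 1 0)
  rw [har_const Y H hV z t, sub_self] at h1
  simpa using h1
lemma net (s : Setup Γ) {η : ℝ} (hη : 0 < η) : ∃ F : Finset Γ, ∀ z, ∃ x ∈ F, z = x ∨ s.E z x ≤ η := by
  have h1 := (exp_tendsto_zero s.hc).eventually (gt_mem_nhds hη)
  obtain ⟨K, hK⟩ := (h1.and (eventually_ge_atTop 0)).exists
  refine ⟨(s.fin (K + 3 * s.C0 + 1)).toFinset, fun z => ?_⟩
  by_cases hz : s.nm z < K + 2 * s.C0
  · refine ⟨z, ?_, Or.inl rfl⟩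
    rw [Set.Finite.mem_toFinset]; show s.nm z < _; linarith [s.hC0]
  · obtain ⟨x, hx, hx'⟩ := s.head z (K + 2 * s.C0) (by linarith [s.hC0, hK.2]) (not_lt.1 hz)
    rw [abs_le] at hx
    refine ⟨x, ?_, Or.inr (le_trans ?_ hK.1.le)⟩
    · rw [Set.Finite.mem_toFinset]; show s.nm x < _; linarith
    · rw [Setup.E, s.gp_comm]; exact Real.exp_le_exp.2 (by nlinarith [s.hc])
lemma v_unif (Y : Mix X) (H : NA W) (hφ : Tst φ) (hL : ∀ t t', |φ t - φ t'| ≤ L * |t - t'|) {η : ℝ} (hη : 0 < η) :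
    ∀ᶠ S in atTop, ∀ z, |X.v φ z S - X.v φ 1 S| ≤ η := by
  obtain ⟨M, hM⟩ := X.v_lipz hφ hL
  have hM0 := (hM 0).nonneg
  obtain ⟨F, hF⟩ := net s (show 0 < η / (2 * (M+1)) by positivity)
  have h1 : ∀ x ∈ F, ∀ᶠ S in atTop, |X.v φ x S - X.v φ 1 S| < η/2 := fun x _ => by
    have := (v_conv Y H hφ hL x 0).abs
    rw [abs_zero] at this
    filter_upwards [this.eventually (gt_mem_nhds (half_pos hη))] with S h
    simpa using h
  rw [← Filter.eventually_all_finset] at h1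
  filter_upwards [h1] with S h z
  obtain ⟨x, hx, hx'⟩ := hF z
  have h2 := h x hx
  rcases hx' with rfl | h3
  · linarith
  · have h4 := hM S z x
    have h5 : M * s.E z x ≤ η/2 := by
      have := mul_le_mul_of_nonneg_left h3 (show 0 ≤ M + 1 by linarith)
      rw [show (M+1) * (η / (2*(M+1))) = η/2 by field_simp] at this
      nlinarith [s.E_pos z x]
    dsimp only at h4
    rw [abs_le] at *; rw [abs_lt] at h2; constructor <;> linarith
lemma v_unift (Y : Mix X) (H : NA W) (hφ : Tst φ) (hL : ∀ t t', |φ t - φ t'| ≤ L * |t - t'|) {η : ℝ} (hη : 0 < η) (B : ℝ) :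
    ∀ᶠ S in atTop, ∀ t ∈ Icc (-B) B, |X.v φ 1 (S+t) - X.v φ 1 S| ≤ η := by
  obtain ⟨K, hK⟩ := X.v_lipS hφ hL
  have hK0 : 0 ≤ K := by have := (abs_nonneg _).trans (hK 1 0 1); simpa using this
  refine isCompact_Icc.induction_on (p := fun A => ∀ᶠ S in atTop, ∀ t ∈ A, |X.v φ 1 (S+t) - X.v φ 1 S| ≤ η) (by simp)
    (fun A A' h h' => h'.mono fun S hS t ht => hS t (h ht)) (fun A A' h h' => by
      filter_upwards [h, h'] with S h1 h2 t ht
      exact ht.elim (h1 t) (h2 t)) (fun t _ => ?_)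
  refine ⟨Metric.ball t (η / (2 * (K+1))), mem_nhdsWithin_of_mem_nhds (Metric.ball_mem_nhds t (by positivity)), ?_⟩
  have := (v_conv Y H hφ hL 1 t).abs
  rw [abs_zero] at this
  filter_upwards [this.eventually (gt_mem_nhds (half_pos hη))] with S h t' ht'
  have h4 := hK 1 (S+t') (S+t)
  rw [Metric.mem_ball, Real.dist_eq] at ht'
  rw [add_sub_add_left_eq_sub] at h4
  have h5 : K * |t' - t| ≤ η/2 := by
    have := mul_le_mul_of_nonneg_left ht'.le (show 0 ≤ K + 1 by linarith)
    rw [show (K+1) * (η / (2*(K+1))) = η/2 by field_simp] at this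
    nlinarith [abs_nonneg (t' - t)]
  rw [abs_le] at *; rw [abs_lt] at h; constructor <;> linarith
lemma v_unif2 (Y : Mix X) (H : NA W) (hφ : Tst φ) (hL : ∀ t t', |φ t - φ t'| ≤ L * |t - t'|) {η : ℝ} (hη : 0 < η) (B : ℝ) :
    ∀ᶠ S in atTop, ∀ z, ∀ t ∈ Icc (-B) B, |X.v φ z (S+t) - X.v φ 1 S| ≤ η := by
  obtain ⟨S0, h0⟩ := eventually_atTop.1 (v_unif Y H hφ hL (half_pos hη))
  filter_upwards [v_unift Y H hφ hL (half_pos hη) B, eventually_ge_atTop (S0 + B)] with S h1 h2 z t ht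
  have a1 := h0 (S+t) (by linarith [ht.1]) z
  have a2 := h1 t ht
  rw [abs_le] at *; constructor <;> linarith
end Eig
end PaperCLT
end

section
open Filter Set MeasureTheory
namespace PaperCLT
open Walk Eig
namespace Eig
variable {Γ : Type*} [Group Γ] {s : Setup Γ} {W : Walk s} {X : Eig W}
variable {φ : ℝ → ℝ} {L : ℝ}
noncomputable def bb (X : Eig W) (z : Γ) : ℝ := ∑ u ∈ W.U, X.kP z u * b s z u
lemma bb_ge (z : Γ) : 1 ≤ X.bb z := by
  have := X.kP_sum_le (z := z) (f := fun u => - b s z u) (c := -1) fun u hu => by linarith [(X.kP_b hu).1]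
  simp only [mul_neg, Finset.sum_neg_distrib] at this; unfold bb; linarith
lemma bb_le (z : Γ) : X.bb z ≤ W.Bm := X.kP_sum_le fun u hu => (X.kP_b hu).2
/-- mean of a Lipschitz family of step functions -/
lemma step_lip (f : Γ → Γ → ℝ) {C B : ℝ} (hC : ∀ u ∈ W.U, IsLip s (fun z => f z u) C) (hB : ∀ z, ∀ u ∈ W.U, |f z u| ≤ B) :
    ∃ M, IsLip s (fun z => ∑ u ∈ W.U, X.kP z u * f z u) M := by
  obtain ⟨Ck, hk⟩ := X.kP_ker
  exact ⟨_, IsLip.sum W.U (f := fun u z => X.kP z u * f z u) fun u hu => IsLip.mul (hk.lip u hu) (hC u hu) (B := 1) (fun z => by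
    rw [abs_of_nonneg (X.kP0 _ _), ← X.kP_sum z]
    exact Finset.single_le_sum (f := fun u => X.kP z u) (fun v _ => X.kP0 _ _) hu) (fun z => hB z u hu)⟩
lemma bb_lip : ∃ M, IsLip s X.bb M := by
  obtain ⟨C, hC⟩ := W.b_lip
  exact step_lip (fun z u => b s z u) hC (fun z u hu => (b_abs z u).trans (W.kU u hu))
lemma bb_abs (z : Γ) : |X.bb z| ≤ W.Bm := abs_le.2 ⟨by linarith [X.bb_ge z, X.bb_le z], X.bb_le z⟩
lemma bb_cl (Y : Mix X) : ∃ D, Cl s Y.l X.bb D := by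
  obtain ⟨M, hM⟩ := X.bb_lip; exact ⟨_, Y.Cl_of hM bb_abs⟩
lemma hi_cl (Y : Mix X) : ∃ D, Cl s Y.l (fun z => (X.h z)⁻¹) D :=
  ⟨_, Y.Cl_of (X.lip.inv X.hc0 X.lo) (fun z => by rw [abs_of_pos (inv_pos.2 (X.hp z))]; exact inv_anti₀ X.hc0 (X.lo z))⟩
lemma v_cont (hφ : Tst φ) (hL : ∀ t t', |φ t - φ t'| ≤ L * |t - t'|) (z : Γ) : Continuous (X.v φ z) := by
  obtain ⟨K, hK⟩ := X.v_lipS hφ hL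
  have hK0 : 0 ≤ K := by have := (abs_nonneg _).trans (hK 1 0 1); simpa using this
  have : LipschitzWith ⟨K, hK0⟩ (X.v φ z) := LipschitzWith.of_dist_le_mul fun a b => by rw [Real.dist_eq, Real.dist_eq]; exact hK z a b
  exact this.continuous
lemma key_int (Y : Mix X) (hφ : Tst φ) (hL : ∀ t t', |φ t - φ t'| ≤ L * |t - t'|) (S : ℝ) (hS : 0 ≤ S) :
    ∃ Bf : Γ → ℝ, (∃ D, Cl s Y.l Bf D) ∧ X.ν Bf = (∫ r in (0:ℝ)..S, Real.exp (-r) * φ r) * X.ν (fun z => (X.h z)⁻¹) ∧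
    ∀ z, Bf z = ∑ u ∈ W.U, X.kP z u * ∫ r in (S - b s z u)..S, X.v φ (u*z) r := by
  obtain ⟨M, hM⟩ := X.v_lipz hφ hL
  have hc : ∀ z, Continuous (X.v φ z) := v_cont hφ hL
  have hφc : Continuous φ := by
    have hL0 : 0 ≤ L := by have := (abs_nonneg _).trans (hL 0 1); simpa using this
    have : LipschitzWith ⟨L, hL0⟩ φ := LipschitzWith.of_dist_le_mul fun a b => by rw [Real.dist_eq, Real.dist_eq]; exact hL a b
    exact this.continuous
  have hi : ∀ z a b, IntervalIntegrable (X.v φ z) volume a b := fun z a b => (hc z).intervalIntegrable a b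
  obtain ⟨A, hA⟩ : ∃ A : Γ → ℝ, A = fun z => ∫ r in (0:ℝ)..S, X.v φ z r := ⟨_, rfl⟩
  obtain ⟨I, hI⟩ : ∃ I, I = ∫ r in (0:ℝ)..S, Real.exp (-r) * φ r := ⟨_, rfl⟩
  have hAlip : IsLip s A (M * S) := fun z z' => by
    rw [hA]; dsimp only
    rw [← intervalIntegral.integral_sub (hi _ _ _) (hi _ _ _)]
    have := intervalIntegral.norm_integral_le_of_norm_le_const (a := 0) (b := S) (f := fun r => X.v φ z r - X.v φ z' r) (C := M * s.E z z') (fun r _ => by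
      rw [Real.norm_eq_abs]; exact hM r z z')
    rw [sub_zero, abs_of_nonneg hS, Real.norm_eq_abs] at this
    exact this.trans (le_of_eq (by ring))
  have hAbd : ∀ z, |A z| ≤ 4 * X.c0⁻¹ * S := fun z => by
    have := intervalIntegral.norm_integral_le_of_norm_le_const (a := 0) (b := S) (f := fun r => X.v φ z r) (C := 4 * X.c0⁻¹) (fun r _ => by
      rw [Real.norm_eq_abs, abs_of_nonneg (X.v_nn hφ _ _)]; exact X.v_le hφ _ _)
    rw [sub_zero, abs_of_nonneg hS, Real.norm_eq_abs] at this
    rw [hA]; exact this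
  have clA := Y.Cl_of hAlip hAbd
  have clPA : Cl s Y.l (X.P A) _ := Y.cl _ _ clA 1
  obtain ⟨Dh, clh⟩ := hi_cl Y
  -- scaled
  have clIh : ∃ D, Cl s Y.l (fun z => I * (X.h z)⁻¹) D := 
    ⟨_, Y.Cl_of ((X.lip.inv X.hc0 X.lo).smul I) (B := |I| * X.c0⁻¹) (fun z => by rw [abs_mul, abs_of_pos (inv_pos.2 (X.hp z))]; exact mul_le_mul_of_nonneg_left (inv_anti₀ X.hc0 (X.lo z)) (abs_nonneg _))⟩
  obtain ⟨DI, clIh⟩ := clIh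
  have Cl_add : ∀ {f g : Γ → ℝ} {D D' : ℝ}, Cl s Y.l f D → Cl s Y.l g D' → Cl s Y.l (fun z => f z + g z) (D + D') := fun h h' =>
    ⟨fun z z' => by linarith [h.1 z z', h'.1 z z'], (h.2.add h'.2).mono (le_of_eq (by ring))⟩
  have Cl_sub : ∀ {f g : Γ → ℝ} {D D' : ℝ}, Cl s Y.l f D → Cl s Y.l g D' → Cl s Y.l (fun z => f z - g z) (D + D') := fun h h' =>
    ⟨fun z z' => by linarith [h.1 z z', h'.1 z' z], (h.2.sub h'.2).mono (le_of_eq (by ring))⟩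
  refine ⟨fun z => (I * (X.h z)⁻¹ - A z) + X.P A z, ⟨_, Cl_add (Cl_sub clIh clA) clPA⟩, ?_, fun z => ?_⟩
  · rw [Y.ν_add (Cl_sub clIh clA) clPA, Y.ν_sub clIh clA, Y.ν_smul I clh, ← hI]
    have : X.ν (X.P A) = X.ν A := Y.ν_P clA
    rw [this]; ring
  · have hsplit : A z = I * (X.h z)⁻¹ + ∑ u ∈ W.U, X.kP z u * ∫ r in (0:ℝ)..S, X.v φ (u*z) (r - b s z u) := by
      have e : A z = ∫ r in (0:ℝ)..S, (Real.exp (-r) * φ r * (X.h z)⁻¹ + ∑ u ∈ W.U, X.kP z u * X.v φ (u*z) (r - b s z u)) := by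
        rw [hA]; exact intervalIntegral.integral_congr fun r _ => X.v_eq hφ z r
      rw [e, intervalIntegral.integral_add, intervalIntegral.integral_mul_const, ← hI, intervalIntegral.integral_finset_sum]
      · simp only [intervalIntegral.integral_const_mul]
      · intro u _; exact (continuous_const.mul ((hc _).comp (continuous_id.sub continuous_const))).intervalIntegrable _ _
      · exact (((Real.continuous_exp.comp continuous_neg).mul hφc).mul continuous_const).intervalIntegrable _ _
      · exact (continuous_finset_sum _ fun u _ => continuous_const.mul ((hc _).comp (continuous_id.sub continuous_const))).intervalIntegrable _ _
    have hsh : ∀ u ∈ W.U, X.kP z u * ∫ r in (0:ℝ)..S, X.v φ (u*z) (r - b s z u) = X.kP z u * A (u*z) - X.kP z u * ∫ r in (S - b s z u)..S, X.v φ (u*z) r := by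
      intro u _
      by_cases h0 : X.kP z u = 0
      · simp [h0]
      rw [← mul_sub]; congr 1
      rw [intervalIntegral.integral_comp_sub_right (fun r => X.v φ (u*z) r)]
      have hz : ∫ r in (0 - b s z u)..0, X.v φ (u*z) r = 0 := by
        rw [intervalIntegral.integral_congr (g := fun _ => 0)]
        · simp
        · intro r hr
          rw [uIcc_of_le (by linarith [(X.kP_b h0).1])] at hr
          exact X.v_neg hφ hr.2
      rw [← intervalIntegral.integral_add_adjacent_intervals (hi _ _ 0) (hi _ _ _), hz, zero_add, hA]
      dsimp only
      rw [← intervalIntegral.integral_add_adjacent_intervals (hi (u*z) 0 (S - b s z u)) (hi _ (S - b s z u) S)]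
      ring
    rw [Finset.sum_congr rfl hsh, Finset.sum_sub_distrib] at hsplit
    have : X.P A z = ∑ u ∈ W.U, X.kP z u * A (u*z) := rfl
    show I * (X.h z)⁻¹ - A z + X.P A z = _
    rw [this]; linarith
lemma w_lim (Y : Mix X) (H : NA W) (hφ : Tst φ) (hL : ∀ t t', |φ t - φ t'| ≤ L * |t - t'|) {η : ℝ} (hη : 0 < η) :
    ∀ᶠ S in atTop, |X.v φ 1 S * X.ν X.bb - (∫ r in (0:ℝ)..S, Real.exp (-r) * φ r) * X.ν (fun z => (X.h z)⁻¹)| ≤ η := by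
  have hBm : 1 ≤ W.Bm := (X.bb_ge 1).trans (X.bb_le 1)
  obtain ⟨Db, clb⟩ := bb_cl Y
  filter_upwards [v_unif2 Y H hφ hL (show 0 < η / W.Bm by positivity) W.Bm, eventually_ge_atTop 0] with S h1 hS
  obtain ⟨Bf, ⟨D, cl⟩, e1, e2⟩ := key_int Y hφ hL S hS
  have hd : ∀ z, |Bf z - X.v φ 1 S * X.bb z| ≤ η := by
    intro z
    have : Bf z - X.v φ 1 S * X.bb z = ∑ u ∈ W.U, X.kP z u * ∫ r in (S - b s z u)..S, (X.v φ (u*z) r - X.v φ 1 S) := by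
      rw [e2, bb, Finset.mul_sum, ← Finset.sum_sub_distrib]
      refine Finset.sum_congr rfl fun u _ => ?_
      rw [intervalIntegral.integral_sub ((v_cont hφ hL _).intervalIntegrable _ _) intervalIntegrable_const, intervalIntegral.integral_const, smul_eq_mul]
      ring
    have hb : ∀ u, X.kP z u ≠ 0 → |∫ r in (S - b s z u)..S, (X.v φ (u*z) r - X.v φ 1 S)| ≤ η := by
      intro u hu
      have hb := X.kP_b hu
      have := intervalIntegral.norm_integral_le_of_norm_le_const (a := S - b s z u) (b := S) (f := fun r => X.v φ (u*z) r - X.v φ 1 S) (C := η / W.Bm) (fun r hr => by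
        rw [uIoc_of_le (by linarith)] at hr
        have := h1 (u*z) (r - S) ⟨by linarith [hr.1], by linarith [hr.2]⟩
        rw [add_sub_cancel] at this; rw [Real.norm_eq_abs]; exact this)
      rw [Real.norm_eq_abs, sub_sub_cancel, abs_of_nonneg (show 0 ≤ b s z u by linarith)] at this
      refine this.trans ?_
      rw [div_mul_eq_mul_div, div_le_iff₀ (by linarith)]; nlinarith
    rw [this, abs_le]
    constructor
    · have := X.kP_sum_le (z := z) (f := fun u => -∫ r in (S - b s z u)..S, (X.v φ (u*z) r - X.v φ 1 S)) (c := η) fun u hu => (neg_le_abs _).trans (hb u hu)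
      simp only [mul_neg, Finset.sum_neg_distrib] at this; linarith
    · exact X.kP_sum_le fun u hu => (le_abs_self _).trans (hb u hu)
  obtain ⟨M, hM⟩ := X.bb_lip
  have clw := Y.Cl_of (hM.smul (X.v φ 1 S)) (B := |X.v φ 1 S| * W.Bm) (fun z => by rw [abs_mul]; exact mul_le_mul_of_nonneg_left (bb_abs z) (abs_nonneg _))
  have clsub : Cl s Y.l (fun z => Bf z - X.v φ 1 S * X.bb z) (D + (2 * (|X.v φ 1 S| * W.Bm) + |X.v φ 1 S| * M)) :=
    ⟨fun z z' => by linarith [cl.1 z z', clw.1 z' z], (cl.2.sub clw.2).mono (le_of_eq (by ring))⟩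
  have e3 := Y.ν_sub cl clw
  rw [Y.ν_smul _ clb, e1] at e3
  rw [abs_sub_comm, ← e3, abs_le]
  exact ⟨Y.ν_ge clsub fun z => (abs_le.1 (hd z)).1, Y.ν_le clsub fun z => (abs_le.1 (hd z)).2⟩
end Eig
end PaperCLT
end

section
open Filter Set MeasureTheory
namespace PaperCLT
open Walk Eig
namespace Eig
variable {Γ : Type*} [Group Γ] {s : Setup Γ} {W : Walk s} {X : Eig W}
noncomputable def φε (ε t : ℝ) : ℝ := max 0 (min 1 (t/ε))
noncomputable def φ1 (t : ℝ) : ℝ := if 0 < t then 1 else 0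
lemma φε_tst {ε : ℝ} (hε : 0 < ε) : Tst (φε ε) where
  z := fun t ht => by unfold φε; rw [max_eq_left]; exact (min_le_right _ _).trans (div_nonpos_of_nonpos_of_nonneg ht hε.le)
  nn := fun t => le_max_left _ _
  le := fun t => max_le zero_le_one (min_le_left _ _)
lemma φε_lip {ε : ℝ} (hε : 0 < ε) (t t' : ℝ) : |φε ε t - φε ε t'| ≤ ε⁻¹ * |t - t'| := by
  unfold φε
  have e : ε⁻¹ * |t - t'| = |t/ε - t'/ε| := by rw [← sub_div, abs_div, abs_of_pos hε, div_eq_inv_mul]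
  rw [e]
  have h1 : |max 0 (min 1 (t/ε)) - max 0 (min 1 (t'/ε))| ≤ |min 1 (t/ε) - min 1 (t'/ε)| := by
    have := abs_max_sub_max_le_max 0 (min 1 (t/ε)) 0 (min 1 (t'/ε)); simpa using this
  have h2 : |min 1 (t/ε) - min 1 (t'/ε)| ≤ |t/ε - t'/ε| := by
    have := abs_min_sub_min_le_max 1 (t/ε) 1 (t'/ε); simpa using this
  exact h1.trans h2
lemma φ1_tst : Tst φ1 where
  z := fun t ht => if_neg (not_lt.2 ht)
  nn := fun t => by unfold φ1; split_ifs <;> norm_num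
  le := fun t => by unfold φ1; split_ifs <;> norm_num
lemma φε_le {ε : ℝ} (hε : 0 < ε) (t : ℝ) : φε ε t ≤ φ1 t := by
  unfold φ1; split_ifs with h
  · exact (φε_tst hε).le t
  · rw [(φε_tst hε).z t (not_lt.1 h)]
lemma le_φε {ε : ℝ} (hε : 0 < ε) (t : ℝ) : φ1 t ≤ φε ε (t + ε) := by
  unfold φ1; split_ifs with h
  · unfold φε; rw [min_eq_left, max_eq_right zero_le_one]; rw [le_div_iff₀ hε]; linarith
  · exact (φε_tst hε).nn _
lemma J_mono {F G : Γ → ℝ} {T T' : ℝ} (h0 : ∀ z, 0 ≤ G z) (h : ∀ z, F z ≤ G z) (hT : T ≤ T') (z : Γ) : J W F T z ≤ J W G T' z := by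
  refine (Finset.sum_le_sum fun n _ => iter_mono W.k0 h n z).trans ?_
  exact Finset.sum_le_sum_of_subset_of_nonneg (Finset.range_mono (by have := Nat.ceil_mono hT; omega)) fun n _ _ => iter_nonneg W.k0 h0 n z
lemma v_low {ε : ℝ} (hε : 0 < ε) (z : Γ) (S : ℝ) : X.v (φε ε) z S ≤ X.v φ1 z S := by
  unfold v
  exact mul_le_mul_of_nonneg_right (mul_le_mul_of_nonneg_left (J_mono (fun y => φ1_tst.nn _) (fun y => φε_le hε _) le_rfl z) (Real.exp_pos _).le) (inv_pos.2 (X.hp z)).le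
lemma v_high {ε : ℝ} (hε : 0 < ε) (z : Γ) (S : ℝ) : X.v φ1 z S ≤ Real.exp ε * X.v (φε ε) z (S + ε) := by
  unfold v
  rw [← mul_assoc, ← mul_assoc, ← Real.exp_add, show ε + -(S+ε) = -S by ring]
  refine mul_le_mul_of_nonneg_right (mul_le_mul_of_nonneg_left (J_mono (fun y => (φε_tst hε).nn _) (fun y => ?_) (by linarith) z) (Real.exp_pos _).le) (inv_pos.2 (X.hp z)).le
  have := le_φε hε (s.nm z + S - s.nm y)
  rwa [show s.nm z + S - s.nm y + ε = s.nm z + (S + ε) - s.nm y by ring] at this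
lemma I_bd {ε : ℝ} (hε : 0 < ε) {S : ℝ} (hS : ε ≤ S) : (∫ r in (0:ℝ)..S, Real.exp (-r) * φε ε r) ≤ 1 ∧
    Real.exp (-ε) - Real.exp (-S) ≤ ∫ r in (0:ℝ)..S, Real.exp (-r) * φε ε r := by
  have hc : Continuous (φε ε) := by unfold φε; fun_prop
  have hii : ∀ a b : ℝ, IntervalIntegrable (fun r => Real.exp (-r) * φε ε r) volume a b := fun a b => ((Real.continuous_exp.comp continuous_neg).mul hc).intervalIntegrable _ _
  have hie : ∀ a b : ℝ, IntervalIntegrable (fun r : ℝ => Real.exp (-r)) volume a b := fun a b => (Real.continuous_exp.comp continuous_neg).intervalIntegrable _ _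
  have he : ∀ a b : ℝ, ∫ r in a..b, Real.exp (-r) = Real.exp (-a) - Real.exp (-b) := by
    intro a b; rw [intervalIntegral.integral_comp_neg (fun r => Real.exp r), integral_exp]
  constructor
  · have := intervalIntegral.integral_mono_on (hε.le.trans hS) (hii 0 S) (hie 0 S) (fun r _ => mul_le_of_le_one_right (Real.exp_pos _).le ((φε_tst hε).le r))
    rw [he, neg_zero, Real.exp_zero] at this; linarith [Real.exp_pos (-S)]
  · rw [← he, ← intervalIntegral.integral_add_adjacent_intervals (hii 0 ε) (hii ε S)]
    have h1 : 0 ≤ ∫ r in (0:ℝ)..ε, Real.exp (-r) * φε ε r := intervalIntegral.integral_nonneg hε.le fun r _ => mul_nonneg (Real.exp_pos _).le ((φε_tst hε).nn r)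
    have h2 : ∫ r in ε..S, Real.exp (-r) ≤ ∫ r in ε..S, Real.exp (-r) * φε ε r := by
      refine intervalIntegral.integral_mono_on hS (hie _ _) (hii _ _) fun r hr => ?_
      have : φε ε r = 1 := by unfold φε; rw [min_eq_left, max_eq_right zero_le_one]; rw [le_div_iff₀ hε]; linarith [hr.1]
      rw [this, mul_one]
    linarith
theorem renewal (Y : Mix X) (H : NA W) : ∃ c > 0, ∀ η > 0, ∃ S0, ∀ S ≥ S0, ∀ z, |X.v φ1 z S - c| ≤ η := by
  obtain ⟨Db, clb⟩ := bb_cl Y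
  obtain ⟨Dh, clh⟩ := hi_cl Y
  have hb1 : 1 ≤ X.ν X.bb := Y.ν_ge clb bb_ge
  have hh1 : 1 ≤ X.ν (fun z => (X.h z)⁻¹) := Y.ν_ge clh fun z => (one_le_inv₀ (X.hp z)).2 (X.up z)
  obtain ⟨B, hB⟩ : ∃ B, B = X.ν X.bb := ⟨_, rfl⟩
  obtain ⟨Q, hQ⟩ : ∃ Q, Q = X.ν (fun z => (X.h z)⁻¹) := ⟨_, rfl⟩
  rw [← hB] at hb1; rw [← hQ] at hh1
  refine ⟨Q / B, by positivity, fun η hη => ?_⟩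
  -- choose ε
  have hcont : Tendsto (fun ε : ℝ => (Real.exp (-ε) - ε) * Q - 2*ε*B) (nhdsWithin 0 (Ioi 0)) (nhds ((Real.exp (-0) - 0) * Q - 2*0*B)) := by
    refine Tendsto.mono_left (Continuous.tendsto (by fun_prop) 0) nhdsWithin_le_nhds
  have hcont2 : Tendsto (fun ε : ℝ => Real.exp ε * (Q + 2*ε*B)) (nhdsWithin 0 (Ioi 0)) (nhds (Real.exp 0 * (Q + 2*0*B))) := by
    refine Tendsto.mono_left (Continuous.tendsto (by fun_prop) 0) nhdsWithin_le_nhds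
  have e1 := hcont.eventually (lt_mem_nhds (show Q - η * B < _ by simp; positivity))
  have e2 := hcont2.eventually (gt_mem_nhds (show _ < Q + η * B by simp; positivity))
  obtain ⟨ε, ⟨e1, e2⟩, hε⟩ := ((e1.and e2).and self_mem_nhdsWithin).exists
  have hε : 0 < ε := hε
  have w := w_lim Y H (φε_tst hε) (φε_lip hε) hε
  have u := v_unif Y H (φε_tst hε) (φε_lip hε) hε
  have ex : ∀ᶠ S : ℝ in atTop, Real.exp (-S) < ε := (Real.tendsto_exp_neg_atTop_nhds_zero).eventually (gt_mem_nhds hε)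
  obtain ⟨S0, h0⟩ := eventually_atTop.1 (w.and (u.and (ex.and (eventually_ge_atTop ε))))
  refine ⟨S0, fun S hS z => ?_⟩
  have bounds : ∀ S ≥ S0, X.v (φε ε) z S * B ≤ Q + 2*ε*B ∧ (Real.exp (-ε) - ε) * Q - 2*ε*B ≤ X.v (φε ε) z S * B := by
    intro S hS
    obtain ⟨a1, a2, a3, a4⟩ := h0 S hS
    have a2 := a2 z
    obtain ⟨i1, i2⟩ := I_bd hε a4
    rw [← hB, ← hQ] at a1
    rw [abs_le] at a1 a2
    have q1 := mul_le_mul_of_nonneg_right i1 (show 0 ≤ Q by linarith)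
    have q2 := mul_le_mul_of_nonneg_right (show Real.exp (-ε) - ε ≤ ∫ r in (0:ℝ)..S, Real.exp (-r) * φε ε r by linarith) (show 0 ≤ Q by linarith)
    have b1 := mul_le_mul_of_nonneg_right (show X.v (φε ε) z S ≤ X.v (φε ε) 1 S + ε by linarith) (show 0 ≤ B by linarith)
    have b2 := mul_le_mul_of_nonneg_right (show X.v (φε ε) 1 S - ε ≤ X.v (φε ε) z S by linarith) (show 0 ≤ B by linarith)
    constructor <;> nlinarith
  have c1 := (bounds S hS).2
  have c2 := (bounds (S+ε) (by linarith)).1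
  have c3 := v_low (X := X) hε z S
  have c4 := v_high (X := X) hε z S
  have c5 : X.v φ1 z S * B ≤ Q + η * B := by
    refine le_trans (mul_le_mul_of_nonneg_right c4 (by linarith)) ?_
    rw [mul_assoc]; exact (mul_le_mul_of_nonneg_left c2 (Real.exp_pos _).le).trans e2.le
  have c6 : Q - η * B ≤ X.v φ1 z S * B := by
    have := mul_le_mul_of_nonneg_right c3 (show 0 ≤ B by linarith)
    linarith
  have hBp : 0 < B := by linarith
  rw [abs_le]; constructor
  · rw [neg_le_sub_iff_le_add, div_le_iff₀ hBp]; linarith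
  · rw [sub_le_iff_le_add, ← sub_le_iff_le_add', le_div_iff₀ hBp]; linarith
end Eig
end PaperCLT
end

section
open Filter Set
namespace PaperCLT
open Walk Eig
namespace Eig
variable {Γ : Type*} [Group Γ] {s : Setup Γ} {W : Walk s} {X : Eig W}
/-- bounded Lipschitz functions -/
def LB (s : Setup Γ) (f : Γ → ℝ) : Prop := ∃ M B, IsLip s f M ∧ ∀ z, |f z| ≤ B
lemma LB.sub {f g : Γ → ℝ} (h : LB s f) (h' : LB s g) : LB s (fun z => f z - g z) := by
  obtain ⟨M, B, h1, h2⟩ := h; obtain ⟨M', B', h3, h4⟩ := h'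
  exact ⟨_, _, h1.sub h3, fun z => (abs_sub _ _).trans (add_le_add (h2 z) (h4 z))⟩
lemma LB.smul (c : ℝ) {f : Γ → ℝ} (h : LB s f) : LB s (fun z => c * f z) := by
  obtain ⟨M, B, h1, h2⟩ := h
  exact ⟨_, |c| * B, h1.smul c, fun z => by rw [abs_mul]; exact mul_le_mul_of_nonneg_left (h2 z) (abs_nonneg c)⟩
lemma LB.cl {f : Γ → ℝ} (h : LB s f) (Y : Mix X) : ∃ D, Cl s Y.l f D := by
  obtain ⟨M, B, h1, h2⟩ := h; exact ⟨_, Y.Cl_of h1 h2⟩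
lemma LB_mean (f : Γ → Γ → ℝ) {C B : ℝ} (hC : ∀ u ∈ W.U, IsLip s (fun z => f z u) C) (hB : ∀ z, ∀ u ∈ W.U, |f z u| ≤ B) :
    LB s (fun z => ∑ u ∈ W.U, X.kP z u * f z u) := by
  obtain ⟨M, hM⟩ := step_lip (X := X) f hC hB
  refine ⟨M, B, hM, fun z => (Finset.abs_sum_le_sum_abs _ _).trans ?_⟩
  calc _ ≤ ∑ u ∈ W.U, X.kP z u * B := Finset.sum_le_sum fun u hu => by
        rw [abs_mul, abs_of_nonneg (X.kP0 _ _)]; exact mul_le_mul_of_nonneg_left (hB z u hu) (X.kP0 _ _)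
    _ = B := by rw [← Finset.sum_mul, X.kP_sum, one_mul]
noncomputable def _root_.PaperCLT.Setup.q (s : Setup Γ) (z : Γ) : ℝ := s.e 1 z
lemma q_abs (z u : Γ) (hu : u ∈ W.U) : |s.q (u*z) - s.q z| ≤ s.A * W.ρU + s.A := by
  have e : s.q (u*z) = s.e u⁻¹ z := by have := s.li u⁻¹ 1 (u*z); rw [mul_one, inv_mul_cancel_left] at this; exact this.symm
  have h1 := s.me.triangle u⁻¹ 1 z
  have h2 := s.me.triangle 1 u⁻¹ z
  have h3 := s.eA u⁻¹
  have h4 : s.d 1 u⁻¹ ≤ W.ρU := by have := W.kU u hu; rw [← s.nm_inv] at this; exact this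
  have h5 : s.A * s.d 1 u⁻¹ ≤ s.A * W.ρU := mul_le_mul_of_nonneg_left h4 (by linarith [s.hA])
  rw [s.me.symm u⁻¹ 1] at h1
  rw [e, Setup.q, abs_le]; constructor <;> linarith
lemma q_lip : ∃ C, ∀ u ∈ W.U, IsLip s (fun z => s.q (u*z) - s.q z) C := by
  obtain ⟨C, hC, h⟩ := s.ve W.ρU
  refine ⟨C, fun u hu z z' => ?_⟩
  have := h u⁻¹ z z' (by have := W.kU u hu; rw [← s.nm_inv] at this; exact this)
  have e : ∀ z, s.q (u*z) = s.e u⁻¹ z := by intro z; have := s.li u⁻¹ 1 (u*z); rw [mul_one, inv_mul_cancel_left] at this; exact this.symm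
  show |(s.q (u*z) - s.q z) - (s.q (u*z') - s.q z')| ≤ _
  rw [e, e]; exact this
structure _root_.PaperCLT.Mart (X : Eig W) where
  κ : ℝ
  σ2 : ℝ
  hσ : 0 ≤ σ2
  χ : Γ → ℝ
  χ' : Γ → ℝ
  B : ℝ
  B1 : 1 ≤ B
  χB : ∀ z, |χ z| ≤ B
  χB' : ∀ z, |χ' z| ≤ B
  m : Γ → ℝ
  hm : ∀ z, m z = s.q z - κ * s.nm z + χ z
  mB : ∀ z, ∀ u ∈ W.U, |m (u*z) - m z| ≤ B
  ψB : ∀ z, ∀ u ∈ W.U, |(s.q (u*z) - κ * s.nm (u*z)) - (s.q z - κ * s.nm z)| ≤ B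
  zero : ∀ z, ∑ u ∈ W.U, X.kP z u * (m (u*z) - m z) = 0
  sq : ∀ z, ∑ u ∈ W.U, X.kP z u * (m (u*z) - m z)^2 = σ2 * X.bb z + χ' z - ∑ u ∈ W.U, X.kP z u * χ' (u*z)
  mlip : ∃ M, ∀ u ∈ W.U, IsLip s (fun z => m (u*z) - m z) M
  νsq : σ2 = 0 → X.ν (fun z => ∑ u ∈ W.U, X.kP z u * (m (u*z) - m z)^2) = 0
theorem exists_mart (Y : Mix X) : Nonempty (Mart X) := by
  obtain ⟨Cq, hq⟩ := q_lip (s := s) (W := W)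
  obtain ⟨Cb, hb⟩ := W.b_lip
  obtain ⟨abar, ha⟩ : ∃ f : Γ → ℝ, f = fun z => ∑ u ∈ W.U, X.kP z u * (s.q (u*z) - s.q z) := ⟨_, rfl⟩
  have LBa : LB s abar := by rw [ha]; exact LB_mean (fun z u => s.q (u*z) - s.q z) hq (fun z u hu => q_abs z u hu)
  have LBb : LB s X.bb := LB_mean (fun z u => b s z u) hb (fun z u hu => (b_abs z u).trans (W.kU u hu))
  obtain ⟨Db, clb⟩ := LBb.cl Y
  obtain ⟨Da, cla⟩ := LBa.cl Y
  have hb1 : 1 ≤ X.ν X.bb := Y.ν_ge clb bb_ge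
  obtain ⟨κ, hκ⟩ : ∃ κ, κ = X.ν abar / X.ν X.bb := ⟨_, rfl⟩
  obtain ⟨Dk, clk⟩ := (LBb.smul κ).cl Y
  obtain ⟨Dg, clg⟩ := (LBa.sub (LBb.smul κ)).cl Y
  have ν0 : X.ν (fun z => abar z - κ * X.bb z) = 0 := by
    rw [Y.ν_sub cla clk, Y.ν_smul κ clb, hκ]; field_simp; ring
  obtain ⟨χ, χlip, χbd, χeq⟩ := Y.poisson clg
  obtain ⟨B1, hB1⟩ : ∃ x, x = Y.ε1 * Dg := ⟨_, rfl⟩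
  rw [← hB1] at χbd
  obtain ⟨M1, hM1⟩ : ∃ x, x = Y.ε1 * (Y.l * Dg) := ⟨_, rfl⟩
  rw [← hM1] at χlip
  obtain ⟨m, hm⟩ : ∃ m : Γ → ℝ, m = fun z => s.q z - κ * s.nm z + χ z := ⟨_, rfl⟩
  have inc : ∀ z u, m (u*z) - m z = (s.q (u*z) - s.q z) - κ * b s z u + (χ (u*z) - χ z) := by
    intro z u; rw [hm]; unfold b; ring
  have hB10 : 0 ≤ B1 := (abs_nonneg _).trans (χbd 1)
  have ψB : ∀ z, ∀ u ∈ W.U, |(s.q (u*z) - κ * s.nm (u*z)) - (s.q z - κ * s.nm z)| ≤ (s.A * W.ρU + s.A) + |κ| * W.ρU := by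
    intro z u hu
    have e : (s.q (u*z) - κ * s.nm (u*z)) - (s.q z - κ * s.nm z) = (s.q (u*z) - s.q z) - κ * b s z u := by unfold b; ring
    rw [e]
    refine (abs_sub _ _).trans (add_le_add (q_abs z u hu) ?_)
    rw [abs_mul]; exact mul_le_mul_of_nonneg_left ((b_abs z u).trans (W.kU u hu)) (abs_nonneg _)
  obtain ⟨B0, hB0⟩ : ∃ x, x = (s.A * W.ρU + s.A) + |κ| * W.ρU := ⟨_, rfl⟩
  rw [← hB0] at ψB
  have mB : ∀ z, ∀ u ∈ W.U, |m (u*z) - m z| ≤ B0 + (B1 + B1) := by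
    intro z u hu
    have e : m (u*z) - m z = ((s.q (u*z) - κ * s.nm (u*z)) - (s.q z - κ * s.nm z)) + (χ (u*z) - χ z) := by rw [hm]; ring
    rw [e]
    exact (abs_add_le _ _).trans (add_le_add (ψB z u hu) ((abs_sub _ _).trans (add_le_add (χbd _) (χbd _))))
  have mlip : ∀ u ∈ W.U, IsLip s (fun z => m (u*z) - m z) (Cq + |κ| * Cb + (Real.exp (s.c * W.ρU) * M1 + M1)) := by
    intro u hu
    have := ((hq u hu).sub ((hb u hu).smul κ)).add ((IsLip.comp W χlip hu).sub χlip)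
    intro z z'
    have := this z z'
    simp only [inc]; exact this
  have zero : ∀ z, ∑ u ∈ W.U, X.kP z u * (m (u*z) - m z) = 0 := by
    intro z
    have h1 := χeq z
    rw [ν0] at h1
    have e : X.P χ z = ∑ u ∈ W.U, X.kP z u * χ (u*z) := rfl
    have e2 : ∑ u ∈ W.U, X.kP z u * (m (u*z) - m z) = (∑ u ∈ W.U, X.kP z u * (s.q (u*z) - s.q z)) - κ * X.bb z + (∑ u ∈ W.U, X.kP z u * χ (u*z)) - (∑ u ∈ W.U, X.kP z u) * χ z := by
      rw [bb, Finset.mul_sum, Finset.sum_mul, ← Finset.sum_sub_distrib, ← Finset.sum_add_distrib, ← Finset.sum_sub_distrib]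
      exact Finset.sum_congr rfl fun u _ => by rw [inc]; ring
    rw [e2, X.kP_sum, ← e]; rw [ha] at h1; dsimp only at h1; linarith
  obtain ⟨Q, hQ⟩ : ∃ Q : Γ → ℝ, Q = fun z => ∑ u ∈ W.U, X.kP z u * (m (u*z) - m z)^2 := ⟨_, rfl⟩
  have LBQ : LB s Q := by
    rw [hQ]
    have h1 : ∀ u ∈ W.U, ∀ z z' : Γ, |(m (u*z) - m z)^2 - (m (u*z') - m z')^2| ≤ _ := fun u hu z z' => by
      have := ((mlip u hu).mul (mlip u hu) (fun z => mB z u hu) (fun z => mB z u hu)) z z'; simp only [pow_two]; exact this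
    exact LB_mean (X := X) (fun z u => (m (u*z) - m z)^2) h1 (B := (B0 + (B1+B1))^2) (fun z u hu => by
      rw [abs_pow]; exact pow_le_pow_left₀ (abs_nonneg _) (mB z u hu) 2)
  obtain ⟨DQ, clQ⟩ := LBQ.cl Y
  obtain ⟨σ2, hσ2⟩ : ∃ x, x = X.ν Q / X.ν X.bb := ⟨_, rfl⟩
  obtain ⟨Ds, cls⟩ := (LBb.smul σ2).cl Y
  obtain ⟨Dh, clh⟩ := (LBQ.sub (LBb.smul σ2)).cl Y
  have ν1 : X.ν (fun z => Q z - σ2 * X.bb z) = 0 := by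
    rw [Y.ν_sub clQ cls, Y.ν_smul σ2 clb, hσ2]; field_simp; ring
  obtain ⟨χ', _, χbd', χeq'⟩ := Y.poisson clh
  have hQ0 : 0 ≤ X.ν Q := Y.ν_ge clQ fun z => by
    rw [hQ]; exact Finset.sum_nonneg fun u _ => mul_nonneg (X.kP0 _ _) (sq_nonneg _)
  have hBB := (abs_nonneg _).trans (χbd' 1)
  have hB00 : 0 ≤ B0 := by
    by_contra hneg
    push Not at hneg
    have : ∀ u ∈ W.U, False := fun u hu => by linarith [(abs_nonneg _).trans (ψB 1 u hu)]
    have h := X.kP_sum 1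
    rw [Finset.sum_eq_zero (fun u hu => (this u hu).elim)] at h; norm_num at h
  refine ⟨⟨κ, σ2, (by rw [hσ2]; positivity), χ, χ', 1 + B0 + (B1+B1) + Y.ε1 * Dh, (by linarith), fun z => by linarith [χbd z],
    fun z => by linarith [χbd' z], m, fun z => by rw [hm], fun z u hu => by linarith [mB z u hu], fun z u hu => by linarith [ψB z u hu],
    zero, fun z => ?_, ⟨_, mlip⟩, fun h => ?_⟩⟩
  · have h1 := χeq' z
    rw [ν1] at h1
    have e : X.P χ' z = ∑ u ∈ W.U, X.kP z u * χ' (u*z) := rfl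
    rw [e] at h1; rw [hQ] at h1; dsimp only at h1; linarith
  · have : X.ν Q = 0 := by
      have h2 := hσ2.symm; rw [h, div_eq_zero_iff] at h2
      rcases h2 with h2 | h2
      · exact h2
      · linarith
    rw [← hQ]; exact this
end Eig
end PaperCLT
end

section
open Filter Set
namespace PaperCLT
open Walk Eig
lemma exp_tay (x : ℝ) : |Real.exp x - 1 - x - x^2/2| ≤ |x|^3 * Real.exp |x| := by
  have := Complex.norm_exp_sub_sum_le_norm_mul_exp (x : ℂ) 3
  have e : Complex.exp x - ∑ m ∈ Finset.range 3, (x:ℂ)^m / (m.factorial : ℂ) = ((Real.exp x - 1 - x - x^2/2 : ℝ) : ℂ) := by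
    simp [Finset.sum_range_succ]; ring
  rw [e, Complex.norm_real, Complex.norm_real, Real.norm_eq_abs, Real.norm_eq_abs] at this
  exact this
lemma exp3 {B : ℝ} (hB : 0 ≤ B) : ∃ C, 0 ≤ C ∧ ∀ l D c : ℝ, |l| ≤ 1 → |D| ≤ B → |c| ≤ B →
    |Real.exp (l * D + l^2 * c) - 1 - l * D - l^2 * (c + D^2/2)| ≤ C * |l|^3 := by
  refine ⟨(2*B)^3 * Real.exp (2*B) + 2 * B^2, by positivity, fun l D c hl hD hc => ?_⟩
  have hl0 := abs_nonneg l
  have hx : |l * D + l^2 * c| ≤ |l| * (2*B) := by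
    refine (abs_add_le _ _).trans ?_
    rw [abs_mul, abs_mul, abs_pow]
    have h1 : |l| * |D| ≤ |l| * B := mul_le_mul_of_nonneg_left hD hl0
    have h2 : |l|^2 * |c| ≤ |l| * B := mul_le_mul (by nlinarith) hc (abs_nonneg _) hl0
    linarith
  have h1 := exp_tay (l * D + l^2 * c)
  have h2 : |l * D + l^2 * c|^3 * Real.exp |l * D + l^2 * c| ≤ (|l| * (2*B))^3 * Real.exp (2*B) :=
    mul_le_mul (pow_le_pow_left₀ (abs_nonneg _) hx 3) (Real.exp_le_exp.2 (hx.trans (by nlinarith))) (Real.exp_pos _).le (by positivity)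
  have h3 : |l^3 * (D * c) + l^4 * (c^2/2)| ≤ |l|^3 * (2*B^2) := by
    refine (abs_add_le _ _).trans ?_
    rw [abs_mul, abs_mul (l^4), abs_pow, abs_pow, abs_mul, abs_of_nonneg (by positivity : 0 ≤ c^2/2)]
    have e1 : |D| * |c| ≤ B * B := mul_le_mul hD hc (abs_nonneg _) hB
    have e2 : c^2/2 ≤ B^2 := by nlinarith [sq_abs c, abs_nonneg c]
    have e3 : |l|^4 ≤ |l|^3 := pow_le_pow_of_le_one hl0 hl (by norm_num)
    have e4 : |l|^4 * (c^2/2) ≤ |l|^3 * B^2 := mul_le_mul e3 e2 (by positivity) (by positivity)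
    have e5 : |l|^3 * (|D| * |c|) ≤ |l|^3 * (B*B) := mul_le_mul_of_nonneg_left e1 (by positivity)
    nlinarith
  have e : Real.exp (l * D + l^2 * c) - 1 - l * D - l^2 * (c + D^2/2) = (Real.exp (l * D + l^2 * c) - 1 - (l * D + l^2 * c) - (l * D + l^2 * c)^2/2) + (l^3 * (D * c) + l^4 * (c^2/2)) := by ring
  rw [e]
  refine (abs_add_le _ _).trans ((add_le_add (h1.trans h2) h3).trans (le_of_eq (by ring)))
namespace Mart
variable {Γ : Type*} [Group Γ] {s : Setup Γ} {W : Walk s} {X : Eig W} (N : Mart X)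
noncomputable def ψ (z : Γ) : ℝ := s.q z - N.κ * s.nm z
noncomputable def Z (l : ℝ) (z : Γ) : ℝ := l * N.m z - l^2/2 * (N.σ2 * s.nm z - N.χ' z)
lemma Z_mean : ∃ C, 0 ≤ C ∧ ∀ l : ℝ, |l| ≤ 1 → ∀ z, |∑ u ∈ W.U, X.kP z u * Real.exp (N.Z l (u*z) - N.Z l z) - 1| ≤ C * |l|^3 := by
  have hB := N.B1; have hσ := N.hσ
  have hcB : ∀ z, ∀ u ∈ W.U, |-(N.σ2 * b s z u - (N.χ' (u*z) - N.χ' z))/2| ≤ N.B + N.σ2 * |W.ρU| := by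
    intro z u hu
    have h1 := abs_le.1 (N.χB' z); have h2 := abs_le.1 (N.χB' (u*z))
    have h3 := abs_le.1 ((b_abs (s := s) z u).trans ((W.kU u hu).trans (le_abs_self _)))
    have h4 := mul_le_mul_of_nonneg_left h3.1 hσ; have h5 := mul_le_mul_of_nonneg_left h3.2 hσ
    have h6 : 0 ≤ N.σ2 * |W.ρU| := by positivity
    rw [abs_le]; constructor <;> linarith
  have hB' : 0 ≤ N.B + N.σ2 * |W.ρU| := by positivity
  obtain ⟨C, hC, h⟩ := exp3 hB'
  refine ⟨C, hC, fun l hl z => ?_⟩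
  have e : ∑ u ∈ W.U, X.kP z u * Real.exp (N.Z l (u*z) - N.Z l z) - 1 =
      ∑ u ∈ W.U, X.kP z u * (Real.exp (l * (N.m (u*z) - N.m z) + l^2 * (-(N.σ2 * b s z u - (N.χ' (u*z) - N.χ' z))/2)) - 1 - l * (N.m (u*z) - N.m z)
        - l^2 * (-(N.σ2 * b s z u - (N.χ' (u*z) - N.χ' z))/2 + (N.m (u*z) - N.m z)^2/2)) := by
    have e1 : ∀ u, N.Z l (u*z) - N.Z l z = l * (N.m (u*z) - N.m z) + l^2 * (-(N.σ2 * b s z u - (N.χ' (u*z) - N.χ' z))/2) := by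
      intro u; unfold Z b; ring
    have e2 : ∑ u ∈ W.U, X.kP z u * (l^2 * (-(N.σ2 * b s z u - (N.χ' (u*z) - N.χ' z))/2 + (N.m (u*z) - N.m z)^2/2)) = 0 := by
      have : ∑ u ∈ W.U, X.kP z u * (l^2 * (-(N.σ2 * b s z u - (N.χ' (u*z) - N.χ' z))/2 + (N.m (u*z) - N.m z)^2/2)) =
        l^2/2 * (∑ u ∈ W.U, X.kP z u * (N.m (u*z) - N.m z)^2 - N.σ2 * X.bb z + ∑ u ∈ W.U, X.kP z u * N.χ' (u*z) - (∑ u ∈ W.U, X.kP z u) * N.χ' z) := by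
        rw [bb, Finset.mul_sum, Finset.sum_mul, ← Finset.sum_sub_distrib, ← Finset.sum_add_distrib, ← Finset.sum_sub_distrib, Finset.mul_sum]
        exact Finset.sum_congr rfl fun u _ => by ring
      rw [this, N.sq, X.kP_sum]; ring
    have e3 : ∑ u ∈ W.U, X.kP z u * (l * (N.m (u*z) - N.m z)) = 0 := by
      have := N.zero z
      rw [Finset.sum_congr rfl fun u _ => show X.kP z u * (l * (N.m (u*z) - N.m z)) = l * (X.kP z u * (N.m (u*z) - N.m z)) by ring, ← Finset.mul_sum, this, mul_zero]
    have e4 : ∑ u ∈ W.U, X.kP z u * Real.exp (N.Z l (u*z) - N.Z l z) - 1 = ∑ u ∈ W.U, X.kP z u * Real.exp (N.Z l (u*z) - N.Z l z) - ∑ u ∈ W.U, X.kP z u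
      - ∑ u ∈ W.U, X.kP z u * (l * (N.m (u*z) - N.m z)) - ∑ u ∈ W.U, X.kP z u * (l^2 * (-(N.σ2 * b s z u - (N.χ' (u*z) - N.χ' z))/2 + (N.m (u*z) - N.m z)^2/2)) := by
      rw [e2, e3, X.kP_sum z]; ring
    rw [e4, ← Finset.sum_sub_distrib, ← Finset.sum_sub_distrib, ← Finset.sum_sub_distrib]
    exact Finset.sum_congr rfl fun u _ => by rw [e1]; ring
  rw [e]
  refine (Finset.abs_sum_le_sum_abs _ _).trans ?_
  calc _ ≤ ∑ u ∈ W.U, X.kP z u * (C * |l|^3) := Finset.sum_le_sum fun u hu => by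
        rw [abs_mul, abs_of_nonneg (X.kP0 _ _)]
        exact mul_le_mul_of_nonneg_left (h l _ _ hl ((N.mB z u hu).trans (by linarith [mul_nonneg hσ (abs_nonneg W.ρU)])) (hcB z u hu)) (X.kP0 _ _)
    _ = _ := by rw [← Finset.sum_mul, X.kP_sum, one_mul]
end Mart
end PaperCLT
end

section
open Filter Set
namespace PaperCLT
open Walk Eig
namespace Mart
variable {Γ : Type*} [Group Γ] {s : Setup Γ} {W : Walk s} {X : Eig W} (N : Mart X)
noncomputable def F (l T : ℝ) (y : Γ) : ℝ := φ1 (T - s.nm y) * Real.exp (l * N.ψ y)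
lemma F_zero {l T : ℝ} (y : Γ) (h : T ≤ s.nm y) : N.F l T y = 0 := by
  unfold F; rw [φ1_tst.z _ (by linarith), zero_mul]
lemma F_nn (l T : ℝ) (y : Γ) : 0 ≤ N.F l T y := mul_nonneg (φ1_tst.nn _) (Real.exp_pos _).le
lemma F_v (T : ℝ) (z : Γ) : X.v φ1 z (T - s.nm z) = Real.exp (-(T - s.nm z)) * J W (N.F 0 T) T z * (X.h z)⁻¹ := by
  unfold v
  have : (fun y => φ1 (s.nm z + (T - s.nm z) - s.nm y)) = N.F 0 T := by
    funext y; unfold F; rw [zero_mul, Real.exp_zero, mul_one]; congr 1; ring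
  rw [this]; congr 3; ring
lemma kb1 {z u : Γ} (h : W.k z u ≠ 0) : 1 ≤ b s z u ∧ b s z u ≤ W.Bm := ⟨W.R1.trans (W.kb z u h).1, (W.kb z u h).2⟩
lemma J_cmp {l T : ℝ} (z : Γ) : J W (N.F l T) T z ≤ Real.exp (l * N.ψ z + |l| * N.B * (T - s.nm z)) * J W (N.F 0 T) T z ∧
    Real.exp (l * N.ψ z - |l| * N.B * (T - s.nm z)) * J W (N.F 0 T) T z ≤ J W (N.F l T) T z := by
  have hB := N.B1
  have hl := abs_nonneg l
  refine ind (Q := fun z S => S = T - s.nm z → J W (N.F l T) T z ≤ Real.exp (l * N.ψ z + |l| * N.B * (T - s.nm z)) * J W (N.F 0 T) T z ∧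
    Real.exp (l * N.ψ z - |l| * N.B * (T - s.nm z)) * J W (N.F 0 T) T z ≤ J W (N.F l T) T z) ?_ ?_ z _ rfl
  · intro z S hS e
    rw [J_zero (fun y hy => N.F_zero y hy) (by linarith), J_zero (fun y hy => N.F_zero y hy) (by linarith)]; simp
  · intro z S hS ih e
    have hlS : 0 ≤ |l| * N.B * (T - s.nm z) := by rw [← e]; positivity
    have hψ : ∀ u ∈ W.U, |l * N.ψ (u*z) - l * N.ψ z| ≤ |l| * N.B := fun u hu => by
      rw [← mul_sub, abs_mul]; exact mul_le_mul_of_nonneg_left (N.ψB z u hu) hl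
    have hex : ∀ u, W.k z u ≠ 0 → |l| * N.B * (T - s.nm (u*z)) + |l| * N.B ≤ |l| * N.B * (T - s.nm z) := by
      intro u hu
      have := (kb1 hu).1; unfold b at this
      have h2 : 0 ≤ |l| * N.B := by positivity
      nlinarith
    have key : ∀ u ∈ W.U, W.k z u ≠ 0 → _ := fun u hu h => ih (u*z) (T - s.nm (u*z)) (by have := (kb1 h).1; unfold b at this; linarith) rfl
    rw [J_eq (fun y hy => N.F_zero y hy), J_eq (F := N.F 0 T) (fun y hy => N.F_zero y hy)]
    have hF0 : N.F l T z = Real.exp (l * N.ψ z) * N.F 0 T z := by unfold F; rw [zero_mul, Real.exp_zero]; ring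
    have hn := N.F_nn 0 T z
    have J0 : ∀ y, 0 ≤ J W (N.F 0 T) T y := fun y => J_nn (N.F_nn 0 T) y
    constructor
    · rw [mul_add]
      refine add_le_add ?_ ?_
      · rw [hF0]; exact mul_le_mul_of_nonneg_right (Real.exp_le_exp.2 (by linarith)) hn
      · unfold Walk.Op; rw [Finset.mul_sum]
        refine Finset.sum_le_sum fun u hu => ?_
        by_cases h : W.k z u = 0
        · simp [h]
        rw [mul_left_comm]
        refine mul_le_mul_of_nonneg_left ((key u hu h).1.trans (mul_le_mul_of_nonneg_right (Real.exp_le_exp.2 ?_) (J0 _))) (W.k0 _ _)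
        linarith [(abs_le.1 (hψ u hu)).2, hex u h]
    · rw [mul_add]
      refine add_le_add ?_ ?_
      · rw [hF0]; exact mul_le_mul_of_nonneg_right (Real.exp_le_exp.2 (by linarith)) hn
      · unfold Walk.Op; rw [Finset.mul_sum]
        refine Finset.sum_le_sum fun u hu => ?_
        by_cases h : W.k z u = 0
        · simp [h]
        rw [mul_left_comm]
        refine mul_le_mul_of_nonneg_left (le_trans (mul_le_mul_of_nonneg_right (Real.exp_le_exp.2 ?_) (J0 _)) (key u hu h).2) (W.k0 _ _)
        linarith [(abs_le.1 (hψ u hu)).1, hex u h]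
noncomputable def V (l T : ℝ) (z : Γ) : ℝ := J W (N.F l T) T z * (Real.exp (-(T - s.nm z)) * (X.h z)⁻¹ * Real.exp (- N.Z l z - l^2 * N.σ2 * T / 2))
lemma V_nn (l T : ℝ) (z : Γ) : 0 ≤ N.V l T z :=
  mul_nonneg (J_nn (N.F_nn l T) z) (mul_nonneg (mul_nonneg (Real.exp_pos _).le (inv_pos.2 (X.hp z)).le) (Real.exp_pos _).le)
lemma V_eq (l T : ℝ) (z : Γ) : N.V l T z = N.F l T z * (Real.exp (-(T - s.nm z)) * (X.h z)⁻¹ * Real.exp (- N.Z l z - l^2 * N.σ2 * T / 2)) +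
    ∑ u ∈ W.U, X.kP z u * (Real.exp (N.Z l (u*z) - N.Z l z) * N.V l T (u*z)) := by
  unfold V
  rw [J_eq (fun y hy => N.F_zero y hy), add_mul]
  congr 1
  unfold Walk.Op
  rw [Finset.sum_mul]
  refine Finset.sum_congr rfl fun u _ => ?_
  have hp := (X.hp (u*z)).ne'; have hq := (X.hp z).ne'
  have e1 : Real.exp (-(T - s.nm z)) = Real.exp (-b s z u) * Real.exp (-(T - s.nm (u*z))) := by rw [← Real.exp_add]; unfold b; ring_nf
  have e2 : Real.exp (- N.Z l z - l^2 * N.σ2 * T / 2) = Real.exp (N.Z l (u*z) - N.Z l z) * Real.exp (- N.Z l (u*z) - l^2 * N.σ2 * T / 2) := by rw [← Real.exp_add]; ring_nf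
  rw [e1, e2, kP, kL]
  field_simp
lemma expo (l T : ℝ) (z : Γ) (hl : |l| ≤ 1) : l * N.ψ z + (- N.Z l z - l^2 * N.σ2 * T / 2) = -(l * N.χ z) - l^2/2 * N.χ' z - l^2 * N.σ2 * (T - s.nm z)/2 ∧
    |l * N.χ z + l^2/2 * N.χ' z| ≤ |l| * (2 * N.B) := by
  constructor
  · unfold Z ψ; rw [N.hm]; ring
  · refine (abs_add_le _ _).trans ?_
    rw [abs_mul, abs_mul, abs_of_nonneg (by positivity : 0 ≤ l^2/2)]
    have h1 := mul_le_mul_of_nonneg_left (N.χB z) (abs_nonneg l)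
    have h2 : l^2/2 * |N.χ' z| ≤ |l| * N.B := mul_le_mul (by nlinarith [sq_abs l, abs_nonneg l]) (N.χB' z) (abs_nonneg _) (abs_nonneg _)
    linarith
lemma V_force (l T : ℝ) (z : Γ) (hl : |l| ≤ 1) : N.F l T z * (Real.exp (-(T - s.nm z)) * (X.h z)⁻¹ * Real.exp (- N.Z l z - l^2 * N.σ2 * T / 2)) ≤
    (X.c0⁻¹ * Real.exp (2 * N.B)) * Real.exp (-(T - s.nm z)) := by
  by_cases hS : T - s.nm z ≤ 0
  · rw [N.F_zero z (by linarith), zero_mul]; have := X.hc0; positivity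
  obtain ⟨e, hb⟩ := N.expo l T z hl
  have hb := abs_le.1 hb
  have hin : (X.h z)⁻¹ ≤ X.c0⁻¹ := inv_anti₀ X.hc0 (X.lo z)
  have hσ := N.hσ; have hB := N.B1
  have h3 : 0 ≤ l^2 * N.σ2 * (T - s.nm z)/2 := by have := (not_le.1 hS).le; positivity
  calc _ = φ1 (T - s.nm z) * ((X.h z)⁻¹ * Real.exp (l * N.ψ z + (- N.Z l z - l^2 * N.σ2 * T / 2))) * Real.exp (-(T - s.nm z)) := by
        unfold F; rw [Real.exp_add]; ring
    _ ≤ 1 * (X.c0⁻¹ * Real.exp (2 * N.B)) * Real.exp (-(T - s.nm z)) := by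
        have := X.hp z
        refine mul_le_mul_of_nonneg_right (mul_le_mul (φ1_tst.le _) (mul_le_mul hin (Real.exp_le_exp.2 ?_) (Real.exp_pos _).le (inv_pos.2 X.hc0).le) (by positivity) zero_le_one) (Real.exp_pos _).le
        rw [e]; nlinarith [abs_nonneg l]
    _ = _ := by ring
lemma V_near (l T : ℝ) (z : Γ) (hl : |l| ≤ 1) (hS : 0 ≤ T - s.nm z) :
    N.V l T z ≤ X.v φ1 z (T - s.nm z) * Real.exp (|l| * ((3 * N.B + N.σ2) * (1 + (T - s.nm z)))) ∧
    X.v φ1 z (T - s.nm z) * Real.exp (-(|l| * ((3 * N.B + N.σ2) * (1 + (T - s.nm z))))) ≤ N.V l T z := by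
  obtain ⟨e, hb⟩ := N.expo l T z hl
  have hb := abs_le.1 hb
  have hσ := N.hσ; have hB := N.B1; have hl0 := abs_nonneg l
  have hc := N.J_cmp (l := l) (T := T) z
  rw [N.F_v]
  have hp := inv_pos.2 (X.hp z)
  have hl2 : l^2 ≤ |l| := by nlinarith [sq_abs l]
  have h3 : 0 ≤ l^2 * N.σ2 * (T - s.nm z)/2 := by positivity
  have h4 : l^2 * N.σ2 * (T - s.nm z)/2 ≤ |l| * (N.σ2 * (T - s.nm z)) := by
    have : 0 ≤ N.σ2 * (T - s.nm z) := by positivity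
    nlinarith
  have h5 : |l| * ((3 * N.B + N.σ2) * (1 + (T - s.nm z))) = |l| * N.B * (T - s.nm z) + |l| * (2 * N.B) + |l| * (N.σ2 * (T - s.nm z)) + |l| * (N.B + N.σ2 + 2 * N.B * (T - s.nm z)) := by ring
  have h6 : 0 ≤ |l| * (N.B + N.σ2 + 2 * N.B * (T - s.nm z)) := by positivity
  have J0 : 0 ≤ J W (N.F 0 T) T z := J_nn (N.F_nn 0 T) z
  unfold V
  constructor
  · calc _ ≤ (Real.exp (l * N.ψ z + |l| * N.B * (T - s.nm z)) * J W (N.F 0 T) T z) * (Real.exp (-(T - s.nm z)) * (X.h z)⁻¹ * Real.exp (- N.Z l z - l^2 * N.σ2 * T / 2)) :=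
          mul_le_mul_of_nonneg_right hc.1 (by positivity)
      _ = Real.exp (-(T - s.nm z)) * J W (N.F 0 T) T z * (X.h z)⁻¹ * Real.exp ((l * N.ψ z + (- N.Z l z - l^2 * N.σ2 * T / 2)) + |l| * N.B * (T - s.nm z)) := by
          rw [Real.exp_add, Real.exp_add, Real.exp_add]; ring
      _ ≤ _ := by
          refine mul_le_mul_of_nonneg_left (Real.exp_le_exp.2 ?_) (by positivity)
          rw [e, h5]; linarith
  · calc _ ≤ Real.exp (-(T - s.nm z)) * J W (N.F 0 T) T z * (X.h z)⁻¹ * Real.exp ((l * N.ψ z + (- N.Z l z - l^2 * N.σ2 * T / 2)) - |l| * N.B * (T - s.nm z)) := by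
          refine mul_le_mul_of_nonneg_left (Real.exp_le_exp.2 ?_) (by positivity)
          rw [e, h5]; linarith
      _ = (Real.exp (l * N.ψ z - |l| * N.B * (T - s.nm z)) * J W (N.F 0 T) T z) * (Real.exp (-(T - s.nm z)) * (X.h z)⁻¹ * Real.exp (- N.Z l z - l^2 * N.σ2 * T / 2)) := by
          rw [show (l * N.ψ z + (- N.Z l z - l^2 * N.σ2 * T / 2)) - |l| * N.B * (T - s.nm z) = (l * N.ψ z - |l| * N.B * (T - s.nm z)) + (- N.Z l z - l^2 * N.σ2 * T / 2) by ring, Real.exp_add]; ring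
      _ ≤ _ := mul_le_mul_of_nonneg_right hc.2 (by positivity)
lemma V_up {C : ℝ} (hC : 0 ≤ C) {l T K M : ℝ} (hl : |l| ≤ 1) (hq : ∀ z, |∑ u ∈ W.U, X.kP z u * Real.exp (N.Z l (u*z) - N.Z l z) - 1| ≤ C)
    (hK : W.Bm ≤ K) (hM0 : 0 ≤ M) (hM : ∀ z, K - W.Bm ≤ T - s.nm z → T - s.nm z ≤ K → N.V l T z ≤ M) (z : Γ) (hz : K - W.Bm ≤ T - s.nm z) :
    N.V l T z ≤ Real.exp (C * (T - s.nm z)) * (M + (X.c0⁻¹ * Real.exp (2 * N.B)) * (Real.exp (W.Bm - K) - Real.exp (-(T - s.nm z)))) := by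
  have hc0 := inv_pos.2 X.hc0
  obtain ⟨C1, hC1⟩ : ∃ x, x = X.c0⁻¹ * Real.exp (2 * N.B) := ⟨_, rfl⟩
  have hC10 : 0 ≤ C1 := by rw [hC1]; positivity
  rw [← hC1]
  have G0 : ∀ S, K - W.Bm ≤ S → 0 ≤ C1 * (Real.exp (W.Bm - K) - Real.exp (-S)) := fun S hS => mul_nonneg hC10 (by
    have := Real.exp_le_exp.2 (show -S ≤ W.Bm - K by linarith); linarith)
  have base : ∀ z, K - W.Bm ≤ T - s.nm z → T - s.nm z ≤ K → N.V l T z ≤ Real.exp (C * (T - s.nm z)) * (M + C1 * (Real.exp (W.Bm - K) - Real.exp (-(T - s.nm z)))) := by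
    intro z h1 h2
    have h3 : 1 ≤ Real.exp (C * (T - s.nm z)) := Real.one_le_exp (mul_nonneg hC (by linarith))
    have := G0 _ h1
    have := hM z h1 h2
    nlinarith
  refine ind (Q := fun z S => S = T - s.nm z → K - W.Bm ≤ T - s.nm z → N.V l T z ≤ Real.exp (C * (T - s.nm z)) * (M + C1 * (Real.exp (W.Bm - K) - Real.exp (-(T - s.nm z))))) ?_ ?_ z _ rfl hz
  · intro z S hS e h
    have hb := (bb_ge (X := X) 1).trans (bb_le 1)
    exact base z h (by linarith)
  · intro z S hS ih e h
    by_cases hSK : T - s.nm z ≤ K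
    · exact base z h hSK
    rw [← e] at hSK h ⊢
    push Not at hSK
    obtain ⟨G, hG⟩ : ∃ x, x = M + C1 * (Real.exp (W.Bm - K) - Real.exp (-(S-1))) := ⟨_, rfl⟩
    have hG0 : 0 ≤ G := by rw [hG]; have := G0 (S-1) (by linarith [(bb_ge (X := X) 1).trans (bb_le 1)]); linarith
    have key : ∀ u, X.kP z u ≠ 0 → N.V l T (u*z) ≤ Real.exp (C * (S-1)) * G := by
      intro u hu
      have hb := X.kP_b hu
      have eb : T - s.nm (u*z) = S - b s z u := by unfold b; linarith
      have := ih (u*z) (T - s.nm (u*z)) (by rw [eb]; linarith) rfl (by rw [eb]; linarith)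
      rw [eb] at this
      refine this.trans (mul_le_mul (Real.exp_le_exp.2 (mul_le_mul_of_nonneg_left (by linarith) hC)) ?_ ?_ (Real.exp_pos _).le)
      · rw [hG]
        have := Real.exp_le_exp.2 (show -(S-1) ≤ -(S - b s z u) by linarith)
        nlinarith
      · have := G0 (S - b s z u) (by linarith); linarith
    rw [N.V_eq]
    have hf := N.V_force l T z hl
    rw [← hC1, ← e] at hf
    have hsum : ∑ u ∈ W.U, X.kP z u * (Real.exp (N.Z l (u*z) - N.Z l z) * N.V l T (u*z)) ≤ (1 + C) * (Real.exp (C * (S-1)) * G) := by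
      calc _ ≤ ∑ u ∈ W.U, X.kP z u * Real.exp (N.Z l (u*z) - N.Z l z) * (Real.exp (C * (S-1)) * G) := Finset.sum_le_sum fun u _ => by
            by_cases h0 : X.kP z u = 0
            · simp [h0]
            rw [← mul_assoc]; exact mul_le_mul_of_nonneg_left (key u h0) (mul_nonneg (X.kP0 _ _) (Real.exp_pos _).le)
        _ = (∑ u ∈ W.U, X.kP z u * Real.exp (N.Z l (u*z) - N.Z l z)) * (Real.exp (C * (S-1)) * G) := by rw [Finset.sum_mul]
        _ ≤ _ := mul_le_mul_of_nonneg_right (by linarith [(abs_le.1 (hq z)).2]) (by positivity)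
    have h1 : (1 + C) * Real.exp (C * (S-1)) ≤ Real.exp (C * S) := by
      rw [show C * S = C + C * (S-1) by ring, Real.exp_add]
      exact mul_le_mul_of_nonneg_right (by linarith [Real.add_one_le_exp C]) (Real.exp_pos _).le
    have h2 : 1 ≤ Real.exp (C * S) := Real.one_le_exp (by positivity)
    have h3 : Real.exp (-S) + Real.exp (-S) ≤ Real.exp (-(S-1)) := by
      rw [show -(S-1) = 1 + -S by ring, Real.exp_add]
      nlinarith [Real.add_one_le_exp (1:ℝ), Real.exp_pos (-S)]
    have h4 : C1 * Real.exp (-S) ≤ Real.exp (C*S) * (C1 * Real.exp (-S)) := le_mul_of_one_le_left (by positivity) h2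
    have h5 : (1 + C) * (Real.exp (C * (S-1)) * G) ≤ Real.exp (C*S) * G := by rw [← mul_assoc]; exact mul_le_mul_of_nonneg_right h1 hG0
    have h6 : C1 * Real.exp (-S) + G ≤ M + C1 * (Real.exp (W.Bm - K) - Real.exp (-S)) := by rw [hG]; nlinarith
    have h7 := mul_le_mul_of_nonneg_left h6 (Real.exp_pos (C*S)).le
    rw [show Real.exp (-(T - s.nm z)) = Real.exp (-S) by rw [e]] at *
    linarith
lemma V_lo {C : ℝ} (hC : 0 ≤ C) (hC2 : C ≤ 1/2) {l T K M : ℝ} (hq : ∀ z, |∑ u ∈ W.U, X.kP z u * Real.exp (N.Z l (u*z) - N.Z l z) - 1| ≤ C)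
    (hK : W.Bm ≤ K) (hM0 : 0 ≤ M) (hM : ∀ z, K - W.Bm ≤ T - s.nm z → T - s.nm z ≤ K → M ≤ N.V l T z) (z : Γ) (hz : K - W.Bm ≤ T - s.nm z) :
    Real.exp (-(2 * C * (T - s.nm z))) * M ≤ N.V l T z := by
  have base : ∀ z, K - W.Bm ≤ T - s.nm z → T - s.nm z ≤ K → Real.exp (-(2 * C * (T - s.nm z))) * M ≤ N.V l T z := by
    intro z h1 h2
    exact (mul_le_of_le_one_left hM0 (Real.exp_le_one_iff.2 (by have : 0 ≤ 2 * C * (T - s.nm z) := mul_nonneg (by linarith) (by linarith)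
                                                                linarith))).trans (hM z h1 h2)
  refine ind (Q := fun z S => S = T - s.nm z → K - W.Bm ≤ T - s.nm z → Real.exp (-(2 * C * (T - s.nm z))) * M ≤ N.V l T z) ?_ ?_ z _ rfl hz
  · intro z S hS e h
    have hb := (bb_ge (X := X) 1).trans (bb_le 1)
    exact base z h (by linarith)
  · intro z S hS ih e h
    by_cases hSK : T - s.nm z ≤ K
    · exact base z h hSK
    rw [← e] at hSK h ⊢
    push Not at hSK
    have key : ∀ u, X.kP z u ≠ 0 → Real.exp (-(2 * C * (S-1))) * M ≤ N.V l T (u*z) := by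
      intro u hu
      have hb := X.kP_b hu
      have eb : T - s.nm (u*z) = S - b s z u := by unfold b; linarith
      have := ih (u*z) (T - s.nm (u*z)) (by rw [eb]; linarith) rfl (by rw [eb]; linarith)
      rw [eb] at this
      refine le_trans (mul_le_mul_of_nonneg_right (Real.exp_le_exp.2 ?_) hM0) this
      nlinarith
    rw [N.V_eq]
    have hf : 0 ≤ N.F l T z * (Real.exp (-(T - s.nm z)) * (X.h z)⁻¹ * Real.exp (- N.Z l z - l^2 * N.σ2 * T / 2)) :=
      mul_nonneg (N.F_nn _ _ _) (by have := X.hp z; positivity)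
    have hsum : (1 - C) * (Real.exp (-(2 * C * (S-1))) * M) ≤ ∑ u ∈ W.U, X.kP z u * (Real.exp (N.Z l (u*z) - N.Z l z) * N.V l T (u*z)) := by
      calc _ ≤ (∑ u ∈ W.U, X.kP z u * Real.exp (N.Z l (u*z) - N.Z l z)) * (Real.exp (-(2 * C * (S-1))) * M) :=
            mul_le_mul_of_nonneg_right (by linarith [(abs_le.1 (hq z)).1]) (by positivity)
        _ = ∑ u ∈ W.U, X.kP z u * Real.exp (N.Z l (u*z) - N.Z l z) * (Real.exp (-(2 * C * (S-1))) * M) := by rw [Finset.sum_mul]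
        _ ≤ _ := Finset.sum_le_sum fun u _ => by
            by_cases h0 : X.kP z u = 0
            · simp [h0]
            rw [← mul_assoc (X.kP z u) _ (N.V l T (u*z))]; exact mul_le_mul_of_nonneg_left (key u h0) (mul_nonneg (X.kP0 _ _) (Real.exp_pos _).le)
    have h1 : Real.exp (-(2*C)) ≤ 1 - C := by
      have h1 : 1 + C ≤ Real.exp C := by linarith [Real.add_one_le_exp C]
      have h2 : Real.exp (-(2*C)) * (Real.exp C * Real.exp C) = 1 := by rw [← Real.exp_add, ← Real.exp_add]; ring_nf; simp
      have h3 : (1+C)*(1+C) ≤ Real.exp C * Real.exp C := mul_le_mul h1 h1 (by linarith) (Real.exp_pos _).le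
      have h4 : 1 ≤ (1 - C) * ((1+C)*(1+C)) := by
        have : 0 ≤ C * (1 - C - C^2) := mul_nonneg hC (by nlinarith)
        nlinarith
      have hp := Real.exp_pos (-(2*C))
      have h5 : Real.exp (-(2*C)) * ((1+C)*(1+C)) ≤ 1 := (mul_le_mul_of_nonneg_left h3 hp.le).trans h2.le
      have h6 : 0 < (1+C)*(1+C) := by positivity
      by_contra hcon
      push Not at hcon
      nlinarith
    have h2 : Real.exp (-(2 * C * S)) ≤ (1 - C) * Real.exp (-(2 * C * (S-1))) := by
      rw [show -(2 * C * S) = -(2*C) + -(2 * C * (S-1)) by ring, Real.exp_add]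
      exact mul_le_mul_of_nonneg_right h1 (Real.exp_pos _).le
    have h3 := mul_le_mul_of_nonneg_right h2 hM0
    rw [mul_assoc (1 - C)] at h3
    linarith
end Mart
end PaperCLT
end

section
open Filter Set
namespace PaperCLT
open Walk Eig
lemma l_zero (θ : ℝ) : Tendsto (fun T : ℝ => |θ / √T|) atTop (nhds 0) := by
  have := (Real.tendsto_sqrt_atTop.const_div_atTop θ).abs
  rwa [abs_zero] at this
lemma l_cube (θ : ℝ) : Tendsto (fun T : ℝ => |θ / √T|^3 * T) atTop (nhds 0) := by
  have h : Tendsto (fun T : ℝ => |θ|^3 / √T) atTop (nhds 0) := Real.tendsto_sqrt_atTop.const_div_atTop _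
  refine h.congr' ?_
  filter_upwards [eventually_gt_atTop 0] with T hT
  have h1 := Real.sqrt_pos.2 hT
  rw [abs_div, abs_of_pos h1]
  have : T = √T * √T := (Real.mul_self_sqrt hT.le).symm
  rw [div_pow]
  nth_rw 3 [this]
  field_simp
namespace Mart
variable {Γ : Type*} [Group Γ] {s : Setup Γ} {W : Walk s} {X : Eig W} (N : Mart X)
lemma V_lim {c : ℝ} (hc : 0 < c) (hren : ∀ η > 0, ∃ S0, ∀ S ≥ S0, ∀ z, |X.v φ1 z S - c| ≤ η) (θ : ℝ) (x : Γ) :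
    Tendsto (fun T => N.V (θ / √T) T x) atTop (nhds c) := by
  obtain ⟨C, hC, hq⟩ := N.Z_mean
  rw [Metric.tendsto_atTop']
  intro ε hε
  obtain ⟨η, hη⟩ : ∃ η, η = min (c/2) (ε/4) := ⟨_, rfl⟩
  have hη0 : 0 < η := by rw [hη]; positivity
  have hη1 : η < c := by have := min_le_left (c/2) (ε/4); linarith
  have hη2 : η ≤ ε/4 := by rw [hη]; exact min_le_right _ _
  obtain ⟨S0, hS0⟩ := hren η hη0
  have hσ := N.hσ; have hB := N.B1
  have hBm := (bb_ge (X := X) 1).trans (bb_le 1)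
  obtain ⟨C1, hC1⟩ : ∃ x, x = X.c0⁻¹ * Real.exp (2 * N.B) := ⟨_, rfl⟩
  have hC10 : 0 ≤ C1 := by rw [hC1]; have := X.hc0; positivity
  have hlim : Tendsto (fun K : ℝ => C1 * Real.exp (W.Bm - K)) atTop (nhds (C1 * 0)) := by
    refine Tendsto.const_mul _ (Real.tendsto_exp_atBot.comp ?_)
    exact tendsto_atBot_add_const_left _ _ tendsto_neg_atTop_atBot
  rw [mul_zero] at hlim
  obtain ⟨K, h1, h2, h3⟩ := ((hlim.eventually (gt_mem_nhds hη0)).and ((eventually_ge_atTop (S0 + W.Bm)).and (eventually_ge_atTop W.Bm))).exists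
  obtain ⟨B2, hB2⟩ : ∃ x, x = (3 * N.B + N.σ2) * (1 + K) := ⟨_, rfl⟩
  have hU : Tendsto (fun T : ℝ => Real.exp (C * (|θ / √T|^3 * T)) * ((c + η) * Real.exp (|θ / √T| * B2) + η)) atTop (nhds (Real.exp (C * 0) * ((c + η) * Real.exp (0 * B2) + η))) :=
    ((Real.continuous_exp.tendsto _).comp ((l_cube θ).const_mul C)).mul ((((Real.continuous_exp.tendsto _).comp ((l_zero θ).mul_const B2)).const_mul _).add_const _)
  have hL : Tendsto (fun T : ℝ => Real.exp (-(2 * C * (|θ / √T|^3 * T))) * ((c - η) * Real.exp (-(|θ / √T| * B2)))) atTop (nhds (Real.exp (-(2 * C * 0)) * ((c - η) * Real.exp (-(0 * B2))))) :=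
    ((Real.continuous_exp.tendsto _).comp ((l_cube θ).const_mul (2*C)).neg).mul ((((Real.continuous_exp.tendsto _).comp ((l_zero θ).mul_const B2).neg).const_mul _))
  have hCl : Tendsto (fun T : ℝ => C * |θ / √T|^3) atTop (nhds (C * 0^3)) := ((l_zero θ).pow 3).const_mul C
  have e1 := hU.eventually (gt_mem_nhds (show _ < c + ε by simp; linarith))
  have e2 := hL.eventually (lt_mem_nhds (show c - ε < _ by simp; linarith))
  have e3 := hCl.eventually (gt_mem_nhds (show _ < (1/2 : ℝ) by simp))
  have e4 := (l_zero θ).eventually (gt_mem_nhds (show (0:ℝ) < 1 by norm_num))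
  obtain ⟨T0, hT0⟩ := eventually_atTop.1 (e1.and (e2.and (e3.and (e4.and ((eventually_ge_atTop (K + s.nm x)).and (eventually_ge_atTop 0))))))
  refine ⟨T0, fun T hT => ?_⟩
  obtain ⟨a1, a2, a3, a4, a5, a6⟩ := hT0 T hT.le
  obtain ⟨l, hl⟩ : ∃ l, l = θ / √T := ⟨_, rfl⟩
  simp only [← hl] at a1 a2 a3 a4 ⊢
  have hl0 := abs_nonneg l
  have hB20 : ∀ S, 0 ≤ S → S ≤ K → |l| * ((3 * N.B + N.σ2) * (1 + S)) ≤ |l| * B2 := fun S h h' => by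
    rw [hB2]; gcongr
  have near : ∀ z, K - W.Bm ≤ T - s.nm z → T - s.nm z ≤ K → N.V l T z ≤ (c + η) * Real.exp (|l| * B2) ∧ (c - η) * Real.exp (-(|l| * B2)) ≤ N.V l T z := by
    intro z g1 g2
    have g3 := N.V_near l T z a4.le (by linarith)
    have g4 := abs_le.1 (hS0 (T - s.nm z) (by linarith) z)
    have g5 := hB20 _ (by linarith) g2
    constructor
    · exact g3.1.trans (mul_le_mul (by linarith) (Real.exp_le_exp.2 g5) (Real.exp_pos _).le (by linarith))
    · refine le_trans (mul_le_mul (by linarith) (Real.exp_le_exp.2 (by linarith)) (Real.exp_pos _).le ?_) g3.2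
      linarith
  have hxz := s.nm_nonneg x
  have up := N.V_up (C := C * |l|^3) (by positivity) a4.le (fun z => hq l a4.le z) h3 (by positivity) (fun z g1 g2 => (near z g1 g2).1) x (by linarith)
  have lo := N.V_lo (C := C * |l|^3) (by positivity) a3.le (fun z => hq l a4.le z) h3 (mul_nonneg (by linarith) (Real.exp_pos _).le) (fun z g1 g2 => (near z g1 g2).2) x (by linarith)
  rw [← hC1] at up
  have hcl : 0 ≤ C * |l|^3 := by positivity
  have q1 : C * |l|^3 * (T - s.nm x) ≤ C * (|l|^3 * T) := by nlinarith
  have u1 : N.V l T x ≤ Real.exp (C * (|l|^3 * T)) * ((c + η) * Real.exp (|l| * B2) + η) := by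
    refine up.trans (mul_le_mul (Real.exp_le_exp.2 q1) ?_ ?_ (Real.exp_pos _).le)
    · have := mul_nonneg hC10 (Real.exp_pos (-(T - s.nm x))).le
      linarith
    · have := Real.exp_le_exp.2 (show -(T - s.nm x) ≤ W.Bm - K by linarith)
      have := mul_nonneg hC10 (sub_nonneg.2 this)
      positivity
  have u2 : Real.exp (-(2 * C * (|l|^3 * T))) * ((c - η) * Real.exp (-(|l| * B2))) ≤ N.V l T x := by
    refine le_trans (mul_le_mul_of_nonneg_right (Real.exp_le_exp.2 ?_) (mul_nonneg (by linarith) (Real.exp_pos _).le)) lo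
    linarith
  rw [Real.dist_eq, abs_lt]; constructor <;> linarith
lemma J_lim {c : ℝ} (hc : 0 < c) (hren : ∀ η > 0, ∃ S0, ∀ S ≥ S0, ∀ z, |X.v φ1 z S - c| ≤ η) (θ : ℝ) (x : Γ) :
    Tendsto (fun T => J W (N.F (θ / √T) T) T x * Real.exp (-T)) atTop (nhds (c * X.h x * Real.exp (-s.nm x) * Real.exp (θ^2 * N.σ2 / 2))) := by
  have h1 := N.V_lim hc hren θ x
  have hl : Tendsto (fun T : ℝ => θ / √T) atTop (nhds 0) := Real.tendsto_sqrt_atTop.const_div_atTop θ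
  have hZ : Tendsto (fun T : ℝ => N.Z (θ / √T) x) atTop (nhds 0) := by
    have : Tendsto (fun l => N.Z l x) (nhds 0) (nhds (N.Z 0 x)) := Continuous.tendsto (by unfold Z; fun_prop) 0
    have h0 : N.Z 0 x = 0 := by unfold Z; ring
    rw [h0] at this; exact this.comp hl
  have h2 := ((h1.mul_const (X.h x)).mul_const (Real.exp (-s.nm x))).mul (((Real.continuous_exp.tendsto _).comp (hZ.add_const (θ^2 * N.σ2/2))))
  rw [zero_add] at h2
  refine h2.congr' ?_
  filter_upwards [eventually_gt_atTop 0] with T hT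
  have e : (θ / √T)^2 * N.σ2 * T / 2 = θ^2 * N.σ2 / 2 := by
    rw [div_pow, Real.sq_sqrt hT.le]; field_simp
  simp only [V, Function.comp_apply]
  rw [e]
  have hp := (X.hp x).ne'
  have e2 : Real.exp (-(T - s.nm x)) = Real.exp (-T) * Real.exp (s.nm x) := by rw [← Real.exp_add]; ring_nf
  have e3 : Real.exp (-N.Z (θ / √T) x - θ^2 * N.σ2/2) = (Real.exp (N.Z (θ / √T) x + θ^2 * N.σ2/2))⁻¹ := by rw [← Real.exp_neg]; ring_nf
  rw [e2, e3, Real.exp_neg (s.nm x)]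
  have := (Real.exp_pos (N.Z (θ / √T) x + θ^2 * N.σ2/2)).ne'
  have := (Real.exp_pos (s.nm x)).ne'
  field_simp
/-- total exponential sums -/
theorem total (Y : Mix X) (H : NA W) : ∃ C > 0, ∀ θ : ℝ, Tendsto (fun T => (∑ᶠ y, N.F (θ / √T) T y) * Real.exp (-T)) atTop (nhds (C * Real.exp (θ^2 * N.σ2 / 2))) := by
  obtain ⟨c, hc, hren⟩ := renewal Y H
  have hlim : ∀ θ : ℝ, Tendsto (fun T => (∑ᶠ y, N.F (θ / √T) T y) * Real.exp (-T)) atTop (nhds ((∑ x ∈ W.F0, c * X.h x * Real.exp (-s.nm x)) * Real.exp (θ^2 * N.σ2 / 2))) := by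
    intro θ
    have := tendsto_finset_sum W.F0 fun x _ => N.J_lim hc hren θ x
    rw [Finset.sum_mul]
    refine this.congr fun T => ?_
    rw [J_total (fun y hy => N.F_zero y hy), Finset.sum_mul]
  refine ⟨_, ?_, hlim⟩
  have hne : W.F0.Nonempty := by
    by_contra hem
    rw [Finset.not_nonempty_iff_eq_empty] at hem
    have := J_total (W := W) (F := N.F 0 1) (T := 1) (fun y hy => N.F_zero y hy)
    rw [hem, Finset.sum_empty] at this
    have h1 : N.F 0 1 1 ≤ ∑ᶠ y, N.F 0 1 y := by
      have hf := Walk.supp_fin (s := s) (G := N.F 0 1) (T := 1) (fun y hy => N.F_zero y hy)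
      exact single_le_finsum 1 hf (N.F_nn 0 1)
    rw [this] at h1
    unfold F φ1 at h1
    rw [s.nm_one] at h1; norm_num at h1
  exact Finset.sum_pos (fun x _ => by have := X.hp x; positivity) hne
end Mart
end PaperCLT
end

section
open Filter Set
namespace PaperCLT
open Walk Eig
namespace Mart
variable {Γ : Type*} [Group Γ] {s : Setup Γ} {W : Walk s} {X : Eig W}
lemma Pn_sum (f : ℕ → Γ → ℝ) (m K : ℕ) (z : Γ) : X.P^[m] (fun z => ∑ n ∈ Finset.range K, f n z) z = ∑ n ∈ Finset.range K, X.P^[m] (f n) z := by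
  induction K with
  | zero => simpa using X.Pn_const 0 m z
  | succ K ih => simp only [Finset.sum_range_succ]; rw [X.Pn_add, ih]
lemma ν_zero (Y : Mix X) {f : Γ → ℝ} (hf : LB s f) (f0 : ∀ z, 0 ≤ f z) (h : X.ν f = 0) :
    ∃ C ≥ 0, ∀ x, f x ≤ C * Real.exp (-s.c * s.nm x) := by
  obtain ⟨D, cl⟩ := hf.cl Y
  obtain ⟨M, B, lip, bd⟩ := hf
  obtain ⟨C, hC, hr⟩ := W.reach
  have hM := lip.nonneg
  have hB : 0 ≤ B := (abs_nonneg _).trans (bd 1)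
  have hc := s.hc
  refine ⟨M * Real.exp (s.c * C) + B * Real.exp (s.c * (5 * W.R)), by positivity, fun x => ?_⟩
  rw [add_mul]
  by_cases hx : 5 * W.R ≤ s.nm x
  swap
  · push Not at hx
    have h1 : 1 ≤ Real.exp (s.c * (5 * W.R)) * Real.exp (-s.c * s.nm x) := by
      rw [← Real.exp_add]; apply Real.one_le_exp; nlinarith
    have h2 := le_of_abs_le (bd x)
    have h3 : 0 ≤ M * Real.exp (s.c * C) * Real.exp (-s.c * s.nm x) := by positivity
    nlinarith
  have h4 : 0 ≤ B * Real.exp (s.c * (5 * W.R)) * Real.exp (-s.c * s.nm x) := by positivity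
  suffices f x ≤ M * Real.exp (s.c * C) * Real.exp (-s.c * s.nm x) by linarith
  by_contra hcon
  push Not at hcon
  obtain ⟨N, hN⟩ := hr (s.nm x)
  obtain ⟨a, ha⟩ : ∃ a, a = f x - M * Real.exp (s.c * C) * Real.exp (-s.c * s.nm x) := ⟨_, rfl⟩
  have ha0 : 0 < a := by linarith
  have hα := X.α0
  have key : ∀ z, X.α^N * a ≤ ∑ n ∈ Finset.range (N+1), X.P^[n] f z := by
    intro z
    obtain ⟨l, hl, p1, -, p2, -⟩ := hN x z z hx le_rfl
    have h5 := path_lower (W := W) X.kP0 hα.le (fun z u hu hk => X.kP_low hk) f0 l z p1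
    have h6 : a ≤ f (wprod l * z) := by
      have h7 := le_of_abs_le (lip x (wprod l * z))
      have h8 : s.E x (wprod l * z) ≤ Real.exp (s.c * C) * Real.exp (-s.c * s.nm x) := by
        unfold Setup.E; rw [← Real.exp_add, s.gp_comm]; apply Real.exp_le_exp.2; nlinarith
      nlinarith
    have h9 : X.α^N ≤ X.α^l.length := pow_le_pow_of_le_one hα.le X.α1 hl
    have h10 : X.P^[l.length] f z ≤ ∑ n ∈ Finset.range (N+1), X.P^[n] f z :=
      Finset.single_le_sum (f := fun n => X.P^[n] f z) (fun n _ => X.Pn_ge f0 n z) (Finset.mem_range.2 (by omega))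
    refine le_trans ?_ (h5.trans h10)
    exact mul_le_mul h9 h6 ha0.le (by positivity)
  have h11 : ∀ m, X.α^N * a ≤ ∑ n ∈ Finset.range (N+1), X.P^[m+n] f 1 := by
    intro m
    have := X.Pn_ge key m 1
    rw [Pn_sum] at this
    simpa only [← Function.iterate_add_apply] using this
  have h12 : Tendsto (fun m => ∑ n ∈ Finset.range (N+1), X.P^[m+n] f 1) atTop (nhds (∑ n ∈ Finset.range (N+1), (0:ℝ))) :=
    tendsto_finset_sum _ fun n _ => by
      have := Y.νlim cl; rw [h] at this; exact this.comp (tendsto_add_atTop_nat n)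
  have h13 := ge_of_tendsto' h12 h11
  rw [Finset.sum_const_zero] at h13
  have : 0 < X.α^N * a := by positivity
  linarith
variable (N : Mart X)
lemma σ_zero (Y : Mix X) (h : N.σ2 = 0) : ∃ C, ∀ g, |N.ψ g| ≤ C := by
  obtain ⟨M, mlip⟩ := N.mlip
  have LBQ : LB s (fun z => ∑ u ∈ W.U, X.kP z u * (N.m (u*z) - N.m z)^2) := by
    have h1 : ∀ u ∈ W.U, ∀ z z' : Γ, |(N.m (u*z) - N.m z)^2 - (N.m (u*z') - N.m z')^2| ≤ _ := fun u hu z z' => by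
      have := ((mlip u hu).mul (mlip u hu) (fun z => N.mB z u hu) (fun z => N.mB z u hu)) z z'; simp only [pow_two]; exact this
    exact LB_mean (X := X) (fun z u => (N.m (u*z) - N.m z)^2) h1 (B := N.B^2) (fun z u hu => by
      rw [abs_pow]; exact pow_le_pow_left₀ (abs_nonneg _) (N.mB z u hu) 2)
  have q0 : ∀ z, ∀ u ∈ W.U, 0 ≤ X.kP z u * (N.m (u*z) - N.m z)^2 := fun z u _ => mul_nonneg (X.kP0 _ _) (sq_nonneg _)
  obtain ⟨C, hC, hQ⟩ := ν_zero Y LBQ (fun z => Finset.sum_nonneg (q0 z)) (N.νsq h)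
  have hα := X.α0
  have hc := s.hc
  obtain ⟨D, hD⟩ : ∃ D, D = Real.sqrt (C / X.α) := ⟨_, rfl⟩
  have D0 : 0 ≤ D := by rw [hD]; positivity
  have step : ∀ z, ∀ u ∈ W.U, W.κ ≤ W.k z u → |N.m (u*z) - N.m z| ≤ D * Real.exp (-(s.c/2) * s.nm z) := by
    intro z u hu hk
    have h1 := (Finset.single_le_sum (q0 z) hu).trans (hQ z)
    have h2 := mul_le_mul_of_nonneg_right (X.kP_low hk) (sq_nonneg (N.m (u*z) - N.m z))
    apply abs_le_of_sq_le_sq _ (by positivity)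
    rw [mul_pow, hD, Real.sq_sqrt (by positivity), ← Real.exp_nat_mul, div_mul_eq_mul_div, le_div_iff₀ hα]
    have e : ((2:ℕ):ℝ) * (-(s.c/2) * s.nm z) = -s.c * s.nm z := by push_cast; ring
    rw [e]; linarith
  have r1 : Real.exp (-(s.c/2)) < 1 := by rw [Real.exp_lt_one_iff]; linarith
  obtain ⟨G, hG⟩ : ∃ G, G = D / (1 - Real.exp (-(s.c/2))) := ⟨_, rfl⟩
  have G0 : 0 ≤ G := by rw [hG]; exact div_nonneg D0 (by linarith)
  have GD : D + G * Real.exp (-(s.c/2)) = G := by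
    rw [hG]; field_simp [(by linarith : (1 - Real.exp (-(s.c/2))) ≠ 0)]; ring
  have chain : ∀ (l : List Γ) (z : Γ), PathOK W.U W.k W.κ z l → |N.m (wprod l * z) - N.m z| ≤ G * Real.exp (-(s.c/2) * s.nm z) := by
    intro l
    induction l with
    | nil => intro z _; simp only [wprod, one_mul, sub_self, abs_zero]; positivity
    | cons u l ih =>
      intro z ⟨hu, hk, hl⟩
      have h1 := ih _ hl
      have h2 := step z u hu hk
      have h3 := (W.kb z u (by linarith [W.κ0])).1
      have h4 : Real.exp (-(s.c/2) * s.nm (u*z)) ≤ Real.exp (-(s.c/2)) * Real.exp (-(s.c/2) * s.nm z) := by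
        rw [← Real.exp_add]; apply Real.exp_le_exp.2; nlinarith [W.R1]
      have h5 : N.m (wprod (u::l) * z) - N.m z = (N.m (wprod l * (u*z)) - N.m (u*z)) + (N.m (u*z) - N.m z) := by
        simp only [wprod, mul_assoc]; ring
      rw [h5]
      refine (abs_add_le _ _).trans ?_
      have h6 := mul_le_mul_of_nonneg_left h4 G0
      have h7 : G * Real.exp (-(s.c/2) * s.nm z) = D * Real.exp (-(s.c/2) * s.nm z) + G * (Real.exp (-(s.c/2)) * Real.exp (-(s.c/2) * s.nm z)) := by
        rw [← mul_assoc, ← add_mul, GD]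
      linarith
  have hψ : ∀ g, |N.ψ g| ≤ |N.m g| + N.B := by
    intro g
    have e : N.ψ g = N.m g - N.χ g := by rw [N.hm]; unfold ψ; ring
    rw [e]; exact (abs_sub _ _).trans (by linarith [N.χB g])
  have R1 := W.R1
  refine ⟨(G + |N.m 1| + N.B) + (s.A * (5*W.R) + s.A + |N.κ| * (5 * W.R)), fun g => ?_⟩
  have hA := s.hA
  have t1 : 0 ≤ s.A * (5*W.R) := by positivity
  have t2 : 0 ≤ |N.κ| * (5 * W.R) := by positivity
  by_cases hg : 5 * W.R ≤ s.nm g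
  · obtain ⟨n, hn⟩ := W.path (s.nm g)
    obtain ⟨l, -, hl, hp⟩ := hn g⁻¹ (by rw [s.nm_inv]; exact hg) (by rw [s.nm_inv])
    have h1 := chain l 1 (hp 1 (by
      have := s.gp_le_left 1 g⁻¹; rw [s.nm_one] at this; linarith [W.p0, s.hδ]))
    rw [hl, inv_inv, mul_one, s.nm_one] at h1
    simp only [mul_zero, Real.exp_zero, mul_one] at h1
    have h2 := abs_sub_abs_le_abs_sub (N.m g) (N.m 1)
    linarith [hψ g]
  · push Not at hg
    have h1 := s.eA g
    have h0 : 0 ≤ s.q g := metric_nonneg s.me _ _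
    have h2 : s.q g ≤ s.A * s.nm g + s.A := h1
    have h3 : |N.ψ g| ≤ s.q g + |N.κ| * s.nm g := by
      unfold ψ; refine (abs_sub _ _).trans ?_
      rw [abs_mul, abs_of_nonneg h0, abs_of_nonneg (s.nm_nonneg g)]
    have h4 : s.A * s.nm g ≤ s.A * (5 * W.R) := mul_le_mul_of_nonneg_left hg.le (by linarith)
    have h5 : |N.κ| * s.nm g ≤ |N.κ| * (5 * W.R) := mul_le_mul_of_nonneg_left hg.le (abs_nonneg _)
    linarith [abs_nonneg (N.m 1), N.B1]
end Mart
end PaperCLT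
end

section
open Filter Set
namespace PaperCLT
open Walk Eig
lemma coeff_unique {f : ℝ → ℝ} {a b : ℕ → ℝ} (ha : ∀ᶠ x in nhds (0:ℝ), HasSum (fun n => x^n * a n) (f x))
    (hb : ∀ᶠ x in nhds (0:ℝ), HasSum (fun n => x^n * b n) (f x)) : a = b := by
  have h1 : HasFPowerSeriesAt f (FormalMultilinearSeries.ofScalars ℝ a) 0 := by
    rw [hasFPowerSeriesAt_iff]; simpa [FormalMultilinearSeries.coeff_ofScalars] using ha
  have h2 : HasFPowerSeriesAt f (FormalMultilinearSeries.ofScalars ℝ b) 0 := by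
    rw [hasFPowerSeriesAt_iff]; simpa [FormalMultilinearSeries.coeff_ofScalars] using hb
  exact FormalMultilinearSeries.ofScalars_series_injective ℝ ℝ (h1.eq_formalMultilinearSeries h2)
lemma gauss_series (v x : ℝ) : HasSum (fun n => x^n * (if Even n then (v/2)^(n/2) / (n/2).factorial else 0)) (Real.exp (x^2 * v / 2)) := by
  have h := NormedSpace.expSeries_div_hasSum_exp (𝔸 := ℝ) (x^2*v/2)
  rw [← Real.exp_eq_exp_ℝ] at h
  have inj : Function.Injective (fun k : ℕ => 2 * k) := fun a b h => by simp at h; exact h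
  rw [← inj.hasSum_iff]
  · refine h.congr_fun ?_ |> fun h => h
    intro k
    simp [pow_mul]
    rw [show x^2*v/2 = x^2 * (v/2) by ring, mul_pow]; ring
  · intro n hn
    have : ¬ Even n := fun ⟨k, hk⟩ => hn ⟨k, by simp; omega⟩
    simp [this]
lemma abs_pow_le_exp (x : ℝ) (p : ℕ) : |x|^p / p.factorial ≤ Real.exp x + Real.exp (-x) := by
  have h := Real.pow_div_factorial_le_exp |x| (abs_nonneg x) p
  rcases abs_cases x with ⟨h1, _⟩ | ⟨h1, _⟩ <;> rw [h1] at h ⊢ <;> linarith [Real.exp_pos x, Real.exp_pos (-x)]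
lemma mean_abs_le {ι : Type*} (S : Finset ι) (Y : ι → ℝ) (p : ℕ) :
    (S.card:ℝ)⁻¹ * ∑ g ∈ S, |Y g|^p ≤ p.factorial * ((S.card:ℝ)⁻¹ * ∑ g ∈ S, Real.exp (1 * Y g) + (S.card:ℝ)⁻¹ * ∑ g ∈ S, Real.exp (-1 * Y g)) := by
  rw [← mul_add, ← Finset.sum_add_distrib, mul_left_comm]
  refine mul_le_mul_of_nonneg_left ?_ (by positivity)
  rw [Finset.mul_sum]
  refine Finset.sum_le_sum fun g _ => ?_
  have := abs_pow_le_exp (Y g) p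
  rw [div_le_iff₀ (by positivity)] at this
  simp only [one_mul, neg_mul]; linarith
theorem moments {ι : Type*} (S : ℝ → Finset ι) (Y : ℝ → ι → ℝ) {v : ℝ} (hv : 0 ≤ v)
    (h : ∀ θ : ℝ, Tendsto (fun T => ((S T).card:ℝ)⁻¹ * ∑ g ∈ S T, Real.exp (θ * Y T g)) atTop (nhds (Real.exp (θ^2 * v / 2))))
    (p : ℕ) (hp : Even p) (hp2 : 2 ≤ p) :
    Tendsto (fun T => ((S T).card:ℝ)⁻¹ * ∑ g ∈ S T, (Y T g)^p) atTop (nhds (Real.sqrt v ^ p * ((p - 1).doubleFactorial : ℝ))) := by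
  rw [tendsto_iff_ultrafilter]
  intro 𝒰 h𝒰
  obtain ⟨m, hm⟩ : ∃ m : ℕ → ℝ → ℝ, m = fun p T => ((S T).card:ℝ)⁻¹ * ∑ g ∈ S T, (Y T g)^p := ⟨_, rfl⟩
  obtain ⟨B, hB⟩ : ∃ B, B = Real.exp (1^2 * v / 2) + Real.exp ((-1)^2 * v / 2) + 1 := ⟨_, rfl⟩
  have B0 : 0 ≤ B := by rw [hB]; positivity
  have hbd : ∀ᶠ T in (𝒰 : Filter ℝ), ∀ p, |m p T| ≤ p.factorial * B := by
    have := ((h 1).add (h (-1))).eventually (gt_mem_nhds (show _ < B by rw [hB]; linarith))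
    filter_upwards [h𝒰 this] with T hT p
    rw [hm]
    simp only [abs_mul, abs_inv, Nat.abs_cast]
    refine le_trans ?_ ((mean_abs_le (S T) (Y T) p).trans (mul_le_mul_of_nonneg_left hT.le (by positivity)))
    refine mul_le_mul_of_nonneg_left ?_ (by positivity)
    refine (Finset.abs_sum_le_sum_abs _ _).trans (le_of_eq ?_)
    exact Finset.sum_congr rfl fun g _ => abs_pow _ _
  have hlim : ∀ p, ∃ M, Tendsto (m p) 𝒰 (nhds M) := by
    intro p
    have hc : IsCompact (Icc (-(p.factorial * B)) (p.factorial * B)) := isCompact_Icc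
    obtain ⟨M, -, hM⟩ := hc.ultrafilter_le_nhds (𝒰.map (m p)) (by
      rw [le_principal_iff]; show _ ∈ (𝒰 : Filter ℝ)
      filter_upwards [hbd] with T hT
      exact abs_le.1 (hT p))
    exact ⟨M, hM⟩
  choose M hM using hlim
  have key : ∀ᶠ x in nhds (0:ℝ), HasSum (fun n => x^n * (M n / n.factorial)) (Real.exp (x^2 * v / 2)) := by
    filter_upwards [Metric.ball_mem_nhds (0:ℝ) (show (0:ℝ) < 1/2 by norm_num)] with x hx
    have hx' : |x| < 1/2 := by simpa using hx
    have hb : Summable (fun n : ℕ => (1/2:ℝ)^n * B) := (summable_geometric_of_lt_one (by norm_num) (by norm_num)).mul_right B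
    have bnd : ∀ T, (∀ p, |m p T| ≤ p.factorial * B) → ∀ n : ℕ, ‖x^n * (m n T / n.factorial)‖ ≤ (1/2:ℝ)^n * B := by
      intro T hT n
      rw [Real.norm_eq_abs, abs_mul, abs_pow, abs_div, Nat.abs_cast]
      refine mul_le_mul (pow_le_pow_left₀ (abs_nonneg _) hx'.le n) ?_ (by positivity) (by positivity)
      rw [div_le_iff₀ (by positivity)]; linarith [hT n]
    have t1 : Tendsto (fun T => ∑' n, x^n * (m n T / n.factorial)) 𝒰 (nhds (∑' n, x^n * (M n / n.factorial))) :=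
      tendsto_tsum_of_dominated_convergence hb (fun n => ((hM n).div_const _).const_mul _) (by
        filter_upwards [hbd] with T hT n using bnd T hT n)
    have t2 : ∀ T, ∑' n, x^n * (m n T / n.factorial) = ((S T).card:ℝ)⁻¹ * ∑ g ∈ S T, Real.exp (x * Y T g) := by
      intro T
      have : HasSum (fun n => x^n * (m n T / n.factorial)) (((S T).card:ℝ)⁻¹ * ∑ g ∈ S T, Real.exp (x * Y T g)) := by
        have h1 : HasSum (fun n : ℕ => ∑ g ∈ S T, (x * Y T g)^n / n.factorial) (∑ g ∈ S T, Real.exp (x * Y T g)) :=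
          hasSum_sum fun g _ => by rw [Real.exp_eq_exp_ℝ]; exact NormedSpace.expSeries_div_hasSum_exp _
        refine (h1.mul_left ((S T).card:ℝ)⁻¹).congr_fun fun n => ?_
        rw [hm]; simp only [mul_pow]
        rw [← Finset.sum_div, ← Finset.mul_sum]; ring
      exact this.tsum_eq
    simp only [t2] at t1
    have t3 := tendsto_nhds_unique t1 ((h x).mono_left h𝒰)
    rw [← t3]
    apply Summable.hasSum
    refine Summable.of_norm_bounded hb fun n => ?_
    refine le_of_tendsto (((hM n).div_const (n.factorial:ℝ)).const_mul (x^n)).norm ?_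
    filter_upwards [hbd] with T hT using bnd T hT n
  have hc := congrFun (coeff_unique key (Eventually.of_forall fun x => gauss_series v x)) p
  have := hM p
  rw [hm] at this
  convert this using 2
  rw [if_pos hp, div_eq_iff (by positivity)] at hc
  rw [hc]
  obtain ⟨k, rfl⟩ := hp
  obtain ⟨j, rfl⟩ : ∃ j, k = j + 1 := ⟨k-1, by omega⟩
  rw [show (j+1+(j+1))/2 = j+1 by omega, show (j+1+(j+1)) = 2 * (j+1) by ring, pow_mul, Real.sq_sqrt hv]
  have f1 := Nat.factorial_eq_mul_doubleFactorial (2*j+1)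
  have f2 := Nat.doubleFactorial_two_mul (j+1)
  rw [show 2 * (j+1) - 1 = 2*j+1 by omega]
  rw [show 2*j+1+1 = 2*(j+1) by ring, f2] at f1
  rw [f1]; push_cast; field_simp; rw [← mul_pow]; congr 1; ring
end PaperCLT
end

section
open Filter Set
namespace PaperCLT
open Walk Eig
section
variable {Γ : Type*} [Group Γ] {s : Setup Γ}
noncomputable def Setup.Bl (s : Setup Γ) (T : ℝ) : Finset Γ := (s.fin T).toFinset
lemma mem_Bl {T : ℝ} {g : Γ} : g ∈ s.Bl T ↔ s.nm g < T := (s.fin T).mem_toFinset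
lemma Bl_card (T : ℝ) : (ball s.d T).ncard = (s.Bl T).card := ncard_eq_toFinset_card _ (s.fin T)
lemma Bl_sum (T : ℝ) (f : Γ → ℝ) : ∑ᶠ g ∈ ball s.d T, f g = ∑ g ∈ s.Bl T, f g := finsum_mem_eq_finite_toFinset_sum _ (s.fin T)
lemma Bl_pos {T : ℝ} (hT : 0 < T) : (0:ℝ) < (s.Bl T).card := by
  have : (s.Bl T).Nonempty := ⟨1, mem_Bl.2 (by rw [s.nm_one]; exact hT)⟩
  exact_mod_cast this.card_pos
lemma mean_nm {C : ℝ} (hC : 0 < C) (h : Tendsto (fun T => ((s.Bl T).card:ℝ) * Real.exp (-T)) atTop (nhds C)) :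
    Tendsto (fun T => ((s.Bl T).card:ℝ)⁻¹ * ∑ g ∈ s.Bl T, s.nm g / T) atTop (nhds 1) := by
  classical
  rw [Metric.tendsto_nhds]
  intro η hη
  obtain ⟨a, ha⟩ : ∃ a, a = min (η/2) (1/2) := ⟨_, rfl⟩
  have a0 : 0 < a := by rw [ha]; positivity
  have a1 : a ≤ 1/2 := by rw [ha]; exact min_le_right _ _
  have a2 : a ≤ η/2 := by rw [ha]; exact min_le_left _ _
  have h1 : Tendsto (fun T => (((s.Bl ((1-a)*T)).card:ℝ) * Real.exp (-((1-a)*T))) / (((s.Bl T).card:ℝ) * Real.exp (-T)) * Real.exp (-(a*T))) atTop (nhds (C/C*0)) := by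
    refine ((h.comp (tendsto_id.const_mul_atTop (by linarith : 0 < 1-a))).div h hC.ne').mul ?_
    exact Real.tendsto_exp_neg_atTop_nhds_zero.comp (tendsto_id.const_mul_atTop a0)
  rw [mul_zero] at h1
  filter_upwards [h1.eventually (gt_mem_nhds (show (0:ℝ) < η/2 by linarith)), eventually_gt_atTop 0] with T hT T0
  have hp := Bl_pos (s := s) T0
  have e1 : (((s.Bl ((1-a)*T)).card:ℝ) * Real.exp (-((1-a)*T))) / (((s.Bl T).card:ℝ) * Real.exp (-T)) * Real.exp (-(a*T)) = ((s.Bl ((1-a)*T)).card:ℝ) / (s.Bl T).card := by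
    rw [show -((1-a)*T) = -T + a*T by ring, Real.exp_add, Real.exp_neg (a*T)]; field_simp
  rw [e1, div_lt_iff₀ hp] at hT
  have up : ∑ g ∈ s.Bl T, s.nm g / T ≤ (s.Bl T).card * 1 := by
    rw [← nsmul_eq_mul]; exact Finset.sum_le_card_nsmul _ _ _ fun g hg => by rw [div_le_one T0]; exact (mem_Bl.1 hg).le
  have lo : ((s.Bl T).card:ℝ) * (1-a) - (s.Bl ((1-a)*T)).card ≤ ∑ g ∈ s.Bl T, s.nm g / T := by
    have : ∑ g ∈ s.Bl T, ((1-a) - if g ∈ s.Bl ((1-a)*T) then (1:ℝ) else 0) ≤ ∑ g ∈ s.Bl T, s.nm g / T := by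
      refine Finset.sum_le_sum fun g hg => ?_
      split_ifs with hc
      · have : 0 ≤ s.nm g / T := div_nonneg (s.nm_nonneg g) T0.le
        linarith
      · rw [mem_Bl, not_lt] at hc
        rw [sub_zero, le_div_iff₀ T0]; exact hc
    rw [Finset.sum_sub_distrib, Finset.sum_const, nsmul_eq_mul] at this
    have h3 : ∑ g ∈ s.Bl T, (if g ∈ s.Bl ((1-a)*T) then (1:ℝ) else 0) ≤ (s.Bl ((1-a)*T)).card := by
      rw [Finset.sum_ite, Finset.sum_const_zero, add_zero, Finset.sum_const, nsmul_eq_mul, mul_one]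
      exact_mod_cast Finset.card_le_card fun g hg => (Finset.mem_filter.1 hg).2
    linarith
  rw [Real.dist_eq, abs_lt]
  rw [inv_mul_eq_div]
  constructor
  · rw [lt_sub_iff_add_lt, lt_div_iff₀ hp]; nlinarith
  · rw [sub_lt_iff_lt_add, div_lt_iff₀ hp]; nlinarith
theorem core (H : ∀ W : Walk s, NA W) (hn : ¬ RoughlySimilar s.d s.e) (hτ : IsMeanDistortion s.d s.e 1) :
    ∃ C σ2 : ℝ, 0 < C ∧ 0 < σ2 ∧
      Tendsto (fun T : ℝ => piMoment s.d s.e 0 T / (C * Real.exp T)) atTop (nhds 1) ∧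
      (∀ p : ℕ, Even p → 2 ≤ p →
        Tendsto (fun T : ℝ => piMoment s.d s.e p T /
            (C * Real.sqrt σ2 ^ p * ((p - 1).doubleFactorial : ℝ) * Real.exp T * T ^ (p / 2)))
          atTop (nhds 1)) ∧
      (∀ p : ℕ, Even p → 2 ≤ p →
        Tendsto (fun T : ℝ => (((ball s.d T).ncard : ℝ))⁻¹ *
            ∑ᶠ g ∈ ball s.d T, ((s.e 1 g - s.d 1 g) / Real.sqrt T) ^ p)
          atTop (nhds (Real.sqrt σ2 ^ p * ((p - 1).doubleFactorial : ℝ)))) := by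
  obtain ⟨W⟩ := s.exists_walk
  obtain ⟨X⟩ := W.exists_eig
  obtain ⟨Y⟩ := X.exists_mix
  obtain ⟨N⟩ := exists_mart Y
  obtain ⟨C, C0, tot⟩ := N.total Y (H W)
  have e1 : ∀ θ T : ℝ, ∑ᶠ y, N.F (θ / √T) T y = ∑ g ∈ s.Bl T, Real.exp (θ * (N.ψ g / √T)) := by
    intro θ T
    rw [finsum_eq_sum_of_support_subset (s := s.Bl T)]
    · refine Finset.sum_congr rfl fun g hg => ?_
      unfold Mart.F φ1; rw [if_pos (sub_pos.2 (mem_Bl.1 hg)), one_mul]; congr 1; ring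
    · intro g hg
      rw [Finset.mem_coe, mem_Bl]
      by_contra hcon
      apply hg
      unfold Mart.F φ1; rw [if_neg (by linarith), zero_mul]
  simp only [e1] at tot
  have cnt : Tendsto (fun T => ((s.Bl T).card:ℝ) * Real.exp (-T)) atTop (nhds C) := by
    have := tot 0
    simpa using this
  have mgf : ∀ θ : ℝ, Tendsto (fun T => ((s.Bl T).card:ℝ)⁻¹ * ∑ g ∈ s.Bl T, Real.exp (θ * (N.ψ g / √T))) atTop (nhds (Real.exp (θ^2 * N.σ2 / 2))) := by
    intro θ
    have := (tot θ).div cnt C0.ne'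
    rw [mul_div_cancel_left₀ _ C0.ne'] at this
    refine this.congr fun T => ?_
    have := Real.exp_pos (-T)
    rw [Pi.div_apply, mul_div_mul_right _ _ this.ne', inv_mul_eq_div]
  -- κ = 1
  have hκ : N.κ = 1 := by
    have ab : Tendsto (fun T => ((s.Bl T).card:ℝ)⁻¹ * ∑ g ∈ s.Bl T, N.ψ g / T) atTop (nhds 0) := by
      have b1 : Tendsto (fun T : ℝ => (((Nat.factorial 1 : ℕ):ℝ) * (((s.Bl T).card:ℝ)⁻¹ * ∑ g ∈ s.Bl T, Real.exp (1 * (N.ψ g / √T)) + ((s.Bl T).card:ℝ)⁻¹ * ∑ g ∈ s.Bl T, Real.exp (-1 * (N.ψ g / √T)))) * (√T)⁻¹) atTop (nhds (_ * 0)) :=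
        (((mgf 1).add (mgf (-1))).const_mul _).mul (tendsto_inv_atTop_zero.comp Real.tendsto_sqrt_atTop)
      rw [mul_zero] at b1
      refine squeeze_zero_norm' ?_ b1
      filter_upwards [eventually_gt_atTop 0] with T T0
      have := mul_le_mul_of_nonneg_right (mean_abs_le (s.Bl T) (fun g => N.ψ g / √T) 1) (inv_nonneg.2 (Real.sqrt_nonneg T))
      refine le_trans ?_ this
      rw [norm_mul, Real.norm_of_nonneg (by positivity), mul_assoc]
      refine mul_le_mul_of_nonneg_left ?_ (by positivity)
      refine (norm_sum_le _ _).trans (le_of_eq ?_)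
      rw [Finset.sum_mul]
      refine Finset.sum_congr rfl fun g _ => ?_
      rw [Real.norm_eq_abs, pow_one, abs_div, abs_div, abs_of_pos T0, abs_of_pos (Real.sqrt_pos.2 T0)]
      conv_lhs => rw [← Real.mul_self_sqrt T0.le]
      field_simp
    have c1 := ((mean_nm C0 cnt).const_mul N.κ).add ab
    have c2 : Tendsto (fun T => ((s.Bl T).card:ℝ)⁻¹ * ∑ g ∈ s.Bl T, s.e 1 g / T) atTop (nhds 1) := by
      refine hτ.congr fun T => ?_
      rw [Bl_card, Bl_sum]
    have c3 := tendsto_nhds_unique (c1.congr fun T => ?_) c2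
    · linarith
    · rw [mul_left_comm, ← mul_add, Finset.mul_sum, ← Finset.sum_add_distrib]
      congr 1
      refine Finset.sum_congr rfl fun g _ => ?_
      unfold Mart.ψ Setup.q; ring
  have hψ : ∀ g, N.ψ g = s.e 1 g - s.d 1 g := by intro g; unfold Mart.ψ; rw [hκ, one_mul]; rfl
  have hσ : 0 < N.σ2 := by
    rcases N.hσ.eq_or_lt with h | h
    swap
    · exact h
    exfalso
    obtain ⟨D, hD⟩ := N.σ_zero Y h.symm
    apply hn
    have D0 : 0 ≤ D := (abs_nonneg _).trans (hD 1)
    refine ⟨1, one_pos, D+1, by linarith, fun g h => ?_⟩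
    have h1 := hD (g⁻¹*h)
    have h2 := s.ld g⁻¹ g h
    have h3 := s.li g⁻¹ g h
    rw [inv_mul_cancel] at h2 h3
    rw [hψ, h2, h3, abs_sub_comm] at h1
    rw [one_mul]; linarith
  have third : ∀ p : ℕ, Even p → 2 ≤ p →
        Tendsto (fun T : ℝ => (((ball s.d T).ncard : ℝ))⁻¹ *
            ∑ᶠ g ∈ ball s.d T, ((s.e 1 g - s.d 1 g) / Real.sqrt T) ^ p)
          atTop (nhds (Real.sqrt N.σ2 ^ p * ((p - 1).doubleFactorial : ℝ))) := by
    intro p hp hp2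
    have := moments s.Bl (fun T g => N.ψ g / √T) N.hσ mgf p hp hp2
    refine this.congr fun T => ?_
    rw [Bl_card, Bl_sum]; simp only [hψ]
  have first : Tendsto (fun T : ℝ => ((s.Bl T).card:ℝ) / (C * Real.exp T)) atTop (nhds 1) := by
    have := cnt.div_const C
    rw [div_self C0.ne'] at this
    refine this.congr fun T => ?_
    rw [Real.exp_neg]; field_simp
  refine ⟨C, N.σ2, C0, hσ, ?_, ?_, third⟩
  · refine first.congr fun T => ?_
    unfold piMoment; rw [Bl_sum]; simp
  · intro p hp hp2
    have hs : 0 < Real.sqrt N.σ2 ^ p * ((p - 1).doubleFactorial : ℝ) := mul_pos (pow_pos (Real.sqrt_pos.2 hσ) _) (by exact_mod_cast Nat.doubleFactorial_pos _)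
    have := (first.mul (third p hp hp2)).div_const (Real.sqrt N.σ2 ^ p * ((p - 1).doubleFactorial : ℝ))
    rw [one_mul, div_self hs.ne'] at this
    refine this.congr' ?_
    filter_upwards [eventually_gt_atTop 0] with T T0
    have hB := Bl_pos (s := s) T0
    unfold piMoment
    rw [Bl_card, Bl_sum, Bl_sum]
    simp only [div_pow]
    rw [← Finset.sum_div]
    obtain ⟨k, rfl⟩ := hp
    have e : √T^(k+k) = T^((k+k)/2) := by
      rw [show (k+k)/2 = k by omega, ← two_mul, pow_mul, Real.sq_sqrt T0.le]
    rw [e]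
    have := Real.sqrt_pos.2 hσ
    have h5 : (0:ℝ) < ((k + k - 1).doubleFactorial : ℝ) := by exact_mod_cast Nat.doubleFactorial_pos _
    field_simp
end
end PaperCLT
end

section
open Filter Set
namespace PaperCLT
open Walk Eig
section
variable {Γ : Type*} [Group Γ] {s : Setup Γ} {W : Walk s}
lemma sh_gp (s : Setup Γ) {ε : ℝ} (hε : 0 < ε) : ∃ D : ℝ, 0 ≤ D ∧ ∀ x y y', s.gp x y + D ≤ s.gp y y' → |s.gp x y - s.gp x y'| ≤ ε := by
  obtain ⟨c, hc, R0, hR0, h⟩ := s.sh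
  obtain ⟨D, hD⟩ : ∃ D, D = max R0 (-Real.log ε / c) := ⟨_, rfl⟩
  have hD1 : R0 ≤ D := hD ▸ le_max_left _ _
  have hD2 : -Real.log ε / c ≤ D := hD ▸ le_max_right _ _
  refine ⟨D, by linarith, fun x y y' hxy => ?_⟩
  have := h D hD1 x 1 y y' (by
    have e1 := s.gp_def x y; have e2 := s.gp_def y y'
    rw [← s.d_eq] at e1 e2
    have e3 : s.d x 1 = s.nm x := s.md.symm _ _
    have e4 : s.d 1 y' = s.nm y' := rfl
    rw [e3, e4]; linarith)
  have e1 := s.gp_def x y; have e2 := s.gp_def x y'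
  rw [← s.d_eq] at e1 e2
  have e3 : s.d 1 y = s.nm y := rfl
  have e4 : s.d 1 y' = s.nm y' := rfl
  rw [e3, e4, show s.d x y - s.nm y - s.d x y' + s.nm y' = -(2 * (s.gp x y - s.gp x y')) by rw [e1, e2]; ring, abs_neg, abs_mul, abs_two] at this
  have h2 : Real.exp (-c * D) ≤ ε := by
    rw [← Real.le_log_iff_exp_le hε]
    rw [div_le_iff₀ hc] at hD2; linarith
  linarith [abs_nonneg (s.gp x y - s.gp x y')]
lemma exists_far (s : Setup Γ) (M : ℝ) : ∃ y, M ≤ s.nm y := by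
  obtain ⟨ρ, p, hp, h⟩ := s.E1 1 M
  obtain ⟨f, _, hf, _⟩ := h (fun _ => 1) (fun _ => 1)
  exact ⟨f, by linarith⟩
lemma cone' (W : Walk s) {f z w : Γ} (h1 : 2 * W.p + (s.δ + 1) ≤ s.nm f) (h2 : s.gp z f ≤ W.p) (h3 : s.gp f⁻¹ w ≤ W.p + 1/2) :
    s.gp z (f * w) ≤ W.p + s.δ := by
  have e := s.gp_mul_self f w
  have h := s.gp_hyp z f (f*w)
  rcases min_choice (s.gp z (f*w)) (s.gp f (f*w)) with q | q <;> rw [q] at h <;> linarith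
lemma long (W : Walk s) (M : ℝ) (Z V : Fin 4 → Γ) : ∃ g, M ≤ s.nm g ∧ (∀ i, s.gp (Z i) g ≤ W.p + s.δ) ∧ ∀ i, s.gp g⁻¹ (V i) ≤ W.p + s.δ := by
  obtain ⟨D, hD, hsh⟩ := sh_gp s (ε := 1/2) (by norm_num)
  obtain ⟨y, hy⟩ := exists_far s (|M| + D + 2 * W.ρ + W.p)
  obtain ⟨f, f1, f2, f3, f4⟩ := W.eone Z (fun _ => y)
  obtain ⟨k, k1, k2, k3, k4⟩ := W.eone (fun _ => (f*y)⁻¹) V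
  have h1 := s.nm_mul_le (f⁻¹) (f * y * k)
  have h2 := s.nm_mul_le (f⁻¹ * (f*y*k)) k⁻¹
  rw [show f⁻¹ * (f*y*k) * k⁻¹ = y by group] at h2
  rw [s.nm_inv] at h1 h2
  refine ⟨f*y*k, ?_, fun i => ?_, fun i => ?_⟩
  · linarith [le_abs_self M, W.p0]
  · rw [mul_assoc]
    refine cone' W f2 (f3 i) ?_
    have e := s.gp_mul_self y k
    have e2 := s.gp_le_right y⁻¹ k
    have := hsh f⁻¹ y (y*k) (by linarith [f4 0, W.p0, abs_nonneg M, s.nm_nonneg f])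
    linarith [abs_le.1 this, f4 0]
  · rw [mul_inv_rev, s.gp_comm]
    refine cone' W (by rw [s.nm_inv]; exact k2) (by rw [s.gp_comm]; exact k4 i) (by rw [inv_inv, s.gp_comm]; linarith [k3 0])
lemma nice_ap (W : Walk s) {ε : ℝ} (hε : 0 < ε) : ∃ M1 : ℝ, ∀ g, Nice W M1 g → |translationLength s.d g - (s.nm g - 2 * s.gp g g⁻¹)| ≤ ε := by
  obtain ⟨D, hD, hsh⟩ := sh_gp s (ε := ε/2) (by linarith)
  obtain ⟨M1, hM1⟩ : ∃ M1, M1 = 2 * W.p + 8 * s.δ + 1 + D := ⟨_, rfl⟩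
  refine ⟨M1, fun g hg => ?_⟩
  obtain ⟨C, hC, h⟩ := nice_len (by linarith) hg
  have hz : s.gp 1 g⁻¹ ≤ W.p + 4 * s.δ := by linarith [s.gp_le_left 1 g⁻¹, s.nm_one, W.p0, s.hδ]
  have key : ∀ j : ℕ, |translationLength s.d g - (s.nm g - 2 * s.gp g g⁻¹)| ≤ ε + C * Real.exp (-s.c * (j+1:ℕ)) := by
    intro j
    have a := h 1 hz (j+1)
    have b1 := (nice_pow (by linarith) hg hz j).1
    rw [mul_one] at a b1
    have e := s.gp_mul_self g (g^j)
    have e2 := s.nm_mul g (g^(j+1))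
    unfold b at a
    rw [s.gp_comm] at b1
    have := hsh g⁻¹ g (g^(j+1)) (by rw [pow_succ', e, s.gp_comm g⁻¹ g]; linarith [hg.1, hg.2, s.hδ])
    rw [s.gp_comm g⁻¹ g] at this
    rw [abs_le] at *
    constructor <;> linarith
  have hT : Tendsto (fun j : ℕ => ε + C * Real.exp (-s.c * (j+1:ℕ))) atTop (nhds (ε + C * 0)) := by
    refine ((Tendsto.const_mul C ?_)).const_add ε
    have : Tendsto (fun j : ℕ => -(s.c * (j:ℝ))) atTop atBot := tendsto_neg_atTop_atBot.comp (tendsto_natCast_atTop_atTop.const_mul_atTop s.hc)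
    exact (Real.tendsto_exp_atBot.comp (this.comp (tendsto_add_atTop_nat 1))).congr fun j => by simp only [Function.comp]; ring_nf
  have := ge_of_tendsto' hT key
  simpa using this
lemma quant (W : Walk s) {M0 a0 : ℝ} (hQ : ∀ g, Nice W M0 g → ∃ k : ℤ, translationLength s.d g = a0 * k) (K : ℝ) {ε : ℝ} (hε : 0 < ε) :
    ∃ T0 : ℝ, ∀ ξ ξ' η η', T0 ≤ s.nm ξ → T0 ≤ s.nm ξ' → T0 ≤ s.nm η → T0 ≤ s.nm η' → s.gp ξ η ≤ K → s.gp ξ' η ≤ K → s.gp ξ η' ≤ K → s.gp ξ' η' ≤ K →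
    ∃ k : ℤ, |2 * (s.gp ξ η - s.gp ξ' η - s.gp ξ η' + s.gp ξ' η') - a0 * k| ≤ ε := by
  obtain ⟨ε', hε'⟩ : ∃ ε', ε' = min (ε/64) (1/8) := ⟨_, rfl⟩
  have he1 : ε' ≤ ε/64 := hε' ▸ min_le_left _ _
  have he2 : ε' ≤ 1/8 := hε' ▸ min_le_right _ _
  have he0 : 0 < ε' := by rw [hε']; positivity
  obtain ⟨D, hD, hsh⟩ := sh_gp s he0
  obtain ⟨M1, hM1⟩ := nice_ap W he0
  obtain ⟨B, hB⟩ : ∃ B, B = 2 * (W.p + s.δ + 2) + D + max M0 M1 := ⟨_, rfl⟩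
  have hB0 : M0 ≤ max M0 M1 := le_max_left _ _
  have hB1 : M1 ≤ max M0 M1 := le_max_right _ _
  refine ⟨2 * (W.p + s.δ + 2) + D + |K| + |max M0 M1|, fun ξ ξ' η η' t1 t2 t3 t4 h1 h2 h3 h4 => ?_⟩
  obtain ⟨g, g1, g2, g3⟩ := long W (2 * (W.p + s.δ + 2) + D + |max M0 M1|) ![η⁻¹, η'⁻¹, 1, 1] ![ξ⁻¹, ξ'⁻¹, 1, 1]
  have key : ∀ x y, 2 * (W.p + s.δ + 2) + D + |K| + |max M0 M1| ≤ s.nm x → 2 * (W.p + s.δ + 2) + D + |K| + |max M0 M1| ≤ s.nm y → s.gp x y ≤ K →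
      s.gp y⁻¹ g ≤ W.p + s.δ → s.gp g⁻¹ x⁻¹ ≤ W.p + s.δ → ∃ k : ℤ, |(s.nm g + s.nm x + s.nm y - 2 * s.gp x y - 2 * s.gp g⁻¹ x⁻¹ - 2 * s.gp g y⁻¹) - a0 * k| ≤ 16 * ε' := by
    intro x y tx ty hK hy hx
    have k1 := abs_nonneg K; have k2 := le_abs_self K
    have k3 := le_abs_self (max M0 M1); have k4 := abs_nonneg (max M0 M1)
    have p0 := W.p0; have d1 := s.hδ
    obtain ⟨w, hw⟩ : ∃ w, w = x⁻¹ * y := ⟨_, rfl⟩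
    have hwi : w⁻¹ = y⁻¹ * x := by rw [hw]; group
    have e1 := s.gp_mul_self x⁻¹ y
    rw [inv_inv, s.nm_inv, ← hw] at e1
    have e2 := s.gp_mul_self y⁻¹ x
    rw [inv_inv, s.nm_inv, ← hwi, s.gp_comm y x] at e2
    have s1 := hsh g⁻¹ x⁻¹ w (by linarith)
    have s2 := hsh g y⁻¹ w⁻¹ (by rw [s.gp_comm g]; linarith)
    rw [abs_le] at s1 s2
    rw [s.gp_comm y⁻¹] at hy
    have nw : s.nm w = s.nm x + s.nm y - 2 * s.gp x y := by have := s.gp_def x y; rw [← hw] at this; linarith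
    have e3 := s.gp_mul_self g w
    have e4 := s.gp_mul_self w⁻¹ g⁻¹
    rw [inv_inv, s.nm_inv, s.gp_comm w, ← mul_inv_rev] at e4
    have s3 := hsh (g*w)⁻¹ w⁻¹
    have nx : s.gp w⁻¹ (y⁻¹) ≤ s.nm w⁻¹ := s.gp_le_left _ _
    rw [s.nm_inv, s.gp_comm w⁻¹, e2] at nx
    have s3 := hsh w⁻¹ g (g*w) (by rw [s.gp_comm w⁻¹]; linarith)
    have s4 := hsh (g*w) w⁻¹ (g*w)⁻¹ (by rw [s.gp_comm (g*w)]; rw [abs_le] at s3; rw [s.gp_comm w⁻¹ g] at s3; linarith)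
    rw [s.gp_comm w⁻¹ g, s.gp_comm w⁻¹] at s3
    rw [abs_le] at s3 s4
    have ng := s.nm_mul g w
    have hn : s.gp (g*w) (g*w)⁻¹ ≤ W.p + 3 * s.δ := by linarith
    have hm : max M0 M1 ≤ s.nm (g*w) := by linarith
    have l1 := hM1 (g*w) ⟨hn, hB1.trans hm⟩
    obtain ⟨k, hk⟩ := hQ (g*w) ⟨hn, hB0.trans hm⟩
    refine ⟨k, ?_⟩
    rw [← hk]; rw [abs_le] at l1 ⊢
    constructor <;> linarith
  obtain ⟨k1, q1⟩ := key ξ η t1 t3 h1 (g2 0) (g3 0)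
  obtain ⟨k2, q2⟩ := key ξ' η t2 t3 h2 (g2 0) (g3 1)
  obtain ⟨k3, q3⟩ := key ξ η' t1 t4 h3 (g2 1) (g3 0)
  obtain ⟨k4, q4⟩ := key ξ' η' t2 t4 h4 (g2 1) (g3 1)
  refine ⟨k2 + k3 - k1 - k4, ?_⟩
  push_cast
  rw [abs_le] at *
  constructor <;> linarith
end
end PaperCLT
end

section
open Filter Set
namespace PaperCLT
open Walk Eig
section
variable {Γ : Type*} [Group Γ] {s : Setup Γ} {W : Walk s}
lemma len_facts (s : Setup Γ) (g : Γ) (hL : 0 < translationLength s.d g) : (∀ n : ℕ, n * translationLength s.d g ≤ s.nm (g^n)) ∧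
    Tendsto (fun n : ℕ => s.nm (g^(n+1)) - s.nm (g^n)) atTop (nhds (translationLength s.d g)) := by
  have hsub : Subadditive (fun n : ℕ => s.nm (g^n)) := fun m n => by show s.nm (g^(m+n)) ≤ _; rw [pow_add]; exact s.nm_mul_le _ _
  have hbdd : BddBelow (range fun n : ℕ => s.nm (g^n) / n) := ⟨0, by rintro _ ⟨n, rfl⟩; exact div_nonneg (s.nm_nonneg _) (Nat.cast_nonneg _)⟩
  have hlim := hsub.tendsto_lim hbdd
  have hL2 : translationLength s.d g = hsub.lim := Tendsto.limUnder_eq hlim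
  have hn : ∀ n : ℕ, n * translationLength s.d g ≤ s.nm (g^n) := by
    intro n
    rcases Nat.eq_zero_or_pos n with rfl | h0
    · simp [s.nm_one]
    · have := hsub.lim_le_div hbdd h0.ne'
      rw [hL2]; rw [le_div_iff₀ (by exact_mod_cast h0)] at this; linarith
  refine ⟨hn, ?_⟩
  obtain ⟨L, eL⟩ : ∃ L, L = translationLength s.d g := ⟨_, rfl⟩
  rw [← eL] at hL hn ⊢
  obtain ⟨C, hC, hv⟩ := s.vd (s.nm g)
  have hr : Real.exp (-s.c * L) < 1 := by rw [Real.exp_lt_one_iff]; nlinarith [s.hc]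
  have hstep : ∀ j : ℕ, dist (s.nm (g^(j+1)) - s.nm (g^j)) (s.nm (g^(j+1+1)) - s.nm (g^(j+1))) ≤ C * Real.exp (s.c * s.nm g) * Real.exp (-s.c * L) ^ j := by
    intro j
    have := hv g⁻¹ (g^j) (g^(j+1)) (by have := s.nm_inv g; exact this.le)
    have e : ∀ j : ℕ, s.nm (g^(j+1)) - s.nm (g^j) = s.d g⁻¹ (g^j) - s.d 1 (g^j) := by intro j; rw [s.d_eq g⁻¹, inv_inv, ← pow_succ']; rfl
    rw [Real.dist_eq, e, e]; refine this.trans ?_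
    rw [mul_assoc, ← Real.exp_nat_mul, ← Real.exp_add]
    refine mul_le_mul_of_nonneg_left (Real.exp_le_exp.2 ?_) hC.le
    have h1 : s.gp (g^j) (g^(j+1)) = (s.nm (g^j) + s.nm (g^(j+1)) - s.nm g) / 2 := by rw [s.gp_def, pow_succ, inv_mul_cancel_left]
    have h2 := hn j; have h3 := hn (j+1); push_cast at h3
    have h4 : gromov s.d 1 (g^j) (g^(j+1)) = s.gp (g^j) (g^(j+1)) := rfl
    rw [h4, h1]
    have := s.nm_nonneg g
    nlinarith [s.hc]
  obtain ⟨a, ha⟩ := cauchySeq_tendsto_of_complete (cauchySeq_of_le_geometric _ _ hr hstep)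
  have h1 := ha.cesaro
  have h2 : Tendsto (fun n : ℕ => s.nm (g^n) / n) atTop (nhds a) := by
    refine h1.congr fun n => ?_
    rw [Finset.sum_range_sub (fun i => s.nm (g^i)) n, pow_zero, s.nm_one, sub_zero]; ring
  have : L = a := by rw [eL, hL2]; exact tendsto_nhds_unique hlim h2
  rw [this]; exact ha
lemma arith (W : Walk s) {M0 a0 : ℝ} (ha : 0 < a0) (hQ : ∀ g, Nice W M0 g → ∃ k : ℤ, translationLength s.d g = a0 * k) (g : Γ) :
    ∃ k : ℤ, translationLength s.d g = a0 / 2 * k := by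
  by_cases hL : 0 < translationLength s.d g
  swap
  · refine ⟨0, ?_⟩
    have hsub : Subadditive (fun n : ℕ => s.nm (g^n)) := fun m n => by show s.nm (g^(m+n)) ≤ _; rw [pow_add]; exact s.nm_mul_le _ _
    have hbdd : BddBelow (range fun n : ℕ => s.nm (g^n) / n) := ⟨0, by rintro _ ⟨n, rfl⟩; exact div_nonneg (s.nm_nonneg _) (Nat.cast_nonneg _)⟩
    have hL2 : translationLength s.d g = hsub.lim := Tendsto.limUnder_eq (hsub.tendsto_lim hbdd)
    have : 0 ≤ hsub.lim := ge_of_tendsto' (hsub.tendsto_lim hbdd) fun n => div_nonneg (s.nm_nonneg _) (Nat.cast_nonneg _)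
    rw [Int.cast_zero, mul_zero]; exact le_antisymm (not_lt.1 hL) (hL2 ▸ this)
  obtain ⟨hn, hT⟩ := len_facts s g hL
  obtain ⟨L, eL⟩ : ∃ L, L = translationLength s.d g := ⟨_, rfl⟩
  rw [← eL] at hL hn hT ⊢
  have key : ∀ ε > 0, ∃ k : ℤ, |2 * L - a0 * k| ≤ ε := by
    intro ε hε
    obtain ⟨D, hD, hsh⟩ := sh_gp s (ε := ε/16) (by linarith)
    obtain ⟨T0, hT0⟩ := quant W hQ (W.p + s.δ + s.nm g) (ε := ε/2) (by linarith)
    have hTe := Metric.tendsto_atTop.1 hT (ε/16) (by linarith)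
    obtain ⟨N0, hN0⟩ := hTe
    obtain ⟨N1, hN1⟩ := exists_nat_ge ((W.p + s.δ + D + s.nm g + |T0|) / L)
    rw [div_le_iff₀ hL] at hN1
    obtain ⟨N, hN⟩ : ∃ N, N = N0 + N1 := ⟨_, rfl⟩
    have hge : ∀ n ≥ N, W.p + s.δ + D + s.nm g + |T0| ≤ s.nm (g^n) := fun n hh => by
      have : (N1:ℝ) ≤ n := by exact_mod_cast (by omega)
      nlinarith [hn n]
    obtain ⟨x, x1, x2, -⟩ := long W (|T0| + s.nm g) ![g^N, (g^(N+1))⁻¹, g^(N+1), (g^(N+2))⁻¹] ![1,1,1,1]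
    have y0 := x2 0; have y1 := x2 1; have y2 := x2 2; have y3 := x2 3
    change s.gp (g^N) x ≤ _ at y0
    change s.gp (g^(N+1))⁻¹ x ≤ _ at y1
    change s.gp (g^(N+1)) x ≤ _ at y2
    change s.gp (g^(N+2))⁻¹ x ≤ _ at y3
    rw [s.gp_comm] at y0 y1 y2 y3
    have ab := le_abs_self T0
    have g0 := s.nm_nonneg g
    have gx := s.nm_mul_le g⁻¹ (g*x)
    rw [inv_mul_cancel_left, s.nm_inv] at gx
    have c1 := s.gp_smul_ge g⁻¹ (g*x) (g*g^N)
    rw [inv_mul_cancel_left, inv_mul_cancel_left, s.nm_inv, ← pow_succ'] at c1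
    have i1 : (g^(N+1))⁻¹ = g * (g^(N+2))⁻¹ := by rw [pow_succ _ (N+1)]; group
    have c2 := s.gp_smul_ge g⁻¹ (g*x) (g*(g^(N+2))⁻¹)
    rw [inv_mul_cancel_left, inv_mul_cancel_left, s.nm_inv, ← i1] at c2
    obtain ⟨k, hk⟩ := hT0 (g*x) x (g^(N+1)) (g^(N+1))⁻¹ (by linarith) (by linarith) (by linarith [hge (N+1) (by omega), W.p0, s.hδ])
      (by rw [s.nm_inv]; linarith [hge (N+1) (by omega), W.p0, s.hδ]) (by linarith) (by linarith) (by linarith) (by linarith)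
    refine ⟨k, ?_⟩
    have q1 : (g^N)⁻¹ * g^(N+1) = g := by rw [pow_succ, inv_mul_cancel_left]
    have q2 : g^(N+1) * (g^(N+2))⁻¹ = g⁻¹ := by rw [pow_succ' g (N+1), mul_inv_rev, mul_inv_cancel_left]
    have s1 := hsh x (g^N) (g^(N+1)) (by
      rw [s.gp_def (g^N), q1]; linarith [hge N (by omega), hge (N+1) (by omega), abs_nonneg T0])
    have s2 := hsh x (g^(N+1))⁻¹ (g^(N+2))⁻¹ (by
      rw [s.gp_def (g^(N+1))⁻¹, inv_inv, q2, s.nm_inv, s.nm_inv, s.nm_inv]; linarith [hge (N+2) (by omega), hge (N+1) (by omega), abs_nonneg T0])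
    have t1 := hN0 N (by omega)
    have t2 := hN0 (N+1) (by omega)
    rw [Real.dist_eq] at t1 t2
    change |s.nm (g^(N+2)) - s.nm (g^(N+1)) - L| < _ at t2
    have d1 : s.gp (g*x) (g^(N+1)) = (s.nm (g*x) + s.nm (g^(N+1)) - (s.nm x + s.nm (g^N) - 2 * s.gp x (g^N)))/2 := by
      rw [s.gp_def, s.gp_def x, mul_inv_rev, pow_succ', mul_assoc, inv_mul_cancel_left]; ring
    have d2 : s.gp (g*x) (g^(N+1))⁻¹ = (s.nm (g*x) + s.nm (g^(N+1)) - (s.nm x + s.nm (g^(N+2)) - 2 * s.gp x (g^(N+2))⁻¹))/2 := by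
      rw [s.gp_def, s.gp_def x, s.nm_inv, s.nm_inv, mul_inv_rev, i1, mul_assoc, inv_mul_cancel_left]; ring
    rw [d1, d2] at hk
    rw [abs_le] at hk s1 s2 ⊢
    rw [abs_lt] at t1 t2
    constructor <;> linarith
  obtain ⟨k, hk⟩ := key (a0/4) (by linarith)
  refine ⟨k, ?_⟩
  have : |2 * L - a0 * k| ≤ 0 := by
    refine le_of_forall_pos_le_add fun ε hε => ?_
    obtain ⟨k', hk'⟩ := key (min ε (a0/4)) (by positivity)
    have m1 := min_le_left ε (a0/4); have m2 := min_le_right ε (a0/4)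
    have : k' = k := by
      have q : |a0 * ((k' - k : ℤ) : ℝ)| < a0 := by
        push_cast; rw [abs_lt]; rw [abs_le] at hk hk'; constructor <;> linarith
      rw [abs_mul, abs_of_pos ha, mul_lt_iff_lt_one_right ha, ← Int.cast_abs] at q
      have : |k' - k| < 1 := by exact_mod_cast q
      rw [Int.abs_lt_one_iff] at this; omega
    rw [this] at hk'; linarith
  have := abs_nonpos_iff.1 this
  linarith
end
end PaperCLT
end

section
open Filter Set
namespace PaperCLT
open Walk Eig
section
variable {Γ : Type*} [Group Γ] {s : Setup Γ} {W : Walk s}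
def Rel (s : Setup Γ) (K T : ℝ) (z z' : Γ) : Prop := T ≤ s.nm z ∧ T ≤ s.nm z' ∧ K ≤ s.gp z z'
lemma rel_symm {K T : ℝ} {z z' : Γ} (h : Rel s K T z z') : Rel s K T z' z := ⟨h.2.1, h.1, by rw [s.gp_comm]; exact h.2.2⟩
lemma chain (W : Walk s) {M0 a0 : ℝ} (ha : 0 < a0) (hQ : ∀ g, Nice W M0 g → ∃ k : ℤ, translationLength s.d g = a0 * k) (a1 : ℝ) :
    ∃ K T, ∀ z w, T ≤ s.nm w → Relation.ReflTransGen (Rel s K T) z w → a1 < s.gp z w := by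
  obtain ⟨a, haa⟩ : ∃ a, a = max a1 (W.p + 2 * s.δ + 1) := ⟨_, rfl⟩
  have h1a : a1 ≤ a := haa ▸ le_max_left _ _
  have h2a : W.p + 2 * s.δ + 1 ≤ a := haa ▸ le_max_right _ _
  obtain ⟨ε, hε'⟩ : ∃ ε', ε' = min (a0/16) 1 := ⟨_, rfl⟩
  have he1 : ε ≤ a0/16 := hε' ▸ min_le_left _ _
  have he2 : ε ≤ 1 := hε' ▸ min_le_right _ _
  have he0 : 0 < ε := by rw [hε']; positivity
  obtain ⟨D, hD, hsh⟩ := sh_gp s he0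
  obtain ⟨K, hK⟩ : ∃ K, K = a + W.p + 2 * s.δ + 1 := ⟨_, rfl⟩
  obtain ⟨T0, hT0⟩ := quant W hQ (K + 1) he0
  have p0 := W.p0; have d1 := s.hδ
  obtain ⟨T, hT⟩ : ∃ T, T = max T0 (K + 1) := ⟨_, rfl⟩
  have t1 : T0 ≤ T := hT ▸ le_max_left _ _
  have t2 : K + 1 ≤ T := hT ▸ le_max_right _ _
  refine ⟨K + D, T, fun z η hη hz => lt_of_le_of_lt h1a ?_⟩
  suffices H : a < s.gp z η ∧ Relation.ReflTransGen (fun u v => Rel s (K + D) T u v ∧ a < s.gp v η) z η from H.1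
  obtain ⟨η', e1, e2, -⟩ := long W T (fun _ => η) (fun _ => 1)
  have e2 := e2 0
  have hηη : s.gp η η = s.nm η := by rw [s.gp_def, inv_mul_cancel, s.nm_one]; ring
  induction hz using Relation.ReflTransGen.head_induction_on with
  | refl => exact ⟨by linarith, .refl⟩
  | @head z z' hzz _ ih =>
    have hch := Relation.ReflTransGen.head (r := fun u v => Rel s (K + D) T u v ∧ a < s.gp v η) ⟨hzz, ih.1⟩ ih.2
    refine ⟨?_, hch⟩
    by_contra hcon
    rw [not_lt] at hcon
    -- one step
    have step : ∀ u v, Rel s (K + D) T u v → a < s.gp v η → s.gp u η ≤ K → |s.gp u η - s.gp v η| ≤ ε ∧ |s.gp u η' - s.gp v η'| ≤ ε ∧ s.gp u η' ≤ W.p + 2 * s.δ ∧ s.gp v η' ≤ W.p + 2 * s.δ := by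
      intro u v hr hv hu
      have q1 := hsh η u v (by rw [s.gp_comm]; linarith [hr.2.2])
      rw [s.gp_comm η u, s.gp_comm η v] at q1
      have B : ∀ u, W.p + 2 * s.δ < s.gp u η → s.gp u η' ≤ W.p + 2 * s.δ := by
        intro u hu
        have h := s.gp_hyp η' η u
        rw [s.gp_comm η' u, s.gp_comm η u, s.gp_comm η' η] at h
        rcases min_choice (s.gp u η') (s.gp u η) with q | q <;> rw [q] at h <;> linarith
      have b1 := B u (by linarith [abs_le.1 q1])
      have q2 := hsh η' u v (by rw [s.gp_comm]; linarith [hr.2.2])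
      rw [s.gp_comm η' u, s.gp_comm η' v] at q2
      exact ⟨q1, q2, b1, B v (by linarith)⟩
    have hz0 := step z z' hzz ih.1 (by linarith)
    have inv : ∀ u, Relation.ReflTransGen (fun u v => Rel s (K + D) T u v ∧ a < s.gp v η) z u → s.gp u η ≤ K ∧ T ≤ s.nm u ∧ |2 * (s.gp u η - s.gp z η - s.gp u η' + s.gp z η')| ≤ ε := by
      intro u hu
      induction hu with
      | refl => exact ⟨by linarith, hzz.1, by ring_nf; simpa using he0.le⟩
      | @tail u v _ huv ih =>
        obtain ⟨i1, i2, i3⟩ := ih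
        obtain ⟨s1, s2, s3, s4⟩ := step u v huv.1 huv.2 i1
        obtain ⟨k, hk⟩ := hT0 v z η η' (by linarith [huv.1.2.1]) (by linarith [hzz.1]) (by linarith) (by linarith)
          (by linarith [abs_le.1 s1]) (by linarith) (by linarith) (by linarith)
        have k0 : k = 0 := by
          have q : |a0 * (k : ℝ)| < a0 := by rw [abs_lt]; rw [abs_le] at *; constructor <;> linarith
          rw [abs_mul, abs_of_pos ha, mul_lt_iff_lt_one_right ha, ← Int.cast_abs] at q
          exact Int.abs_lt_one_iff.1 (by exact_mod_cast q)
        rw [k0, Int.cast_zero, mul_zero, sub_zero] at hk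
        refine ⟨?_, huv.1.2.1, hk⟩
        rw [abs_le] at hk
        linarith [s.gp_nonneg z η']
    linarith [(inv η hch).1]
lemma classes (W : Walk s) {M0 a0 : ℝ} (ha : 0 < a0) (hQ : ∀ g, Nice W M0 g → ∃ k : ℤ, translationLength s.d g = a0 * k) (a1 : ℝ) :
    ∃ (𝒞 : Set (Set Γ)) (r : ℝ), 𝒞.Finite ∧ (∀ A ∈ 𝒞, ∀ g, {x | ¬ (x ∈ A ↔ x * g ∈ A)}.Finite) ∧
      ∀ x y, r ≤ s.nm x → r ≤ s.nm y → s.gp x y ≤ a1 → ∃ A ∈ 𝒞, x ∈ A ∧ y ∉ A := by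
  obtain ⟨K, T, h⟩ := chain W ha hQ a1
  obtain ⟨r, hr⟩ : ∃ r, r = |K| + |T| + 2 * s.C0 := ⟨_, rfl⟩
  have k1 := le_abs_self K; have k2 := abs_nonneg K
  have k3 := le_abs_self T; have k4 := abs_nonneg T
  have hc := s.hC0
  refine ⟨(fun w => {z | T ≤ s.nm z ∧ Relation.ReflTransGen (Rel s K T) z w}) '' {w | s.nm w ≤ r + s.C0 ∧ T ≤ s.nm w}, r, ((s.fin_le (r + s.C0)).subset fun w hw => hw.1).image _, ?_, ?_⟩
  · rintro _ ⟨w, hw, rfl⟩ g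
    refine (s.fin_le (|K| + |T| + s.nm g)).subset fun x hx => ?_
    by_contra hcon
    rw [mem_setOf_eq, not_le] at hcon
    refine hx ?_
    have n1 := s.nm_mul_le (x*g) g⁻¹
    rw [mul_inv_cancel_right, s.nm_inv] at n1
    have e := s.gp_mul_self x g
    have e2 := s.gp_le_right x⁻¹ g
    have hrel : Rel s K T x (x*g) := ⟨by linarith [s.nm_nonneg g], by linarith, by linarith⟩
    exact ⟨fun hA => ⟨hrel.2.1, .head (rel_symm hrel) hA.2⟩, fun hA => ⟨hrel.1, .head hrel hA.2⟩⟩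
  · intro x y hx hy hxy
    obtain ⟨w, w1, w2⟩ := s.head x r (by linarith) hx
    rw [abs_le] at w1
    have hrel : Rel s K T x w := ⟨by linarith, by linarith, by rw [s.gp_comm]; linarith⟩
    refine ⟨_, ⟨w, ⟨by linarith, by linarith⟩, rfl⟩, ⟨hrel.1, .single hrel⟩, fun hy' => ?_⟩
    have : a1 < s.gp y x := h y x hrel.1 (hy'.2.tail (rel_symm hrel))
    rw [s.gp_comm] at this; linarith
end
end PaperCLT
end

section
open Filter Set
namespace PaperCLT
open scoped Pointwise
/-- an invariant nested system of cuts of a group -/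
structure Tr (Γ : Type*) [Group Γ] where
  𝓔 : Set (Set Γ)
  inv : ∀ A ∈ 𝓔, ∀ g : Γ, g • A ∈ 𝓔
  cpl : ∀ A ∈ 𝓔, Aᶜ ∈ 𝓔
  nest : ∀ A ∈ 𝓔, ∀ B ∈ 𝓔, A ⊆ B ∨ A ⊆ Bᶜ ∨ Aᶜ ⊆ B ∨ Aᶜ ⊆ Bᶜ
  ne : ∀ A ∈ 𝓔, A.Nonempty
  fin : ∀ x y, {A | A ∈ 𝓔 ∧ x ∈ A ∧ y ∉ A}.Finite
  prp : ∀ m : ℕ, {g : Γ | {A | A ∈ 𝓔 ∧ 1 ∈ A ∧ g ∉ A}.ncard ≤ m}.Finite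
  orb : ∃ 𝓡 : Set (Set Γ), 𝓡.Finite ∧ 𝓡 ⊆ 𝓔 ∧ ∀ A ∈ 𝓔, ∃ g : Γ, g • A ∈ 𝓡
  Zp : Set Γ → Set Γ
  zf : ∀ A ∈ 𝓔, (Zp A).Finite ∧ (Zp A).Nonempty
  zs : ∀ A, ∀ g : Γ, Zp (g • A) = g • Zp A
  zc : ∀ A, Zp Aᶜ = Zp A
  non : 𝓔.Nonempty
namespace Tr
variable {Γ : Type*} [Group Γ] (t : Tr Γ)
def vx (A : Set Γ) : Set (Set Γ) := {B | B ∈ t.𝓔 ∧ (A ⊆ B ∨ Aᶜ ⊂ B)}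
def o : Set (Set Γ) := {B | B ∈ t.𝓔 ∧ (1:Γ) ∈ B}
variable {t}
lemma smem (g : Γ) (A : Set Γ) : g • A ∈ t.𝓔 ↔ A ∈ t.𝓔 := ⟨fun h => by simpa using t.inv _ h g⁻¹, fun h => t.inv _ h g⟩
lemma vx_smul (g : Γ) (A : Set Γ) : t.vx (g • A) = g • t.vx A := by
  ext B
  rw [mem_smul_set_iff_inv_smul_mem]
  unfold vx
  rw [mem_setOf_eq, mem_setOf_eq, smem, ← smul_set_compl, ssubset_iff_subset_ne, ssubset_iff_subset_ne, smul_set_subset_iff_subset_inv_smul_set, smul_set_subset_iff_subset_inv_smul_set, Ne, Ne, smul_eq_iff_eq_inv_smul]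
lemma nn {A : Set Γ} (hA : A ∈ t.𝓔) (h : A ⊆ Aᶜ) : False := by
  obtain ⟨x, hx⟩ := t.ne A hA; exact h hx hx
lemma nn' {A : Set Γ} (hA : A ∈ t.𝓔) (h : Aᶜ ⊆ A) : False := nn (t.cpl A hA) (by rwa [compl_compl])
/-- exactly one of `B`, `Bᶜ` belongs to a vertex -/
lemma vx_or {A B : Set Γ} (hA : A ∈ t.𝓔) (hB : B ∈ t.𝓔) (h : B ∉ t.vx A) : Bᶜ ∈ t.vx A := by
  refine ⟨t.cpl B hB, ?_⟩
  have h1 : ¬ (A ⊆ B ∨ Aᶜ ⊂ B) := fun q => h ⟨hB, q⟩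
  push Not at h1
  rcases t.nest A hA B hB with q | q | q | q
  · exact absurd q h1.1
  · exact .inl q
  · have : Aᶜ = B := by by_contra hne; exact h1.2 (ssubset_iff_subset_ne.2 ⟨q, hne⟩)
    exact .inl (by rw [← this, compl_compl])
  · refine .inr (ssubset_iff_subset_ne.2 ⟨q, fun e => h1.1 ?_⟩)
    rw [compl_inj_iff] at e; rw [e]
lemma vx_and {A B : Set Γ} (hA : A ∈ t.𝓔) (hB : B ∈ t.vx A) (h : Bᶜ ∈ t.vx A) : False := by
  rcases hB.2 with p | p <;> rcases h.2 with q | q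
  · obtain ⟨x, hx⟩ := t.ne A hA; exact q hx (p hx)
  · exact q.2 (compl_subset_compl.2 p)
  · exact p.2 (by rw [← compl_compl B]; exact compl_subset_compl.2 q)
  · obtain ⟨x, hx⟩ := t.ne _ (t.cpl A hA); exact q.1 hx (p.1 hx)
lemma vx_eq {A : Set Γ} (hA : A ∈ t.𝓔) {v : Set (Set Γ)} (hv : v ⊆ t.𝓔) (h : ∀ B ∈ v, Bᶜ ∉ v) (hs : t.vx A ⊆ v) : t.vx A = v := by
  refine hs.antisymm fun B hB => ?_
  by_contra hc
  exact h B hB (hs (vx_or hA (hv hB) hc))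
lemma V1 {A B : Set Γ} (hA : A ∈ t.𝓔) (hB : B ∈ t.𝓔) (a : (1:Γ) ∉ A) (b : (1:Γ) ∉ B) (h : t.vx A = t.vx B) : A = B := by
  have key : ∀ A B : Set Γ, A ∈ t.𝓔 → (1:Γ) ∉ A → (1:Γ) ∉ B → t.vx A = t.vx B → B ⊆ A := by
    intro A B hA a b h
    have : A ∈ t.vx B := h ▸ ⟨hA, .inl subset_rfl⟩
    rcases this.2 with q | q
    · exact q
    · exact absurd (q.1 b) a
  exact (key B A hB b a h.symm).antisymm (key A B hA a b h)
lemma V2 {A : Set Γ} (hA : A ∈ t.𝓔) (a : (1:Γ) ∈ A) : t.vx A = t.o ∨ ∃ B ∈ t.𝓔, (1:Γ) ∉ B ∧ t.vx B = t.vx A := by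
  obtain ⟨y, hy⟩ := t.ne _ (t.cpl A hA)
  by_cases hm : ∃ C ∈ t.𝓔, (1:Γ) ∈ C ∧ C ⊂ A
  · right
    have hf : {C | C ∈ t.𝓔 ∧ (1:Γ) ∈ C ∧ C ⊂ A}.Finite := (t.fin 1 y).subset fun C hC => ⟨hC.1, hC.2.1, fun h => hy (hC.2.2.1 h)⟩
    obtain ⟨C, ⟨⟨c1, c2, c3⟩, hmax⟩⟩ := hf.exists_maximal (by obtain ⟨C, h1, h2, h3⟩ := hm; exact ⟨C, h1, h2, h3⟩)
    refine ⟨Cᶜ, t.cpl C c1, fun h => h c2, ?_⟩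
    refine (vx_eq hA (fun B hB => hB.1) (fun B h1 h2 => vx_and (t.cpl C c1) h1 h2) fun D hD => ⟨hD.1, ?_⟩).symm
    rw [compl_compl]
    rcases hD.2 with q | q
    · exact .inr (c3.trans_subset q)
    rcases t.nest C c1 D hD.1 with r | r | r | r
    · refine .inr (ssubset_iff_subset_ne.2 ⟨r, fun e => ?_⟩)
      exact nn' hA (q.1.trans (e ▸ c3.1))
    · have : Dᶜ ⊂ A := by rw [← compl_compl A]; exact compl_lt_compl_iff_lt.2 q
      have := hmax ⟨t.cpl D hD.1, r c2, this⟩ r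
      exact .inl (by rw [← compl_compl D]; exact compl_subset_compl.2 this)
    · exact .inl r
    · exact absurd (q.1.trans ((compl_subset_compl.1 r).trans c3.1)) (nn' hA)
  · left
    refine vx_eq hA (fun B hB => hB.1) (fun B h1 h2 => h2.2 h1.2) fun B hB => ⟨hB.1, ?_⟩
    rcases hB.2 with q | q
    · exact q a
    · by_contra hc
      exact hm ⟨Bᶜ, t.cpl B hB.1, hc, by rw [← compl_compl A]; exact compl_lt_compl_iff_lt.2 q⟩
variable (t) in
lemma base : ∃ A ∈ t.𝓔, t.vx A = t.o := by
  obtain ⟨A, hA, a⟩ : ∃ A ∈ t.𝓔, (1:Γ) ∈ A := by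
    obtain ⟨A, hA⟩ := t.non
    by_cases h : (1:Γ) ∈ A
    · exact ⟨A, hA, h⟩
    · exact ⟨Aᶜ, t.cpl A hA, h⟩
  obtain ⟨y, hy⟩ := t.ne _ (t.cpl A hA)
  have hf : {C | C ∈ t.𝓔 ∧ (1:Γ) ∈ C ∧ C ⊆ A}.Finite := (t.fin 1 y).subset fun C hC => ⟨hC.1, hC.2.1, fun h => hy (hC.2.2 h)⟩
  obtain ⟨C, ⟨⟨c1, c2, c3⟩, hmin⟩⟩ := hf.exists_minimal ⟨A, hA, a, subset_rfl⟩
  refine ⟨C, c1, vx_eq c1 (fun B hB => hB.1) (fun B h1 h2 => h2.2 h1.2) fun B hB => ⟨hB.1, ?_⟩⟩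
  rcases hB.2 with q | q
  · exact q c2
  · by_contra hc
    have : Bᶜ ⊂ C := by rw [← compl_compl C]; exact compl_lt_compl_iff_lt.2 q
    exact this.2 (hmin ⟨t.cpl B hB.1, hc, this.1.trans c3⟩ this.1)
lemma par {A : Set Γ} (hA : A ∈ t.𝓔) (a : (1:Γ) ∉ A) : t.vx Aᶜ = t.o ∨ ∃ B, (B ∈ t.𝓔 ∧ (1:Γ) ∉ B ∧ A ⊂ B) ∧ t.vx B = t.vx Aᶜ := by
  rcases V2 (t.cpl A hA) a with h | ⟨B, hB, b, h⟩
  · exact .inl h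
  · refine .inr ⟨B, ⟨hB, b, ?_⟩, h⟩
    have : B ∈ t.vx Aᶜ := h ▸ ⟨hB, .inl subset_rfl⟩
    rcases this.2 with q | q
    · exact absurd (q a) b
    · rwa [compl_compl] at q
variable (t) in
def up (B A : Set Γ) : Prop := (A ∈ t.𝓔 ∧ (1:Γ) ∉ A) ∧ B ∈ t.𝓔 ∧ (1:Γ) ∉ B ∧ A ⊂ B
variable (t) in
lemma up_wf : WellFounded t.up := by
  refine Subrelation.wf (r := InvImage (· < ·) fun A : Set Γ => {C | C ∈ t.𝓔 ∧ (1:Γ) ∉ C ∧ A ⊆ C}.ncard) (fun {B A} h => ?_) (InvImage.wf _ Nat.lt_wfRel.wf)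
  obtain ⟨⟨h1, h2⟩, h3, h4, h5⟩ := h
  obtain ⟨x, hx⟩ := t.ne A h1
  refine ncard_lt_ncard (ssubset_iff_subset_ne.2 ⟨fun C hC => ⟨hC.1, hC.2.1, h5.1.trans hC.2.2⟩, fun e => ?_⟩) ((t.fin x 1).subset fun C hC => ⟨hC.1, hC.2.2 hx, hC.2.1⟩)
  have : A ∈ {C | C ∈ t.𝓔 ∧ (1:Γ) ∉ C ∧ B ⊆ C} := e ▸ ⟨h1, h2, subset_rfl⟩
  exact h5.2 this.2.2
lemma uniq {X : Type*} (T : Set Γ → X → X) {Φ Ψ : Set (Set Γ) → X} (h1 : ∀ A ∈ t.𝓔, Φ (t.vx A) = T A (Φ (t.vx Aᶜ))) (h2 : ∀ A ∈ t.𝓔, Ψ (t.vx A) = T A (Ψ (t.vx Aᶜ)))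
    (h0 : Φ t.o = Ψ t.o) {A : Set Γ} (hA : A ∈ t.𝓔) : Φ (t.vx A) = Ψ (t.vx A) := by
  have key : ∀ A, A ∈ t.𝓔 → (1:Γ) ∉ A → Φ (t.vx A) = Ψ (t.vx A) := by
    intro A
    induction A using (up_wf t).induction with
    | _ A ih =>
      intro hA a
      rw [h1 A hA, h2 A hA]
      rcases par hA a with e | ⟨B, hB, e⟩
      · rw [e, h0]
      · rw [← e, ih B ⟨⟨hA, a⟩, hB⟩ hB.1 hB.2.1]
  by_cases a : (1:Γ) ∈ A
  · rcases V2 hA a with e | ⟨B, hB, b, e⟩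
    · rw [e, h0]
    · rw [← e, key B hB b]
  · exact key A hA a
open Classical in
lemma pot {X : Type*} (Fib : Set (Set Γ) → Set X) (T : Set Γ → X → X) {x0 : X} (hx : x0 ∈ Fib t.o)
    (hT : ∀ A ∈ t.𝓔, ∀ x ∈ Fib (t.vx Aᶜ), T A x ∈ Fib (t.vx A) ∧ T Aᶜ (T A x) = x) :
    ∃ Φ : Set (Set Γ) → X, Φ t.o = x0 ∧ ∀ A ∈ t.𝓔, Φ (t.vx A) ∈ Fib (t.vx A) ∧ Φ (t.vx A) = T A (Φ (t.vx Aᶜ)) := by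
  let F : Set Γ → X := (up_wf t).fix fun A ih => T A (if h : ∃ B, t.up B A ∧ t.vx B = t.vx Aᶜ then ih h.choose h.choose_spec.1 else x0)
  have hF : ∀ A, F A = T A (if h : ∃ B, t.up B A ∧ t.vx B = t.vx Aᶜ then F h.choose else x0) := fun A => by
    exact (up_wf t).fix_eq _ _
  let Φ : Set (Set Γ) → X := fun v => if h : ∃ B, (B ∈ t.𝓔 ∧ (1:Γ) ∉ B) ∧ t.vx B = v then F h.choose else x0
  have hno : ∀ B, B ∈ t.𝓔 → (1:Γ) ∉ B → t.vx B ≠ t.o := fun B hB b e => by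
    have : B ∈ t.o := e ▸ ⟨hB, .inl subset_rfl⟩
    exact b this.2
  have Φo : Φ t.o = x0 := by
    refine dif_neg ?_
    rintro ⟨B, ⟨hB, b⟩, e⟩; exact hno B hB b e
  have ΦB : ∀ B, B ∈ t.𝓔 → (1:Γ) ∉ B → Φ (t.vx B) = F B := by
    intro B hB b
    have h : ∃ C, (C ∈ t.𝓔 ∧ (1:Γ) ∉ C) ∧ t.vx C = t.vx B := ⟨B, ⟨hB, b⟩, rfl⟩
    show (if h : ∃ C, (C ∈ t.𝓔 ∧ (1:Γ) ∉ C) ∧ t.vx C = t.vx B then F h.choose else x0) = _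
    rw [dif_pos h, V1 h.choose_spec.1.1 hB h.choose_spec.1.2 b h.choose_spec.2]
  have ΦF : ∀ A, A ∈ t.𝓔 → (1:Γ) ∉ A → F A = T A (Φ (t.vx Aᶜ)) := by
    intro A hA a
    rw [hF]
    congr 1
    split_ifs with h
    · exact (ΦB _ h.choose_spec.1.2.1 h.choose_spec.1.2.2.1).symm.trans (congrArg Φ h.choose_spec.2)
    · rcases par hA a with e | ⟨B, hB, e⟩
      · rw [e, Φo]
      · exact absurd ⟨B, ⟨⟨hA, a⟩, hB⟩, e⟩ h
  have m1 : ∀ A, A ∈ t.𝓔 → (1:Γ) ∉ A → Φ (t.vx A) ∈ Fib (t.vx A) ∧ Φ (t.vx Aᶜ) ∈ Fib (t.vx Aᶜ) := by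
    intro A
    induction A using (up_wf t).induction with
    | _ A ih =>
      intro hA a
      have : Φ (t.vx Aᶜ) ∈ Fib (t.vx Aᶜ) := by
        rcases par hA a with e | ⟨B, hB, e⟩
        · rw [e, Φo]; exact hx
        · rw [← e]; exact (ih B ⟨⟨hA, a⟩, hB⟩ hB.1 hB.2.1).1
      refine ⟨?_, this⟩
      rw [ΦB A hA a, ΦF A hA a]
      exact (hT A hA _ this).1
  refine ⟨Φ, Φo, fun A hA => ?_⟩
  by_cases a : (1:Γ) ∈ A
  · have hc := t.cpl A hA
    have a' : (1:Γ) ∉ Aᶜ := fun h => h a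
    have := m1 Aᶜ hc a'
    rw [compl_compl] at this
    refine ⟨this.2, ?_⟩
    have h2 := (hT Aᶜ hc (Φ (t.vx A)) (by rw [compl_compl]; exact this.2)).2
    have h3 := ΦF Aᶜ hc a'
    rw [compl_compl] at h2 h3
    rw [ΦB Aᶜ hc a', h3, h2]
  · exact ⟨(m1 A hA a).1, by rw [ΦB A hA a, ΦF A hA a]⟩
end Tr
end PaperCLT
end

section
open Filter Set
namespace PaperCLT
open scoped Pointwise
namespace Tr
variable {Γ : Type*} [Group Γ] {t : Tr Γ}
def ac (g : Γ) (x : Γ × ℕ) : Γ × ℕ := (g * x.1, x.2)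
lemma ac_one (x : Γ × ℕ) : ac 1 x = x := by simp [ac]
lemma ac_mul (g h : Γ) (x : Γ × ℕ) : ac (g * h) x = ac g (ac h x) := by simp [ac, mul_assoc]
lemma ac_inv (g : Γ) (x : Γ × ℕ) : ac g⁻¹ (ac g x) = x := by simp [ac]
lemma ac_inv' (g : Γ) (x : Γ × ℕ) : ac g (ac g⁻¹ x) = x := by simp [ac]
lemma ac_inj (g : Γ) : Function.Injective (ac g) := fun x y h => by rw [← ac_inv g x, h, ac_inv]
lemma ac_free {g : Γ} {x : Γ × ℕ} (h : ac g x = x) : g = 1 := by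
  have := congrArg Prod.fst h; simpa [ac] using this
lemma eqb (G : Subgroup Γ) (n : ℕ) : ∀ P Q : Set (Γ × ℕ), P.Finite → Q.Finite → P.ncard = n → Q.ncard = n →
    (∀ g ∈ G, ∀ x ∈ P, ac g x ∈ P) → (∀ g ∈ G, ∀ x ∈ Q, ac g x ∈ Q) →
    ∃ U : Γ × ℕ → Γ × ℕ, BijOn U P Q ∧ ∀ g ∈ G, ∀ x ∈ P, U (ac g x) = ac g (U x) := by
  classical
  induction n using Nat.strong_induction_on with
  | _ n ih =>
  intro P Q fP fQ cP cQ iP iQ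
  rcases P.eq_empty_or_nonempty with rfl | ⟨a, ha⟩
  · rw [ncard_empty] at cP
    rw [← cP, ncard_eq_zero fQ] at cQ
    subst cQ
    exact ⟨id, bijOn_id _, fun _ _ _ h => h.elim⟩
  have n0 : 0 < n := cP ▸ (ncard_pos fP).2 ⟨a, ha⟩
  obtain ⟨b, hb⟩ : Q.Nonempty := (ncard_pos fQ).1 (cQ ▸ n0)
  have orb : ∀ a : Γ × ℕ, ((fun g => ac g a) '' (G : Set Γ)).ncard = (G : Set Γ).ncard := fun a =>
    ncard_image_of_injective _ fun g h e => by have := congrArg Prod.fst e; simpa [ac] using this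
  obtain ⟨Oa, hOa⟩ : ∃ O, O = (fun g => ac g a) '' (G : Set Γ) := ⟨_, rfl⟩
  obtain ⟨Ob, hOb⟩ : ∃ O, O = (fun g => ac g b) '' (G : Set Γ) := ⟨_, rfl⟩
  have sa : Oa ⊆ P := by rw [hOa]; rintro _ ⟨g, hg, rfl⟩; exact iP g hg a ha
  have sb : Ob ⊆ Q := by rw [hOb]; rintro _ ⟨g, hg, rfl⟩; exact iQ g hg b hb
  have aO : a ∈ Oa := hOa ▸ ⟨1, G.one_mem, ac_one a⟩
  have ca : (P \ Oa).ncard = n - Oa.ncard := by rw [ncard_diff sa (fP.subset sa), cP]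
  have cb : (Q \ Ob).ncard = n - Oa.ncard := by rw [ncard_diff sb (fQ.subset sb), cQ, hOa, hOb, orb, orb]
  have p0 : 0 < Oa.ncard := (ncard_pos (fP.subset sa)).2 ⟨a, aO⟩
  have invO : ∀ (a : Γ × ℕ) (g : Γ), g ∈ G → ∀ x, ac g x ∈ (fun g => ac g a) '' (G : Set Γ) ↔ x ∈ (fun g => ac g a) '' (G : Set Γ) := by
    intro a g hg x
    constructor
    · rintro ⟨k, hk, e⟩
      exact ⟨g⁻¹ * k, G.mul_mem (G.inv_mem hg) hk, by show ac _ a = x; rw [ac_mul]; change ac g⁻¹ ((fun g => ac g a) k) = x; rw [e, ac_inv]⟩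
    · rintro ⟨k, hk, rfl⟩; exact ⟨g * k, G.mul_mem hg hk, ac_mul _ _ _⟩
  obtain ⟨U, hU, eU⟩ := ih (n - Oa.ncard) (by omega) (P \ Oa) (Q \ Ob) (fP.subset diff_subset) (fQ.subset diff_subset) ca cb
    (fun g hg x hx => ⟨iP g hg x hx.1, fun h => hx.2 (by rw [hOa] at h ⊢; exact (invO a g hg x).1 h)⟩)
    (fun g hg x hx => ⟨iQ g hg x hx.1, fun h => hx.2 (by rw [hOb] at h ⊢; exact (invO b g hg x).1 h)⟩)
  obtain ⟨V, hV⟩ : ∃ V : Γ × ℕ → Γ × ℕ, V = fun x => if x ∈ Oa then ac (x.1 * a.1⁻¹) b else U x := ⟨_, rfl⟩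
  have V1 : ∀ g ∈ G, V (ac g a) = ac g b := fun g hg => by
    rw [hV]; show (if _ then _ else _) = _
    rw [if_pos (hOa ▸ ⟨g, hg, rfl⟩)]; simp [ac]
  have V2 : ∀ x, x ∉ Oa → V x = U x := fun x hx => by rw [hV]; exact if_neg hx
  have bO : BijOn V Oa Ob := by
    refine ⟨?_, ?_, ?_⟩
    · rw [hOa]; rintro _ ⟨g, hg, rfl⟩; show V (ac g a) ∈ Ob; rw [V1 g hg, hOb]; exact ⟨g, hg, rfl⟩
    · rw [hOa]; rintro _ ⟨g, hg, rfl⟩ _ ⟨k, hk, rfl⟩ e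
      change V (ac g a) = V (ac k a) at e
      rw [V1 g hg, V1 k hk] at e
      have := congrArg Prod.fst e
      simp only [ac, mul_left_inj] at this
      rw [this]
    · rw [hOb]; rintro _ ⟨g, hg, rfl⟩; exact ⟨ac g a, hOa ▸ ⟨g, hg, rfl⟩, V1 g hg⟩
  have bU : BijOn V (P \ Oa) (Q \ Ob) := hU.congr fun x hx => (V2 x hx.2).symm
  refine ⟨V, ?_, ?_⟩
  · have := bO.union bU (by
      have hd := union_diff_cancel sa
      rw [injOn_union disjoint_sdiff_right]
      refine ⟨bO.injOn, bU.injOn, fun x hx y hy e => ?_⟩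
      exact (bU.mapsTo hy).2 (e ▸ bO.mapsTo hx))
    rwa [union_diff_cancel sa, union_diff_cancel sb] at this
  · intro g hg x hx
    by_cases h : x ∈ Oa
    · rw [hOa] at h
      obtain ⟨k, hk, rfl⟩ := h
      show V (ac g (ac k a)) = ac g (V (ac k a))
      rw [← ac_mul, V1 _ (G.mul_mem hg hk), V1 k hk, ac_mul]
    · have h2 : ac g x ∉ Oa := fun q => h (by rw [hOa] at q ⊢; exact (invO a g hg x).1 q)
      rw [V2 _ h, V2 _ h2]; exact eU g hg x ⟨hx, h⟩
noncomputable def Dv (x : Γ) (v : Set (Set Γ)) : ℕ := {B | B ∈ v ∧ x ∉ B}.ncard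
def Zv (v : Set (Set Γ)) : Set Γ := {x | ∀ y, Dv x v ≤ Dv y v}
lemma ncard_sm {α : Type*} [MulAction Γ α] (g : Γ) (Z : Set α) : (g • Z).ncard = Z.ncard := ncard_image_of_injective _ (MulAction.injective g)
lemma Dv_smul (g x : Γ) (v : Set (Set Γ)) : Dv (g * x) (g • v) = Dv x v := by
  unfold Dv
  rw [← ncard_sm g {B | B ∈ v ∧ x ∉ B}]
  congr 1; ext B
  rw [mem_smul_set_iff_inv_smul_mem]
  simp only [mem_setOf_eq, mem_smul_set_iff_inv_smul_mem (a := g), inv_inv, mem_inv_smul_set_iff, smul_eq_mul]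
lemma Zv_smul (g : Γ) (v : Set (Set Γ)) : Zv (g • v) = g • Zv v := by
  ext x
  rw [mem_smul_set_iff_inv_smul_mem]
  constructor
  · intro h y
    have := h (g * y)
    rw [Dv_smul] at this; refine le_trans (le_of_eq ?_) this
    rw [← Dv_smul g]; simp
  · intro h y
    have := h (g⁻¹ * y)
    rw [← Dv_smul g, ← Dv_smul g (g⁻¹ * y)] at this; simpa using this
lemma Dfin {A : Set Γ} (hA : A ∈ t.𝓔) (x : Γ) : {B | B ∈ t.vx A ∧ x ∉ B}.Finite := by
  obtain ⟨a, ha⟩ := t.ne A hA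
  obtain ⟨b, hb⟩ := t.ne _ (t.cpl A hA)
  refine ((t.fin a x).union (t.fin b x)).subset ?_
  rintro B ⟨⟨h1, h2 | h2⟩, h3⟩
  · exact .inl ⟨h1, h2 ha, h3⟩
  · exact .inr ⟨h1, h2.1 hb, h3⟩
lemma Zv_ne (v : Set (Set Γ)) : (Zv v).Nonempty := by
  obtain ⟨x, hx⟩ := Nat.sInf_mem (range_nonempty fun x : Γ => Dv x v)
  exact ⟨x, fun y => by have : Dv x v = _ := hx; rw [this]; exact Nat.sInf_le ⟨y, rfl⟩⟩
lemma Zv_fin {A : Set Γ} (hA : A ∈ t.𝓔) : (Zv (t.vx A)).Finite := by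
  obtain ⟨x0, h0⟩ := Zv_ne (t.vx A)
  refine ((t.prp (2 * Dv x0 (t.vx A))).smul_set (a := x0)).subset fun x hx => ?_
  rw [mem_smul_set_iff_inv_smul_mem, mem_setOf_eq, ← ncard_sm x0]
  have hsub : x0 • {B | B ∈ t.𝓔 ∧ 1 ∈ B ∧ x0⁻¹ • x ∉ B} ⊆ {B | B ∈ t.vx A ∧ x ∉ B} ∪ compl '' {B | B ∈ t.vx A ∧ x0 ∉ B} := by
    rintro _ ⟨B, ⟨h1, h2, h3⟩, rfl⟩
    have h1' := t.inv B h1 x0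
    have h2' : x0 ∈ x0 • B := ⟨1, h2, by simp⟩
    have h3' : x ∉ x0 • B := by rwa [mem_smul_set_iff_inv_smul_mem]
    by_cases hv : x0 • B ∈ t.vx A
    · exact .inl ⟨hv, h3'⟩
    · exact .inr ⟨(x0 • B)ᶜ, ⟨vx_or hA h1' hv, fun h => h h2'⟩, compl_compl _⟩
  refine (ncard_le_ncard hsub ((Dfin hA x).union ((Dfin hA x0).image _))).trans ((ncard_union_le _ _).trans ?_)
  rw [ncard_image_of_injective _ compl_injective]
  have := hx x0
  unfold Dv at this ⊢; omega
variable (t) in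
lemma exn : ∃ n : ℕ, 0 < n ∧ ∀ A ∈ t.𝓔, (Zv (t.vx A)).ncard ∣ n ∧ (t.Zp A).ncard ∣ n := by
  obtain ⟨𝓡, fR, sR, hR⟩ := t.orb
  obtain ⟨N, hN⟩ := (fR.image fun A => (Zv (t.vx A)).ncard + (t.Zp A).ncard).bddAbove
  refine ⟨N.factorial, Nat.factorial_pos _, fun A hA => ?_⟩
  obtain ⟨g, hg⟩ := hR A hA
  have := hN ⟨_, hg, rfl⟩
  simp only [vx_smul, Zv_smul, t.zs, ncard_sm] at this
  have h1 := (ncard_pos (Zv_fin hA)).2 (Zv_ne _)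
  have h2 := (ncard_pos (t.zf A hA).1).2 (t.zf A hA).2
  exact ⟨Nat.dvd_factorial h1 (by omega), Nat.dvd_factorial h2 (by omega)⟩
def Fb (n : ℕ) (Z : Set Γ) : Set (Γ × ℕ) := Z ×ˢ Iio (n / Z.ncard)
lemma Fb_card {n : ℕ} {Z : Set Γ} (h : Z.ncard ∣ n) : (Fb n Z).ncard = n := by
  unfold Fb
  rw [ncard_prod, ← Nat.mul_div_cancel' h]
  congr 1
  rw [Nat.mul_div_cancel' h, ← Finset.coe_Iio, ncard_coe_finset, Nat.card_Iio]
lemma Fb_fin {n : ℕ} {Z : Set Γ} (h : Z.Finite) : (Fb n Z).Finite := h.prod (finite_Iio _)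
lemma Fb_smul {n : ℕ} {Z : Set Γ} (g : Γ) (x : Γ × ℕ) : ac g x ∈ Fb n (g • Z) ↔ x ∈ Fb n Z := by
  unfold Fb ac
  simp only [mem_prod, ncard_sm, mem_smul_set_iff_inv_smul_mem, smul_eq_mul, inv_mul_cancel_left]
/-- equivariant identifications of the fibres -/
lemma exR {n : ℕ} (hn : ∀ A ∈ t.𝓔, (Zv (t.vx A)).ncard ∣ n ∧ (t.Zp A).ncard ∣ n) : ∃ R : Set Γ → Γ × ℕ → Γ × ℕ,
    ∀ A ∈ t.𝓔, BijOn (R A) (Fb n (Zv (t.vx A))) (Fb n (t.Zp A)) ∧ ∀ g : Γ, ∀ x ∈ Fb n (Zv (t.vx A)), R (g • A) (ac g x) = ac g (R A x) := by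
  have h1 : ∀ A : Set Γ, ∃ U : Γ × ℕ → Γ × ℕ, A ∈ t.𝓔 → BijOn U (Fb n (Zv (t.vx A))) (Fb n (t.Zp A)) ∧ ∀ g : Γ, g • A = A → ∀ x ∈ Fb n (Zv (t.vx A)), U (ac g x) = ac g (U x) := by
    intro A
    by_cases hA : A ∈ t.𝓔
    · have iP : ∀ g : Γ, g • A = A → ∀ x ∈ Fb n (Zv (t.vx A)), ac g x ∈ Fb n (Zv (t.vx A)) := fun g hg x hx => by
        have := (Fb_smul (n := n) g x).2 hx
        rwa [← Zv_smul, ← vx_smul, hg] at this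
      have iQ : ∀ g : Γ, g • A = A → ∀ x ∈ Fb n (t.Zp A), ac g x ∈ Fb n (t.Zp A) := fun g hg x hx => by
        have := (Fb_smul (n := n) g x).2 hx
        rwa [← t.zs, hg] at this
      obtain ⟨U, h, h'⟩ := eqb (MulAction.stabilizer Γ A) n _ _ (Fb_fin (Zv_fin hA)) (Fb_fin (t.zf A hA).1) (Fb_card (hn A hA).1) (Fb_card (hn A hA).2) iP iQ
      exact ⟨U, fun _ => ⟨h, h'⟩⟩
    · exact ⟨id, fun h => absurd h hA⟩
  choose U hU using h1
  obtain ⟨r, hr⟩ : ∃ r : Set Γ → Set Γ, r = fun A => (Quotient.mk (MulAction.orbitRel Γ (Set Γ)) A).out := ⟨_, rfl⟩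
  have hr1 : ∀ A, ∃ k : Γ, k • r A = A := fun A => by
    have : MulAction.orbitRel Γ (Set Γ) A (r A) := by
      rw [hr]; exact (MulAction.orbitRel Γ (Set Γ)).symm (Quotient.mk_out (s := MulAction.orbitRel Γ (Set Γ)) A)
    exact this
  choose k hk using hr1
  have hr2 : ∀ (g : Γ) A, r (g • A) = r A := fun g A => by
    rw [hr]; show Quotient.out _ = Quotient.out _
    congr 1; exact Quotient.sound (s := MulAction.orbitRel Γ (Set Γ)) ⟨g, rfl⟩
  refine ⟨fun A x => ac (k A) (U (r A) (ac (k A)⁻¹ x)), fun A hA => ?_⟩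
  have hrA : r A ∈ t.𝓔 := by rw [← smem (k A), hk]; exact hA
  obtain ⟨b, e⟩ := hU (r A) hrA
  have f1 : ∀ x, ac (k A)⁻¹ x ∈ Fb n (Zv (t.vx (r A))) ↔ x ∈ Fb n (Zv (t.vx A)) := fun x => by
    rw [← Fb_smul (k A), ac_inv', ← Zv_smul, ← vx_smul, hk]
  have f2 : ∀ x, ac (k A)⁻¹ x ∈ Fb n (t.Zp (r A)) ↔ x ∈ Fb n (t.Zp A) := fun x => by
    rw [← Fb_smul (k A), ac_inv', ← t.zs, hk]
  refine ⟨⟨fun x hx => ?_, fun x hx y hy h => ?_, fun y hy => ?_⟩, fun g x hx => ?_⟩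
  · rw [← f2, ac_inv]; exact b.mapsTo ((f1 x).2 hx)
  · exact ac_inj _ (b.injOn ((f1 x).2 hx) ((f1 y).2 hy) (ac_inj _ h))
  · obtain ⟨x, hx, h⟩ := b.surjOn ((f2 y).2 hy)
    refine ⟨ac (k A) x, by rw [← f1, ac_inv]; exact hx, ?_⟩
    show ac (k A) (U (r A) (ac (k A)⁻¹ (ac (k A) x))) = y
    rw [ac_inv, h, ac_inv']
  · show ac (k (g • A)) (U (r (g • A)) (ac (k (g • A))⁻¹ (ac g x))) = ac g (ac (k A) (U (r A) (ac (k A)⁻¹ x)))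
    rw [hr2]
    have hs : ((k (g • A))⁻¹ * g * k A) • r A = r A := by
      have := hk (g • A); rw [hr2] at this
      rw [mul_smul, hk, mul_smul, inv_smul_eq_iff]; exact this.symm
    have := e _ hs _ ((f1 x).2 hx)
    rw [ac_mul, ac_inv', ac_mul] at this
    rw [this, ← ac_mul, ← ac_mul]; congr 1; group
end Tr
end PaperCLT
end

section
open Filter Set
namespace PaperCLT
open scoped Pointwise
namespace Tr
variable {Γ : Type*} [Group Γ] {t : Tr Γ}
lemma exT {n : ℕ} (hn : ∀ A ∈ t.𝓔, (Zv (t.vx A)).ncard ∣ n ∧ (t.Zp A).ncard ∣ n) : ∃ T : Set Γ → Γ × ℕ → Γ × ℕ,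
    ∀ A ∈ t.𝓔, ∀ x ∈ Fb n (Zv (t.vx Aᶜ)), (T A x ∈ Fb n (Zv (t.vx A)) ∧ T Aᶜ (T A x) = x) ∧ (∀ h : Γ, T (h • A) (ac h x) = ac h (T A x)) ∧
      ∀ h : Γ, h • A = Aᶜ → x = ac h (T A x) → h = 1 := by
  obtain ⟨R, hR⟩ := exR hn
  have h1 : ∀ A x, ∃ y, A ∈ t.𝓔 → x ∈ Fb n (Zv (t.vx Aᶜ)) → y ∈ Fb n (Zv (t.vx A)) ∧ R A y = R Aᶜ x := by
    intro A x
    by_cases h : A ∈ t.𝓔 ∧ x ∈ Fb n (Zv (t.vx Aᶜ))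
    · have h2 := (hR _ (t.cpl A h.1)).1.mapsTo h.2
      rw [t.zc] at h2
      obtain ⟨y, hy, e⟩ := (hR A h.1).1.surjOn h2
      exact ⟨y, fun _ _ => ⟨hy, e⟩⟩
    · exact ⟨x, fun a b => absurd ⟨a, b⟩ h⟩
  choose T hT using h1
  refine ⟨T, fun A hA x hx => ?_⟩
  obtain ⟨m, e⟩ := hT A x hA hx
  refine ⟨⟨m, ?_⟩, fun h => ?_, fun h hh ex => ?_⟩
  · obtain ⟨m2, e2⟩ := hT Aᶜ (T A x) (t.cpl A hA) (by rwa [compl_compl])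
    rw [compl_compl, e] at e2
    exact (hR _ (t.cpl A hA)).1.injOn m2 hx e2
  · have hx' : ac h x ∈ Fb n (Zv (t.vx (h • A)ᶜ)) := by
      rw [← smul_set_compl, vx_smul, Zv_smul, Fb_smul]; exact hx
    obtain ⟨m2, e2⟩ := hT (h • A) (ac h x) (t.inv A hA h) hx'
    refine (hR _ (t.inv A hA h)).1.injOn m2 (by rw [vx_smul, Zv_smul, Fb_smul]; exact m) ?_
    rw [e2, (hR A hA).2 h _ m, ← smul_set_compl, (hR _ (t.cpl A hA)).2 h _ hx, e]
  · have := (hR A hA).2 h _ m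
    rw [hh, ← ex, ← e] at this
    exact ac_free this.symm
variable (t) in
lemma exH : ∃ H : Subgroup Γ, H.FiniteIndex ∧ (∀ h ∈ H, ∀ A ∈ t.𝓔, h • t.vx A = t.vx A → h = 1) ∧ ∀ h ∈ H, ∀ A ∈ t.𝓔, h • A ≠ Aᶜ := by
  obtain ⟨n, n0, hn⟩ := exn t
  obtain ⟨T, hT⟩ := exT hn
  obtain ⟨A0, hA0, e0⟩ := base t
  have h1 : ∀ x : Fb n (Zv t.o), ∃ Φ : Set (Set Γ) → Γ × ℕ, Φ t.o = x ∧ ∀ A ∈ t.𝓔, Φ (t.vx A) ∈ Fb n (Zv (t.vx A)) ∧ Φ (t.vx A) = T A (Φ (t.vx Aᶜ)) := fun x =>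
    pot (fun v => Fb n (Zv v)) T x.2 fun A hA x hx => (hT A hA x hx).1
  choose Φ Φo hΦ using h1
  have vo : ∀ h : Γ, h • t.o = t.vx (h • A0) := fun h => by rw [vx_smul, e0]
  have hm : ∀ (h : Γ) (x : Fb n (Zv t.o)), ac h (Φ x (h⁻¹ • t.o)) ∈ Fb n (Zv t.o) := fun h x => by
    have := (hΦ x (h⁻¹ • A0) (t.inv _ hA0 _)).1
    rw [← vo, ← Fb_smul h, ← Zv_smul, smul_inv_smul] at this; exact this
  have hu : ∀ (h : Γ) (x : Fb n (Zv t.o)) A, A ∈ t.𝓔 → Φ ⟨_, hm h x⟩ (t.vx A) = ac h (Φ x (h⁻¹ • t.vx A)) := fun h x A hA => by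
    refine uniq (Ψ := fun v => ac h (Φ x (h⁻¹ • v))) T (fun A hA => (hΦ _ A hA).2) (fun A hA => ?_) (Φo _) hA
    show ac h (Φ x (h⁻¹ • t.vx A)) = T A (ac h (Φ x (h⁻¹ • t.vx Aᶜ)))
    have hi := t.inv A hA h⁻¹
    have hc := (hΦ x _ (t.cpl _ hi)).1
    have := (hT _ hi _ hc).2.1 h
    rw [← vx_smul, ← vx_smul, (hΦ x _ hi).2, smul_set_compl, ← this, smul_inv_smul]
  letI act : MulAction Γ (Fb n (Zv t.o)) :=
    { smul := fun h x => ⟨_, hm h x⟩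
      one_smul := fun x => Subtype.ext (by show ac 1 (Φ x ((1:Γ)⁻¹ • t.o)) = x; rw [ac_one, inv_one, one_smul, Φo])
      mul_smul := fun g h x => Subtype.ext (by
        show ac (g * h) (Φ x ((g * h)⁻¹ • t.o)) = ac g (Φ ⟨_, hm h x⟩ (g⁻¹ • t.o))
        rw [vo g⁻¹, hu h x _ (t.inv _ hA0 _), ← vo, ac_mul, mul_inv_rev, mul_smul]) }
  have hfin : Finite (Fb n (Zv t.o)) := by
    have := Fb_fin (n := n) (Zv_fin hA0); rw [e0] at this; exact this
  obtain ⟨x0, hx0⟩ : (Fb n (Zv t.o)).Nonempty := by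
    have h2 := Fb_card (hn A0 hA0).1
    rw [e0] at h2
    exact nonempty_of_ncard_ne_zero (by omega)
  have hk : ∀ h ∈ (MulAction.toPermHom Γ (Fb n (Zv t.o))).ker, ∀ A ∈ t.𝓔, Φ ⟨x0, hx0⟩ (h • t.vx A) = ac h (Φ ⟨x0, hx0⟩ (t.vx A)) := fun h hh A hA => by
    have := hu h ⟨x0, hx0⟩ (h • A) (t.inv A hA h)
    rw [← vx_smul]
    have e : (⟨_, hm h ⟨x0, hx0⟩⟩ : Fb n (Zv t.o)) = ⟨x0, hx0⟩ := by
      have := congrArg (fun p : Equiv.Perm (Fb n (Zv t.o)) => p ⟨x0, hx0⟩) (MonoidHom.mem_ker.1 hh)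
      exact this
    rw [e, ← vx_smul, inv_smul_smul] at this
    exact this
  refine ⟨(MulAction.toPermHom Γ (Fb n (Zv t.o))).ker, inferInstance, fun h hh A hA e => ?_, fun h hh A hA e => ?_⟩
  · have := hk h hh A hA
    rw [e] at this; exact ac_free this.symm
  · have h2 := hk h hh A hA
    rw [← vx_smul, e] at h2
    have h3 := hΦ ⟨x0, hx0⟩ A hA
    have h4 := hΦ ⟨x0, hx0⟩ Aᶜ (t.cpl A hA)
    have := (hT A hA _ h4.1).2.2 h e (by rw [← h3.2]; exact h2)
    rw [this, one_smul] at e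
    exact nn hA e.le
end Tr
end PaperCLT
end

section
open Filter Set
namespace PaperCLT
open scoped Pointwise
namespace Tr
variable {Γ : Type*} [Group Γ] {t : Tr Γ}
lemma red1 {α : Type*} {a b : α} (h : a ≠ b) : FreeGroup.IsReduced [(a, true), (b, false)] := by
  unfold FreeGroup.IsReduced
  simp [h]
lemma red2 {α : Type*} {l : List (α × Bool)} {a b c : α} (hl : FreeGroup.IsReduced (l ++ [(c, false)])) (h : a ≠ b) (h' : c ≠ a) : FreeGroup.IsReduced (l ++ [(c, false), (a, true)] ++ [(b, false)]) := by
  unfold FreeGroup.IsReduced at *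
  have : l ++ [(c, false), (a, true)] ++ [(b, false)] = l ++ (c, false) :: (a, true) :: [(b, false)] := by simp
  rw [this, List.isChain_append_cons_cons]
  exact ⟨hl, fun e => absurd e h', by simp [h]⟩
/-- a group acting on a suitable nested system of cuts is virtually free -/
theorem vfree (t : Tr Γ) : VirtuallyFree Γ := by
  classical
  obtain ⟨H, hfi, hst, hni⟩ := exH t
  refine ⟨H, hfi, ?_⟩
  obtain ⟨A0, hA0, e0⟩ := base t
  let q : Set Γ → Quotient (MulAction.orbitRel H (Set Γ)) := fun A => Quotient.mk _ A
  have hq : ∀ A B, q A = q B → ∃ h ∈ H, h • B = A := fun A B e => by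
    have := Quotient.exact e
    obtain ⟨h, hh⟩ := MulAction.mem_orbit_iff.1 (MulAction.orbitRel_apply.1 this)
    exact ⟨h, h.2, hh⟩
  have hq' : ∀ h ∈ H, ∀ A, q (h • A) = q A := fun h hh A => Quotient.sound (MulAction.orbitRel_apply.2 ⟨⟨h, hh⟩, rfl⟩)
  obtain ⟨e, he⟩ : ∃ e : Set Γ → FreeGroup (Quotient (MulAction.orbitRel H (Set Γ))), e = fun A => FreeGroup.of (q Aᶜ) * (FreeGroup.of (q A))⁻¹ := ⟨_, rfl⟩
  have hec : ∀ A, e A * e Aᶜ = 1 := fun A => by rw [he]; simp only [compl_compl]; group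
  have hes : ∀ h ∈ H, ∀ A, e (h • A) = e A := fun h hh A => by rw [he]; simp only [← smul_set_compl, hq' h hh]
  obtain ⟨Φ, Φo, hΦ⟩ := pot (t := t) (fun _ => univ) (fun A x => x * e A) (x0 := 1) (mem_univ _) fun A hA x hx => ⟨mem_univ _, by rw [mul_assoc, hec, mul_one]⟩
  have hΦ : ∀ A ∈ t.𝓔, Φ (t.vx A) = Φ (t.vx Aᶜ) * e A := fun A hA => (hΦ A hA).2
  have eqv : ∀ h ∈ H, ∀ A ∈ t.𝓔, Φ (h • t.vx A) = Φ (h • t.o) * Φ (t.vx A) := fun h hh A hA => by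
    refine uniq (t := t) (Φ := fun v => Φ (h • v)) (Ψ := fun v => Φ (h • t.o) * Φ v) (fun A x => x * e A) (fun A hA => ?_) (fun A hA => ?_) ?_ hA
    · show Φ (h • t.vx A) = Φ (h • t.vx Aᶜ) * e A
      rw [← vx_smul, ← vx_smul, hΦ _ (t.inv A hA h), hes h hh, smul_set_compl]
    · show Φ (h • t.o) * Φ (t.vx A) = Φ (h • t.o) * Φ (t.vx Aᶜ) * e A
      rw [hΦ A hA, mul_assoc]
    · show Φ (h • t.o) = Φ (h • t.o) * Φ t.o
      rw [Φo, mul_one]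
  have key : ∀ A, A ∈ t.𝓔 → (1:Γ) ∉ A → ∃ l, Φ (t.vx A) = FreeGroup.mk (l ++ [(q A, false)]) ∧ FreeGroup.IsReduced (l ++ [(q A, false)]) := by
    intro A
    induction A using (up_wf t).induction with
    | _ A ih =>
      intro hA a
      have n1 : q Aᶜ ≠ q A := fun hc => by
        obtain ⟨h, hh, hhA⟩ := hq _ _ hc
        exact hni h hh A hA hhA
      have eA : e A = FreeGroup.mk [(q Aᶜ, true), (q A, false)] := by rw [he]; rfl
      rcases par hA a with ep | ⟨B, hB, ep⟩
      · refine ⟨[(q Aᶜ, true)], ?_, red1 n1⟩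
        rw [hΦ A hA, ep, Φo, one_mul, eA]; rfl
      · obtain ⟨l, h1, h2⟩ := ih B ⟨⟨hA, a⟩, hB⟩ hB.1 hB.2.1
        have n2 : q B ≠ q Aᶜ := fun hc => by
          obtain ⟨h, hh, hhA⟩ := hq _ _ hc
          have := hst h hh _ (t.cpl A hA) (by rw [← vx_smul, hhA, ep])
          rw [this, one_smul] at hhA
          exact hB.2.1 (hhA ▸ a)
        refine ⟨l ++ [(q B, false), (q Aᶜ, true)], ?_, red2 h2 n1 n2⟩
        rw [hΦ A hA, ← ep, h1, eA, FreeGroup.mul_mk]; simp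
  have key2 : ∀ A, A ∈ t.𝓔 → Φ (t.vx A) = 1 → t.vx A = t.o := by
    have : ∀ A, A ∈ t.𝓔 → (1:Γ) ∉ A → Φ (t.vx A) ≠ 1 := fun A hA a h => by
      obtain ⟨l, h1, h2⟩ := key A hA a
      rw [h1] at h
      have := congrArg FreeGroup.toWord h
      rw [FreeGroup.toWord_mk, h2.reduce_eq] at this
      simp at this
    intro A hA h
    by_cases a : (1:Γ) ∈ A
    · rcases V2 hA a with h1 | ⟨B, hB, b, eB⟩
      · exact h1
      · exact absurd (eB ▸ h) (this B hB b)
    · exact absurd h (this A hA a)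
  let f : H →* FreeGroup (Quotient (MulAction.orbitRel H (Set Γ))) := MonoidHom.mk' (fun h => Φ ((h:Γ) • t.o)) fun a b => by
    have := eqv a a.2 (b.1 • A0) (t.inv _ hA0 _)
    rw [vx_smul, e0, ← mul_smul] at this
    exact this
  have finj : Function.Injective f := by
    rw [injective_iff_map_eq_one]
    intro h hh
    change Φ ((h:Γ) • t.o) = 1 at hh
    rw [← e0, ← vx_smul] at hh
    have := key2 _ (t.inv A0 hA0 h) hh
    rw [vx_smul, e0] at this
    exact Subtype.ext (hst h h.2 A0 hA0 (by rw [e0, this]))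
  exact ⟨IsFreeGroup.ofMulEquiv (MonoidHom.ofInjective finj).symm⟩
end Tr
end PaperCLT
end

section
open Filter Set
namespace PaperCLT
open scoped Pointwise
namespace Cut
variable {Γ : Type*} [Group Γ]
def bd (g : Γ) (A : Set Γ) : Set Γ := {x | ¬(x ∈ A ↔ x * g ∈ A)}
def CF (A : Set Γ) : Prop := ∀ g, (bd g A).Finite
lemma bd_compl (g : Γ) (A : Set Γ) : bd g Aᶜ = bd g A := by
  ext x; simp only [bd, mem_setOf_eq, mem_compl_iff]; tauto
lemma bd_smul (h g : Γ) (A : Set Γ) : bd g (h • A) = h • bd g A := by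
  ext x; simp only [bd, mem_setOf_eq, mem_smul_set_iff_inv_smul_mem, smul_eq_mul, mul_assoc]
lemma CF.compl {A : Set Γ} (h : CF A) : CF Aᶜ := fun g => by rw [bd_compl]; exact h g
lemma CF.inter {A B : Set Γ} (h : CF A) (h' : CF B) : CF (A ∩ B) := fun g =>
  ((h g).union (h' g)).subset fun x hx => by simp only [bd, mem_setOf_eq, mem_union, mem_inter_iff] at *; tauto
lemma CF.union {A B : Set Γ} (h : CF A) (h' : CF B) : CF (A ∪ B) := fun g =>
  ((h g).union (h' g)).subset fun x hx => by simp only [bd, mem_setOf_eq, mem_union, mem_inter_iff] at *; tauto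
lemma CF.smul {A : Set Γ} (h : CF A) (g : Γ) : CF (g • A) := fun k => by rw [bd_smul]; exact (h k).smul_set
lemma sub1 {A B : Set Γ} (hA : CF A) (hB : CF B) (g : Γ) : (bd g (A ∩ B)).ncard + (bd g (A ∪ B)).ncard ≤ (bd g A).ncard + (bd g B).ncard := by
  rw [← ncard_union_add_ncard_inter _ _ (hA.inter hB g) (hA.union hB g), ← ncard_union_add_ncard_inter _ _ (hA g) (hB g)]
  refine add_le_add (ncard_le_ncard (fun x hx => ?_) ((hA g).union (hB g))) (ncard_le_ncard (fun x hx => ?_) ((hA g).inter_of_left _))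
  · simp only [bd, mem_setOf_eq, mem_union, mem_inter_iff] at *; tauto
  · simp only [bd, mem_setOf_eq, mem_union, mem_inter_iff] at *; tauto
lemma sub2 {A B : Set Γ} (hA : CF A) (hB : CF B) {x g : Γ} (h1 : x ∈ A) (h2 : x ∉ B) (h3 : x * g ∈ B) (h4 : x * g ∉ A) : (bd g (A ∩ B)).ncard + (bd g (A ∪ B)).ncard < (bd g A).ncard + (bd g B).ncard := by
  rw [← ncard_union_add_ncard_inter _ _ (hA.inter hB g) (hA.union hB g), ← ncard_union_add_ncard_inter _ _ (hA g) (hB g)]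
  refine add_lt_add_of_le_of_lt (ncard_le_ncard (fun x hx => ?_) ((hA g).union (hB g))) (ncard_lt_ncard ((ssubset_iff_of_subset fun x hx => ?_).2 ⟨x, ?_, ?_⟩) ((hA g).inter_of_left _))
  all_goals simp only [bd, mem_setOf_eq, mem_union, mem_inter_iff] at *; tauto
variable (S : Finset Γ) (e : ℕ → Γ)
noncomputable def f1 (A : Set Γ) : ℕ := ∑ s ∈ S, (bd s A).ncard
noncomputable def fc (A : Set Γ) : ℕ → ℤ
  | 0 => f1 S A
  | i + 1 => (bd (e i) A).ncard
noncomputable def F (A : Set Γ) : Lex (ℕ → ℤ) := toLex (fc S e A)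
variable {S e}
lemma f1_compl (A : Set Γ) : f1 S Aᶜ = f1 S A := by unfold f1; simp only [bd_compl]
lemma f1_smul (g : Γ) (A : Set Γ) : f1 S (g • A) = f1 S A := by unfold f1; simp only [bd_smul, Tr.ncard_sm]
lemma F_compl (A : Set Γ) : F S e Aᶜ = F S e A := by
  unfold F; congr 1; funext i; cases i <;> simp only [fc, f1_compl, bd_compl]
lemma F_smul (g : Γ) (A : Set Γ) : F S e (g • A) = F S e A := by
  unfold F; congr 1; funext i; cases i <;> simp only [fc, f1_smul, bd_smul, Tr.ncard_sm]
lemma F_lt {A B : Set Γ} (h : f1 S A < f1 S B) : F S e A < F S e B :=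
  ⟨0, fun j hj => absurd hj (Nat.not_lt_zero j), by show (f1 S A : ℤ) < f1 S B; exact_mod_cast h⟩
lemma f1_le {A B : Set Γ} (h : F S e A ≤ F S e B) : f1 S A ≤ f1 S B := by
  by_contra hc; exact absurd (F_lt (e := e) (not_le.1 hc)) (not_lt.2 h)
lemma F_sub (he : Function.Surjective e) {A B : Set Γ} (hA : CF A) (hB : CF B) (h1 : (A ∩ Bᶜ).Nonempty) (h2 : (Aᶜ ∩ B).Nonempty) : F S e (A ∩ B) + F S e (A ∪ B) < F S e A + F S e B := by
  obtain ⟨x, hx⟩ := h1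
  obtain ⟨y, hy⟩ := h2
  obtain ⟨i, hi⟩ := he (x⁻¹ * y)
  have : fc S e (A ∩ B) + fc S e (A ∪ B) < fc S e A + fc S e B := by
    refine Pi.lt_def.2 ⟨fun j => ?_, i + 1, ?_⟩
    · cases j with
      | zero =>
        show (f1 S (A ∩ B) : ℤ) + f1 S (A ∪ B) ≤ f1 S A + f1 S B
        have : f1 S (A ∩ B) + f1 S (A ∪ B) ≤ f1 S A + f1 S B := by
          unfold f1; rw [← Finset.sum_add_distrib, ← Finset.sum_add_distrib]
          exact Finset.sum_le_sum fun s _ => sub1 hA hB s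
        exact_mod_cast this
      | succ j =>
        show ((bd (e j) (A ∩ B)).ncard : ℤ) + (bd (e j) (A ∪ B)).ncard ≤ (bd (e j) A).ncard + (bd (e j) B).ncard
        exact_mod_cast sub1 hA hB (e j)
    · show ((bd (e i) (A ∩ B)).ncard : ℤ) + (bd (e i) (A ∪ B)).ncard < (bd (e i) A).ncard + (bd (e i) B).ncard
      have := sub2 hA hB (x := x) (g := e i) hx.1 hx.2 (by rw [hi]; simpa using hy.2) (by rw [hi]; simpa using hy.1)
      exact_mod_cast this
  exact Pi.toLex_strictMono this
lemma ord4 {α : Type*} [AddCommGroup α] [LinearOrder α] [IsOrderedAddMonoid α] {A B X1 X2 Y1 Y2 : α}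
    (h1 : A ≤ X1 ∨ A ≤ Y1) (h2 : A ≤ X2 ∨ A ≤ Y2) (h3 : B ≤ X1 ∨ B ≤ Y2) (h4 : B ≤ X2 ∨ B ≤ Y1) (hX : X1 + X2 < A + B) (hY : Y1 + Y2 < A + B) : False := by
  have k1 : ¬ (A ≤ X1 ∧ B ≤ X2) := fun h => absurd hX (not_lt.2 (add_le_add h.1 h.2))
  have k2 : ¬ (A ≤ X2 ∧ B ≤ X1) := fun h => absurd hX (not_lt.2 (by rw [add_comm X1]; exact add_le_add h.1 h.2))
  have k3 : ¬ (A ≤ Y1 ∧ B ≤ Y2) := fun h => absurd hY (not_lt.2 (add_le_add h.1 h.2))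
  have k4 : ¬ (A ≤ Y2 ∧ B ≤ Y1) := fun h => absurd hY (not_lt.2 (by rw [add_comm Y1]; exact add_le_add h.1 h.2))
  have k5 : ¬ (A ≤ X1 ∧ A ≤ X2 ∧ B ≤ Y1 ∧ B ≤ Y2) := fun h => by
    have a1 := lt_of_add_lt_add_left ((add_le_add h.1 h.2.1).trans_lt hX)
    have a2 := lt_of_add_lt_add_right ((add_le_add h.2.2.1 h.2.2.2).trans_lt hY)
    exact lt_asymm a1 a2
  have k6 : ¬ (A ≤ Y1 ∧ A ≤ Y2 ∧ B ≤ X1 ∧ B ≤ X2) := fun h => by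
    have a1 := lt_of_add_lt_add_left ((add_le_add h.1 h.2.1).trans_lt hY)
    have a2 := lt_of_add_lt_add_right ((add_le_add h.2.2.1 h.2.2.2).trans_lt hX)
    exact lt_asymm a1 a2
  rcases h1 with h1 | h1 <;> rcases h2 with h2 | h2 <;> rcases h3 with h3 | h3 <;> rcases h4 with h4 | h4 <;>
    first
    | exact k1 ⟨h1, h4⟩
    | exact k2 ⟨h2, h3⟩
    | exact k3 ⟨h1, h3⟩
    | exact k4 ⟨h2, h4⟩
    | exact k5 ⟨h1, h2, h4, h3⟩
    | exact k6 ⟨h1, h2, h3, h4⟩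
variable (S e) in
def Opt (p q : Ultrafilter Γ) (A : Set Γ) : Prop := (CF A ∧ A ∈ p ∧ Aᶜ ∈ q) ∧ ∀ B, CF B → B ∈ p → Bᶜ ∈ q → F S e A ≤ F S e B
lemma Opt.compl {p q : Ultrafilter Γ} {A : Set Γ} (h : Opt S e p q A) : Opt S e q p Aᶜ :=
  ⟨⟨h.1.1.compl, h.1.2.2, by rw [compl_compl]; exact h.1.2.1⟩, fun B h1 h2 h3 => by
    rw [F_compl, ← F_compl B]; exact h.2 _ h1.compl h3 (by rw [compl_compl]; exact h2)⟩
lemma Opt.smul {p q : Ultrafilter Γ} {A : Set Γ} (h : Opt S e p q A) (g : Γ) : Opt S e (p.map (g * ·)) (q.map (g * ·)) (g • A) := by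
  have hp : ∀ (p : Ultrafilter Γ) (B : Set Γ), B ∈ p.map (g * ·) ↔ g⁻¹ • B ∈ p := fun p B => by
    rw [Ultrafilter.mem_map]
    have : (g * ·) ⁻¹' B = g⁻¹ • B := by ext x; simp [mem_smul_set_iff_inv_smul_mem]
    rw [this]
  refine ⟨⟨h.1.1.smul g, by rw [hp, inv_smul_smul]; exact h.1.2.1, by rw [hp, smul_set_compl, inv_smul_smul]; exact h.1.2.2⟩, fun B h1 h2 h3 => ?_⟩
  rw [hp] at h2 h3
  rw [smul_set_compl] at h3
  rw [F_smul, ← F_smul g⁻¹ B]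
  exact h.2 _ (h1.smul _) h2 h3
lemma Opt.corner {p q : Ultrafilter Γ} {A B : Set Γ} (h : Opt S e p q A) (hB : CF B) : F S e A ≤ F S e (A ∩ B) ∨ F S e A ≤ F S e (A ∩ Bᶜ) := by
  rcases p.mem_or_compl_mem B with hb | hb
  · exact .inl (h.2 _ (h.1.1.inter hB) (Filter.inter_mem h.1.2.1 hb) (mem_of_superset h.1.2.2 (compl_subset_compl.2 inter_subset_left)))
  · exact .inr (h.2 _ (h.1.1.inter hB.compl) (Filter.inter_mem h.1.2.1 hb) (mem_of_superset h.1.2.2 (compl_subset_compl.2 inter_subset_left)))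
lemma nested (he : Function.Surjective e) {p q p' q' : Ultrafilter Γ} {A B : Set Γ} (hA : Opt S e p q A) (hB : Opt S e p' q' B) : A ⊆ B ∨ A ⊆ Bᶜ ∨ Aᶜ ⊆ B ∨ Aᶜ ⊆ Bᶜ := by
  by_contra hc
  push Not at hc
  obtain ⟨c1, c2, c3, c4⟩ := hc
  have n1 : (A ∩ Bᶜ).Nonempty := by obtain ⟨x, h⟩ := not_subset.1 c1; exact ⟨x, h.1, h.2⟩
  have n2 : (A ∩ B).Nonempty := by obtain ⟨x, h⟩ := not_subset.1 c2; exact ⟨x, h.1, not_not.1 h.2⟩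
  have n3 : (Aᶜ ∩ Bᶜ).Nonempty := by obtain ⟨x, h⟩ := not_subset.1 c3; exact ⟨x, h.1, h.2⟩
  have n4 : (Aᶜ ∩ B).Nonempty := by obtain ⟨x, h⟩ := not_subset.1 c4; exact ⟨x, h.1, not_not.1 h.2⟩
  have s1 := F_sub (S := S) he hA.1.1 hB.1.1 n1 n4
  have s2 := F_sub (S := S) he hA.1.1 hB.1.1.compl (by rwa [compl_compl]) n3
  rw [← F_compl (A ∪ B), compl_union] at s1
  rw [← F_compl (A ∪ Bᶜ), compl_union, compl_compl, F_compl B] at s2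
  have o1 := hA.corner hB.1.1
  have o2 := hA.compl.corner hB.1.1
  have o3 := hB.corner hA.1.1
  have o4 := hB.compl.corner hA.1.1
  rw [F_compl] at o2 o4
  rw [inter_comm B, inter_comm B] at o3
  rw [inter_comm Bᶜ, inter_comm Bᶜ] at o4
  exact ord4 o1 o2.symm o3 o4.symm s1 s2
end Cut
end PaperCLT
end

section
open Filter Set
namespace PaperCLT
open scoped Pointwise
namespace Cut
variable {Γ : Type*} [Group Γ] {S : Finset Γ} {e : ℕ → Γ}
variable (S) in
def Conn (D : Set Γ) : Prop := ∀ C : Set Γ, (D ∩ C).Nonempty → (D ∩ Cᶜ).Nonempty → ∃ x, ∃ s ∈ S, x ∈ D ∧ x * s ∈ D ∧ x ∈ bd s C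
lemma Conn.smul {D : Set Γ} (h : Conn S D) (g : Γ) : Conn S (g • D) := by
  rintro C ⟨a, ⟨a1, a2⟩⟩ ⟨b, ⟨b1, b2⟩⟩
  rw [mem_smul_set_iff_inv_smul_mem, smul_eq_mul] at a1 b1
  have hm : ∀ x, x ∈ g⁻¹ • C ↔ g * x ∈ C := fun x => by rw [mem_smul_set_iff_inv_smul_mem, inv_inv, smul_eq_mul]
  obtain ⟨x, s, hs, h1, h2, h3⟩ := h (g⁻¹ • C) ⟨_, a1, by rw [hm]; simpa using a2⟩ ⟨_, b1, by rw [mem_compl_iff, hm]; simpa using b2⟩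
  rw [bd_smul, mem_smul_set_iff_inv_smul_mem, inv_inv, smul_eq_mul] at h3
  exact ⟨g * x, s, hs, ⟨x, h1, rfl⟩, ⟨x * s, h2, by simp [mul_assoc]⟩, h3⟩
lemma bne (hS : Subgroup.closure (S : Set Γ) = ⊤) {A : Set Γ} (h1 : A.Nonempty) (h2 : Aᶜ.Nonempty) : ∃ x, ∃ s ∈ S, x ∈ bd s A := by
  by_contra hc
  push Not at hc
  have : ∀ g : Γ, ∀ x, x ∈ A ↔ x * g ∈ A := by
    intro g
    have hg : g ∈ Subgroup.closure (S : Set Γ) := by rw [hS]; trivial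
    induction hg using Subgroup.closure_induction with
    | mem s hs => exact fun x => not_not.1 (hc x s hs)
    | one => simp
    | mul a b _ _ ha hb => intro x; rw [ha x, hb, mul_assoc]
    | inv a _ ha => intro x; rw [ha (x * a⁻¹)]; simp
  obtain ⟨a, ha⟩ := h1
  obtain ⟨b, hb⟩ := h2
  exact hb (by have := (this (a⁻¹ * b) a).1 ha; simpa using this)
lemma cf_gen (hS : Subgroup.closure (S : Set Γ) = ⊤) {A : Set Γ} (h : ∀ s ∈ S, (bd s A).Finite) : CF A := by
  intro g
  have hg : g ∈ Subgroup.closure (S : Set Γ) := by rw [hS]; trivial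
  induction hg using Subgroup.closure_induction with
  | mem s hs => exact h s hs
  | one => convert finite_empty; ext x; simp [bd]
  | mul a b _ _ ha hb =>
    refine (ha.union (hb.image (· * a⁻¹))).subset fun x hx => ?_
    by_cases h1 : x ∈ bd a A
    · exact .inl h1
    · refine .inr ⟨x * a, ?_, by simp⟩
      simp only [bd, mem_setOf_eq, not_not, mul_assoc] at *; tauto
  | inv a _ ha =>
    refine (ha.image (· * a)).subset fun x hx => ⟨x * a⁻¹, ?_, by simp⟩
    simp only [bd, mem_setOf_eq, inv_mul_cancel_right] at *; tauto
lemma conn_of_min (hS : Subgroup.closure (S : Set Γ) = ⊤) {p q : Ultrafilter Γ} {A : Set Γ} (hA : CF A) (hp : A ∈ p) (hq : Aᶜ ∈ q)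
    (hm : ∀ B, CF B → B ∈ p → Bᶜ ∈ q → f1 S A ≤ f1 S B) : Conn S A := by
  have key : ∀ C : Set Γ, A ∩ C ∈ p → (A ∩ Cᶜ).Nonempty → ∃ x, ∃ s ∈ S, x ∈ A ∧ x * s ∈ A ∧ x ∈ bd s C := by
    intro C hC h2
    by_contra hc
    push Not at hc
    have hc' : ∀ x, ∀ s ∈ S, x ∈ A → x * s ∈ A → (x ∈ C ↔ x * s ∈ C) := fun x s hs h1 h2 => not_not.1 (hc x s hs h1 h2)
    have hsub : ∀ s ∈ S, bd s (A ∩ C) ⊆ bd s A := fun s hs x hx => by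
      have := hc' x s hs
      simp only [bd, mem_setOf_eq, mem_inter_iff] at *; tauto
    have hcf : CF (A ∩ C) := cf_gen hS fun s hs => (hA s).subset (hsub s hs)
    have hne : (A ∩ Cᶜ)ᶜ.Nonempty := by
      obtain ⟨x, hx⟩ := p.nonempty_of_mem hC
      exact ⟨x, fun h => h.2 hx.2⟩
    obtain ⟨x, s, hs, hx⟩ := bne hS h2 hne
    have hlt : f1 S (A ∩ C) < f1 S A := by
      refine Finset.sum_lt_sum (fun s hs => ncard_le_ncard (hsub s hs) (hA s)) ⟨s, hs, ncard_lt_ncard ((ssubset_iff_of_subset (hsub s hs)).2 ⟨x, ?_, ?_⟩) (hA s)⟩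
      · have := hc' x s hs
        simp only [bd, mem_setOf_eq, mem_inter_iff, mem_compl_iff] at *; tauto
      · have := hc' x s hs
        simp only [bd, mem_setOf_eq, mem_inter_iff, mem_compl_iff] at *; tauto
    exact absurd (hm _ hcf hC (mem_of_superset hq (compl_subset_compl.2 inter_subset_left))) (not_le.2 hlt)
  intro C h1 h2
  rcases p.mem_or_compl_mem C with h | h
  · exact key C (Filter.inter_mem hp h) h2
  · obtain ⟨x, s, hs, a, b, c⟩ := key Cᶜ (Filter.inter_mem hp h) (by rwa [compl_compl])
    exact ⟨x, s, hs, a, b, by rwa [bd_compl] at c⟩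
variable (S) in
def Bond (K : ℕ) (A : Set Γ) : Prop := CF A ∧ f1 S A ≤ K ∧ Conn S A ∧ Conn S Aᶜ
lemma Bond.smul {K : ℕ} {A : Set Γ} (h : Bond S K A) (g : Γ) : Bond S K (g • A) :=
  ⟨h.1.smul g, by rw [f1_smul]; exact h.2.1, h.2.2.1.smul g, by rw [← smul_set_compl]; exact h.2.2.2.smul g⟩
lemma Bond.compl {K : ℕ} {A : Set Γ} (h : Bond S K A) : Bond S K Aᶜ :=
  ⟨h.1.compl, by rw [f1_compl]; exact h.2.1, h.2.2.2, by rw [compl_compl]; exact h.2.2.1⟩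
lemma fin_bonds (K : ℕ) (x y : Γ) : {A | Bond S K A ∧ x ∈ A ∧ y ∉ A}.Finite := by
  by_contra hinf
  have hinf : {A | Bond S K A ∧ x ∈ A ∧ y ∉ A}.Infinite := hinf
  obtain ⟨a, ha⟩ : ∃ a : ℕ → Set Γ, a = fun n => (hinf.natEmbedding _ n : Set Γ) := ⟨_, rfl⟩
  have hai : Function.Injective a := by rw [ha]; exact fun m n h => (hinf.natEmbedding _).injective (Subtype.ext h)
  have hab : ∀ n, Bond S K (a n) ∧ x ∈ a n ∧ y ∉ a n := fun n => by rw [ha]; exact (hinf.natEmbedding _ n).2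
  let u : Ultrafilter ℕ := hyperfilter ℕ
  obtain ⟨A, hA⟩ : ∃ A : Set Γ, A = {z | ∀ᶠ n in (u : Filter ℕ), z ∈ a n} := ⟨_, rfl⟩
  have hz : ∀ z, ∀ᶠ n in (u : Filter ℕ), (z ∈ a n ↔ z ∈ A) := fun z => by
    by_cases h : z ∈ A
    · have h' := h; rw [hA] at h'
      filter_upwards [h'] with n hn; exact iff_of_true hn h
    · have h' := h; rw [hA] at h'
      filter_upwards [Ultrafilter.eventually_not.2 h'] with n hn; exact iff_of_false hn h
  have hfb : ∀ s ∈ S, (bd s A).Finite := fun s hs => by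
    by_contra hi
    obtain ⟨P, hP, hPf, hPc⟩ := Infinite.exists_subset_ncard_eq (hi : (bd s A).Infinite) (K + 1)
    have : ∀ᶠ n in (u : Filter ℕ), ∀ z ∈ P, z ∈ bd s (a n) := by
      rw [hPf.eventually_all] 
      intro z hzP
      filter_upwards [hz z, hz (z * s)] with n h1 h2
      have := hP hzP
      simp only [bd, mem_setOf_eq] at *; tauto
    obtain ⟨n, hn⟩ := this.exists
    have h1 := ncard_le_ncard (fun z hz => hn z hz : P ⊆ bd s (a n)) ((hab n).1.1 s)
    have h2 : (bd s (a n)).ncard ≤ f1 S (a n) := Finset.single_le_sum (f := fun s => (bd s (a n)).ncard) (fun _ _ => Nat.zero_le _) hs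
    have := (hab n).1.2.1
    omega
  have hag : ∀ᶠ n in (u : Filter ℕ), ∀ s ∈ S, ∀ z ∈ bd s A, z ∈ bd s (a n) ∧ (z ∈ a n ↔ z ∈ A) := by
    rw [Finset.eventually_all]
    intro s hs
    rw [(hfb s hs).eventually_all]
    intro z hzP
    filter_upwards [hz z, hz (z * s)] with n h1 h2
    simp only [bd, mem_setOf_eq] at *; tauto
  have hx : x ∈ A := by rw [hA]; exact Eventually.of_forall fun n => (hab n).2.1
  have hy : y ∉ A := by
    intro h; rw [hA] at h
    obtain ⟨n, hn⟩ := Eventually.exists h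
    exact (hab n).2.2 hn
  have heq : ∀ᶠ n in (u : Filter ℕ), a n = A := by
    filter_upwards [hag] with n hn
    refine Subset.antisymm (fun z hzn => ?_) (fun z hzA => ?_)
    · by_contra hc
      obtain ⟨w, s, hs, h1, h2, h3⟩ := (hab n).1.2.2.1 A ⟨x, (hab n).2.1, hx⟩ ⟨z, hzn, hc⟩
      have := (hn s hs w h3).1
      simp only [bd, mem_setOf_eq] at this; tauto
    · by_contra hc
      obtain ⟨w, s, hs, h1, h2, h3⟩ := (hab n).1.2.2.2 A ⟨z, hc, hzA⟩ ⟨y, (hab n).2.2, hy⟩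
      have := (hn s hs w h3).1
      simp only [bd, mem_setOf_eq, mem_compl_iff] at *; tauto
  obtain ⟨m, hm⟩ := heq.exists
  have hfm : ∀ᶠ n in (u : Filter ℕ), n ≠ m := by
    have : ∀ᶠ n in cofinite, n ≠ m := (finite_singleton m).compl_mem_cofinite
    exact hyperfilter_le_cofinite this
  obtain ⟨n, hn, hnm⟩ := (heq.and hfm).exists
  exact hnm (hai (hn.trans hm.symm))
variable (S) in
def NN (K : ℕ) : Set (Set Γ) := {A | Bond S K A ∧ ∃ s ∈ S, (1:Γ) ∈ bd s A}
variable (S) in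
lemma NN_fin (K : ℕ) : (NN S K).Finite := by
  refine ((S.finite_toSet.biUnion fun s _ => fin_bonds (S := S) K 1 s).union (S.finite_toSet.biUnion fun s _ => fin_bonds (S := S) K s 1)).subset ?_
  rintro A ⟨h, s, hs, h1⟩
  simp only [bd, mem_setOf_eq, one_mul] at h1
  by_cases h2 : (1:Γ) ∈ A
  · exact .inl (mem_biUnion hs ⟨h, h2, by tauto⟩)
  · exact .inr (mem_biUnion hs ⟨h, by tauto, h2⟩)
lemma norm (hS : Subgroup.closure (S : Set Γ) = ⊤) {K : ℕ} {A : Set Γ} (h : Bond S K A) (h1 : A.Nonempty) (h2 : Aᶜ.Nonempty) : ∃ g : Γ, g • A ∈ NN S K := by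
  obtain ⟨x, s, hs, hx⟩ := bne hS h1 h2
  refine ⟨x⁻¹, h.smul _, s, hs, ?_⟩
  rw [bd_smul, mem_smul_set_iff_inv_smul_mem]; simpa using hx
lemma exists_opt (hS : Subgroup.closure (S : Set Γ) = ⊤) (e : ℕ → Γ) {K : ℕ} {p q : Ultrafilter Γ} {C : Set Γ} (hC : CF C) (hK : f1 S C ≤ K) (hp : C ∈ p) (hq : Cᶜ ∈ q) :
    ∃ A, Opt S e p q A ∧ Bond S K A := by
  obtain ⟨G, hG⟩ : ∃ G : Set (Set Γ), G = {B | CF B ∧ B ∈ p ∧ Bᶜ ∈ q} := ⟨_, rfl⟩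
  have hCG : C ∈ G := by rw [hG]; exact ⟨hC, hp, hq⟩
  obtain ⟨B0, hB0, hm0⟩ := Nat.sInf_mem (⟨_, C, hCG, rfl⟩ : (f1 S '' G).Nonempty)
  have hmin : ∀ B ∈ G, f1 S B0 ≤ f1 S B := fun B hB => by rw [hm0]; exact Nat.sInf_le ⟨B, hB, rfl⟩
  obtain ⟨Gm, hGm⟩ : ∃ Gm : Set (Set Γ), Gm = {B | B ∈ G ∧ f1 S B = f1 S B0} := ⟨_, rfl⟩
  have hbond : ∀ B ∈ Gm, Bond S K B := fun B hB => by
    rw [hGm] at hB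
    obtain ⟨hB1, hB2⟩ := hB
    have hB3 := hB1
    rw [hG] at hB1
    obtain ⟨b1, b2, b3⟩ := hB1
    have hle : ∀ D, CF D → D ∈ p → Dᶜ ∈ q → f1 S B ≤ f1 S D := fun D h1 h2 h3 => by rw [hB2]; exact hmin D (by rw [hG]; exact ⟨h1, h2, h3⟩)
    refine ⟨b1, by rw [hB2]; exact (hmin C hCG).trans hK, conn_of_min hS b1 b2 b3 hle, conn_of_min hS b1.compl b3 (by rwa [compl_compl]) fun D h1 h2 h3 => ?_⟩
    rw [f1_compl, ← f1_compl D]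
    exact hle _ h1.compl h3 (by rwa [compl_compl])
  have hfin : (F S e '' Gm).Finite := by
    refine ((NN_fin S K).image (F S e)).subset ?_
    rintro _ ⟨B, hB, rfl⟩
    have hb := hbond B hB
    rw [hGm, hG] at hB
    obtain ⟨g, hg⟩ := norm hS hb (p.nonempty_of_mem hB.1.2.1) (q.nonempty_of_mem hB.1.2.2)
    exact ⟨_, hg, F_smul g B⟩
  obtain ⟨v, ⟨⟨A, hA, rfl⟩, hv⟩⟩ := hfin.exists_minimal ⟨_, B0, by rw [hGm]; exact ⟨hB0, rfl⟩, rfl⟩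
  refine ⟨A, ⟨?_, fun B h1 h2 h3 => ?_⟩, hbond A hA⟩
  · rw [hGm, hG] at hA; exact hA.1
  · have hBG : B ∈ G := by rw [hG]; exact ⟨h1, h2, h3⟩
    have hA' := hA
    rw [hGm] at hA'
    rcases (hmin B hBG).eq_or_lt with h | h
    · rcases le_total (F S e A) (F S e B) with h' | h'
      · exact h'
      · exact hv ⟨B, by rw [hGm]; exact ⟨hBG, h.symm⟩, rfl⟩ h'
    · exact (F_lt (by rw [hA'.2]; exact h)).le
end Cut
end PaperCLT
end

section
open Filter Set
namespace PaperCLT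
open scoped Pointwise
namespace Cut
variable {Γ : Type*} [Group Γ] {S : Finset Γ} {e : ℕ → Γ}
variable (S e) in
def EE (K : ℕ) : Set (Set Γ) := {A | Bond S K A ∧ ∃ p q, Opt S e p q A}
variable (S) in
def ZZ (A : Set Γ) : Set Γ := ⋃ s ∈ S, bd s A
lemma ZZ_smul (g : Γ) (A : Set Γ) : ZZ S (g • A) = g • ZZ S A := by
  ext x; simp only [ZZ, bd_smul, mem_iUnion, mem_smul_set_iff_inv_smul_mem]
lemma EE_ne {K : ℕ} {A : Set Γ} (h : A ∈ EE S e K) : A.Nonempty ∧ Aᶜ.Nonempty := by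
  obtain ⟨_, p, q, h⟩ := h
  exact ⟨p.nonempty_of_mem h.1.2.1, q.nonempty_of_mem h.1.2.2⟩
lemma EE_smul {K : ℕ} {A : Set Γ} (h : A ∈ EE S e K) (g : Γ) : g • A ∈ EE S e K := by
  obtain ⟨h1, p, q, h⟩ := h
  exact ⟨h1.smul g, _, _, h.smul g⟩
lemma ZZ_fin {K : ℕ} {A : Set Γ} (h : A ∈ EE S e K) : (ZZ S A).Finite := S.finite_toSet.biUnion fun s _ => h.1.1 s
lemma ZZ_ne (hS : Subgroup.closure (S : Set Γ) = ⊤) {K : ℕ} {A : Set Γ} (h : A ∈ EE S e K) : (ZZ S A).Nonempty := by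
  obtain ⟨x, s, hs, hx⟩ := bne hS (EE_ne h).1 (EE_ne h).2
  exact ⟨x, mem_biUnion (s := (S : Set Γ)) hs hx⟩
lemma EE_fin (K : ℕ) (x y : Γ) : {A | A ∈ EE S e K ∧ x ∈ A ∧ y ∉ A}.Finite := (fin_bonds K x y).subset fun A h => ⟨h.1.1, h.2⟩
lemma star (s : Setup Γ) (hS : Subgroup.closure (S : Set Γ) = ⊤) {𝒞 : Set (Set Γ)} {r : ℝ} (hf : 𝒞.Finite) (hcf : ∀ A ∈ 𝒞, CF A)
    (hsep : ∀ x y, r ≤ s.nm x → r ≤ s.nm y → s.gp x y ≤ s.C0 → ∃ A ∈ 𝒞, x ∈ A ∧ y ∉ A) : ∃ K : ℕ, ∃ 𝒜 : Set (Set Γ), 𝒜.Finite ∧ 𝒜 ⊆ EE S e K ∧ ∃ r : ℝ,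
      ∀ x y, r ≤ s.nm x → r ≤ s.nm y → s.gp x y ≤ s.C0 → ∃ A ∈ 𝒜, x ∈ A ∧ y ∉ A := by
  obtain ⟨K, hK⟩ := (hf.image (f1 S)).bddAbove
  refine ⟨K, ?_⟩
  by_contra hc
  push Not at hc
  obtain ⟨𝒜, h𝒜⟩ : ∃ 𝒜 : ℕ → Set (Set Γ), 𝒜 = fun n : ℕ => {A | A ∈ EE S e K ∧ ∃ x y, s.nm x ≤ n ∧ s.nm y ≤ n ∧ x ∈ A ∧ y ∉ A} := ⟨_, rfl⟩
  have hfin : ∀ n, (𝒜 n).Finite := fun n => by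
    refine ((s.fin_le n).biUnion fun x _ => (s.fin_le n).biUnion fun y _ => EE_fin (S := S) (e := e) K x y).subset fun A h => ?_
    rw [h𝒜] at h
    obtain ⟨h1, x, y, h2, h3, h4⟩ := h
    exact mem_biUnion h2 (mem_biUnion h3 ⟨h1, h4⟩)
  have hx : ∀ n : ℕ, ∃ x y, (n:ℝ) ≤ s.nm x ∧ (n:ℝ) ≤ s.nm y ∧ s.gp x y ≤ s.C0 ∧ ∀ A ∈ 𝒜 n, x ∈ A → y ∈ A := fun n => by
    obtain ⟨x, y, h1, h2, h3, h4⟩ := hc (𝒜 n) (hfin n) (by rw [h𝒜]; exact fun A h => h.1) n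
    exact ⟨x, y, h1, h2, h3, h4⟩
  choose x y hx hy hg hn using hx
  let u : Ultrafilter ℕ := hyperfilter ℕ
  have hge : ∀ M : ℝ, ∀ᶠ n : ℕ in (u : Filter ℕ), M ≤ n := fun M =>
    (Nat.hyperfilter_le_atTop : (u : Filter ℕ) ≤ atTop) (tendsto_natCast_atTop_atTop.eventually (eventually_ge_atTop M))
  obtain ⟨C, hC, hCu⟩ : ∃ C ∈ 𝒞, ∀ᶠ n in (u : Filter ℕ), x n ∈ C ∧ y n ∉ C := by
    have : (⋃ C ∈ 𝒞, {n | x n ∈ C ∧ y n ∉ C}) ∈ u := by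
      refine mem_of_superset (hge r) fun n hnr => ?_
      obtain ⟨C, hC, h⟩ := hsep (x n) (y n) (le_trans hnr (hx n)) (le_trans hnr (hy n)) (hg n)
      exact mem_biUnion hC h
    exact (Ultrafilter.finite_biUnion_mem_iff hf).1 this
  obtain ⟨A, hA, hb⟩ := exists_opt hS e (K := K) (p := u.map x) (q := u.map y) (hcf C hC) (hK ⟨C, hC, rfl⟩)
    (Ultrafilter.mem_map.2 (hCu.mono fun n h => h.1)) (Ultrafilter.mem_map.2 (hCu.mono fun n h => h.2))
  have hAE : A ∈ EE S e K := ⟨hb, _, _, hA⟩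
  obtain ⟨⟨a, ha⟩, ⟨b, hb'⟩⟩ := EE_ne hAE
  have h1 : ∀ᶠ n in (u : Filter ℕ), x n ∈ A := Ultrafilter.mem_map.1 hA.1.2.1
  have h2 : ∀ᶠ n in (u : Filter ℕ), y n ∈ Aᶜ := Ultrafilter.mem_map.1 hA.1.2.2
  obtain ⟨n, n1, n2, n3, n4⟩ := (h1.and (h2.and ((hge (s.nm a)).and (hge (s.nm b))))).exists
  exact n2 (hn n A (by rw [h𝒜]; exact ⟨hAE, a, b, n3, n4, ha, hb'⟩) n1)
lemma prop (s : Setup Γ) (hS : Subgroup.closure (S : Set Γ) = ⊤) {K : ℕ} {𝒜 : Set (Set Γ)} {r : ℝ} (hf : 𝒜.Finite) (hs : 𝒜 ⊆ EE S e K)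
    (hsep : ∀ x y, r ≤ s.nm x → r ≤ s.nm y → s.gp x y ≤ s.C0 → ∃ A ∈ 𝒜, x ∈ A ∧ y ∉ A) (m : ℕ) :
    {g : Γ | {A | A ∈ EE S e K ∧ 1 ∈ A ∧ g ∉ A}.ncard ≤ m}.Finite := by
  have hT : {h : Γ | ∃ A ∈ 𝒜, ∃ A' ∈ 𝒜, h • A = A'}.Finite := by
    have : ∀ A ∈ 𝒜, ∀ A' ∈ 𝒜, {h : Γ | h • A = A'}.Finite := fun A hA A' hA' => by
      obtain ⟨x, hx⟩ := ZZ_ne hS (hs hA)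
      refine ((ZZ_fin (hs hA')).image (· * x⁻¹)).subset fun h hh => ⟨h * x, ?_, by simp⟩
      rw [← (hh : h • A = A'), ZZ_smul]; exact ⟨x, hx, rfl⟩
    refine (hf.biUnion fun A hA => hf.biUnion fun A' hA' => this A hA A' hA').subset ?_
    rintro h ⟨A, hA, A', hA', hh⟩
    exact mem_biUnion hA (mem_biUnion hA' hh)
  obtain ⟨ρ, hρ⟩ := (hT.image s.nm).bddAbove
  obtain ⟨L, hL⟩ : ∃ L, L = |r| + |ρ| + 2 * s.C0 + 1 := ⟨_, rfl⟩
  have r1 := le_abs_self r; have r2 := abs_nonneg r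
  have p1 := le_abs_self ρ; have p2 := abs_nonneg ρ
  have c0 := s.hC0
  refine (s.fin_le ((m + 2) * L)).subset fun g hg => ?_
  rw [mem_setOf_eq] at hg ⊢
  by_contra hc
  rw [not_le] at hc
  have hp : ∀ j : Fin (m + 1), ∃ p, |s.d 1 p - ((j:ℕ) + 1) * L| ≤ s.C0 ∧ gromov s.d p 1 g ≤ s.C0 := fun j => by
    have hL0 : 0 ≤ L := by linarith
    refine s.rg 1 g _ (by positivity) ?_
    have : ((j:ℕ):ℝ) + 1 ≤ m + 1 := by exact_mod_cast j.2
    have h2 : s.d 1 g = s.nm g := rfl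
    rw [h2]; nlinarith
  choose p hp1 hp2 using hp
  have hA : ∀ j, ∃ A ∈ 𝒜, (p j)⁻¹ ∈ A ∧ (p j)⁻¹ * g ∉ A := fun j => by
    have h1 := abs_le.1 (hp1 j)
    have h2 : s.d 1 (p j) = s.nm (p j) := rfl
    rw [h2] at h1
    have h3 : ((j:ℕ):ℝ) + 1 ≤ m + 1 := by exact_mod_cast j.2
    have h4 : (0:ℝ) ≤ ((j:ℕ):ℝ) := Nat.cast_nonneg _
    have h5 := s.nm_mul_le (p j) ((p j)⁻¹ * g)
    rw [mul_inv_cancel_left] at h5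
    refine hsep _ _ ?_ ?_ ?_
    · rw [s.nm_inv]; nlinarith
    · nlinarith
    · have h6 := hp2 j
      unfold gromov at h6
      rw [s.d_eq (p j) 1, s.d_eq (p j) g, mul_one] at h6
      rw [s.gp_def, inv_inv, mul_inv_cancel_left]
      exact h6
  choose A hA1 hA2 hA3 using hA
  have hlt : ∀ i j : Fin (m + 1), i < j → p i • A i ≠ p j • A j := fun i j hij he => by
    have hmem : (p j)⁻¹ * p i ∈ {h : Γ | ∃ A ∈ 𝒜, ∃ A' ∈ 𝒜, h • A = A'} := ⟨A i, hA1 i, A j, hA1 j, by rw [mul_smul, he, inv_smul_smul]⟩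
    have h1 : s.nm ((p j)⁻¹ * p i) ≤ ρ := hρ ⟨_, hmem, rfl⟩
    have h2 := abs_le.1 (hp1 i)
    have h3 := abs_le.1 (hp1 j)
    have e2 : s.d 1 (p i) = s.nm (p i) := rfl
    have e3 : s.d 1 (p j) = s.nm (p j) := rfl
    rw [e2] at h2; rw [e3] at h3
    have h4 := s.nm_mul_le (p i) ((p j)⁻¹ * p i)⁻¹
    rw [s.nm_inv, mul_inv_rev, inv_inv, mul_inv_cancel_left] at h4
    have h5 : ((i:ℕ):ℝ) + 1 ≤ (j:ℕ) := by exact_mod_cast hij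
    nlinarith
  have hinj : Function.Injective fun j => p j • A j := fun i j h => by
    rcases lt_trichotomy i j with h1 | h1 | h1
    · exact absurd h (hlt i j h1)
    · exact h1
    · exact absurd h.symm (hlt j i h1)
  have hcard : (range fun j => p j • A j).ncard = m + 1 := by
    rw [← image_univ, ncard_image_of_injective _ hinj, ncard_univ, Nat.card_fin]
  have hle := ncard_le_ncard (s := range fun j => p j • A j) (t := {A | A ∈ EE S e K ∧ 1 ∈ A ∧ g ∉ A}) (by
    rintro _ ⟨j, rfl⟩
    refine ⟨EE_smul (hs (hA1 j)) _, ?_, ?_⟩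
    · show 1 ∈ p j • A j
      rw [mem_smul_set_iff_inv_smul_mem]; simpa using hA2 j
    · show g ∉ p j • A j
      rw [mem_smul_set_iff_inv_smul_mem]; exact hA3 j) (EE_fin K 1 g)
  omega
lemma vf (s : Setup Γ) (hS : Subgroup.closure (S : Set Γ) = ⊤) {𝒞 : Set (Set Γ)} {r : ℝ} (hf : 𝒞.Finite) (hcf : ∀ A ∈ 𝒞, CF A)
    (hsep : ∀ x y, r ≤ s.nm x → r ≤ s.nm y → s.gp x y ≤ s.C0 → ∃ A ∈ 𝒞, x ∈ A ∧ y ∉ A) : VirtuallyFree Γ := by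
  obtain ⟨e, he⟩ : ∃ e : ℕ → Γ, Function.Surjective e := by
    have : (univ : Set Γ).Countable := by
      have h : (univ : Set Γ) = ⋃ n : ℕ, {g | s.nm g ≤ n} := by
        ext g; simp only [mem_univ, mem_iUnion, true_iff]; exact exists_nat_ge (s.nm g)
      rw [h]; exact countable_iUnion fun n => (s.fin_le n).countable
    have : Countable Γ := countable_univ_iff.1 this
    exact exists_surjective_nat Γ
  obtain ⟨K, 𝒜, h1, h2, r', h3⟩ := star (e := e) s hS hf hcf hsep
  have hprp := prop s hS h1 h2 h3
  refine Tr.vfree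
    { 𝓔 := EE S e K
      inv := fun A hA g => EE_smul hA g
      cpl := fun A hA => by obtain ⟨a, p, q, b⟩ := hA; exact ⟨a.compl, _, _, b.compl⟩
      nest := fun A hA B hB => by
        obtain ⟨_, p, q, h⟩ := hA
        obtain ⟨_, p', q', h'⟩ := hB
        exact nested he h h'
      ne := fun A hA => (EE_ne hA).1
      fin := EE_fin K
      prp := hprp
      orb := ⟨NN S K ∩ EE S e K, (NN_fin S K).subset inter_subset_left, inter_subset_right, fun A hA => by
        obtain ⟨g, hg⟩ := norm hS hA.1 (EE_ne hA).1 (EE_ne hA).2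
        exact ⟨g, hg, EE_smul hA g⟩⟩
      Zp := ZZ S
      zf := fun A hA => ⟨ZZ_fin hA, ZZ_ne hS hA⟩
      zs := fun A g => ZZ_smul g A
      zc := fun A => by unfold ZZ; simp only [bd_compl]
      non := ?_ }
  by_contra hne
  rw [not_nonempty_iff_eq_empty] at hne
  have h0 := hprp 0
  rw [hne] at h0
  simp only [mem_empty_iff_false, false_and, setOf_false, ncard_empty, le_refl, setOf_true] at h0
  obtain ⟨M, hM⟩ := (h0.image s.nm).bddAbove
  obtain ⟨y, hy⟩ := exists_far s (M + 1)
  have := hM ⟨y, mem_univ _, rfl⟩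
  linarith
end Cut
theorem final {Γ : Type*} [Group Γ]
    (d dst : Γ → Γ → ℝ) (hd : MemD d) (hdst : MemD dst)
    (hshd : StronglyHyperbolic d) (hshdst : StronglyHyperbolic dst)
    (hnrs : ¬ RoughlySimilar d dst)
    (hcase : ¬ VirtuallyFree Γ ∨ (VirtuallyFree Γ ∧ NonArithmetic d))
    (hv : growthRate d = 1) (hτ : IsMeanDistortion d dst 1) :
    ∃ C σ2 : ℝ, 0 < C ∧ 0 < σ2 ∧
      Tendsto (fun T : ℝ => piMoment d dst 0 T / (C * Real.exp T)) atTop (nhds 1) ∧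
      (∀ p : ℕ, Even p → 2 ≤ p →
        Tendsto (fun T : ℝ => piMoment d dst p T /
            (C * Real.sqrt σ2 ^ p * ((p - 1).doubleFactorial : ℝ) * Real.exp T * T ^ (p / 2)))
          atTop (nhds 1)) ∧
      (∀ p : ℕ, Even p → 2 ≤ p →
        Tendsto (fun T : ℝ => (((ball d T).ncard : ℝ))⁻¹ *
            ∑ᶠ g ∈ ball d T, ((dst 1 g - d 1 g) / Real.sqrt T) ^ p)
          atTop (nhds (Real.sqrt σ2 ^ p * ((p - 1).doubleFactorial : ℝ)))) := by
  obtain ⟨S, ⟨hSf, hS⟩, _⟩ := hd.quasiIsom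
  obtain ⟨s, rfl, rfl⟩ := exists_setup hd hdst hshd hshdst hv
  refine core (fun W M0 => ?_) hnrs hτ
  rintro ⟨a0, ha, hQ⟩
  rcases hcase with h | ⟨_, h⟩
  · obtain ⟨𝒞, r, h1, h2, h3⟩ := classes W ha hQ s.C0
    exact h (Cut.vf (S := hSf.toFinset) s (by rwa [hSf.coe_toFinset]) h1 h2 h3)
  · exact h ⟨a0 / 2, arith W ha hQ⟩
end PaperCLT
end

namespace PaperCLT

variable {Γ : Type*} [Group Γ]

/-- Asymptotics of the even moment sums `π_p`. -/
theorem even_moment_asymptotics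
    (hΓ : IsHyperbolicGroup Γ) (hNE : NonElementary Γ)
    (d dst : Γ → Γ → ℝ) (hd : MemD d) (hdst : MemD dst)
    (hshd : StronglyHyperbolic d) (hshdst : StronglyHyperbolic dst)
    (hnrs : ¬ RoughlySimilar d dst)
    (hcase : ¬ VirtuallyFree Γ ∨ (VirtuallyFree Γ ∧ NonArithmetic d))
    (hv : growthRate d = 1) (hτ : IsMeanDistortion d dst 1) :
    ∃ C σ2 : ℝ, 0 < C ∧ 0 < σ2 ∧
      Tendsto (fun T : ℝ => piMoment d dst 0 T / (C * Real.exp T)) atTop (nhds 1) ∧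
      (∀ p : ℕ, Even p → 2 ≤ p →
        Tendsto (fun T : ℝ => piMoment d dst p T /
            (C * Real.sqrt σ2 ^ p * ((p - 1).doubleFactorial : ℝ) * Real.exp T * T ^ (p / 2)))
          atTop (nhds 1)) ∧
      (∀ p : ℕ, Even p → 2 ≤ p →
        Tendsto (fun T : ℝ => (((ball d T).ncard : ℝ))⁻¹ *
            ∑ᶠ g ∈ ball d T, ((dst 1 g - d 1 g) / Real.sqrt T) ^ p)
          atTop (nhds (Real.sqrt σ2 ^ p * ((p - 1).doubleFactorial : ℝ)))) := by
  exact final d dst hd hdst hshd hshdst hnrs hcase hv hτ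

end PaperCLT
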